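/- Let Γ be a connected defining graph with all labels at least 3 and no three edges forming a triangle (A_Γ is a connected large-type triangle-free Artin group). Then A_Γ has rigid chunks: (1) for every defining graph Λ and every group isomorphism ψ : A_Γ → A_Λ, and for every chunk parabolic subgroup g A_{Γ'} g⁻¹ of A_Γ (with g ∈ A_Γ and Γ' a chunk of Γ), there exist h ∈ A_Λ and a chunk Λ' of Λ such that ψ(g A_{Γ'} g⁻¹) = h A_{Λ'} h⁻¹; and (2) for every chunk Γ' of Γ, either Out(A_{Γ'}) is finite, or Γ' is a single edge with even label. -/

import Mathlib

/-- The alternating product `a * b * a * ⋯` with `n` factors. -/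
def altProd {M : Type*} [Monoid M] : M → M → ℕ → M
  | _, _, 0 => 1
  | a, b, n + 1 => a * altProd b a n

/-- A defining graph: a finite simplicial graph with each edge labelled by a natural
number `≥ 2`. -/
structure DefiningGraph (V : Type*) where
  graph : SimpleGraph V
  label : V → V → ℕ
  label_symm : ∀ a b, label a b = label b a
  two_le_label : ∀ a b, graph.Adj a b → 2 ≤ label a b

/-- The Artin relations `π(a,b;m_ab) = π(b,a;m_ab)`, one for each edge `{a,b}` of the
defining graph. -/
def DefiningGraph.rels {V : Type*} (Γ : DefiningGraph V) : Set (FreeGroup V) :=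
  {r | ∃ a b, Γ.graph.Adj a b ∧
    r = altProd (FreeGroup.of a) (FreeGroup.of b) (Γ.label a b) *
      (altProd (FreeGroup.of b) (FreeGroup.of a) (Γ.label a b))⁻¹}

/-- The Artin group of a defining graph, as a presented group. -/
abbrev ArtinGroup {V : Type*} (Γ : DefiningGraph V) : Type _ := PresentedGroup Γ.rels

/-- The induced labelled subgraph on a subset `S` of the vertices. -/
def DefiningGraph.induce {V : Type*} (Γ : DefiningGraph V) (S : Set V) : DefiningGraph S where
  graph := Γ.graph.induce S
  label a b := Γ.label a b
  label_symm a b := Γ.label_symm a b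
  two_le_label a b h := Γ.two_le_label a b h

/-- The standard parabolic subgroup of `A_Γ` generated by the standard generators in `S`. -/
def parabolic {V : Type*} (Γ : DefiningGraph V) (S : Set V) : Subgroup (ArtinGroup Γ) :=
  Subgroup.closure ((PresentedGroup.of : V → ArtinGroup Γ) '' S)

/-- The subgroup of inner automorphisms of a group. -/
def innerAutSubgroup (G : Type*) [Group G] : Subgroup (MulAut G) :=
  (MulAut.conj (G := G)).range

instance innerAutSubgroup_normal (G : Type*) [Group G] : (innerAutSubgroup G).Normal := by
  constructor
  rintro f ⟨g, rfl⟩ φ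
  refine ⟨φ g, ?_⟩
  ext x
  simp only [MulAut.conj_apply, MulAut.mul_apply, MulAut.inv_def, map_mul, map_inv,
    MulEquiv.apply_symm_apply]

/-- The outer automorphism group of a group: the quotient of the automorphism group by the
normal subgroup of inner automorphisms. -/
abbrev Out (G : Type*) [Group G] : Type _ := MulAut G ⧸ innerAutSubgroup G

/-- A vertex subset has no separating vertices and no separating edges: for each vertex `v`
of `S` (resp. each edge `{a,b}` of the induced graph on `S`), removing the open star of `v`
(resp. of the edge `{a,b}`) from the induced graph on `S` leaves a graph that is not
disconnected. -/
def NoSeparating {V : Type*} (G : SimpleGraph V) (S : Set V) : Prop :=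
  (∀ v ∈ S, (G.induce (S \ {v})).Preconnected) ∧
  (∀ a ∈ S, ∀ b ∈ S, G.Adj a b → (G.induce (S \ {a, b})).Preconnected)

/-- A chunk of a graph: (the vertex set of) an induced subgraph which is connected, has no
separating vertices and no separating edges, and is maximal under inclusion with these
properties. -/
def IsChunk {V : Type*} (G : SimpleGraph V) (S : Set V) : Prop :=
  ((G.induce S).Connected ∧ NoSeparating G S) ∧
  ∀ T : Set V, S ⊆ T → ((G.induce T).Connected ∧ NoSeparating G T) → T = S

universe u v

namespace ArtinRigid

/-! ### Alternating products and the basic interface of Artin groups -/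

section Basic

theorem map_altProd {M N : Type*} [Monoid M] [Monoid N] (f : M →* N) (a b : M) (n : ℕ) :
    f (altProd a b n) = altProd (f a) (f b) n := by
  induction n generalizing a b with
  | zero => simp [altProd]
  | succ n ih => simp [altProd, ih]

theorem altProd_even {M : Type*} [Monoid M] (a b : M) (k : ℕ) :
    altProd a b (2 * k) = (a * b) ^ k := by
  induction k with
  | zero => simp [altProd]
  | succ n ih => rw [show 2 * (n + 1) = 2 * n + 1 + 1 by ring, altProd, altProd, ih, pow_succ',
      mul_assoc]

theorem altProd_odd {M : Type*} [Monoid M] (a b : M) (k : ℕ) :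
    altProd a b (2 * k + 1) = (a * b) ^ k * a := by
  rw [altProd, altProd_even]
  induction k with
  | zero => simp
  | succ n ih => rw [pow_succ', pow_succ', mul_assoc, mul_assoc, mul_assoc, ← ih]

variable {V : Type*} {Γ : DefiningGraph V}

/-- The standard generator attached to a vertex. -/
def gen (Γ : DefiningGraph V) (v : V) : ArtinGroup Γ := PresentedGroup.of v

theorem gen_rel {a b : V} (h : Γ.graph.Adj a b) :
    altProd (gen Γ a) (gen Γ b) (Γ.label a b) = altProd (gen Γ b) (gen Γ a) (Γ.label a b) := by
  have := PresentedGroup.mk_eq_mk_of_mul_inv_mem (rels := Γ.rels)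
    (x := altProd (FreeGroup.of a) (FreeGroup.of b) (Γ.label a b))
    (y := altProd (FreeGroup.of b) (FreeGroup.of a) (Γ.label a b)) ⟨a, b, h, rfl⟩
  rw [map_altProd, map_altProd] at this
  exact this

/-- Maps on generators respecting the Artin relations extend to homomorphisms. -/
def liftHom {H : Type*} [Group H] (f : V → H) (hf : ∀ a b, Γ.graph.Adj a b →
      altProd (f a) (f b) (Γ.label a b) = altProd (f b) (f a) (Γ.label a b)) :
    ArtinGroup Γ →* H :=
  PresentedGroup.toGroup (f := f) (rels := Γ.rels) (by
    rintro r ⟨a, b, h, rfl⟩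
    rw [map_mul, map_inv, map_altProd, map_altProd, FreeGroup.lift_apply_of,
      FreeGroup.lift_apply_of, hf a b h, mul_inv_cancel])

@[simp] theorem liftHom_gen {H : Type*} [Group H] (f : V → H) (hf) (v : V) :
    liftHom (Γ := Γ) f hf (gen Γ v) = f v :=
  PresentedGroup.toGroup.of _

theorem hom_ext {H : Type*} [Group H] {f g : ArtinGroup Γ →* H}
    (h : ∀ v, f (gen Γ v) = g (gen Γ v)) : f = g :=
  PresentedGroup.ext h

/-- Parabolic subgroups written with `gen`. -/
theorem gen_mem {S : Set V} {v : V} (h : v ∈ S) : gen Γ v ∈ parabolic Γ S :=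
  Subgroup.subset_closure ⟨v, h, rfl⟩

theorem parabolic_le {S : Set V} {H : Subgroup (ArtinGroup Γ)} (h : ∀ v ∈ S, gen Γ v ∈ H) :
    parabolic Γ S ≤ H := by
  rw [parabolic, Subgroup.closure_le]
  rintro _ ⟨v, hv, rfl⟩
  exact h v hv

theorem parabolic_mono {S T : Set V} (h : S ⊆ T) : parabolic Γ S ≤ parabolic Γ T :=
  parabolic_le fun _ hv => gen_mem (h hv)

theorem parabolic_univ : parabolic Γ Set.univ = ⊤ := by
  rw [parabolic, Set.image_univ]
  exact PresentedGroup.closure_range_of _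

theorem parabolic_union (S T : Set V) : parabolic Γ (S ∪ T) = parabolic Γ S ⊔ parabolic Γ T := by
  rw [parabolic, Set.image_union, Subgroup.closure_union]; rfl

theorem parabolic_empty : parabolic Γ ∅ = ⊥ := by simp [parabolic]

theorem parabolic_singleton (s : V) : parabolic Γ {s} = Subgroup.zpowers (gen Γ s) := by
  rw [parabolic, Set.image_singleton, Subgroup.zpowers_eq_closure]; rfl

theorem parabolic_pair (a b : V) : parabolic Γ {a, b} = Subgroup.closure {gen Γ a, gen Γ b} := by
  rw [parabolic, Set.image_pair]; rfl

/-- The length homomorphism, sending every generator to `1`. -/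
def lam (Γ : DefiningGraph V) : ArtinGroup Γ →* Multiplicative ℤ :=
  liftHom (fun _ => Multiplicative.ofAdd 1) (fun _ _ _ => rfl)

/-- The length homomorphism with integer values. -/
def len (g : ArtinGroup Γ) : ℤ := (lam Γ g).toAdd

@[simp] theorem len_gen (v : V) : len (gen Γ v) = 1 := by simp [len, lam]
@[simp] theorem len_one : len (1 : ArtinGroup Γ) = 0 := by simp [len]
@[simp] theorem len_mul (g h : ArtinGroup Γ) : len (g * h) = len g + len h := by simp [len]
@[simp] theorem len_inv (g : ArtinGroup Γ) : len g⁻¹ = -len g := by simp [len]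
@[simp] theorem len_zpow (g : ArtinGroup Γ) (n : ℤ) : len (g ^ n) = n * len g := by simp [len]

theorem len_conj (g h : ArtinGroup Γ) : len (g * h * g⁻¹) = len h := by simp

theorem gen_zpow_eq_one {v : V} {i : ℤ} (h : gen Γ v ^ i = 1) : i = 0 := by
  have := congrArg len h
  simpa using this

/-- Conjugates of powers of standard generators. -/
def VertexType (k : ArtinGroup Γ) : Prop := ∃ (g : ArtinGroup Γ) (s : V) (i : ℤ),
  k = g * gen Γ s ^ i * g⁻¹

theorem VertexType.eq_one {k : ArtinGroup Γ} (h : VertexType k) (hl : len k = 0) : k = 1 := by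
  obtain ⟨g, s, i, rfl⟩ := h
  rw [len_conj, len_zpow, len_gen, mul_one] at hl
  simp [hl]

theorem VertexType.conj {k : ArtinGroup Γ} (h : VertexType k) (x : ArtinGroup Γ) :
    VertexType (x * k * x⁻¹) := by
  obtain ⟨g, s, i, rfl⟩ := h
  exact ⟨x * g, s, i, by group⟩

theorem vertexType_conj_iff {k : ArtinGroup Γ} (x : ArtinGroup Γ) :
    VertexType (x * k * x⁻¹) ↔ VertexType k :=
  ⟨fun h => by simpa [mul_assoc] using h.conj x⁻¹, fun h => h.conj x⟩

theorem VertexType.zpow {k : ArtinGroup Γ} (h : VertexType k) (n : ℤ) : VertexType (k ^ n) := by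
  obtain ⟨g, s, i, rfl⟩ := h
  exact ⟨g, s, i * n, by rw [conj_zpow, zpow_mul]⟩

theorem vertexType_one [Nonempty V] : VertexType (1 : ArtinGroup Γ) :=
  ⟨1, Classical.arbitrary V, 0, by simp⟩

theorem len_comm (x y : ArtinGroup Γ) : len (x * y * x⁻¹ * y⁻¹) = 0 := by simp

theorem not_vertexType_comm {x y : ArtinGroup Γ} (h : x * y ≠ y * x) :
    ¬ VertexType (x * y * x⁻¹ * y⁻¹) := fun hv => by
  have := hv.eq_one (len_comm x y)
  rw [mul_inv_eq_one, mul_inv_eq_iff_eq_mul] at this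
  exact h this

end Basic

/-! ### A reflection representation -/

section Ring

variable {R : Type*} [Ring R] [Algebra ℝ R]

/-- The braid relation for generalized reflections. -/
theorem altProd_reflection {A B : R} {m : ℕ} (hm : 3 ≤ m) {κ : ℝ}
    (hκ : κ = 4 * Real.cos (Real.pi / m)) (hA : A * A = (5 : ℝ) • A) (hB : B * B = (5 : ℝ) • B)
    (hABA : A * B * A = κ ^ 2 • A) (hBAB : B * A * B = κ ^ 2 • B) :
    altProd (1 - A) (1 - B) m = altProd (1 - B) (1 - A) m := by
  set θ : ℝ := 2 * Real.pi / m with hθ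
  have hκ2 : κ ^ 2 = 8 * Real.cos θ + 8 := by
    rw [hκ, hθ, mul_div_assoc, Real.cos_two_mul]; ring
  have hmul {X Y Z : R} (h : X * Y = Z) (x : R) : X * (Y * x) = Z * x := by rw [← h, mul_assoc]
  rw [mul_assoc] at hABA hBAB
  have hABA' (x : R) : A * (B * (A * x)) = κ ^ 2 • (A * x) := by
    rw [← mul_assoc B, hmul hABA, smul_mul_assoc]
  have hBAB' (x : R) : B * (A * (B * x)) = κ ^ 2 • (B * x) := by
    rw [← mul_assoc A, hmul hBAB, smul_mul_assoc]
  obtain ⟨E, h1, h2, ha, hb⟩ : ∃ E : R, (1 - A) * (1 - B) * ((1 - A) * (1 - B)) =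
        E + (8 * Real.cos θ) • ((1 - A) * (1 - B)) - (16 : ℝ) • 1 ∧
      (1 - B) * (1 - A) * ((1 - B) * (1 - A)) =
        E + (8 * Real.cos θ) • ((1 - B) * (1 - A)) - (16 : ℝ) • 1 ∧
      E * (1 - A) = E ∧ E * (1 - B) = E := by
    refine ⟨(1 - A) * (1 - B) * ((1 - A) * (1 - B)) -
      (8 * Real.cos θ) • ((1 - A) * (1 - B)) + (16 : ℝ) • 1, by abel, ?_, ?_, ?_⟩ <;>
    · simp only [sub_mul, add_mul, mul_sub, one_mul, mul_one, mul_assoc, hA, hB, hmul hA, hmul hB,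
        hABA, hBAB, hABA', hBAB', hκ2, smul_sub, mul_smul_comm, smul_mul_assoc]
      module
  have hE (n : ℕ) : E * altProd (1 - A) (1 - B) n = E ∧ E * altProd (1 - B) (1 - A) n = E := by
    induction n with
    | zero => simp [altProd]
    | succ n ih => simp only [altProd, ← mul_assoc, ha, hb]; exact ih.symm
  have hrec (n : ℕ) : altProd (1 - A) (1 - B) (n + 4) - altProd (1 - B) (1 - A) (n + 4) =
      (8 * Real.cos θ) • (altProd (1 - A) (1 - B) (n + 2) - altProd (1 - B) (1 - A) (n + 2)) -
        (16 : ℝ) • (altProd (1 - A) (1 - B) n - altProd (1 - B) (1 - A) n) := by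
    have f (x y : R) : altProd x y (n + 4) = x * y * (x * y) * altProd x y n ∧
        altProd x y (n + 2) = x * y * altProd x y n := by simp only [altProd, mul_assoc, and_self]
    rw [(f _ _).1, (f _ _).1, (f _ _).2, (f _ _).2, h1, h2]
    simp only [sub_mul, add_mul, (hE n).1, (hE n).2, smul_mul_assoc, one_mul, smul_sub]
    abel
  have hsol (u : ℕ → R) (hu : ∀ n, u (n + 2) = (8 * Real.cos θ) • u (n + 1) - (16 : ℝ) • u n)
      (n : ℕ) : Real.sin θ • u n = (4 : ℝ) ^ n •
        ((Real.sin (n * θ) / 4) • u 1 - (Real.sin (n * θ - θ)) • u 0) := by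
    induction n using Nat.twoStepInduction with
    | zero => simp
    | one => simp; module
    | more n ih1 ih2 =>
      rw [hu, smul_sub, smul_comm, ih2, smul_comm _ (16 : ℝ), ih1]
      push_cast
      simp only [add_mul, one_mul, two_mul, ← add_assoc, add_sub_cancel_right, Real.sin_add,
        Real.sin_sub, Real.cos_add]
      have := Real.sin_sq_add_cos_sq θ
      match_scalars <;> grind
  have hm3 : (3 : ℝ) ≤ m := by exact_mod_cast hm
  have hmθ : m * θ = 2 * Real.pi := by rw [hθ]; field_simp
  have hθpos : 0 < θ := by positivity
  have hs : Real.sin θ ≠ 0 := (Real.sin_pos_of_pos_of_lt_pi hθpos (by nlinarith)).ne'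
  rw [← sub_eq_zero]
  refine (smul_eq_zero.1 ?_).resolve_left hs
  rcases Nat.even_or_odd' m with ⟨k, hk | hk⟩
  · have h2 : (k : ℝ) * θ = Real.pi := by rw [hk] at hmθ; push_cast at hmθ; linarith
    have := hsol (fun n => altProd (1 - A) (1 - B) (2 * n) - altProd (1 - B) (1 - A) (2 * n))
      (fun n => hrec (2 * n)) k
    rw [← hk, h2] at this
    simpa [altProd] using this
  · have h2 : (k : ℝ) * θ = Real.pi - θ / 2 := by rw [hk] at hmθ; push_cast at hmθ; linarith
    have := hsol (fun n => altProd (1 - A) (1 - B) (2 * n + 1) - altProd (1 - B) (1 - A) (2 * n + 1))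
      (fun n => hrec (2 * n + 1)) k
    rw [← hk, h2] at this
    rw [this]
    simp only [altProd, sub_mul, mul_sub, one_mul, mul_one, hA, hB, hABA, hBAB, hκ2]
    obtain ⟨x, hx⟩ : ∃ x, θ = 2 * x := ⟨θ / 2, by ring⟩
    rw [hx, mul_div_cancel_left₀ _ two_ne_zero, show Real.pi - x - 2 * x = Real.pi - (x + 2 * x) by ring,
      Real.sin_pi_sub, Real.sin_pi_sub, Real.sin_add, Real.sin_two_mul, Real.cos_two_mul]
    have := Real.sin_sq_add_cos_sq x
    match_scalars <;> grind

end Ring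

section Rep

variable {W : Type*} (Λ : DefiningGraph W)

open Classical in
/-- The coefficients of the reflections. -/
noncomputable def coef (s t : W) : ℝ := if s = t then 5 else if Λ.graph.Adj s t then
    (if Λ.label s t = 2 then 0 else -(4 * Real.cos (Real.pi / Λ.label s t))) else -1

/-- The rank one endomorphism attached to a vertex. -/
noncomputable def rankOne (s : W) : Module.End ℝ (W → ℝ) :=
  (LinearMap.proj (R := ℝ) (φ := fun _ : W => ℝ) s).smulRight (coef Λ s)

@[simp] theorem rankOne_apply (s : W) (f : W → ℝ) : rankOne Λ s f = f s • coef Λ s := rfl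

@[simp] theorem coef_self (s : W) : coef Λ s s = 5 := by simp [coef]

theorem coef_symm (s t : W) : coef Λ s t = coef Λ t s := by
  grind [coef, Λ.label_symm s t, Λ.graph.adj_comm s t]

theorem coef_eq_zero {s t : W} (h : coef Λ s t = 0) : Λ.graph.Adj s t ∧ Λ.label s t = 2 := by
  rw [coef] at h
  split_ifs at h with h1 h2 h3
  · norm_num at h
  · exact ⟨h2, h3⟩
  · exfalso
    have h4 := Λ.two_le_label s t h2
    have h5 : (3 : ℝ) ≤ Λ.label s t := by exact_mod_cast (show 3 ≤ Λ.label s t by omega)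
    have hp := Real.pi_pos
    have := Real.cos_pos_of_mem_Ioo (x := Real.pi / Λ.label s t)
      ⟨by linarith [show 0 < Real.pi / Λ.label s t by positivity],
        by rw [div_lt_div_iff₀ (by linarith) (by norm_num)]; nlinarith⟩
    linarith
  · norm_num at h

theorem coef_sq_lt {s t : W} (h : s ≠ t) : coef Λ s t ^ 2 < 25 := by
  rw [coef, if_neg h]
  split_ifs
  · norm_num
  · have h1 := Real.cos_le_one (Real.pi / Λ.label s t)
    have h2 := Real.neg_one_le_cos (Real.pi / Λ.label s t)
    nlinarith
  · norm_num

theorem rankOne_sq (s : W) : rankOne Λ s * rankOne Λ s = (5 : ℝ) • rankOne Λ s := by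
  ext f t
  simp
  ring

/-- The reflection as a unit. -/
noncomputable def reflUnit (s : W) : (Module.End ℝ (W → ℝ))ˣ where
  val := 1 - rankOne Λ s
  inv := 1 - (1 / 4 : ℝ) • rankOne Λ s
  val_inv := by
    simp only [sub_mul, mul_sub, one_mul, mul_one, mul_smul_comm, rankOne_sq]
    module
  inv_val := by
    simp only [sub_mul, mul_sub, one_mul, mul_one, smul_mul_assoc, rankOne_sq]
    module

/-- The reflection representation. -/
noncomputable def rep : ArtinGroup Λ →* (Module.End ℝ (W → ℝ))ˣ := liftHom (reflUnit Λ) (by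
    intro a b hab
    ext1
    rw [← Units.coeHom_apply, ← Units.coeHom_apply, map_altProd, map_altProd]
    change altProd (1 - rankOne Λ a) (1 - rankOne Λ b) _ =
      altProd (1 - rankOne Λ b) (1 - rankOne Λ a) _
    by_cases h2 : Λ.label a b = 2
    · rw [h2]
      have h0 : coef Λ a b = 0 := by simp [coef, hab, hab.ne, h2]
      have h0' : coef Λ b a = 0 := by rw [coef_symm, h0]
      have e1 : rankOne Λ a * rankOne Λ b = 0 := LinearMap.ext fun f => by simp [h0']
      have e2 : rankOne Λ b * rankOne Λ a = 0 := LinearMap.ext fun f => by simp [h0]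
      simp only [altProd, sub_mul, mul_sub, one_mul, mul_one, e1, e2]
      abel
    · have h3 := Λ.two_le_label a b hab
      have hc : coef Λ a b = -(4 * Real.cos (Real.pi / Λ.label a b)) := by
        simp [coef, hab, hab.ne, h2]
      refine altProd_reflection (by omega) (κ := 4 * Real.cos (Real.pi / Λ.label a b)) rfl
        (rankOne_sq Λ a) (rankOne_sq Λ b) ?_ ?_ <;>
      · refine LinearMap.ext fun f => ?_
        simp only [Module.End.mul_apply, rankOne_apply, Pi.smul_apply, smul_eq_mul,
          LinearMap.smul_apply, smul_smul, coef_symm Λ b a, hc]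
        congr 1; ring)

/-- The representation as a monoid hom to endomorphisms. -/
noncomputable def repE : ArtinGroup Λ →* Module.End ℝ (W → ℝ) := (Units.coeHom _).comp (rep Λ)

theorem repE_gen (s : W) : repE Λ (gen Λ s) = 1 - rankOne Λ s := by
  simp [repE, rep, reflUnit]

theorem repE_gen_zpow (s : W) (p : ℤ) :
    repE Λ (gen Λ s ^ p) = 1 + (((-4 : ℝ) ^ p - 1) / 5) • rankOne Λ s := by
  have hinv : repE Λ (gen Λ s)⁻¹ = 1 - (1 / 4 : ℝ) • rankOne Λ s := by
    simp [repE, rep, reflUnit, Units.inv_mk]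
  induction p using Int.induction_on with
  | zero => simp
  | succ p ih =>
    rw [zpow_add_one, map_mul, ih, repE_gen, zpow_add_one₀ (by norm_num)]
    simp only [mul_sub, add_mul, mul_one, one_mul, smul_mul_assoc, rankOne_sq]
    module
  | pred p ih =>
    rw [zpow_sub_one, map_mul, ih, hinv, zpow_sub_one₀ (by norm_num)]
    simp only [mul_sub, add_mul, mul_one, one_mul, smul_mul_assoc, mul_smul_comm, rankOne_sq]
    module

theorem zpow_neg_four_eq_one {p : ℤ} (h : (-4 : ℝ) ^ p = 1) : p = 0 := by
  have h1 := congrArg abs h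
  rwa [abs_zpow, abs_neg, abs_one, abs_of_pos (by norm_num), zpow_eq_one_iff_right₀ (by norm_num)
    (by norm_num)] at h1

variable {Λ}

open Classical in
theorem repE_fix {w : W} {g : ArtinGroup Λ} (hg : g ∈ parabolic Λ {w}ᶜ) :
    repE Λ g (Pi.single w 1) = Pi.single w 1 := by
  induction hg using Subgroup.closure_induction with
  | mem x hx =>
    obtain ⟨t, ht, rfl⟩ := hx
    change repE Λ (gen Λ t) _ = _
    simp [repE_gen, show t ≠ w from ht]
  | one => simp
  | mul x y _ _ h1 h2 => rw [map_mul, Module.End.mul_apply, h2, h1]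
  | inv x _ h =>
    conv_lhs => rw [← h, ← Module.End.mul_apply, ← map_mul, inv_mul_cancel, map_one]
    rfl

/-- A power of a generator lying in the parabolic on the other vertices is trivial. -/
theorem zpow_mem_compl {w : W} {p : ℤ} (h : gen Λ w ^ p ∈ parabolic Λ {w}ᶜ) : p = 0 := by
  classical
  have := congrFun (repE_fix h) w
  rw [repE_gen_zpow] at this
  simp at this
  apply zpow_neg_four_eq_one
  linarith

/-- Commuting generators are joined by an edge with label `2`. -/
theorem adj_of_commute {s t : W} (hst : s ≠ t) (h : Commute (gen Λ s) (gen Λ t)) :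
    Λ.graph.Adj s t ∧ Λ.label s t = 2 := by
  classical
  have h1 := congrArg (repE Λ) h.eq
  rw [map_mul, map_mul, repE_gen, repE_gen] at h1
  have h2 := congrFun (congrArg (fun f => f (Pi.single t (1 : ℝ))) h1) s
  simp [hst, sub_mul, mul_sub] at h2
  exact coef_eq_zero Λ (coef_symm Λ s t ▸ h2)

/-- Powers of two noncommuting generators. -/
theorem zpow_relation {s t : W} (hst : s ≠ t) (hne : ¬ (Λ.graph.Adj s t ∧ Λ.label s t = 2))
    {i p j q : ℤ} (hi : i ≠ 0)
    (h : gen Λ s ^ i * gen Λ t ^ p * gen Λ s ^ j = gen Λ t ^ q) : p = 0 := by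
  classical
  have h0 : gen Λ t ^ p * gen Λ s ^ j = gen Λ s ^ (-i) * gen Λ t ^ q := by
    rw [← h, zpow_neg]; group
  have h1 := congrArg (repE Λ) h0
  simp only [map_mul, repE_gen_zpow] at h1
  have h2 := congrArg (fun f => f (Pi.single s (1 : ℝ))) h1
  have hs := congrFun h2 s
  have ht := congrFun h2 t
  have hk : coef Λ s t ≠ 0 := fun h => hne (coef_eq_zero Λ h)
  have hlt := coef_sq_lt Λ hst
  simp [hst.symm, coef_symm Λ t s] at hs ht
  set c := coef Λ s t
  set P : ℝ := (-4) ^ p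
  set J : ℝ := (-4) ^ j
  set I : ℝ := ((-4) ^ i)⁻¹
  have ht' : (J - 1) + (P - 1) * (J - 1) = I - 1 :=
    mul_left_cancel₀ hk (by linear_combination 5 * ht)
  have h3 : (P - 1) * (J - 1) * (25 - c ^ 2) = 0 := by linear_combination 25 * ht' - 25 * hs
  rcases mul_eq_zero.1 ((mul_eq_zero.1 h3).resolve_right (by linarith)) with h | h
  · exact zpow_neg_four_eq_one (by linarith)
  · have : I = 1 := by rw [h] at ht'; linarith
    exact absurd (zpow_neg_four_eq_one (inv_eq_one.1 this)) hi

theorem coef_eq_zero_of_commute {a b c : W} (hab : a ≠ b) (hac : a ≠ c) (hbc : b ≠ c) {N : ℕ}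
    (hN : N ≠ 0) (ha : Commute ((gen Λ a * gen Λ b) ^ N) (gen Λ a))
    (hb : Commute ((gen Λ a * gen Λ b) ^ N) (gen Λ b))
    (hc : Commute ((gen Λ a * gen Λ b) ^ N) (gen Λ c)) : coef Λ a c = 0 ∧ coef Λ b c = 0 := by
  classical
  set z := (gen Λ a * gen Λ b) ^ N with hz
  set Z := repE Λ z
  have comm : ∀ x, Commute z (gen Λ x) → ∀ f, f x • Z (coef Λ x) = (Z f) x • coef Λ x := by
    intro x hx f
    have h1 := congrArg (repE Λ) hx.eq
    rw [map_mul, map_mul, repE_gen, mul_sub, sub_mul, mul_one, one_mul, sub_right_inj] at h1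
    simpa using congrArg (fun F => F f) h1
  have e3 : Z (coef Λ c) = coef Λ c := by
    have := comm c hc (Pi.single c 1)
    rw [repE_fix (pow_mem (mul_mem (gen_mem (by simpa using hac)) (gen_mem (by simpa using hbc))) _)]
      at this
    simpa using this
  have ev (f : W → ℝ) : (Z f) c = f c := by
    have := congrFun (comm c hc f) c
    rw [e3] at this
    simpa using this.symm
  have eig {x : W} (hx : Commute z (gen Λ x)) : Z (coef Λ x) = ((Z (coef Λ x)) x / 5) • coef Λ x := by
    have := comm x hx (coef Λ x)
    rw [coef_self] at this
    rw [div_eq_inv_mul, mul_smul, ← this, smul_smul]; norm_num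
  have e1 := eig ha
  have e2 := eig hb
  set α := (Z (coef Λ a)) a / 5
  set β := (Z (coef Λ b)) b / 5
  have h16 : (1 : ℝ) < 16 ^ N := one_lt_pow₀ (by norm_num) hN
  have key : α ≠ 1 ∧ β ≠ 1 := by
    by_cases hab0 : coef Λ a b = 0
    · have h (n : ℕ) (f : W → ℝ) : repE Λ ((gen Λ a * gen Λ b) ^ n) f a = (-4) ^ n * f a ∧
          repE Λ ((gen Λ a * gen Λ b) ^ n) f b = (-4) ^ n * f b := by
        induction n with
        | zero => simp
        | succ n ih =>
          rw [pow_succ', map_mul, map_mul, repE_gen, repE_gen]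
          simp [ih, hab0, coef_symm Λ b a, -map_pow, -map_mul]
          constructor <;> ring
      have h1 : α = (-4) ^ N := by simp [α, (h N _).1, Z, hz, -map_pow]
      have h2 : β = (-4) ^ N := by simp [β, (h N _).2, Z, hz, -map_pow]
      have h4 : ((-4 : ℝ) ^ N) ^ 2 = 16 ^ N := by rw [← pow_mul, mul_comm, pow_mul]; norm_num
      rw [h1, h2, and_self]
      rintro h
      rw [h] at h4
      linarith
    · have h (n : ℕ) (f g : W → ℝ) : repE Λ ((gen Λ a * gen Λ b) ^ n) f a *
          repE Λ ((gen Λ a * gen Λ b) ^ n) g b - repE Λ ((gen Λ a * gen Λ b) ^ n) f b *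
          repE Λ ((gen Λ a * gen Λ b) ^ n) g a = 16 ^ n * (f a * g b - f b * g a) := by
        induction n with
        | zero => simp
        | succ n ih =>
          rw [pow_succ' (16 : ℝ), mul_assoc (16 : ℝ), ← ih, pow_succ', map_mul, map_mul,
            repE_gen, repE_gen]
          simp [coef_symm Λ b a, -map_pow, -map_mul]
          ring
      have hdet := h N (coef Λ a) (coef Λ b)
      have hαβ : α = β := by
        have := congrFun (comm a ha (coef Λ b)) a
        rw [e1, e2] at this
        simp [coef_symm Λ b a] at this
        exact mul_left_cancel₀ hab0 (by linarith)
      change Z _ a * Z _ b - Z _ b * Z _ a = _ at hdet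
      rw [e1, e2, ← hαβ] at hdet
      simp [coef_symm Λ b a] at hdet
      have hlt := coef_sq_lt Λ hab
      rw [← hαβ, and_self]
      rintro h1
      rw [h1] at hdet
      nlinarith
  constructor <;> by_contra hc'
  · have := ev (coef Λ a)
    rw [e1] at this
    exact key.1 (mul_right_cancel₀ hc' (by simpa using this))
  · have := ev (coef Λ b)
    rw [e2] at this
    exact key.2 (mul_right_cancel₀ hc' (by simpa using this))

end Rep

/-! ### Amalgamated products detected by normal forms -/

section Amalg

variable {G : Type*} [Group G]
variable {a b c g x y : G} {l l' : List G}

/-- Every entry lies in exactly one of `A`, `B`, and consecutive entries lie in different ones. -/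
def Alt (A B : Subgroup G) (l : List G) : Prop :=
  (∀ x ∈ l, ¬ (x ∈ A ↔ x ∈ B)) ∧ l.IsChain (fun x y => (x ∈ A ↔ y ∈ B))

/-- `G` is the amalgamated product of its subgroups `A` and `B` over `A ⊓ B`. -/
structure Amalg (A B : Subgroup G) : Prop where
  sup : A ⊔ B = ⊤
  nf : ∀ l : List G, Alt A B l → l ≠ [] → ¬ (l.prod ∈ A ∧ l.prod ∈ B)

/-- Elements with an alternating expression whose first entry lies in `B`. -/
def Starts (A B : Subgroup G) (g : G) : Prop := ∃ x l, Alt A B (x :: l) ∧ x ∈ B ∧ (x :: l).prod = g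

variable {A B : Subgroup G}

theorem Alt.symm (h : Alt A B l) : Alt B A l :=
  ⟨fun x hx h' => h.1 x hx h'.symm, h.2.imp_of_mem_imp fun x y hx hy hxy => by
    have := h.1 x hx; have := h.1 y hy; tauto⟩

theorem Amalg.symm (h : Amalg A B) : Amalg B A :=
  ⟨by rw [sup_comm]; exact h.sup, fun l hl hn hc => h.nf l hl.symm hn hc.symm⟩

theorem Alt.tail (h : Alt A B (x :: l)) : Alt A B l := ⟨fun z hz => h.1 z (by simp [hz]), h.2.tail⟩

theorem alt_cons_cons :
    Alt A B (x :: y :: l) ↔ ¬ (x ∈ A ↔ x ∈ B) ∧ (x ∈ A ↔ y ∈ B) ∧ Alt A B (y :: l) := by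
  simp only [Alt, List.isChain_cons_cons, List.mem_cons, forall_eq_or_imp]
  tauto

theorem alt_singleton : Alt A B [x] ↔ ¬ (x ∈ A ↔ x ∈ B) := by
  simp [Alt]

theorem Alt.inv_reverse (h : Alt A B l) : Alt A B (l.map (·⁻¹)).reverse := by
  refine ⟨fun x hx => ?_, ?_⟩
  · simp only [List.mem_reverse, List.mem_map] at hx
    obtain ⟨y, hy, rfl⟩ := hx
    simpa using h.1 y hy
  · rw [List.isChain_reverse, List.isChain_map]
    exact h.symm.2.imp fun x y hxy => by simpa [flip] using hxy.symm

/-- Concatenate alternating lists. -/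
theorem Alt.append (h : Alt A B l) (h' : Alt A B l')
    (hc : ∀ x ∈ l.getLast?, ∀ y ∈ l'.head?, (x ∈ A ↔ y ∈ B)) : Alt A B (l ++ l') :=
  ⟨fun x hx => (List.mem_append.1 hx).elim (h.1 x) (h'.1 x), List.isChain_append.2 ⟨h.2, h'.2, hc⟩⟩

theorem Starts.of_mem (hB : g ∈ B) (hA : g ∉ A) : Starts A B g :=
  ⟨g, [], by rw [alt_singleton]; tauto, hB, by simp⟩

/-- Left multiplication by an element of `B` outside `A` of something starting in `A`. -/
theorem Starts.cons (hB : b ∈ B) (hA : b ∉ A) (h : Starts B A g) : Starts A B (b * g) := by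
  obtain ⟨x, l, hl, hx, rfl⟩ := h
  refine ⟨b, x :: l, ?_, hB, by simp⟩
  rw [alt_cons_cons]
  have hl' := hl.symm
  have := hl'.1 x (by simp)
  tauto

/-- Right multiplication by an element of `A` or of `B`. -/
theorem Alt.mul_right (hl : Alt A B (x :: l)) (hx : x ∈ B) (hc : c ∈ A ∨ c ∈ B) : Starts A B
    ((x :: l).prod * c) ∨ ((x :: l).prod * c ∈ A ∧ (x :: l).prod * c ∈ B) := by
  have hxA : x ∉ A := by have := hl.1 x (by simp); tauto
  induction l generalizing A B x with
  | nil =>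
    rw [List.prod_singleton]
    by_cases hB : c ∈ B
    · by_cases hA : x * c ∈ A
      · exact Or.inr ⟨hA, mul_mem hx hB⟩
      · exact Or.inl (.of_mem (mul_mem hx hB) hA)
    · exact Or.inl (.cons hx hxA (.of_mem (hc.resolve_right hB) hB))
  | cons y l ih =>
    have hy := hl.tail.1 y (by simp)
    have := (alt_cons_cons.1 hl).2.1
    rw [List.prod_cons, mul_assoc]
    rcases ih hl.tail.symm (by tauto) hc.symm (by tauto) with h | h
    · exact Or.inl (.cons hx hxA h)
    · exact Or.inl (.of_mem (mul_mem hx h.1) (by rwa [Subgroup.mul_mem_cancel_right _ h.2]))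

theorem starts_trichotomy (h : A ⊔ B = ⊤) (g : G) :
    (g ∈ A ∧ g ∈ B) ∨ Starts A B g ∨ Starts B A g := by
  have key (g c : G) (hc : c ∈ A ∨ c ∈ B) (hg : (g ∈ A ∧ g ∈ B) ∨ Starts A B g ∨ Starts B A g) :
      (g * c ∈ A ∧ g * c ∈ B) ∨ Starts A B (g * c) ∨ Starts B A (g * c) := by
    rcases hg with hg | ⟨x, l, hl, hx, rfl⟩ | ⟨x, l, hl, hx, rfl⟩
    · have h1 := mul_mem (S := Subgroup G) (b := c) hg.1
      have h2 := mul_mem (S := Subgroup G) (b := c) hg.2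
      have h3 := Starts.of_mem (A := A) (B := B) (g := g * c)
      have h4 := Starts.of_mem (A := B) (B := A) (g := g * c)
      tauto
    · have := hl.mul_right hx hc; tauto
    · have := hl.mul_right hx hc.symm; tauto
  have hg : g ∈ Subgroup.closure ((A : Set G) ∪ B) := by
    rw [Subgroup.closure_union, Subgroup.closure_eq, Subgroup.closure_eq, h]; trivial
  induction hg using Subgroup.closure_induction_right with
  | one => exact Or.inl ⟨one_mem _, one_mem _⟩
  | mul_right x _ y hy ih => exact key x y hy ih
  | mul_inv_cancel x _ y hy ih => exact key x _ (hy.imp inv_mem inv_mem) ih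

/-- Right multiplication by `b ∈ B` changes the side of the base edge only at `A ⊓ B`. -/
theorem starts_mul_right_iff' (hb : b ∈ B)
    (hg : ¬ (g ∈ A ∧ g ∈ B)) (h : Starts A B (g * b)) : Starts A B g := by
  obtain ⟨x, l, hl, hx, e⟩ := h
  simpa [e, hg] using hl.mul_right hx (.inr (inv_mem hb))

variable (h : Amalg A B)
include h

theorem Amalg.trichotomy (g : G) : (g ∈ A ∧ g ∈ B) ∨ Starts A B g ∨ Starts B A g :=
  starts_trichotomy h.sup g

theorem Amalg.not_starts_of_mem (hA : g ∈ A) (hB : g ∈ B) : ¬ Starts A B g :=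
  fun ⟨_, _, hl, _, e⟩ => h.nf _ hl (by simp) (by rw [e]; exact ⟨hA, hB⟩)

theorem Amalg.not_starts_both (h1 : Starts A B g) : ¬ Starts B A g := by
  rintro ⟨y, m, hm, hy, e⟩
  obtain ⟨x, l, hl, hx, rfl⟩ := h1
  have hm' := hm.symm
  have := h.nf (((y :: m).map (·⁻¹)).reverse ++ (x :: l)) (hm'.inv_reverse.append hl (by
    have h1 := hm'.1 y (by simp)
    have h2 := hl.1 x (by simp)
    simp
    tauto)) (by simp)
  rw [List.prod_append, ← List.prod_inv_reverse, e, inv_mul_cancel] at this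
  exact this ⟨one_mem _, one_mem _⟩

theorem Amalg.not_starts_one : ¬ Starts A B 1 := h.not_starts_of_mem (one_mem _) (one_mem _)

theorem Amalg.not_starts_of_memA (hA : g ∈ A) : ¬ Starts A B g := by
  by_cases hB : g ∈ B
  · exact h.not_starts_of_mem hA hB
  · exact fun h' => h.not_starts_both h' (Starts.of_mem hA hB)

theorem Starts.cons_iff (hB : b ∈ B) (hA : b ∉ A) (hg : ¬ Starts A B g) : Starts A B (b * g) :=
  (h.trichotomy g).elim
    (fun h1 => .of_mem (mul_mem hB h1.2) fun h => hA (by simpa using mul_mem h (inv_mem h1.1)))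
    fun h1 => (h1.resolve_left hg).cons hB hA

/-- Right multiplication by elements of `A` does not change whether an element starts in `B`. -/
theorem Amalg.starts_mul_right (ha : a ∈ A) (hg : Starts A B g) : Starts A B (g * a) := by
  obtain ⟨x, l, hl, hx, rfl⟩ := hg
  exact (hl.mul_right hx (.inl ha)).resolve_right fun h' => h.not_starts_of_memA
    (by simpa using mul_mem h'.1 (inv_mem ha)) ⟨x, l, hl, hx, rfl⟩

theorem Amalg.starts_mul_right_iff (ha : a ∈ A) : Starts A B (g * a) ↔ Starts A B g :=
  ⟨fun hg => by simpa using h.starts_mul_right (inv_mem ha) hg, h.starts_mul_right ha⟩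

end Amalg

section SubAmalg

variable {G : Type*} [Group G] {A B : Subgroup G}
variable {g : G}

theorem Alt.map {H : Type*} [Group H] {A' B' : Subgroup H} (f : H → G) {l : List H}
    (hA : ∀ x ∈ l, f x ∈ A ↔ x ∈ A') (hB : ∀ x ∈ l, f x ∈ B ↔ x ∈ B')
    (h : Alt A' B' l) : Alt A B (l.map f) := by
  refine ⟨fun y hy => ?_, ?_⟩
  · obtain ⟨x, hx, rfl⟩ := List.mem_map.1 hy
    rw [hA x hx, hB x hx]
    exact h.1 x hx
  · rw [List.isChain_map]
    exact h.2.imp_of_mem_imp fun x y hx hy hxy => by rwa [hA x hx, hB y hy]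

theorem Starts.exists_tail (h : Starts A B g) : g ∈ B ∨ ∃ x ∈ B, Starts B A (x⁻¹ * g) := by
  obtain ⟨x, l, hl, hx, rfl⟩ := h
  cases l with
  | nil => left; simpa using hx
  | cons y l =>
    right
    refine ⟨x, hx, y, l, hl.tail.symm, ?_, by simp⟩
    have h1 := hl.1 x (by simp)
    rw [alt_cons_cons] at hl
    have := hl.2.2.1 y (by simp)
    tauto

variable {A₀ B₀ : Subgroup G}

theorem Alt.coe (hA : A₀ ≤ A) (hB : B₀ ≤ B) (hAB : ∀ x ∈ A₀, x ∈ B → x ∈ B₀)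
    (hBA : ∀ x ∈ B₀, x ∈ A → x ∈ A₀) {l : List ↥(A₀ ⊔ B₀)} (hl : Alt (A₀.subgroupOf (A₀ ⊔ B₀))
    (B₀.subgroupOf (A₀ ⊔ B₀)) l) : Alt A B (l.map Subtype.val) := by
  refine hl.map _ ?_ ?_ <;> intro x hx <;> have := hl.1 x hx <;>
    simp only [Subgroup.mem_subgroupOf] at this ⊢ <;> have h1 := @hA x <;> have h2 := @hB x <;>
    have h3 := hAB x <;> have h4 := hBA x <;> tauto

theorem Amalg.sub (h : Amalg A B) (hA : A₀ ≤ A) (hB : B₀ ≤ B) (hAB : ∀ x ∈ A₀, x ∈ B → x ∈ B₀)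
    (hBA : ∀ x ∈ B₀, x ∈ A → x ∈ A₀) :
    Amalg (A₀.subgroupOf (A₀ ⊔ B₀)) (B₀.subgroupOf (A₀ ⊔ B₀)) := by
  refine ⟨?_, fun l hl hn hc => h.nf _ (hl.coe hA hB hAB hBA) (hn ∘ List.map_eq_nil_iff.1) ?_⟩
  · rw [← Subgroup.subgroupOf_sup le_sup_left le_sup_right, Subgroup.subgroupOf_self]
  · rw [show (l.map Subtype.val).prod = (l.prod : G) from (map_list_prod (A₀ ⊔ B₀).subtype l).symm]
    exact ⟨hA hc.1, hB hc.2⟩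

theorem Amalg.starts_of_sub (hA : A₀ ≤ A) (hB : B₀ ≤ B) (hAB : ∀ x ∈ A₀, x ∈ B → x ∈ B₀)
    (hBA : ∀ x ∈ B₀, x ∈ A → x ∈ A₀) {g : ↥(A₀ ⊔ B₀)} (hg : Starts (A₀.subgroupOf (A₀ ⊔ B₀))
    (B₀.subgroupOf (A₀ ⊔ B₀)) g) : Starts A B (g : G) := by
  obtain ⟨y, l, hl, hy, rfl⟩ := hg
  exact ⟨y, _, hl.coe hA hB hAB hBA, hB hy, (map_list_prod (A₀ ⊔ B₀).subtype (y :: l)).symm⟩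

theorem Amalg.sub_inter (h : Amalg A B) (hA : A₀ ≤ A) (hB : B₀ ≤ B) (hAB : ∀ x ∈ A₀, x ∈ B → x ∈ B₀)
    (hBA : ∀ x ∈ B₀, x ∈ A → x ∈ A₀) (hg : g ∈ A₀ ⊔ B₀) (hgA : g ∈ A) : g ∈ A₀ := by
  have hs := h.sub hA hB hAB hBA
  rcases hs.trichotomy ⟨g, hg⟩ with h1 | h1 | h1
  · exact h1.1
  · exact absurd (starts_of_sub hA hB hAB hBA h1) (h.not_starts_of_memA hgA)
  · rcases h1.exists_tail with h2 | ⟨x, hx, h2⟩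
    · exact h2
    · have h3 := starts_of_sub hA hB hAB hBA h2
      exact absurd h3 (h.not_starts_of_memA (mul_mem (inv_mem (hA hx)) hgA))

end SubAmalg

/-! ### The Bass-Serre tree -/

section Tree

/-- A type preserving action on a bipartite tree. -/
structure TreeAction (G : Type*) {T : Type*} [Group G] [MulAction G T] (X : SimpleGraph T)
    (τ : T → Bool) : Prop where
  tree : X.IsTree
  smul_adj : ∀ (g : G) v w, X.Adj v w → X.Adj (g • v) (g • w)
  smul_type : ∀ (g : G) v, τ (g • v) = τ v
  type_ne : ∀ v w, X.Adj v w → τ v ≠ τ w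

variable {G : Type*} [Group G]
variable {g k : G}

/-- The vertices of the Bass-Serre tree. -/
abbrev BSVert (A B : Subgroup G) := (G ⧸ A) ⊕ (G ⧸ B)

/-- The vertex `g A`. -/
def vA (A B : Subgroup G) (g : G) : BSVert A B := Sum.inl (g : G ⧸ A)
/-- The vertex `g B`. -/
def vB (A B : Subgroup G) (g : G) : BSVert A B := Sum.inr (g : G ⧸ B)

/-- The Bass-Serre tree. -/
def bsTree (A B : Subgroup G) : SimpleGraph (BSVert A B) where
  Adj v w := ∃ g, (v = vA A B g ∧ w = vB A B g) ∨ (v = vB A B g ∧ w = vA A B g)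
  symm := ⟨fun v w ⟨g, h⟩ => ⟨g, by tauto⟩⟩
  loopless := ⟨by rintro v ⟨g, ⟨rfl, h⟩ | ⟨rfl, h⟩⟩ <;> simp [vA, vB] at h⟩

variable {A B : Subgroup G}

@[simp] theorem smul_vA (g h : G) : g • vA A B h = vA A B (g * h) := rfl
@[simp] theorem smul_vB (g h : G) : g • vB A B h = vB A B (g * h) := rfl

theorem vA_eq {h : G} : vA A B g = vA A B h ↔ g⁻¹ * h ∈ A := by
  simp [vA, QuotientGroup.eq]
theorem vB_eq {h : G} : vB A B g = vB A B h ↔ g⁻¹ * h ∈ B := by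
  simp [vB, QuotientGroup.eq]
@[simp] theorem vA_ne_vB (g h : G) : vA A B g ≠ vB A B h := by simp [vA, vB]
@[simp] theorem vB_ne_vA (g h : G) : vB A B g ≠ vA A B h := by simp [vA, vB]

theorem bs_cases (v : BSVert A B) : (∃ g, v = vA A B g) ∨ (∃ g, v = vB A B g) := by
  rcases v with v | v
  · exact Or.inl ⟨v.out, by simp [vA]⟩
  · exact Or.inr ⟨v.out, by simp [vB]⟩

theorem smul_vA_eq_iff : k • vA A B g = vA A B g ↔ g⁻¹ * k * g ∈ A := by
  rw [smul_vA, eq_comm, vA_eq, mul_assoc]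
theorem smul_vB_eq_iff : k • vB A B g = vB A B g ↔ g⁻¹ * k * g ∈ B := by
  rw [smul_vB, eq_comm, vB_eq, mul_assoc]

theorem bs_adj (g : G) : (bsTree A B).Adj (vA A B g) (vB A B g) := ⟨g, Or.inl ⟨rfl, rfl⟩⟩

theorem bs_adj_iff {h : G} : (bsTree A B).Adj (vA A B g) (vB A B h) ↔
    ∃ x, g⁻¹ * x ∈ A ∧ h⁻¹ * x ∈ B := by
  constructor
  · rintro ⟨x, h | h⟩
    · exact ⟨x, vA_eq.1 h.1, vB_eq.1 h.2⟩
    · simp at h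
  · rintro ⟨x, h1, h2⟩
    rw [vA_eq.2 h1, vB_eq.2 h2]; exact bs_adj x

theorem bs_smul_adj (g : G) {v w : BSVert A B} (h : (bsTree A B).Adj v w) :
    (bsTree A B).Adj (g • v) (g • w) := by
  obtain ⟨x, ⟨rfl, rfl⟩ | ⟨rfl, rfl⟩⟩ := h
  · exact bs_adj _
  · exact (bs_adj _).symm

theorem bs_reachable_smul (g : G) {v w : BSVert A B} (h : (bsTree A B).Reachable v w) :
    (bsTree A B).Reachable (g • v) (g • w) := by
  let f : bsTree A B →g bsTree A B := ⟨fun v => g • v, fun h => bs_smul_adj g h⟩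
  exact h.map f

theorem bs_connected (hs : A ⊔ B = ⊤) : (bsTree A B).Connected := by
  have base (g : G) : (bsTree A B).Reachable (vA A B 1) (g • vA A B 1) := by
    have hg : g ∈ Subgroup.closure ((A : Set G) ∪ B) := by
      rw [Subgroup.closure_union, Subgroup.closure_eq, Subgroup.closure_eq, hs]; trivial
    induction hg using Subgroup.closure_induction with
    | mem x hx =>
      rcases hx with hx | hx
      · rw [smul_vA_eq_iff.2 (by simpa using hx)]
      · have h1 := (bs_adj (A := A) (B := B) 1).reachable
        have h2 := bs_reachable_smul x h1
        rw [smul_vB_eq_iff.2 (by simpa using hx)] at h2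
        exact h1.trans h2.symm
    | one => rw [one_smul]
    | mul x y _ _ h1 h2 => rw [mul_smul]; exact h1.trans (bs_reachable_smul x h2)
    | inv x _ h => simpa using (bs_reachable_smul x⁻¹ h).symm
  have base' (v) : (bsTree A B).Reachable (vA A B 1) v := by
    rcases bs_cases v with ⟨g, rfl⟩ | ⟨g, rfl⟩
    · simpa using base g
    · have h1 := base g
      rw [smul_vA, mul_one] at h1
      exact h1.trans (bs_adj g).reachable
  rw [SimpleGraph.connected_iff]
  exact ⟨fun v w => (base' v).symm.trans (base' w), ⟨vA A B 1⟩⟩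

/-- The side of the base edge containing the vertex `A`-coset or `B`-coset: the cut function. -/
def side (A B : Subgroup G) : BSVert A B → Prop
  | .inl q => ∃ g : G, (g : G ⧸ A) = q ∧ Starts A B g
  | .inr q => ∃ g : G, (g : G ⧸ B) = q ∧ ¬ Starts B A g

variable (h : Amalg A B)
include h

theorem Amalg.side_vA (g : G) : side A B (vA A B g) ↔ Starts A B g := by
  constructor
  · rintro ⟨x, hx, hs⟩
    have : x⁻¹ * g ∈ A := by simpa [QuotientGroup.eq] using hx
    simpa using h.starts_mul_right this hs
  · intro hs; exact ⟨g, rfl, hs⟩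

theorem Amalg.side_vB (g : G) : side A B (vB A B g) ↔ ¬ Starts B A g := by
  constructor
  · rintro ⟨x, hx, hs⟩ h'
    have : x⁻¹ * g ∈ B := by simpa [QuotientGroup.eq] using hx
    exact hs (by simpa using h.symm.starts_mul_right (inv_mem this) h')
  · intro hs; exact ⟨g, rfl, hs⟩

theorem Amalg.side_iff_of_edge (hg : ¬ (g ∈ A ∧ g ∈ B)) :
    side A B (vA A B g) ↔ side A B (vB A B g) := by
  rw [h.side_vA, h.side_vB]
  have h1 := h.trichotomy g
  have h2 : Starts A B g → ¬ Starts B A g := h.not_starts_both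
  tauto

theorem Amalg.isTree : (bsTree A B).IsTree := by
  refine ⟨bs_connected h.sup, ?_⟩
  rw [SimpleGraph.isAcyclic_iff_forall_adj_isBridge]
  have base : (bsTree A B).IsBridge s(vA A B 1, vB A B 1) := by
    rw [SimpleGraph.isBridge_iff]
    intro hr
    have he (g : G) (hne : s(vA A B g, vB A B g) ≠ s(vA A B 1, vB A B 1)) :
        side A B (vA A B g) ↔ side A B (vB A B g) :=
      h.side_iff_of_edge fun hg => hne (by
        rw [vA_eq.2 (by simpa using hg.1 : g⁻¹ * 1 ∈ A), vB_eq.2 (by simpa using hg.2 : g⁻¹ * 1 ∈ B)])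
    have hinv (v w) (hr : ((bsTree A B).deleteEdges {s(vA A B 1, vB A B 1)}).Reachable v w) :
        side A B v ↔ side A B w := by
      obtain ⟨p⟩ := hr
      induction p with
      | nil => rfl
      | cons hadj p ih =>
        rw [← ih]
        rw [SimpleGraph.deleteEdges_adj] at hadj
        obtain ⟨⟨g, ⟨rfl, rfl⟩ | ⟨rfl, rfl⟩⟩, hne⟩ := hadj
        · exact he g hne
        · exact (he g (by rwa [Sym2.eq_swap])).symm
    have := hinv _ _ hr
    rw [h.side_vA, h.side_vB] at this
    exact h.not_starts_one (this.2 h.symm.not_starts_one)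
  have tr : ∀ g : G, (bsTree A B).IsBridge s(vA A B g, vB A B g) := by
    intro g
    rw [SimpleGraph.isBridge_iff] at base ⊢
    intro hr
    apply base
    let f : (bsTree A B).deleteEdges {s(vA A B g, vB A B g)} →g
        (bsTree A B).deleteEdges {s(vA A B 1, vB A B 1)} := ⟨fun v => g⁻¹ • v, by
      intro v w hvw
      rw [SimpleGraph.deleteEdges_adj] at hvw ⊢
      refine ⟨bs_smul_adj _ hvw.1, fun he => hvw.2 ?_⟩
      have := congrArg (Sym2.map (fun v => g • v)) (show _ = _ from he)
      simpa using this⟩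
    have := hr.map f
    simpa [f] using this
  rintro v w ⟨g, ⟨rfl, rfl⟩ | ⟨rfl, rfl⟩⟩
  · exact tr g
  · rw [Sym2.eq_swap]; exact tr g

theorem Amalg.treeAction : TreeAction G (bsTree A B) Sum.isLeft where
  tree := h.isTree
  smul_adj g _ _ := bs_smul_adj g
  smul_type g v := by cases v <;> rfl
  type_ne := by rintro v w ⟨g, ⟨rfl, rfl⟩ | ⟨rfl, rfl⟩⟩ <;> simp [vA, vB]

end Tree

/-! ### Geometry of trees -/

section TreeGeom

variable {T : Type*} {X : SimpleGraph T}
variable {c s t v w x y y' z : T} {Y Y₁ Y₂ Y₃ Z : Set T}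

open Classical in
/-- The neighbour of `v` in the direction of `w`. -/
noncomputable def nxt (X : SimpleGraph T) (v w : T) : T :=
  if h : ∃ x, X.Adj v x ∧ X.dist x w < X.dist v w then h.choose else v

variable (hX : X.IsTree)
include hX

theorem nxt_exists (h : v ≠ w) : ∃ x, X.Adj v x ∧ X.dist x w < X.dist v w := by
  obtain ⟨p, hp⟩ := hX.1.exists_walk_length_eq_dist v w
  cases p with
  | nil => exact absurd rfl h
  | cons hadj q =>
    refine ⟨_, hadj, ?_⟩
    have := SimpleGraph.dist_le q
    rw [← hp, SimpleGraph.Walk.length_cons]; omega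

theorem nxt_adj (h : v ≠ w) : X.Adj v (nxt X v w) := by
  have := nxt_exists hX h
  rw [nxt, dif_pos this]; exact this.choose_spec.1

theorem dist_step (h : X.Adj v x) (w : T) :
    X.dist v w = X.dist x w + 1 ∨ X.dist x w = X.dist v w + 1 := by
  have := hX.dist_eq_dist_add_one_of_adj w h
  simpa only [SimpleGraph.dist_comm (u := w)] using this

theorem dist_nxt (h : v ≠ w) : X.dist (nxt X v w) w + 1 = X.dist v w := by
  have := nxt_exists hX h
  have h1 : X.dist (nxt X v w) w < X.dist v w := by
    rw [nxt, dif_pos this]; exact this.choose_spec.2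
  have := dist_step hX (nxt_adj hX h) w
  omega

theorem eq_of_adj_of_dist_lt (hx : X.Adj v x) (hy : X.Adj v y)
    (hx' : X.dist x w < X.dist v w) (hy' : X.dist y w < X.dist v w) : x = y := by
  classical
  obtain ⟨p, hp, hpl⟩ := (hX.1.preconnected x w).exists_path_of_dist
  obtain ⟨q, hq, hql⟩ := (hX.1.preconnected y w).exists_path_of_dist
  have hvp : v ∉ p.support := fun h => by
    have := SimpleGraph.dist_le (p.dropUntil v h)
    have := p.length_dropUntil_le_length h
    omega
  have hvq : v ∉ q.support := fun h => by
    have := SimpleGraph.dist_le (q.dropUntil v h)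
    have := q.length_dropUntil_le_length h
    omega
  have e := (hX.existsUnique_path v w).unique (hp.cons (h := hx) hvp) (hq.cons (h := hy) hvq)
  simp_all

theorem eq_nxt (hx : X.Adj v x) (hd : X.dist x w < X.dist v w) : x = nxt X v w := by
  have hne : v ≠ w := by rintro rfl; simp at hd
  exact eq_of_adj_of_dist_lt hX hx (nxt_adj hX hne) hd (by have := dist_nxt hX hne; omega)

theorem nxt_of_adj (hx : X.Adj v x) : nxt X v x = x :=
  (eq_nxt hX hx (by rw [SimpleGraph.dist_self]; exact (hX.1.pos_dist_of_ne hx.ne))).symm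

theorem dist_of_ne_nxt (hx : X.Adj v x) (hn : x ≠ nxt X v w) : X.dist x w = X.dist v w + 1 := by
  rcases dist_step hX hx w with h | h
  · exact absurd (eq_nxt hX hx (by omega)) hn
  · exact h

theorem dist_eq_zero' : X.dist v w = 0 ↔ v = w := (hX.1.dist_eq_zero_iff)

theorem nxt_branch (h : X.Adj y y') (hy : v ≠ y) (hy' : v ≠ y') : nxt X v y = nxt X v y' := by
  have key : ∀ {y y' : T}, X.Adj y y' → v ≠ y → X.dist v y' = X.dist v y + 1 →
      nxt X v y = nxt X v y' := by
    intro y y' h hy hd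
    apply eq_nxt hX (nxt_adj hX hy)
    have h1 := dist_nxt hX hy
    have h2 := hX.1.dist_triangle (u := nxt X v y) (v := y) (w := y')
    rw [SimpleGraph.dist_eq_one_iff_adj.2 h] at h2
    omega
  rcases dist_step hX h v with h1 | h1 <;>
    rw [SimpleGraph.dist_comm (v := v), SimpleGraph.dist_comm (v := v)] at h1
  · exact (key h.symm hy' h1).symm
  · exact key h hy h1

/-- A path turning at `y` without backtracking is geodesic. -/
theorem dist_turn (h : x = y ∨ c = y ∨ nxt X y x ≠ nxt X y c) :
    X.dist x c = X.dist x y + X.dist y c := by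
  rcases h with rfl | rfl | h
  · simp
  · simp
  obtain ⟨n, hn⟩ : ∃ n, X.dist y c = n := ⟨_, rfl⟩
  induction n generalizing c with
  | zero => rw [(dist_eq_zero' hX).1 hn]; simp
  | succ n ih =>
    have hcy : c ≠ y := by rintro rfl; simp at hn
    set c' := nxt X c y with hc'
    have hadj : X.Adj c c' := nxt_adj hX hcy
    have hd : X.dist c' y + 1 = X.dist c y := dist_nxt hX hcy
    rw [SimpleGraph.dist_comm] at hn
    by_cases hcy' : c' = y
    · have e1 : nxt X y c = c := nxt_of_adj hX (hcy' ▸ hadj.symm)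
      have h2 := dist_of_ne_nxt hX (w := x) (hcy' ▸ hadj.symm) (fun h' => h (by rw [e1, ← h']))
      rw [hcy', SimpleGraph.dist_self] at hd
      rw [SimpleGraph.dist_comm, h2, SimpleGraph.dist_comm (u := y), SimpleGraph.dist_comm (u := y)]
      omega
    · have hb := nxt_branch hX (v := y) hadj (Ne.symm hcy) (Ne.symm hcy')
      have h3 := ih (c := c') (by rw [← hb]; exact h) (by rw [SimpleGraph.dist_comm]; omega)
      have hz := dist_nxt hX hcy'
      have hza := nxt_adj hX hcy'
      set z := nxt X c' y
      have hzx := hX.1.dist_triangle (u := x) (v := y) (w := z)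
      rw [SimpleGraph.dist_comm (u := y)] at hzx h3
      have e2 : z = nxt X c' x := eq_nxt hX hza (by
        rw [SimpleGraph.dist_comm, SimpleGraph.dist_comm (u := c')]; omega)
      have h4 := dist_of_ne_nxt hX (w := x) hadj.symm (fun h' => by
        rw [← e2] at h'; rw [h'] at hd; omega)
      rw [SimpleGraph.dist_comm, h4, SimpleGraph.dist_comm, h3, SimpleGraph.dist_comm (u := y)]
      omega

/-- An edge separating another edge is equal to it. -/
theorem edge_crossing (hvw : X.Adj v w) (hst : X.Adj s t)
    (h1 : X.dist v s < X.dist w s) (h2 : X.dist w t < X.dist v t) : v = s ∧ w = t := by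
  have a1 := dist_step hX hvw s
  have a2 := dist_step hX hvw t
  have a3 := dist_step hX hst v
  have a4 := dist_step hX hst w
  rw [SimpleGraph.dist_comm, SimpleGraph.dist_comm (u := t)] at a3 a4
  have h0 : X.dist v s = 0 := by
    by_contra hne
    have hvs : v ≠ s := fun h => hne ((dist_eq_zero' hX).2 h)
    have e1 : w = nxt X v t := eq_nxt hX hvw (by omega)
    have e2 := dist_nxt hX hvs
    have e3 := hX.1.dist_triangle (u := nxt X v s) (v := s) (w := t)
    rw [SimpleGraph.dist_eq_one_iff_adj.2 hst] at e3
    have e4 : nxt X v s = nxt X v t := eq_nxt hX (nxt_adj hX hvs) (by omega)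
    rw [e4, ← e1] at e2
    omega
  have h0' : X.dist w t = 0 := by omega
  exact ⟨(dist_eq_zero' hX).1 h0, (dist_eq_zero' hX).1 h0'⟩

/-- Convex vertex sets of a tree. -/
def Cvx (X : SimpleGraph T) (Y : Set T) : Prop := ∀ v ∈ Y, ∀ w ∈ Y, v ≠ w → nxt X v w ∈ Y

omit hX in
theorem Cvx.inter (hY : Cvx X Y) (hZ : Cvx X Z) : Cvx X (Y ∩ Z) :=
  fun v hv w hw h => ⟨hY v hv.1 w hw.1 h, hZ v hv.2 w hw.2 h⟩

theorem Cvx.between (hY : Cvx X Y) (hx : x ∈ Y)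
    (hz : z ∈ Y) (h : X.dist x z = X.dist x y + X.dist y z) : y ∈ Y := by
  obtain ⟨n, hn⟩ : ∃ n, X.dist x y = n := ⟨_, rfl⟩
  induction n generalizing x with
  | zero => rw [← (dist_eq_zero' hX).1 hn]; exact hx
  | succ n ih =>
    have hxy : x ≠ y := by rintro rfl; simp at hn
    have e := dist_nxt hX hxy
    have e3 := hX.1.dist_triangle (u := nxt X x y) (v := y) (w := z)
    have e1 : nxt X x y = nxt X x z := eq_nxt hX (nxt_adj hX hxy) (by omega)
    have hxz : x ≠ z := by rintro rfl; simp at h; omega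
    have e2 := dist_nxt hX hxz
    refine ih (x := nxt X x y) (e1 ▸ hY x hx z hz hxz) ?_ (by omega)
    rw [e1] at e3 e ⊢
    omega

theorem walk_visits (p : X.Walk w v) (h : v ≠ w) : nxt X v w ∈ p.support := by
  induction p with
  | nil => exact absurd rfl h
  | @cons a b c hadj q ih =>
    by_cases hb : c = b
    · subst hb
      rw [nxt_of_adj hX hadj.symm]; simp
    · rw [nxt_branch hX hadj h hb]
      simp [ih hb]

theorem cvx_of_walks (r : T) (h : ∀ v ∈ Y, ∃ p : X.Walk r v, ∀ x ∈ p.support, x ∈ Y) : Cvx X Y := by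
  intro v hv w hw hne
  obtain ⟨p, hp⟩ := h v hv
  obtain ⟨q, hq⟩ := h w hw
  have := walk_visits hX (q.reverse.append p) hne
  rw [SimpleGraph.Walk.mem_support_append_iff] at this
  rcases this with h | h
  · exact hq _ (by simpa using h)
  · exact hp _ h

/-- The closest point projection to a convex set. -/
theorem gate_exists (hY : Cvx X Y) (hne : Y.Nonempty) (x : T) :
    ∃ y ∈ Y, ∀ c ∈ Y, X.dist x c = X.dist x y + X.dist y c := by
  obtain ⟨y, hy, hmin⟩ : ∃ y ∈ Y, ∀ c ∈ Y, X.dist x y ≤ X.dist x c := by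
    obtain ⟨y, hy⟩ := WellFounded.has_min (measure (fun y => X.dist x y)).wf Y hne
    exact ⟨y, hy.1, fun c hc => not_lt.1 (hy.2 c hc)⟩
  refine ⟨y, hy, fun c hc => dist_turn hX ?_⟩
  by_cases hxy : x = y
  · exact Or.inl hxy
  by_cases hcy : c = y
  · exact Or.inr (Or.inl hcy)
  refine Or.inr (Or.inr fun e => ?_)
  have h1 := hY y hy c hc (Ne.symm hcy)
  rw [← e] at h1
  have h2 := dist_nxt hX (Ne.symm hxy)
  have := hmin _ h1
  rw [SimpleGraph.dist_comm, SimpleGraph.dist_comm (u := x)] at this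
  omega

theorem helly_three (h1 : Cvx X Y₁) (h2 : Cvx X Y₂) (h3 : Cvx X Y₃) (h12 : (Y₁ ∩ Y₂).Nonempty)
    (h13 : (Y₁ ∩ Y₃).Nonempty) (h23 : (Y₂ ∩ Y₃).Nonempty) : ∃ y, y ∈ Y₁ ∧ y ∈ Y₂ ∧ y ∈ Y₃ := by
  obtain ⟨x, hx2, hx3⟩ := h23
  obtain ⟨y, hy, hg⟩ := gate_exists hX h1 (h12.mono Set.inter_subset_left) x
  obtain ⟨c, hc1, hc2⟩ := h12
  obtain ⟨e, he1, he3⟩ := h13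
  exact ⟨y, hy, h2.between hX hx2 hc2 (hg c hc1), h3.between hX hx3 he3 (hg e he1)⟩

theorem helly {ι : Type*} (s : Finset ι) (hs : s.Nonempty) (Y : ι → Set T)
    (hY : ∀ i ∈ s, Cvx X (Y i)) (hp : ∀ i ∈ s, ∀ j ∈ s, (Y i ∩ Y j).Nonempty) :
    ∃ y, ∀ i ∈ s, y ∈ Y i := by
  classical
  induction s using Finset.induction_on generalizing Y with
  | empty => exact absurd hs (by simp)
  | insert a s ha ih =>
    by_cases hse : s.Nonempty
    · obtain ⟨y, hy⟩ := ih hse (fun i => Y i ∩ Y a)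
        (fun i hi => (hY i (by simp [hi])).inter (hY a (by simp)))
        (fun i hi j hj => by
          obtain ⟨y, h1, h2, h3⟩ := helly_three hX (hY a (by simp)) (hY i (by simp [hi]))
            (hY j (by simp [hj])) (hp a (by simp) i (by simp [hi])) (hp a (by simp) j (by simp [hj]))
            (hp i (by simp [hi]) j (by simp [hj]))
          exact ⟨y, ⟨h2, h1⟩, h3, h1⟩)
      refine ⟨y, fun i hi => ?_⟩
      grind
    · rw [Finset.not_nonempty_iff_eq_empty] at hse
      subst hse
      obtain ⟨y, hy, _⟩ := hp a (by simp) a (by simp)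
      exact ⟨y, by simpa using hy⟩

end TreeGeom

section Action

variable {G T : Type*} [Group G] [MulAction G T] {X : SimpleGraph T} {τ : T → Bool}
variable {z : G}

/-- The fixed point set of an element. -/
def fixS (T : Type*) [MulAction G T] (k : G) : Set T := {v | k • v = v}

@[simp] theorem mem_fixS {k : G} {v : T} : v ∈ fixS T k ↔ k • v = v := Iff.rfl

/-- Elements without fixed points. -/
def Hyp (T : Type*) [MulAction G T] (z : G) : Prop := ∀ v : T, z • v ≠ v

theorem not_hyp_iff : ¬ Hyp T z ↔ ∃ v : T, z • v = v := by simp [Hyp]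

/-- One step of the flow towards the attracting end of `z`. -/
noncomputable def flow (X : SimpleGraph T) (z : G) (v : T) : T := nxt X v (z • v)

namespace TreeAction

variable (h : TreeAction G X τ)
include h

theorem dist_smul (g : G) (v w : T) : X.dist (g • v) (g • w) = X.dist v w := by
  have key : ∀ (g : G) (v w : T), X.dist (g • v) (g • w) ≤ X.dist v w := by
    intro g v w
    obtain ⟨p, hp⟩ := h.tree.1.exists_walk_length_eq_dist v w
    let f : X →g X := ⟨fun v => g • v, fun e => h.smul_adj g _ _ e⟩
    have := SimpleGraph.dist_le (p.map f)
    rw [SimpleGraph.Walk.length_map, hp] at this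
    exact this
  refine le_antisymm (key g v w) ?_
  simpa using key g⁻¹ (g • v) (g • w)

theorem smul_nxt (g : G) {v w : T} (hne : v ≠ w) : g • nxt X v w = nxt X (g • v) (g • w) := by
  refine eq_nxt h.tree (h.smul_adj _ _ _ (nxt_adj h.tree hne)) ?_
  rw [h.dist_smul, h.dist_smul]
  have := dist_nxt h.tree hne
  omega

theorem cvx_fixS (k : G) : Cvx X (fixS T k) := by
  intro v hv w hw hne
  rw [mem_fixS] at *
  rw [h.smul_nxt k hne, hv, hw]

theorem cvx_smul {Y : Set T} (hY : Cvx X Y) (g : G) : Cvx X {v | g⁻¹ • v ∈ Y} := by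
  intro v hv w hw hne
  rw [Set.mem_ofPred_eq] at *
  have hne' : g⁻¹ • v ≠ g⁻¹ • w := fun h => hne (smul_left_cancel _ h)
  rw [h.smul_nxt _ hne]
  exact hY _ hv _ hw hne'

/-- A group element fixing `x` and preserving a convex set fixes the projection of `x`. -/
theorem gate_fixed {Y : Set T} {g : G} (hg : ∀ v ∈ Y, g • v ∈ Y) {x y : T} (hx : g • x = x)
    (hy : y ∈ Y) (hgate : ∀ c ∈ Y, X.dist x c = X.dist x y + X.dist y c) : g • y = y := by
  have h1 := hgate (g • y) (hg y hy)
  have h2 := h.dist_smul g x y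
  rw [hx] at h2
  have : X.dist y (g • y) = 0 := by omega
  exact ((dist_eq_zero' h.tree).1 this).symm

/-- Commuting elliptic elements have a common fixed point. -/
theorem commuting_fix {x y : G} (hc : Commute x y) {p q : T}
    (hp : x • p = p) (hq : y • q = q) : ∃ v : T, x • v = v ∧ y • v = v := by
  obtain ⟨v, hv, hg⟩ := gate_exists h.tree (h.cvx_fixS x) ⟨p, hp⟩ q
  refine ⟨v, hv, h.gate_fixed (Y := fixS T x) ?_ hq hv hg⟩
  intro w hw
  rw [mem_fixS] at *
  rw [← mul_smul, hc.eq, mul_smul, hw]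

variable {z : G} (hz : Hyp T z)
include hz

theorem flow_adj (v : T) : X.Adj v (flow X z v) := nxt_adj h.tree (hz v).symm

theorem flow_or {v w : T} (ha : X.Adj v w) : flow X z v = w ∨ flow X z w = v := by
  by_contra! hcon
  have h1 := dist_of_ne_nxt h.tree (w := z • v) ha (Ne.symm hcon.1)
  have h2 := dist_of_ne_nxt h.tree (w := z • w) ha.symm (Ne.symm hcon.2)
  have hza := h.smul_adj z _ _ ha
  have h3 := dist_step h.tree hza v
  have h4 := dist_step h.tree hza w
  simp only [SimpleGraph.dist_comm (v := v), SimpleGraph.dist_comm (v := w)] at h3 h4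
  have := edge_crossing h.tree ha hza (by omega) (by omega)
  exact hz v this.1.symm

theorem flow_flow_ne (v : T) : flow X z (flow X z v) ≠ v := by
  intro he
  set w := flow X z v with hw
  have ha : X.Adj v w := h.flow_adj hz v
  have h1 : X.dist w (z • v) + 1 = X.dist v (z • v) := dist_nxt h.tree (hz v).symm
  have h2 : X.dist (flow X z w) (z • w) + 1 = X.dist w (z • w) := dist_nxt h.tree (hz w).symm
  rw [he] at h2
  have hza := h.smul_adj z _ _ ha
  have h3 := dist_step h.tree hza v
  have h4 := dist_step h.tree hza w
  simp only [SimpleGraph.dist_comm (v := v), SimpleGraph.dist_comm (v := w)] at h3 h4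
  have := edge_crossing h.tree ha hza.symm (by omega) (by omega)
  have ht := h.type_ne _ _ ha
  rw [this.2, h.smul_type] at ht
  exact ht rfl

theorem flow_smul {x : G} (hx : Commute x z) (v : T) : x • flow X z v = flow X z (x • v) := by
  rw [flow, flow, h.smul_nxt x (hz v).symm, ← mul_smul, ← mul_smul, hx.eq]

theorem flow_iterate_smul {x : G} (hx : Commute x z) (n : ℕ) (v : T) : x • (flow X z)^[n] v =
    (flow X z)^[n] (x • v) := by
  induction n with
  | zero => rfl
  | succ n ih =>
    rw [Function.iterate_succ_apply', Function.iterate_succ_apply', h.flow_smul hz hx, ih]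

theorem flow_merge (v w : T) : ∃ i j, (flow X z)^[i] v = (flow X z)^[j] w := by
  obtain ⟨p⟩ := h.tree.1.preconnected v w
  induction p with
  | nil => exact ⟨0, 0, rfl⟩
  | @cons a b c hadj q ih =>
    obtain ⟨i, j, e⟩ := ih
    rcases h.flow_or hz hadj with h1 | h1
    · exact ⟨i + 1, j, by rw [Function.iterate_succ_apply, h1, e]⟩
    · refine ⟨i, j + 1, ?_⟩
      rw [Function.iterate_succ_apply', ← e, ← h1, ← Function.iterate_succ_apply,
        Function.iterate_succ_apply']

/-- Elliptic elements commuting with a hyperbolic element fix far points of its flow lines. -/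
theorem elliptic_fix_flow {x : G} (hx : Commute x z) {p : T} (hp : x • p = p) (v : T) : ∃ i, ∀ k, i
    ≤ k → x • (flow X z)^[k] v = (flow X z)^[k] v := by
  obtain ⟨i, j, e⟩ := h.flow_merge hz v p
  refine ⟨i, fun k hk => ?_⟩
  obtain ⟨m, rfl⟩ := Nat.exists_eq_add_of_le' hk
  rw [Function.iterate_add_apply, e, h.flow_iterate_smul hz hx, h.flow_iterate_smul hz hx, hp]

/-- The commutator of two elements commuting with a hyperbolic element is elliptic. -/
theorem comm_elliptic {x y : G}
    (hx : Commute x z) (hy : Commute y z) : ∃ p : T, (x * y * x⁻¹ * y⁻¹) • p = p := by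
  obtain ⟨v⟩ := h.tree.1.nonempty
  obtain ⟨i, j, e⟩ := h.flow_merge hz (x • v) v
  obtain ⟨i', j', e'⟩ := h.flow_merge hz (y • v) v
  have ex : ∀ k, x • (flow X z)^[i + k] v = (flow X z)^[j + k] v := fun k => by
    rw [h.flow_iterate_smul hz hx, add_comm, Function.iterate_add_apply, e,
      ← Function.iterate_add_apply, add_comm]
  have ey : ∀ k, y • (flow X z)^[i' + k] v = (flow X z)^[j' + k] v := fun k => by
    rw [h.flow_iterate_smul hz hy, add_comm, Function.iterate_add_apply, e',
      ← Function.iterate_add_apply, add_comm]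
  have e1 : (x * y) • (flow X z)^[i + i'] v = (flow X z)^[j + j'] v := by
    rw [mul_smul, add_comm i, ey, add_comm, ex]
  have e2 : (y * x) • (flow X z)^[i + i'] v = (flow X z)^[j + j'] v := by
    rw [mul_smul, ex, add_comm, ey, add_comm]
  refine ⟨(flow X z)^[j + j'] v, ?_⟩
  nth_rw 1 [← e2]
  rw [← mul_smul, ← e1]
  congr 1
  group

theorem dist_flow (v : T) (n : ℕ) : X.dist v ((flow X z)^[n] v) = n := by
  induction n with
  | zero => simp
  | succ n ih =>
    rw [Function.iterate_succ_apply']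
    cases n with
    | zero => exact SimpleGraph.dist_eq_one_iff_adj.2 (h.flow_adj hz v)
    | succ n =>
      set u := (flow X z)^[n + 1] v with hu
      have hadj := h.flow_adj hz u
      by_contra hne
      have h1 := dist_step h.tree hadj v
      rw [SimpleGraph.dist_comm, SimpleGraph.dist_comm (v := v)] at h1
      have e1 : flow X z u = nxt X u v := eq_nxt h.tree hadj (by
        rw [SimpleGraph.dist_comm, SimpleGraph.dist_comm (u := u)]; omega)
      obtain ⟨w, hw⟩ : ∃ w, w = (flow X z)^[n] v := ⟨_, rfl⟩
      have hwu : u = flow X z w := by rw [hu, hw, Function.iterate_succ_apply']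
      have hwa := h.flow_adj hz w
      rw [← hwu] at hwa
      have h2 := dist_step h.tree hwa v
      have hwv : X.dist w v = n ∨ w = nxt X u v := by
        by_cases hc : w = nxt X u v
        · exact Or.inr hc
        · left
          have := dist_of_ne_nxt h.tree hwa.symm hc
          rw [SimpleGraph.dist_comm] at ih
          have h5 : X.dist w v ≤ n := by
            rw [hw, SimpleGraph.dist_comm]
            have : ∀ m, X.dist v ((flow X z)^[m] v) ≤ m := by
              intro m
              induction m with
              | zero => simp
              | succ m ihm =>
                rw [Function.iterate_succ_apply']
                have := h.tree.1.dist_triangle (u := v) (v := (flow X z)^[m] v)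
                  (w := flow X z ((flow X z)^[m] v))
                rw [SimpleGraph.dist_eq_one_iff_adj.2 (h.flow_adj hz _)] at this
                omega
            exact this n
          omega
      have e2 : w = nxt X u v := by
        rcases hwv with h' | h'
        · refine eq_nxt h.tree hwa.symm ?_
          rw [SimpleGraph.dist_comm] at ih
          omega
        · exact h'
      rw [← e2, hwu] at e1
      exact h.flow_flow_ne hz w e1

theorem flow_iterate_ne (v : T) {n : ℕ} (hn : n ≠ 0) : (flow X z)^[n] v ≠ v := fun e => by
  have := h.dist_flow hz v n
  simp_all

omit hz in
/-- Elements with an elliptic power are elliptic. -/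
theorem elliptic_of_pow {n : ℕ} (hn : n ≠ 0) {p : T} (hp : z ^ n • p = p) : ∃ v : T, z • v = v := by
  by_contra! hz
  obtain ⟨i, j, e⟩ := h.flow_merge hz (z • p) p
  rw [← h.flow_iterate_smul hz (Commute.refl z)] at e
  have hfix : ∀ k, z ^ n • (flow X z)^[k] p = (flow X z)^[k] p := fun k => by
    rw [h.flow_iterate_smul hz ((Commute.refl z).pow_left n), hp]
  rcases le_total i j with hij | hij
  · obtain ⟨m, rfl⟩ := Nat.exists_eq_add_of_le' hij
    rw [Function.iterate_add_apply] at e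
    set u := (flow X z)^[i] p with hu
    have hk : ∀ k, z ^ k • u = (flow X z)^[m * k] u := by
      intro k
      induction k with
      | zero => simp
      | succ k ih =>
        rw [pow_succ', mul_smul, ih, h.flow_iterate_smul hz (Commute.refl z), e,
          ← Function.iterate_add_apply]; rfl
    have h1 := hk n
    rw [hu, hfix i, ← hu] at h1
    by_cases hm : m = 0
    · subst hm; exact hz u e
    · exact h.flow_iterate_ne hz u (Nat.mul_ne_zero hm hn) h1.symm
  · obtain ⟨m, rfl⟩ := Nat.exists_eq_add_of_le' hij
    rw [Function.iterate_add_apply] at e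
    set u := (flow X z)^[j] p with hu
    have hk : ∀ k, z ^ k • (flow X z)^[m * k] u = u := by
      intro k
      induction k with
      | zero => simp
      | succ k ih =>
        rw [Nat.mul_succ, Function.iterate_add_apply, pow_succ, mul_smul,
          h.flow_iterate_smul hz (Commute.refl z), e, ih]
    have h1 := hk n
    rw [hu, ← Function.iterate_add_apply, hfix, Function.iterate_add_apply, ← hu] at h1
    by_cases hm : m = 0
    · subst hm; exact hz u e
    · exact h.flow_iterate_ne hz u (Nat.mul_ne_zero hm hn) h1

omit hz in
theorem elliptic_of_zpow {n : ℤ} (hn : n ≠ 0) {p : T}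
    (hp : z ^ n • p = p) : ∃ v : T, z • v = v := by
  obtain ⟨m, rfl | rfl⟩ := n.eq_nat_or_neg
  · exact h.elliptic_of_pow (n := m) (by simpa using hn) (by simpa using hp)
  · refine h.elliptic_of_pow (n := m) (p := p) (by simpa using hn) ?_
    rw [zpow_neg, zpow_natCast] at hp
    nth_rw 1 [← hp]
    rw [smul_inv_smul]

/-- Invariant convex sets contain flow lines. -/
theorem flow_mem {Y : Set T} (hY : Cvx X Y)
    (hzY : ∀ v ∈ Y, z • v ∈ Y) {v : T} (hv : v ∈ Y) (n : ℕ) : (flow X z)^[n] v ∈ Y := by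
  induction n with
  | zero => exact hv
  | succ n ih =>
    rw [Function.iterate_succ_apply']
    exact hY _ ih _ (hzY _ ih) (hz _).symm

/-- Two invariant convex sets of a hyperbolic element meet. -/
theorem inter_nonempty {Y Z : Set T} (hY : Cvx X Y) (hZ : Cvx X Z) (hzY : ∀ v ∈ Y, z • v ∈ Y)
    (hzZ : ∀ v ∈ Z, z • v ∈ Z) (hYn : Y.Nonempty) (hZn : Z.Nonempty) : (Y ∩ Z).Nonempty := by
  obtain ⟨v, hv⟩ := hYn
  obtain ⟨w, hw⟩ := hZn
  obtain ⟨i, j, e⟩ := h.flow_merge hz v w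
  exact ⟨_, h.flow_mem hz hY hzY hv i, e ▸ h.flow_mem hz hZ hzZ hw j⟩

end TreeAction

end Action

section Criterion

variable {G : Type*} [Group G]
variable {A B C : Subgroup G}

/-- The two factors of an amalgam, as a family. -/
def factors (A B : Subgroup G) (i : Bool) : Subgroup G := if i then B else A

theorem le_factors (hA : C ≤ A) (hB : C ≤ B) (i : Bool) : C ≤ factors A B i := by
  cases i
  · exact hA
  · exact hB

/-- The inclusions of the amalgamated subgroup. -/
abbrev inclusions {A B C : Subgroup G} (hA : C ≤ A) (hB : C ≤ B) (i : Bool) :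
    C →* factors A B i := Subgroup.inclusion (le_factors hA hB i)

open Monoid in
open Classical in
/-- A homomorphism to the abstract amalgamated product detects amalgams. -/
theorem amalg_of_hom (hA : C ≤ A) (hB : C ≤ B) (hsup : A ⊔ B = ⊤)
    (F : G →* PushoutI (inclusions hA hB))
    (FA : ∀ a (ha : a ∈ A), F a = PushoutI.of (φ := inclusions hA hB) false ⟨a, ha⟩)
    (FB : ∀ b (hb : b ∈ B), F b = PushoutI.of (φ := inclusions hA hB) true ⟨b, hb⟩) :
    Amalg A B ∧ A ⊓ B = C := by
  have hinj : ∀ i, Function.Injective (inclusions hA hB i) :=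
    fun i => Subgroup.inclusion_injective _
  have hbase : ∀ g, g ∈ A → g ∈ B → F g ∈ (PushoutI.base (inclusions hA hB)).range := by
    intro g h1 h2
    rw [← PushoutI.inf_of_range_eq_base_range hinj (i := false) (j := true) (by simp)]
    exact ⟨⟨_, (FA g h1).symm⟩, ⟨_, (FB g h2).symm⟩⟩
  have hinter : A ⊓ B = C := by
    apply le_antisymm _ (le_inf hA hB)
    rintro x ⟨h1, h2⟩
    obtain ⟨c, hc⟩ := hbase x h1 h2
    rw [← PushoutI.of_apply_eq_base _ false, FA x h1] at hc
    have := congrArg Subtype.val (PushoutI.of_injective hinj false hc)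
    exact (show (c : G) = x from this) ▸ c.2
  refine ⟨⟨hsup, ?_⟩, hinter⟩
  intro l hl hne ⟨h1, h2⟩
  let e : G → Σ i, factors A B i := fun x =>
    if h : x ∈ A then ⟨false, ⟨x, h⟩⟩ else if h : x ∈ B then ⟨true, ⟨x, h⟩⟩ else ⟨false, 1⟩
  have eA : ∀ x (h : x ∈ A), e x = ⟨false, ⟨x, h⟩⟩ := fun x h => by simp [e, h]
  have eB : ∀ x (h : x ∈ B) (_ : x ∉ A), e x = ⟨true, ⟨x, h⟩⟩ := fun x h h' => by simp [e, h, h']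
  have ecase : ∀ x ∈ l, (x ∈ A ∧ x ∉ B) ∨ (x ∉ A ∧ x ∈ B) := fun x hx => by
    have := hl.1 x hx; tauto
  have eval : ∀ x ∈ l, ((e x).2 : G) = x := by
    intro x hx
    rcases ecase x hx with ⟨h, _⟩ | ⟨h', h⟩
    · rw [eA x h]
    · rw [eB x h h']
  have efst : ∀ x ∈ l, ((e x).1 = false ↔ x ∈ A) := by
    intro x hx
    rcases ecase x hx with ⟨h, _⟩ | ⟨h', h⟩
    · rw [eA x h]; simpa using h
    · rw [eB x h h']; simpa using h'
  have eF : ∀ x ∈ l, PushoutI.of (φ := inclusions hA hB) (e x).1 (e x).2 = F x := by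
    intro x hx
    rcases ecase x hx with ⟨h, _⟩ | ⟨h', h⟩
    · rw [eA x h, FA x h]
    · rw [eB x h h', FB x h]
  let w : CoprodI.Word (fun i => factors A B i) := {
      toList := l.map e
      ne_one := by
        intro y hy h
        obtain ⟨x, hx, rfl⟩ := List.mem_map.1 hy
        have h3 := eval x hx
        rw [h] at h3
        have : x = 1 := h3.symm
        apply hl.1 x hx
        simp [this]
      chain_ne := by
        rw [List.isChain_map]
        have h3 := hl.2
        refine (List.IsChain.imp_of_mem_imp ?_ h3)
        intro x y hx hy hxy h
        have e1 := efst x hx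
        have e2 := efst y hy
        rw [h] at e1
        have := hl.1 y hy
        tauto }
  have hred : PushoutI.Reduced (inclusions hA hB) w := by
    rintro y hy ⟨c, hc⟩
    obtain ⟨x, hx, rfl⟩ := List.mem_map.1 hy
    have h3 := eval x hx
    rw [← hc] at h3
    have : x ∈ C := by rw [← h3]; exact c.2
    apply hl.1 x hx
    simp [hA this, hB this]
  have hprod : PushoutI.ofCoprodI w.prod = F l.prod := by
    have : ∀ l' : List G, (∀ x ∈ l', x ∈ l) → PushoutI.ofCoprodI (φ := inclusions hA hB)
          ((l'.map e).map (fun y => CoprodI.of y.2)).prod = F l'.prod := by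
      intro l'
      induction l' with
      | nil => simp
      | cons x l' ih =>
        simp_all
    exact this l fun _ h => h
  have := hred.eq_empty_of_mem_range hinj (by rw [hprod]; exact hbase _ h1 h2)
  have h4 : l.map e = [] := congrArg CoprodI.Word.toList this
  exact hne (by simpa using h4)

end Criterion

section Visual

variable {V : Type*} {Γ : DefiningGraph V}
variable {P Q : Set V}

open Monoid in
open Classical in
/-- Visual splittings of Artin groups. -/
theorem visual_amalg (hPQ : ∀ v, v ∈ P ∨ v ∈ Q) (hadj : ∀ a b, Γ.graph.Adj a b → (a ∈
    P ∧ b ∈ P) ∨ (a ∈ Q ∧ b ∈ Q)) : Amalg (parabolic Γ P) (parabolic Γ Q) ∧ parabolic Γ P ⊓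
    parabolic Γ Q = parabolic Γ (P ∩ Q) := by
  have hA : parabolic Γ (P ∩ Q) ≤ parabolic Γ P := parabolic_mono Set.inter_subset_left
  have hB : parabolic Γ (P ∩ Q) ≤ parabolic Γ Q := parabolic_mono Set.inter_subset_right
  let ofA : parabolic Γ P →* PushoutI (inclusions hA hB) :=
    PushoutI.of (φ := inclusions hA hB) false
  let ofB : parabolic Γ Q →* PushoutI (inclusions hA hB) := PushoutI.of (φ := inclusions hA hB) true
  have hcomm : ∀ v (h1 : v ∈ P) (h2 : v ∈ Q), ofA ⟨gen Γ v, gen_mem h1⟩ =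
      ofB ⟨gen Γ v, gen_mem h2⟩ := by
    intro v h1 h2
    have e1 := PushoutI.of_apply_eq_base (inclusions hA hB) false ⟨gen Γ v, gen_mem ⟨h1, h2⟩⟩
    have e2 := PushoutI.of_apply_eq_base (inclusions hA hB) true ⟨gen Γ v, gen_mem ⟨h1, h2⟩⟩
    exact e1.trans e2.symm
  let f : V → PushoutI (inclusions hA hB) := fun v =>
    if h : v ∈ P then ofA ⟨gen Γ v, gen_mem h⟩ else
      ofB ⟨gen Γ v, gen_mem ((hPQ v).resolve_left h)⟩
  have fA : ∀ v (h : v ∈ P), f v = ofA ⟨gen Γ v, gen_mem h⟩ := fun v h => by simp [f, h]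
  have fB : ∀ v (h : v ∈ Q), f v = ofB ⟨gen Γ v, gen_mem h⟩ := fun v h => by
    grind
  let F : ArtinGroup Γ →* PushoutI (inclusions hA hB) := liftHom f (by
    intro a b hab
    rcases hadj a b hab with ⟨ha, hb⟩ | ⟨ha, hb⟩
    · rw [fA a ha, fA b hb, ← map_altProd, ← map_altProd]
      congr 1
      apply Subtype.ext
      have := gen_rel hab
      have e := map_altProd (parabolic Γ P).subtype ⟨gen Γ a, gen_mem ha⟩ ⟨gen Γ b, gen_mem hb⟩
        (Γ.label a b)
      have e' := map_altProd (parabolic Γ P).subtype ⟨gen Γ b, gen_mem hb⟩ ⟨gen Γ a, gen_mem ha⟩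
        (Γ.label a b)
      exact e.trans (this.trans e'.symm)
    · rw [fB a ha, fB b hb, ← map_altProd, ← map_altProd]
      congr 1
      apply Subtype.ext
      have := gen_rel hab
      have e := map_altProd (parabolic Γ Q).subtype ⟨gen Γ a, gen_mem ha⟩ ⟨gen Γ b, gen_mem hb⟩
        (Γ.label a b)
      have e' := map_altProd (parabolic Γ Q).subtype ⟨gen Γ b, gen_mem hb⟩ ⟨gen Γ a, gen_mem ha⟩
        (Γ.label a b)
      exact e.trans (this.trans e'.symm))
  have Fg : ∀ v, F (gen Γ v) = f v := fun v => liftHom_gen _ _ v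
  refine amalg_of_hom hA hB ?_ F ?_ ?_
  · rw [← parabolic_union, ← parabolic_univ]
    congr 1
    exact Set.eq_univ_of_forall hPQ
  · intro a ha
    change F a = ofA ⟨a, ha⟩
    induction ha using Subgroup.closure_induction with
    | mem x hx => obtain ⟨v, hv, rfl⟩ := hx; exact (Fg v).trans (fA v hv)
    | one => rw [map_one]; exact (map_one ofA).symm
    | mul x y hx hy h1 h2 => rw [map_mul, h1, h2, ← map_mul]; rfl
    | inv x hx h1 => rw [map_inv, h1, ← map_inv]; rfl
  · intro a ha
    change F a = ofB ⟨a, ha⟩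
    induction ha using Subgroup.closure_induction with
    | mem x hx => obtain ⟨v, hv, rfl⟩ := hx; exact (Fg v).trans (fB v hv)
    | one => rw [map_one]; exact (map_one ofB).symm
    | mul x y hx hy h1 h2 => rw [map_mul, h1, h2, ← map_mul]; rfl
    | inv x hx h1 => rw [map_inv, h1, ← map_inv]; rfl

end Visual

section Orbit

variable {G : Type*} [Group G] {A B : Subgroup G}
variable {f f' h : G} {A₀ B₀ H : Subgroup G}

/-- The union of the translates of the base edge under a subgroup. -/
def orbY (A B H : Subgroup G) : Set (BSVert A B) := {v | ∃ h ∈ H, v = vA A B h ∨ v = vB A B h}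

theorem vA_mem_orbY (hh : h ∈ H) : vA A B h ∈ orbY A B H := ⟨h, hh, Or.inl rfl⟩
theorem vB_mem_orbY (hh : h ∈ H) : vB A B h ∈ orbY A B H := ⟨h, hh, Or.inr rfl⟩

theorem smul_orbY (hh : h ∈ H) {v : BSVert A B} (hv : v ∈ orbY A B H) : h • v ∈ orbY A B H := by
  obtain ⟨x, hx, rfl | rfl⟩ := hv
  · exact vA_mem_orbY (mul_mem hh hx)
  · exact vB_mem_orbY (mul_mem hh hx)

theorem orbY_walk (hA : A₀ ≤ A) (hB : B₀ ≤ B) (hh : h ∈ A₀ ⊔ B₀) : ∃ p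
    : (bsTree A B).Walk (vA A B 1) (vA A B h), (∀ x ∈ p.support, x ∈ orbY A B (A₀ ⊔ B₀)) ∧ ∀ e ∈
    p.edges, ∃ x ∈ A₀ ⊔ B₀, e = s(vA A B x, vB A B x) := by
  have key : ∀ h : G, h ∈ Subgroup.closure ((A₀ : Set G) ∪ B₀) →
      ∃ p : (bsTree A B).Walk (vA A B 1) (vA A B h),
      (∀ x ∈ p.support, x ∈ orbY A B (A₀ ⊔ B₀)) ∧
      ∀ e ∈ p.edges, ∃ x ∈ A₀ ⊔ B₀, e = s(vA A B x, vB A B x) := by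
    have step : ∀ x y, x ∈ A₀ ⊔ B₀ → y ∈ (A₀ : Set G) ∪ B₀ →
        (∃ p : (bsTree A B).Walk (vA A B 1) (vA A B x), (∀ x ∈ p.support, x ∈ orbY A B (A₀ ⊔ B₀)) ∧
          ∀ e ∈ p.edges, ∃ x ∈ A₀ ⊔ B₀, e = s(vA A B x, vB A B x)) →
        (∃ p : (bsTree A B).Walk (vA A B 1) (vA A B (x * y)),
          (∀ x ∈ p.support, x ∈ orbY A B (A₀ ⊔ B₀)) ∧
          ∀ e ∈ p.edges, ∃ x ∈ A₀ ⊔ B₀, e = s(vA A B x, vB A B x)) := by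
      intro x y hx hy ⟨p, hp, hp'⟩
      rcases hy with hy | hy
      · have : vA A B (x * y) = vA A B x := by rw [eq_comm, vA_eq]; simpa using hA hy
        rw [this]
        exact ⟨p, hp, hp'⟩
      · have e1 : vB A B x = vB A B (x * y) := by rw [vB_eq]; simpa using hB hy
        have hxy : x * y ∈ A₀ ⊔ B₀ := mul_mem hx (Subgroup.mem_sup_right hy)
        have a1 : (bsTree A B).Adj (vA A B x) (vB A B x) := bs_adj x
        have a2 : (bsTree A B).Adj (vB A B x) (vA A B (x * y)) := by
          rw [e1]; exact (bs_adj (x * y)).symm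
        refine ⟨(p.concat a1).concat a2, ?_, ?_⟩
        · intro z hz
          simp only [SimpleGraph.Walk.support_concat, List.concat_eq_append,
            List.mem_append, List.mem_singleton] at hz
          rcases hz with (hz | rfl) | rfl
          · exact hp z hz
          · exact vB_mem_orbY hx
          · exact vA_mem_orbY hxy
        · intro e he
          simp only [SimpleGraph.Walk.edges_concat, List.concat_eq_append,
            List.mem_append, List.mem_singleton] at he
          grind
    have hcl : Subgroup.closure ((A₀ : Set G) ∪ B₀) = A₀ ⊔ B₀ := by
      rw [Subgroup.closure_union, Subgroup.closure_eq, Subgroup.closure_eq]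
    intro h hh
    induction hh using Subgroup.closure_induction_right with
    | one => exact ⟨.nil, by simpa using vA_mem_orbY (one_mem _), by simp⟩
    | mul_right x hx y hy ih => exact step x y (hcl ▸ hx) hy ih
    | mul_inv_cancel x hx y hy ih =>
      refine step x y⁻¹ (hcl ▸ hx) ?_ ih
      rcases hy with hy | hy
      · exact Or.inl (inv_mem hy)
      · exact Or.inr (inv_mem hy)
  apply key
  rwa [Subgroup.closure_union, Subgroup.closure_eq, Subgroup.closure_eq]

theorem Amalg.cvx_orbY (h : Amalg A B) (hA : A₀ ≤ A) (hB : B₀ ≤ B) :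
    Cvx (bsTree A B) (orbY A B (A₀ ⊔ B₀)) := by
  refine cvx_of_walks h.isTree (vA A B 1) ?_
  rintro v ⟨x, hx, rfl | rfl⟩
  · obtain ⟨p, hp, -⟩ := orbY_walk hA hB hx
    exact ⟨p, hp⟩
  · obtain ⟨p, hp, -⟩ := orbY_walk hA hB hx
    refine ⟨p.concat (bs_adj x), ?_⟩
    intro z hz
    simp only [SimpleGraph.Walk.support_concat, List.concat_eq_append,
      List.mem_append, List.mem_singleton] at hz
    rcases hz with hz | rfl
    · exact hp z hz
    · exact vB_mem_orbY hx

/-- An edge with both ends in an orbit set is a translate of the base edge. -/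
theorem Amalg.orbY_edge (h : Amalg A B) (hA : A₀ ≤ A) (hB : B₀ ≤ B)
    (hf : f ∈ A₀ ⊔ B₀) (hf' : f' ∈ A₀ ⊔ B₀) (hadj : (bsTree A B).Adj (vA A B f) (vB A B f')) : ∃ x ∈
    A₀ ⊔ B₀, vA A B f = vA A B x ∧ vB A B f' = vB A B x := by
  obtain ⟨p, -, hp⟩ := orbY_walk hA hB hf
  obtain ⟨q, -, hq⟩ := orbY_walk hA hB hf'
  have hb := SimpleGraph.isAcyclic_iff_forall_adj_isBridge.1 h.isTree.2 hadj
  rw [SimpleGraph.isBridge_iff_forall_walk_mem_edges] at hb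
  have h1 := hb (p.reverse.append (q.concat (bs_adj f')))
  simp only [SimpleGraph.Walk.edges_append, SimpleGraph.Walk.edges_reverse,
    SimpleGraph.Walk.edges_concat, List.concat_eq_append, List.mem_append, List.mem_reverse,
    List.mem_singleton] at h1
  have h2 : ∃ x ∈ A₀ ⊔ B₀, s(vA A B f, vB A B f') = s(vA A B x, vB A B x) := by
    rcases h1 with h1 | h1 | h1
    · exact hp _ h1
    · exact hq _ h1
    · exact ⟨f', hf', h1⟩
  simp_all

end Orbit

section Graph

variable {V : Type*} {Γ : DefiningGraph V}
variable {H : Set (ArtinGroup Γ)}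
variable {f f' g x : ArtinGroup Γ} {L L' P Q : Set V} {b u : V}

/-- The link of a vertex. -/
def lk (Γ : DefiningGraph V) (u : V) : Set V := {v | Γ.graph.Adj u v}

/-- The star of a vertex. -/
def st (Γ : DefiningGraph V) (u : V) : Set V := insert u (lk Γ u)

@[simp] theorem mem_lk {u v : V} : v ∈ lk Γ u ↔ Γ.graph.Adj u v := Iff.rfl
theorem lk_sub_st (u : V) : lk Γ u ⊆ st Γ u := Set.subset_insert _ _
theorem mem_st_self (u : V) : u ∈ st Γ u := Set.mem_insert _ _
theorem lk_sub_compl (u : V) : lk Γ u ⊆ {u}ᶜ := by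
  rintro v hv rfl
  exact Γ.graph.irrefl hv
theorem compl_inter_st (u : V) : {u}ᶜ ∩ st Γ u = lk Γ u := by
  ext v
  constructor
  · rintro ⟨h1, rfl | h2⟩
    · exact absurd rfl h1
    · exact h2
  · exact fun h => ⟨lk_sub_compl u h, lk_sub_st u h⟩

/-- The standard subgroups at a vertex. -/
abbrev pA (Γ : DefiningGraph V) (u : V) := parabolic Γ {u}ᶜ
abbrev pS (Γ : DefiningGraph V) (u : V) := parabolic Γ (st Γ u)
abbrev pL (Γ : DefiningGraph V) (u : V) := parabolic Γ (lk Γ u)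

theorem split_aux (u : V) : Amalg (pA Γ u) (pS Γ u) ∧ pA Γ u ⊓ pS Γ u = pL Γ u := by
  rw [pL, ← compl_inter_st u]
  apply visual_amalg
  · intro v
    by_cases h : v = u
    · exact Or.inr (by rw [h]; exact mem_st_self u)
    · exact Or.inl h
  · intro a b hab
    by_cases ha : a = u
    · subst ha
      exact Or.inr ⟨mem_st_self a, lk_sub_st a hab⟩
    · by_cases hb : b = u
      · subst hb
        exact Or.inr ⟨lk_sub_st b hab.symm, mem_st_self b⟩
      · exact Or.inl ⟨ha, hb⟩

theorem am (Γ : DefiningGraph V) (u : V) : Amalg (pA Γ u) (pS Γ u) := (split_aux u).1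

theorem mem_pL_iff : g ∈ pL Γ u ↔ g ∈ pA Γ u ∧ g ∈ pS Γ u := by
  rw [← (split_aux u).2]; rfl

/-- The tree of the splitting at a vertex. -/
abbrev TV (Γ : DefiningGraph V) (u : V) := BSVert (pA Γ u) (pS Γ u)
abbrev TX (Γ : DefiningGraph V) (u : V) : SimpleGraph (TV Γ u) := bsTree (pA Γ u) (pS Γ u)
theorem ta (Γ : DefiningGraph V) (u : V) : TreeAction (ArtinGroup Γ) (TX Γ u) Sum.isLeft :=
  (am Γ u).treeAction

/-- Independent sets of vertices. -/
def Indep (Γ : DefiningGraph V) (L : Set V) : Prop := ∀ a ∈ L, ∀ b ∈ L, ¬ Γ.graph.Adj a b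

theorem Indep.mono (h : Indep Γ L) (hs : L' ⊆ L) : Indep Γ L' :=
  fun a ha b hb => h a (hs ha) b (hs hb)

theorem indep_amalg (hL : Indep Γ L) (hb : b ∈ L) : Amalg (pA Γ b) (parabolic Γ (L \ {b})ᶜ) := by
  refine (visual_amalg ?_ ?_).1
  · grind
  · intro x y hxy
    by_cases hx : x = b
    · right
      subst hx
      exact ⟨by simp, fun h => hL x hb y h.1 hxy⟩
    · by_cases hy : y = b
      · right
        subst hy
        exact ⟨fun h => hL x h.1 y hb hxy, by simp⟩
      · exact Or.inl ⟨hx, hy⟩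

theorem indep_step (hL : Indep Γ L) (hb : b ∈ L)
    (ht : ∀ x ∈ parabolic Γ (L \ {b}), x ∈ parabolic Γ (L \ {b})ᶜ → x = 1)
    (hg : g ∈ parabolic Γ L) (hg' : g ∈ pA Γ b) : g ∈ parabolic Γ (L \ {b}) := by
  refine (indep_amalg hL hb).sub_inter (A₀ := parabolic Γ (L \ {b})) (B₀ := parabolic Γ {b})
    (parabolic_mono fun x hx => hx.2) (parabolic_mono (by simp)) ?_ ?_ ?_ hg'
  · simp_all
  · intro x h1 h2
    rw [parabolic_singleton] at h1
    obtain ⟨p, rfl⟩ := h1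
    have := zpow_mem_compl h2
    subst this
    simp
  · rwa [← parabolic_union, Set.sdiff_union_of_subset (by simpa using hb)]

variable [Finite V]

theorem indep_trivial (hL : Indep Γ L) : ∀ x ∈ parabolic Γ L, x ∈ parabolic Γ Lᶜ → x = 1 := by
  induction hn : L.ncard generalizing L with
  | zero =>
    rw [Set.ncard_eq_zero (Set.toFinite L)] at hn
    subst hn
    intro x hx _
    rw [parabolic_empty] at hx
    simpa using hx
  | succ n ih =>
    obtain ⟨b, hb⟩ : L.Nonempty := by
      rw [← Set.ncard_pos (Set.toFinite L)]; omega
    have hc : (L \ {b}).ncard = n := by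
      rw [Set.ncard_sdiff_singleton_of_mem hb, hn]; rfl
    have ih' := ih (hL.mono Set.sdiff_subset) hc
    intro x hx hx'
    refine ih' x (indep_step hL hb ih' hx (parabolic_mono ?_ hx')) (parabolic_mono ?_ hx')
    · rintro y hy rfl; exact hy hb
    · intro y hy h; exact hy h.1

theorem indep_inter (hL : Indep Γ L) (P : Set V)
    (hx : x ∈ parabolic Γ L) (hP : x ∈ parabolic Γ P) : x ∈ parabolic Γ (L ∩ P) := by
  induction hn : L.ncard generalizing L with
  | zero =>
    rw [Set.ncard_eq_zero (Set.toFinite L)] at hn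
    subst hn
    simpa using hx
  | succ n ih =>
    by_cases hLP : L ⊆ P
    · rwa [Set.inter_eq_left.2 hLP]
    · obtain ⟨b, hb, hbP⟩ := Set.not_subset.1 hLP
      have hc : (L \ {b}).ncard = n := by
        rw [Set.ncard_sdiff_singleton_of_mem hb, hn]; rfl
      have h1 := indep_step hL hb (indep_trivial (hL.mono Set.sdiff_subset)) hx
        (parabolic_mono (by rintro y hy rfl; exact hbP hy) hP)
      exact parabolic_mono (S := (L \ {b}) ∩ P) (by intro y hy; exact ⟨hy.1.1, hy.2⟩)
        (ih (hL.mono Set.sdiff_subset) h1 hc)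

/-- Triangle-free graphs. -/
class TF (Γ : DefiningGraph V) : Prop where
  out : ∀ a b c : V, Γ.graph.Adj a b → Γ.graph.Adj b c → Γ.graph.Adj a c → False

theorem TF.indep_lk [TF Γ] (u : V) : Indep Γ (lk Γ u) := fun a ha b hb hab => TF.out u a b ha hab hb

theorem diff_sup_inter_st (u : V) :
    parabolic Γ (P \ {u}) ⊔ parabolic Γ (P ∩ st Γ u) = parabolic Γ P := by
  rw [← parabolic_union]
  congr 1
  ext v
  constructor
  · grind
  · intro h
    by_cases hv : v = u
    · exact Or.inr ⟨h, by rw [hv]; exact mem_st_self u⟩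
    · exact Or.inl ⟨h, hv⟩

theorem TF.inter_compl [TF Γ]
    (hP : x ∈ parabolic Γ P) (hu : x ∈ pA Γ u) : x ∈ parabolic Γ (P \ {u}) := by
  refine (am Γ u).sub_inter (A₀ := parabolic Γ (P \ {u})) (B₀ := parabolic Γ (P ∩ st Γ u))
    (parabolic_mono fun x hx => hx.2) (parabolic_mono Set.inter_subset_right) ?_ ?_ ?_ hu
  · intro y h1 h2
    have h3 : y ∈ pL Γ u := mem_pL_iff.2 ⟨parabolic_mono (fun x hx => hx.2) h1, h2⟩
    have h4 := indep_inter (TF.indep_lk u) _ h3 h1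
    exact parabolic_mono (S := lk Γ u ∩ (P \ {u})) (by intro z hz; exact ⟨hz.2.1, lk_sub_st u hz.1⟩) h4
  · intro y h1 h2
    have h3 : y ∈ pL Γ u := mem_pL_iff.2 ⟨h2, parabolic_mono Set.inter_subset_right h1⟩
    have h4 := indep_inter (TF.indep_lk u) _ h3 h1
    exact parabolic_mono (S := lk Γ u ∩ (P ∩ st Γ u))
      (by intro z hz; exact ⟨hz.2.1, lk_sub_compl u hz.1⟩) h4
  · rwa [diff_sup_inter_st]

/-- Intersections of standard parabolic subgroups. -/
theorem TF.inter [TF Γ]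
    (hP : x ∈ parabolic Γ P) (hQ : x ∈ parabolic Γ Q) : x ∈ parabolic Γ (P ∩ Q) := by
  induction hn : P.ncard generalizing P with
  | zero =>
    rw [Set.ncard_eq_zero (Set.toFinite P)] at hn
    subst hn
    simpa using hP
  | succ n ih =>
    by_cases hPQ : P ⊆ Q
    · rwa [Set.inter_eq_left.2 hPQ]
    · obtain ⟨b, hb, hbQ⟩ := Set.not_subset.1 hPQ
      have hc : (P \ {b}).ncard = n := by
        rw [Set.ncard_sdiff_singleton_of_mem hb, hn]; rfl
      have h1 := TF.inter_compl hP (u := b) (parabolic_mono (by rintro y hy rfl; exact hbQ hy) hQ)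
      exact parabolic_mono (S := (P \ {b}) ∩ Q) (by intro y hy; exact ⟨hy.1.1, hy.2⟩) (ih h1 hc)

/-- The orbit of the base edge under a standard parabolic subgroup. -/
abbrev YP (Γ : DefiningGraph V) (u : V) (P : Set V) : Set (TV Γ u) :=
  orbY (pA Γ u) (pS Γ u) (parabolic Γ P)

theorem cvx_YP (u : V) (P : Set V) : Cvx (TX Γ u) (YP Γ u P) := by
  have := (am Γ u).cvx_orbY (A₀ := parabolic Γ (P \ {u})) (B₀ := parabolic Γ (P ∩ st Γ u))
    (parabolic_mono fun x hx => hx.2) (parabolic_mono Set.inter_subset_right)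
  rwa [diff_sup_inter_st] at this

theorem YP_edge (hf : f ∈ parabolic Γ P)
    (hf' : f' ∈ parabolic Γ P) (h : (TX Γ u).Adj (vA _ _ f) (vB _ _ f')) : ∃ x ∈ parabolic Γ P, vA
    (pA Γ u) (pS Γ u) f = vA _ _ x ∧ vB (pA Γ u) (pS Γ u) f' = vB _ _ x := by
  have := (am Γ u).orbY_edge (A₀ := parabolic Γ (P \ {u})) (B₀ := parabolic Γ (P ∩ st Γ u))
    (parabolic_mono fun x hx => hx.2) (parabolic_mono Set.inter_subset_right)
    (f := f) (f' := f')
  rw [diff_sup_inter_st] at this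
  exact this hf hf' h

theorem exists_fixed_YP (hH : ∀ h ∈ H, h ∈ parabolic Γ P)
    (he : ∃ v : TV Γ u, ∀ h ∈ H, h • v = v) : ∃ y ∈ YP Γ u P, ∀ h ∈ H, h • y = y := by
  obtain ⟨v, hv⟩ := he
  obtain ⟨y, hy, hg⟩ := gate_exists (ta Γ u).tree (cvx_YP u P) ⟨_, vA_mem_orbY (one_mem _)⟩ v
  exact ⟨y, hy, fun h hh => (ta Γ u).gate_fixed (fun w hw => smul_orbY (hH h hh) hw) (hv h hh) hy hg⟩

/-- Cliques. -/
def IsCl (Γ : DefiningGraph V) (K : Set V) : Prop := ∀ a ∈ K, ∀ b ∈ K, a ≠ b → Γ.graph.Adj a b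

theorem TF.fixed_cases [TF Γ]
    (hH : ∀ h ∈ H, h ∈ parabolic Γ P) (he : ∃ v : TV Γ u, ∀ h ∈ H, h • v = v) :
    ∃ a ∈ parabolic Γ P, (∀ h ∈ H, a⁻¹ * h * a ∈ parabolic Γ (P \ {u})) ∨
      (∀ h ∈ H, a⁻¹ * h * a ∈ parabolic Γ (P ∩ st Γ u)) := by
  obtain ⟨y, ⟨a, ha, rfl | rfl⟩, hfix⟩ := exists_fixed_YP hH he
  · refine ⟨a, ha, Or.inl fun h hh => ?_⟩
    exact TF.inter_compl (mul_mem (mul_mem (inv_mem ha) (hH h hh)) ha)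
      (smul_vA_eq_iff.1 (hfix h hh))
  · refine ⟨a, ha, Or.inr fun h hh => ?_⟩
    exact TF.inter (mul_mem (mul_mem (inv_mem ha) (hH h hh)) ha) (smul_vB_eq_iff.1 (hfix h hh))

/-- A subgroup of a parabolic fixing a vertex in every tree is conjugate into a clique. -/
theorem TF.desc [TF Γ]
    (hH : ∀ h ∈ H, h ∈ parabolic Γ P) (he : ∀ u ∈ P, ∃ v : TV Γ u, ∀ h ∈ H, h • v = v) :
    ∃ g ∈ parabolic Γ P, ∃ K ⊆ P, IsCl Γ K ∧ ∀ h ∈ H, g⁻¹ * h * g ∈ parabolic Γ K := by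
  induction hn : P.ncard using Nat.strong_induction_on generalizing P H with
  | _ n ih =>
    by_cases hcl : IsCl Γ P
    · exact ⟨1, one_mem _, P, subset_rfl, hcl, by simpa using hH⟩
    · simp only [IsCl, not_forall] at hcl
      obtain ⟨u, hu, w, hw, huw, hadj⟩ := hcl
      obtain ⟨a, ha, hcase⟩ := TF.fixed_cases hH (he u hu)
      have hred : ∀ P' ⊂ P, (∀ h ∈ H, a⁻¹ * h * a ∈ parabolic Γ P') →
          ∃ g ∈ parabolic Γ P, ∃ K ⊆ P, IsCl Γ K ∧ ∀ h ∈ H, g⁻¹ * h * g ∈ parabolic Γ K := by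
        intro P' hP' h1
        have hc : P'.ncard < n := hn ▸ Set.ncard_lt_ncard hP' (Set.toFinite P)
        obtain ⟨g, hg, K, hK, hK', h2⟩ := ih _ hc (P := P') (H := (fun h => a⁻¹ * h * a) '' H)
          (by rintro _ ⟨h, hh, rfl⟩; exact h1 h hh)
          (by
            intro x hx
            obtain ⟨v, hv⟩ := he x (hP'.1 hx)
            refine ⟨a⁻¹ • v, ?_⟩
            rintro _ ⟨h, hh, rfl⟩
            simp only [mul_smul, smul_inv_smul, hv h hh]) rfl
        refine ⟨a * g, mul_mem ha (parabolic_mono hP'.1 hg), K, hK.trans hP'.1, hK', ?_⟩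
        intro h hh
        have := h2 _ ⟨h, hh, rfl⟩
        simpa [mul_assoc] using this
      rcases hcase with h1 | h1
      · exact hred (P \ {u}) ⟨Set.sdiff_subset, fun h => (h hu).2 rfl⟩ h1
      · refine hred _ ⟨Set.inter_subset_left, fun h => ?_⟩ h1
        rcases (h hw).2 with h | h
        · exact huw h.symm
        · exact hadj h

end Graph

section

variable {V : Type*} {Γ : DefiningGraph V}
variable {l l' : List (V × ArtinGroup Γ)}
variable {b g h k t x : ArtinGroup Γ} {K L S : Set V} {a u : V} {i p : ℤ}

/-- All labels are at least `3`. -/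
class Large (Γ : DefiningGraph V) : Prop where
  out : ∀ a b, Γ.graph.Adj a b → 3 ≤ Γ.label a b

theorem gen_zpow_mem (h : a ∈ S) (i : ℤ) : gen Γ a ^ i ∈ parabolic Γ S := zpow_mem (gen_mem h) i

theorem mem_zpow (h : g ∈ parabolic Γ {a}) : ∃ i : ℤ, g = gen Γ a ^ i := by
  rw [parabolic_singleton] at h
  obtain ⟨i, hi⟩ := Subgroup.mem_zpowers_iff.1 h
  exact ⟨i, hi.symm⟩

theorem zpow_not_mem (ha : a ∉ S) (hi : i ≠ 0) : gen Γ a ^ i ∉ parabolic Γ S := fun h =>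
  hi (zpow_mem_compl (parabolic_mono (by intro y hy; rintro rfl; exact ha hy) h))

theorem exists_reduced_mul (ha : a ∈ L) (i : ℤ) (l : List (V × ℤ)) (hl : ∀ p ∈ l, p.1 ∈ L ∧ p.2 ≠ 0)
    (hc : l.IsChain (fun p q => p.1 ≠ q.1)) : ∃ l' : List (V × ℤ), (∀ p ∈ l', p.1 ∈ L ∧ p.2 ≠ 0) ∧
    l'.IsChain (fun p q => p.1 ≠ q.1) ∧ (l'.map fun p => gen Γ p.1 ^ p.2).prod = gen Γ a ^ i *
    (l.map fun p => gen Γ p.1 ^ p.2).prod := by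
  by_cases hi : i = 0
  · exact ⟨l, hl, hc, by simp [hi]⟩
  cases l with
  | nil => exact ⟨[(a, i)], by simp [ha, hi], by simp, by simp⟩
  | cons p l =>
    obtain ⟨c, j⟩ := p
    by_cases hac : a = c
    · subst hac
      have hl' : ∀ p ∈ l, p.1 ∈ L ∧ p.2 ≠ 0 := fun p hp => hl p (List.mem_cons_of_mem _ hp)
      by_cases hij : i + j = 0
      · refine ⟨l, hl', hc.tail, ?_⟩
        simp only [List.map_cons, List.prod_cons]
        rw [← mul_assoc, ← zpow_add, hij, zpow_zero, one_mul]
      · refine ⟨(a, i + j) :: l, ?_, ?_, ?_⟩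
        · grind
        · cases l with
          | nil => simp
          | cons q l =>
            simp_all
        · simp only [List.map_cons, List.prod_cons]
          rw [← mul_assoc, ← zpow_add]
    · refine ⟨(a, i) :: (c, j) :: l, ?_, ?_, ?_⟩
      · grind
      · simp_all
      · simp

theorem exists_reduced (hg : g ∈ parabolic Γ L) : ∃ l : List (V × ℤ), (∀ p ∈ l, p.1 ∈ L ∧ p.2 ≠ 0) ∧
    l.IsChain (fun p q => p.1 ≠ q.1) ∧ (l.map fun p => gen Γ p.1 ^ p.2).prod = g := by
  induction hg using Subgroup.closure_induction_left with
  | one => exact ⟨[], by simp, by simp, by simp⟩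
  | mul_left x hx y hy ih =>
    obtain ⟨a, ha, rfl⟩ := hx
    obtain ⟨l, h1, h2, rfl⟩ := ih
    obtain ⟨l', h1', h2', h3'⟩ := exists_reduced_mul (Γ := Γ) ha 1 l h1 h2
    exact ⟨l', h1', h2', by rw [h3', zpow_one]; rfl⟩
  | inv_mul_cancel x hx y hy ih =>
    obtain ⟨a, ha, rfl⟩ := hx
    obtain ⟨l, h1, h2, rfl⟩ := ih
    obtain ⟨l', h1', h2', h3'⟩ := exists_reduced_mul (Γ := Γ) ha (-1) l h1 h2
    exact ⟨l', h1', h2', by rw [h3', zpow_neg_one]; rfl⟩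

/-- Reduced sequences in the star of `u`. -/
def StarRed (Γ : DefiningGraph V) (u : V) (l : List (V × ArtinGroup Γ)) : Prop :=
  (∀ p ∈ l, Γ.graph.Adj u p.1 ∧ p.2 ∈ parabolic Γ {u, p.1} ∧ p.2 ∉ parabolic Γ {u}) ∧
    l.IsChain (fun p q => p.1 ≠ q.1)

theorem StarRed.of_append_left (h : StarRed Γ u (l ++ l')) : StarRed Γ u l :=
  ⟨fun p hp => h.1 p (List.mem_append_left _ hp), h.2.left_of_append⟩

theorem StarRed.of_append_right (h : StarRed Γ u (l ++ l')) : StarRed Γ u l' :=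
  ⟨fun p hp => h.1 p (List.mem_append_right _ hp), h.2.right_of_append⟩

variable [Finite V]

theorem TF.mem_compl_pair [TF Γ] (hua : u ≠ a)
    (hx : x ∈ parabolic Γ {u, a}) (h : x ∈ pA Γ a) : x ∈ parabolic Γ {u} := by
  refine parabolic_mono ?_ (TF.inter_compl hx h)
  simp_all

theorem TF.st_inter [TF Γ] (h : Γ.graph.Adj u a) : st Γ u ∩ st Γ a ⊆ {u, a} := by
  rintro v ⟨rfl | h1, rfl | h2⟩
  · simp
  · simp
  · simp
  · exact absurd h2 fun h2 => TF.out u a v h h2 h1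

theorem StarRed.prod_not_mem [TF Γ] (l : List (V × ArtinGroup Γ))
    (hl : StarRed Γ u l) (hne : l ≠ []) : (l.map Prod.snd).prod ∉ parabolic Γ {u} := by
  induction hn : l.length using Nat.strong_induction_on generalizing l with
  | _ n ih =>
    cases l with
    | nil => exact absurd rfl hne
    | cons p l =>
      obtain ⟨a, x⟩ := p
      have hua : Γ.graph.Adj u a := (hl.1 (a, x) (List.mem_cons_self ..)).1
      have hB : ∀ y, y ∈ parabolic Γ {u, a} → y ∈ pS Γ a := fun y hy => by
        refine parabolic_mono ?_ hy
        rintro v (rfl | rfl)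
        · exact lk_sub_st _ hua.symm
        · exact mem_st_self _
      have hA : ∀ y, y ∈ parabolic Γ {u, a} → y ∉ parabolic Γ {u} → y ∉ pA Γ a :=
        fun y hy hy' hya => hy' (TF.mem_compl_pair hua.ne hy hya)
      have inner : ∀ m, ∀ r : List (V × ArtinGroup Γ), r.length = m → ∀ blk, blk ≠ [] →
          (∀ q ∈ blk, q.1 ≠ a) → StarRed Γ u (blk ++ r) → (blk ++ r).length < n →
          Starts (pS Γ a) (pA Γ a) ((blk ++ r).map Prod.snd).prod := by
        intro m
        induction m using Nat.strong_induction_on with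
        | _ m ihm =>
          intro r hr blk hblk hba hred hlen
          have hblkB : (blk.map Prod.snd).prod ∉ pS Γ a := by
            intro hmem
            refine ih blk.length (by simp at hlen; omega) blk hred.of_append_left hblk rfl ?_
            have h1 : (blk.map Prod.snd).prod ∈ parabolic Γ (st Γ u \ {a}) := by
              refine Subgroup.list_prod_mem _ ?_
              intro y hy
              obtain ⟨q, hq, rfl⟩ := List.mem_map.1 hy
              have h3 := hred.1 q (List.mem_append_left _ hq)
              refine parabolic_mono ?_ h3.2.1
              rintro v (rfl | rfl)
              · exact ⟨mem_st_self _, hua.ne⟩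
              · exact ⟨lk_sub_st _ h3.1, hba q hq⟩
            refine parabolic_mono ?_ (TF.inter h1 hmem)
            rintro v ⟨⟨h4, h5⟩, h6⟩
            rcases TF.st_inter hua ⟨h4, h6⟩ with h | h
            · exact h
            · exact absurd h h5
          have hblkA : (blk.map Prod.snd).prod ∈ pA Γ a := by
            refine Subgroup.list_prod_mem _ ?_
            intro y hy
            obtain ⟨q, hq, rfl⟩ := List.mem_map.1 hy
            have h3 := hred.1 q (List.mem_append_left _ hq)
            refine parabolic_mono ?_ h3.2.1
            rintro v (rfl | rfl)
            · exact hua.ne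
            · exact hba q hq
          cases r with
          | nil =>
            rw [List.append_nil]
            exact Starts.of_mem hblkA hblkB
          | cons q r =>
            by_cases hq : q.1 = a
            · obtain ⟨c, y⟩ := q
              obtain rfl : c = a := hq
              have hr2 := hred.of_append_right
              have hy := hr2.1 (c, y) (List.mem_cons_self ..)
              rw [List.map_append, List.prod_append, List.map_cons, List.prod_cons]
              refine Starts.cons hblkA hblkB ?_
              cases r with
              | nil => simpa using Starts.of_mem (hB y hy.2.1) (hA y hy.2.1 hy.2.2)
              | cons q r =>
                refine Starts.cons (hB y hy.2.1) (hA y hy.2.1 hy.2.2) ?_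
                have := ihm r.length (by simp at hr; omega) r rfl [q] (by simp) ?_
                  (StarRed.of_append_right (l := [(c, y)]) hr2) ?_
                · simpa using this
                · have := hr2.2
                  grind
                · simp at hlen ⊢; omega
            · have h5 : blk ++ q :: r = (blk ++ [q]) ++ r := by simp
              rw [h5] at hred hlen ⊢
              refine ihm r.length (by simp at hr; omega) r rfl _ (by simp) ?_ hred hlen
              grind
      have hx := hl.1 (a, x) (List.mem_cons_self ..)
      intro hmem
      refine (am Γ a).not_starts_of_memA (parabolic_mono (by
        rintro v rfl; exact hua.ne) hmem) ?_
      rw [List.map_cons, List.prod_cons]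
      cases l with
      | nil => grind
      | cons q l =>
        refine Starts.cons (hB x hx.2.1) (hA x hx.2.1 hx.2.2) ?_
        refine inner l.length l rfl [q] (by simp) ?_ (StarRed.of_append_right (l := [(a, x)]) hl) ?_
        · have := hl.2
          grind
        · simp at hn ⊢; omega

theorem clique_elliptic (hK : IsCl Γ K) (u : V) : ∃ v : TV Γ u, ∀ h ∈ parabolic Γ K, h • v = v := by
  by_cases hu : u ∈ K
  · refine ⟨vB _ _ 1, fun h hh => ?_⟩
    rw [smul_vB_eq_iff, inv_one, one_mul, mul_one]
    refine parabolic_mono ?_ hh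
    intro v hv
    by_cases hvu : v = u
    · rw [hvu]; exact mem_st_self u
    · exact lk_sub_st _ (hK u hu v hv (Ne.symm hvu))
  · refine ⟨vA _ _ 1, fun h hh => ?_⟩
    rw [smul_vA_eq_iff, inv_one, one_mul, mul_one]
    refine parabolic_mono ?_ hh
    rintro v hv rfl
    exact hu hv

theorem smul_conj_iff {G T : Type*} [Group G] [MulAction G T] {g k : G} {v : T} :
    (g⁻¹ * k * g) • g⁻¹ • v = g⁻¹ • v ↔ k • v = v := by
  rw [smul_smul, mul_assoc, mul_inv_cancel, mul_one, mul_smul]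
  exact (MulAction.injective g⁻¹).eq_iff

theorem vertexType_of_mem_indep [TF Γ] (hL : Indep Γ L) (hk : k ∈ parabolic Γ L)
    (he : ∀ x ∈ L, ∃ v : TV Γ x, k • v = v) (hV : Nonempty V) : VertexType k := by
  obtain ⟨g, -, K, hKL, hK, h⟩ := TF.desc (P := L) (H := {k}) (by simpa using hk)
    (by simpa using he)
  have h := h k rfl
  have : ∃ s, K ⊆ {s} := by
    rcases K.eq_empty_or_nonempty with rfl | ⟨s, hs⟩
    · exact ⟨hV.some, by simp⟩
    · refine ⟨s, fun a ha => ?_⟩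
      by_contra hne
      exact hL a (hKL ha) s (hKL hs) (hK a ha s hs hne)
  obtain ⟨s, hs⟩ := this
  obtain ⟨i, hi⟩ := mem_zpow (parabolic_mono hs h)
  exact ⟨g, s, i, by rw [← hi]; group⟩

theorem adj_label [Large Γ] : ¬ (Γ.graph.Adj a u ∧ Γ.label a u = 2) := by
  rintro ⟨h1, h2⟩
  have := Large.out _ _ h1
  omega

variable [TF Γ] [Large Γ]

theorem star (hk : k ∈ pL Γ u)
    (hb : b ∈ pS Γ u) (hb' : b ∉ pL Γ u) (hbk : b⁻¹ * k * b ∈ pL Γ u) : VertexType k := by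
  by_contra hv
  have : ∃ a ∈ lk Γ u, Hyp (TV Γ a) k := by
    by_contra! hcon
    exact hv (vertexType_of_mem_indep (TF.indep_lk u) hk
      (fun x hx => not_hyp_iff.1 (hcon x hx)) ⟨u⟩)
  obtain ⟨a, ha, hhyp⟩ := this
  set Y := YP Γ a (lk Γ u)
  have hY : Cvx (TX Γ a) Y := cvx_YP a _
  have hZ := (ta Γ a).cvx_smul hY b
  have hkY : ∀ v ∈ Y, k • v ∈ Y := fun v hv => smul_orbY hk hv
  have hkZ : ∀ v ∈ {v | b⁻¹ • v ∈ Y}, k • v ∈ {v | b⁻¹ • v ∈ Y} := by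
    intro v hv
    have h := smul_orbY hbk hv
    rw [smul_smul] at h
    simpa [smul_smul, mul_assoc] using h
  obtain ⟨v₀, hv₀Y, hv₀Z⟩ := (ta Γ a).inter_nonempty hhyp hY hZ hkY hkZ
    ⟨_, vA_mem_orbY (one_mem _)⟩ ⟨b • vA _ _ 1, by
      change b⁻¹ • b • vA _ _ 1 ∈ Y
      rw [inv_smul_smul]; exact vA_mem_orbY (one_mem _)⟩
  have hflowY : ∀ v ∈ Y, flow (TX Γ a) k v ∈ Y := fun v hv =>
    (ta Γ a).flow_mem hhyp hY hkY hv 1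
  have hflowZ : ∀ v, b⁻¹ • v ∈ Y → b⁻¹ • flow (TX Γ a) k v ∈ Y := fun v hv =>
    (ta Γ a).flow_mem hhyp hZ hkZ hv 1
  have : ∃ g, vA (pA Γ a) (pS Γ a) g ∈ Y ∧ b⁻¹ • vA (pA Γ a) (pS Γ a) g ∈ Y := by
    rcases bs_cases v₀ with ⟨g, rfl⟩ | ⟨g, rfl⟩
    · exact ⟨g, hv₀Y, hv₀Z⟩
    · have hadj := (ta Γ a).flow_adj hhyp (vB _ _ g)
      have h1 := hflowY _ hv₀Y
      have h2 := hflowZ _ hv₀Z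
      rcases bs_cases (flow (TX Γ a) k (vB (pA Γ a) (pS Γ a) g)) with ⟨g', h⟩ | ⟨g', h⟩
      · grind
      · rw [h] at hadj
        exact ((ta Γ a).type_ne _ _ hadj rfl).elim
  obtain ⟨g₀, hgY, hgZ⟩ := this
  have hadj := (ta Γ a).flow_adj hhyp (vA _ _ g₀)
  have hoY := hflowY _ hgY
  have hoZ := hflowZ _ hgZ
  rcases bs_cases (flow (TX Γ a) k (vA (pA Γ a) (pS Γ a) g₀)) with ⟨g₁, h₁⟩ | ⟨g₁, h₁⟩
  · rw [h₁] at hadj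
    exact ((ta Γ a).type_ne _ _ hadj rfl).elim
  have hff := (ta Γ a).flow_flow_ne hhyp (vA _ _ g₀)
  have hadj2 := (ta Γ a).flow_adj hhyp (flow (TX Γ a) k (vA _ _ g₀))
  have hwY := hflowY _ hoY
  have hwZ := hflowZ _ hoZ
  rcases bs_cases (flow (TX Γ a) k (flow (TX Γ a) k (vA (pA Γ a) (pS Γ a) g₀)))
    with ⟨g₂, h₂⟩ | ⟨g₂, h₂⟩
  swap
  · rw [h₁] at hadj2 h₂
    rw [h₂] at hadj2
    exact ((ta Γ a).type_ne _ _ hadj2 rfl).elim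
  rw [h₂] at hff hadj2 hwY hwZ
  rw [h₁] at hadj hadj2 hoY hoZ
  -- description of edges inside `Y`
  have edge : ∀ c p q : ArtinGroup Γ, c⁻¹ • vA (pA Γ a) (pS Γ a) p ∈ Y →
      c⁻¹ • vB (pA Γ a) (pS Γ a) q ∈ Y → (TX Γ a).Adj (vA _ _ p) (vB _ _ q) →
      ∃ f ∈ pL Γ u, vA (pA Γ a) (pS Γ a) p = vA _ _ (c * f) ∧
        vB (pA Γ a) (pS Γ a) q = vB _ _ (c * f) := by
    intro c p q hp hq hpq
    have hadj' := bs_smul_adj c⁻¹ hpq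
    obtain ⟨x, hx, hpx | hpx⟩ := hp
    swap
    · simp_all
    obtain ⟨y, hy, hqy | hqy⟩ := hq
    · simp_all
    rw [hpx, hqy] at hadj'
    obtain ⟨f, hf, e1, e2⟩ := YP_edge hx hy hadj'
    refine ⟨f, hf, ?_, ?_⟩
    · rw [← smul_vA, ← e1, ← hpx, smul_inv_smul]
    · rw [← smul_vB, ← e2, ← hqy, smul_inv_smul]
  have hinter : st Γ a ∩ lk Γ u ⊆ {a} := by
    rintro v ⟨h1, h2⟩
    rcases TF.st_inter (u := u) ha ⟨lk_sub_st _ h2, h1⟩ with h | h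
    · exact absurd h (lk_sub_compl u h2)
    · exact h
  have pair : ∀ c : ArtinGroup Γ, c⁻¹ • vA (pA Γ a) (pS Γ a) g₀ ∈ Y →
      c⁻¹ • vB (pA Γ a) (pS Γ a) g₁ ∈ Y → c⁻¹ • vA (pA Γ a) (pS Γ a) g₂ ∈ Y →
      ∃ f ∈ pL Γ u, ∃ j : ℤ, vA (pA Γ a) (pS Γ a) g₀ = vA _ _ (c * f) ∧
        vB (pA Γ a) (pS Γ a) g₁ = vB _ _ (c * f) ∧
        vA (pA Γ a) (pS Γ a) g₂ = vA _ _ (c * f * gen Γ a ^ j) := by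
    intro c h0 h1 h2
    obtain ⟨f, hf, e1, e2⟩ := edge c _ _ h0 h1 hadj
    obtain ⟨f', hf', e1', e2'⟩ := edge c _ _ h2 h1 hadj2.symm
    have hmem : f⁻¹ * f' ∈ parabolic Γ {a} := by
      refine parabolic_mono hinter (TF.inter ?_ (mul_mem (inv_mem hf) hf'))
      rw [e2] at e2'
      have := vB_eq.1 e2'
      simpa [mul_assoc] using this
    obtain ⟨j, hj⟩ := mem_zpow hmem
    refine ⟨f, hf, j, e1, e2, ?_⟩
    rw [← hj, e1']
    congr 1
    group
  obtain ⟨f, hf, j, e1, e2, e3⟩ := pair 1 (by simpa using hgY) (by simpa using hoY)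
    (by simpa using hwY)
  obtain ⟨g, hg, j', e1', e2', e3'⟩ := pair b hgZ hoZ hwZ
  rw [one_mul] at e1 e2 e3
  have hj : -j ≠ 0 := by
    intro h
    rw [neg_eq_zero.1 h, zpow_zero, mul_one, ← e1] at e3
    exact hff e3
  have hb0st : f⁻¹ * (b * g) ∈ parabolic Γ {u, a} := by
    refine parabolic_mono (TF.st_inter ha) (TF.inter ?_ ?_)
    · exact mul_mem (inv_mem (parabolic_mono (lk_sub_st _) hf))
        (mul_mem hb (parabolic_mono (lk_sub_st _) hg))
    · rw [e2] at e2'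
      exact vB_eq.1 e2'
  have hb0 : f⁻¹ * (b * g) ∈ parabolic Γ {u} := by
    refine TF.mem_compl_pair (Γ.graph.ne_of_adj ha) hb0st ?_
    rw [e1] at e1'
    exact vA_eq.1 e1'
  have hb1 : (gen Γ a ^ j)⁻¹ * (f⁻¹ * (b * g)) * gen Γ a ^ j' ∈ parabolic Γ {u} := by
    refine TF.mem_compl_pair (Γ.graph.ne_of_adj ha) (mul_mem (mul_mem (inv_mem ?_) hb0st) ?_) ?_
    · exact gen_zpow_mem (by simp) _
    · exact gen_zpow_mem (by simp) _
    · rw [e3] at e3'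
      have := vA_eq.1 e3'
      simpa [mul_assoc] using this
  obtain ⟨p, hp⟩ := mem_zpow hb0
  obtain ⟨q, hq⟩ := mem_zpow hb1
  rw [hp, ← zpow_neg] at hq
  have hp0 := zpow_relation (Γ.graph.ne_of_adj ha).symm (adj_label) hj hq
  rw [hp0, zpow_zero] at hp
  apply hb'
  have : b = f * g⁻¹ := by
    rw [inv_mul_eq_one] at hp
    rw [hp]; group
  rw [this]
  exact mul_mem hf (inv_mem hg)

theorem star_zpow (hp : p ≠ 0)
    (hk : k ∈ pL Γ u) (hk' : (gen Γ u ^ p)⁻¹ * k * gen Γ u ^ p ∈ pL Γ u) : k = 1 := by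
  by_contra hk1
  obtain ⟨k', hk'def⟩ : ∃ k', k' = (gen Γ u ^ p)⁻¹ * k * gen Γ u ^ p := ⟨_, rfl⟩
  rw [← hk'def] at hk'
  obtain ⟨l, h1, h2, h3⟩ := exists_reduced (inv_mem hk)
  obtain ⟨l', h1', h2', h3'⟩ := exists_reduced hk'
  rcases List.eq_nil_or_concat l with rfl | ⟨r, ⟨a, i⟩, rfl⟩
  swap; rw [List.concat_eq_append] at h1 h2 h3; swap
  · exact hk1 (by simpa using h3.symm)
  cases l' with
  | nil =>
    apply hk1
    simp only [List.map_nil, List.prod_nil] at h3'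
    have : k = gen Γ u ^ p * k' * (gen Γ u ^ p)⁻¹ := by rw [hk'def]; group
    rw [this, ← h3']; group
  | cons q l' =>
    obtain ⟨c, j⟩ := q
    simp only [List.map_append, List.prod_append, List.map_cons, List.map_nil, List.prod_cons,
      List.prod_nil, mul_one] at h3 h3'
    have hrel : k⁻¹ * gen Γ u ^ p * k' = gen Γ u ^ p := by rw [hk'def]; group
    have ha : a ∈ lk Γ u ∧ i ≠ 0 := h1 (a, i) (by simp)
    have hc : c ∈ lk Γ u ∧ j ≠ 0 := h1' (c, j) (by simp)
    have hua : u ≠ a := Γ.graph.ne_of_adj ha.1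
    let F : V × ℤ → V × ArtinGroup Γ := fun p => (p.1, gen Γ p.1 ^ p.2)
    have hF : ∀ q : V × ℤ, q.1 ∈ lk Γ u ∧ q.2 ≠ 0 → Γ.graph.Adj u (F q).1 ∧
        (F q).2 ∈ parabolic Γ {u, (F q).1} ∧ (F q).2 ∉ parabolic Γ {u} := by
      intro q hq
      refine ⟨hq.1, gen_zpow_mem (by simp [F]) _, zpow_not_mem ?_ hq.2⟩
      exact fun h => lk_sub_compl u hq.1 h
    have hr := List.isChain_append.1 h2
    have hsnd : ∀ s : List (V × ℤ), (s.map F).map Prod.snd = s.map fun p => gen Γ p.1 ^ p.2 := by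
      intro s; rw [List.map_map]; rfl
    have hchain : ∀ s : List (V × ℤ), s.IsChain (fun p q => p.1 ≠ q.1) →
        (s.map F).IsChain (fun p q => p.1 ≠ q.1) := by
      intro s hs
      rw [List.isChain_map]
      exact hs
    have hup : gen Γ u ^ p ∈ parabolic Γ {u} := gen_zpow_mem (Set.mem_singleton u) _
    by_cases hac : a = c
    · subst hac
      refine StarRed.prod_not_mem (u := u) (r.map F ++ (a, gen Γ a ^ i * gen Γ u ^ p * gen Γ a ^ j) :: l'.map F)
        ⟨?_, ?_⟩ (by simp) ?_
      · intro q hq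
        rcases List.mem_append.1 hq with hq | hq
        · obtain ⟨q, hq', rfl⟩ := List.mem_map.1 hq
          grind
        · rcases List.mem_cons.1 hq with rfl | hq
          · refine ⟨ha.1, mul_mem (mul_mem (gen_zpow_mem (by simp) _) (gen_zpow_mem (by simp) _))
              (gen_zpow_mem (by simp) _), fun hmem => ?_⟩
            obtain ⟨q, hq⟩ := mem_zpow hmem
            exact hp (zpow_relation hua.symm (adj_label) ha.2 hq)
          · obtain ⟨q, hq', rfl⟩ := List.mem_map.1 hq
            grind
      · refine List.isChain_append.2 ⟨hchain r hr.1, ?_, ?_⟩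
        · have := hchain _ h2'
          cases l' with
          | nil => simp
          | cons q l' =>
            grind
        · intro x hx y hy
          simp only [List.head?_cons, Option.mem_def, Option.some.injEq] at hy
          rw [List.getLast?_map] at hx
          obtain ⟨z, hz, rfl⟩ := Option.map_eq_some_iff.1 hx
          subst hy
          exact hr.2.2 z hz (a, i) (by simp)
      grind
    · refine StarRed.prod_not_mem (u := u) (r.map F ++ (a, gen Γ a ^ i * gen Γ u ^ p) ::
        ((c, j) :: l').map F) ⟨?_, ?_⟩ (by simp) ?_
      · intro q hq
        rcases List.mem_append.1 hq with hq | hq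
        · obtain ⟨q, hq', rfl⟩ := List.mem_map.1 hq
          grind
        · rcases List.mem_cons.1 hq with rfl | hq
          · refine ⟨ha.1, mul_mem (gen_zpow_mem (by simp) _) (gen_zpow_mem (by simp) _),
              fun hmem => ?_⟩
            exact zpow_not_mem (S := {u}) hua.symm ha.2 ((mul_mem_cancel_right hup).1 hmem)
          · obtain ⟨q, hq', rfl⟩ := List.mem_map.1 hq
            exact hF q (h1' q hq')
      · refine List.isChain_append.2 ⟨hchain r hr.1, ?_, ?_⟩
        · grind
        · intro x hx y hy
          simp only [List.head?_cons, Option.mem_def, Option.some.injEq] at hy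
          rw [List.getLast?_map] at hx
          obtain ⟨z, hz, rfl⟩ := Option.map_eq_some_iff.1 hx
          subst hy
          exact hr.2.2 z hz (a, i) (by simp)
      grind

/-- An element of the link commuting with a nontrivial power of `u` is trivial. -/
theorem lk_inter_centralizer
    (hp : p ≠ 0) (hk : k ∈ pL Γ u) (hc : Commute k (gen Γ u ^ p)) : k = 1 := by
  refine star_zpow hp hk ?_
  have : (gen Γ u ^ p)⁻¹ * k * gen Γ u ^ p = k := by
    rw [mul_assoc, hc.eq]; group
  rwa [this]

theorem fixed_vA_unique (hk : ¬ VertexType k) (hg : k • vA (pA Γ u) (pS Γ u) g = vA _ _ g)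
    (hh : k • vA (pA Γ u) (pS Γ u) h = vA _ _ h) : vA (pA Γ u) (pS Γ u) g = vA _ _ h := by
  by_contra hne
  have hT := (ta Γ u).tree
  have hadj := nxt_adj hT hne
  have hfix1 := (ta Γ u).cvx_fixS k _ hg _ hh hne
  have hd := dist_nxt hT hne
  set w := vA (pA Γ u) (pS Γ u) h with hw
  set o := nxt (TX Γ u) (vA _ _ g) w with ho
  rcases bs_cases o with ⟨x, hx⟩ | ⟨x, hx⟩
  · rw [hx] at hadj
    exact ((ta Γ u).type_ne _ _ hadj rfl).elim
  have how : o ≠ w := by rw [hx, hw]; exact vB_ne_vA _ _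
  have hadj2 := nxt_adj hT how
  have hfix2 := (ta Γ u).cvx_fixS k _ hfix1 _ hh how
  have hd2 := dist_nxt hT how
  set v := nxt (TX Γ u) o w with hv
  rw [hx] at hadj hadj2
  rcases bs_cases v with ⟨y, hy⟩ | ⟨y, hy⟩
  swap
  · rw [hy] at hadj2
    exact ((ta Γ u).type_ne _ _ hadj2 rfl).elim
  rw [hy] at hadj2
  obtain ⟨p, hp, hp'⟩ := bs_adj_iff.1 hadj
  obtain ⟨q, hq, hq'⟩ := bs_adj_iff.1 hadj2.symm
  rw [mem_fixS] at hfix1 hfix2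
  rw [hx, vB_eq.2 hp'] at hfix1
  rw [hy, vA_eq.2 hq] at hfix2
  rw [vA_eq.2 hp] at hg
  have hpq : p⁻¹ * q ∈ pS Γ u := by
    have := mul_mem (inv_mem hp') hq'
    simpa [mul_assoc] using this
  have hk0 : p⁻¹ * k * p ∈ pL Γ u := mem_pL_iff.2 ⟨smul_vA_eq_iff.1 hg, smul_vB_eq_iff.1 hfix1⟩
  have hk1 : q⁻¹ * k * q ∈ pL Γ u := by
    refine mem_pL_iff.2 ⟨smul_vA_eq_iff.1 hfix2, ?_⟩
    have := mul_mem (mul_mem (inv_mem hpq) (mem_pL_iff.1 hk0).2) hpq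
    simpa [mul_assoc] using this
  refine hk ?_
  have : VertexType (p⁻¹ * k * p) := by
    refine star hk0 hpq ?_ ?_
    · intro hpq'
      have e1 : vA (pA Γ u) (pS Γ u) g = v := by
        rw [hy, vA_eq.2 hp, vA_eq.2 hq]
        exact vA_eq.2 (mem_pL_iff.1 hpq').1
      rw [e1] at hd
      omega
    · have e : (p⁻¹ * q)⁻¹ * (p⁻¹ * k * p) * (p⁻¹ * q) = q⁻¹ * k * q := by group
      rwa [e]
  have e : k = p * (p⁻¹ * k * p) * p⁻¹ := by group
  rw [e]
  exact this.conj p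

theorem exists_fixed_by_centralizer (hk : ¬ VertexType k)
    (he : ∃ v : TV Γ u, k • v = v) : ∃ v : TV Γ u, ∀ c, Commute c k → c • v = v := by
  have hcf : ∀ c, Commute c k → ∀ v : TV Γ u, k • v = v → k • c • v = c • v := by
    intro c hc v hv
    rw [smul_smul, ← hc.eq, mul_smul, hv]
  by_cases h : ∃ g, k • vA (pA Γ u) (pS Γ u) g = vA _ _ g
  · obtain ⟨g, hg⟩ := h
    refine ⟨vA _ _ g, fun c hc => ?_⟩
    have := hcf c hc _ hg
    rw [smul_vA] at this ⊢
    exact fixed_vA_unique hk this hg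
  · obtain ⟨v, hv⟩ := he
    refine ⟨v, fun c hc => ?_⟩
    by_contra hne
    have h1 := hcf c hc v hv
    have h2 := (ta Γ u).cvx_fixS k _ hv _ h1 (Ne.symm hne)
    have hadj := nxt_adj (ta Γ u).tree (Ne.symm hne)
    rcases bs_cases v with ⟨g, rfl⟩ | ⟨g, rfl⟩
    · exact h ⟨g, hv⟩
    · rcases bs_cases (nxt (TX Γ u) (vB (pA Γ u) (pS Γ u) g) (c • vB (pA Γ u) (pS Γ u) g)) with ⟨g', h'⟩ | ⟨g', h'⟩
      · rw [h'] at h2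
        exact h ⟨g', h2⟩
      · rw [h'] at hadj
        exact ((ta Γ u).type_ne _ _ hadj rfl).elim

theorem TF.mem_of_forall (h : ∀ u ∉ S, g ∈ pA Γ u) : g ∈ parabolic Γ S := by
  have key : ∀ F : Set V, F.Finite → (∀ u ∈ F, g ∈ pA Γ u) → g ∈ parabolic Γ Fᶜ := by
    intro F hF
    induction F, hF using Set.Finite.induction_on with
    | empty => intro _; rw [Set.compl_empty, parabolic_univ]; trivial
    | insert _ _ ih =>
      intro h
      rename_i a F' _ _
      have h1 := ih fun u hu => h u (Set.mem_insert_of_mem _ hu)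
      refine parabolic_mono ?_ (TF.inter h1 (h a (Set.mem_insert ..)))
      grind
  have := key Sᶜ (Set.toFinite _) h
  rwa [compl_compl] at this

theorem mem_of_conj_mem (ht : ¬ VertexType t)
    (h1 : t ∈ parabolic Γ S) (h2 : g⁻¹ * t * g ∈ parabolic Γ S) : g ∈ parabolic Γ S := by
  refine TF.mem_of_forall fun u hu => ?_
  have hS : S ⊆ {u}ᶜ := by rintro v hv rfl; exact hu hv
  have e1 : t • vA (pA Γ u) (pS Γ u) 1 = vA _ _ 1 := by
    rw [smul_vA_eq_iff]; simpa using parabolic_mono hS h1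
  have e2 : t • vA (pA Γ u) (pS Γ u) g = vA _ _ g := by
    rw [smul_vA_eq_iff]; exact parabolic_mono hS h2
  simpa using vA_eq.1 (fixed_vA_unique ht e1 e2)

theorem clique_conj_sub (hK : IsCl Γ K) (ht : ¬ VertexType t)
    (h1 : t ∈ parabolic Γ S) (h2 : g⁻¹ * t * g ∈ parabolic Γ K) : K ⊆ S ∧ g ∈ parabolic Γ S := by
  have hell : ∀ w, ∃ v : TV Γ w, t • v = v := by
    intro w
    obtain ⟨v, hv⟩ := clique_elliptic hK w
    refine ⟨g • v, ?_⟩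
    have := hv _ h2
    rw [← smul_conj_iff (g := g), inv_smul_smul]
    exact this
  have hKS : K ⊆ S := by
    intro u huK
    by_contra huS
    have hS : S ⊆ {u}ᶜ := by rintro v hv rfl; exact huS hv
    have e1 : t • vA (pA Γ u) (pS Γ u) 1 = vA _ _ 1 := by
      rw [smul_vA_eq_iff]; simpa using parabolic_mono hS h1
    have hKst : K ⊆ st Γ u := by
      intro v hv
      by_cases hvu : v = u
      · rw [hvu]; exact mem_st_self u
      · exact lk_sub_st _ (hK u huK v hv (Ne.symm hvu))
    have e2 : t • vB (pA Γ u) (pS Γ u) g = vB _ _ g := by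
      rw [smul_vB_eq_iff]; exact parabolic_mono hKst h2
    have hne : vB (pA Γ u) (pS Γ u) g ≠ vA _ _ 1 := vB_ne_vA _ _
    have h3 := (ta Γ u).cvx_fixS t _ e2 _ e1 hne
    have hadj := nxt_adj (ta Γ u).tree hne
    rcases bs_cases (nxt (TX Γ u) (vB (pA Γ u) (pS Γ u) g) (vA (pA Γ u) (pS Γ u) 1)) with ⟨y, hy⟩ | ⟨y, hy⟩
    swap
    · rw [hy] at hadj
      exact ((ta Γ u).type_ne _ _ hadj rfl).elim
    rw [hy] at h3 hadj
    obtain ⟨x, hx, hx'⟩ := bs_adj_iff.1 hadj.symm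
    rw [mem_fixS, vA_eq.2 hx] at h3
    rw [vB_eq.2 hx'] at e2
    have hL : x⁻¹ * t * x ∈ pL Γ u := mem_pL_iff.2 ⟨smul_vA_eq_iff.1 h3, smul_vB_eq_iff.1 e2⟩
    have hv := vertexType_of_mem_indep (TF.indep_lk u) hL (fun w _ => by
      obtain ⟨v, hv⟩ := hell w
      exact ⟨x⁻¹ • v, smul_conj_iff.2 hv⟩) ⟨u⟩
    apply ht
    have e : t = x * (x⁻¹ * t * x) * x⁻¹ := by group
    rw [e]
    exact hv.conj x
  exact ⟨hKS, mem_of_conj_mem ht h1 (parabolic_mono hKS h2)⟩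

end

section Half

variable {V : Type*} {Γ : DefiningGraph V}
variable {a b g : ArtinGroup Γ} {L : Set V} {u x y : V} {i : ℤ}

theorem gen_induction {P : ArtinGroup Γ → Prop} (one : P 1) (mul : ∀ h v, P h → P (h * gen Γ v))
    (mul_inv : ∀ h v, P h → P (h * (gen Γ v)⁻¹)) (g : ArtinGroup Γ) : P g := by
  have hg : g ∈ parabolic Γ Set.univ := by rw [parabolic_univ]; exact Subgroup.mem_top g
  induction hg using Subgroup.closure_induction_right with
  | one => exact one
  | mul_right x hx y hy h => obtain ⟨v, -, rfl⟩ := hy; exact mul _ _ h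
  | mul_inv_cancel x hx y hy h => obtain ⟨v, -, rfl⟩ := hy; exact mul_inv _ _ h

/-- The half-space of `A_Γ` beyond the base wall of the splitting at `u`. -/
def Half (Γ : DefiningGraph V) (u : V) (g : ArtinGroup Γ) : Prop := Starts (pA Γ u) (pS Γ u) g

theorem half_one (u : V) : ¬ Half Γ u 1 := (am Γ u).not_starts_one

theorem not_half_of_mem (h : g ∈ pA Γ u) : ¬ Half Γ u g := (am Γ u).not_starts_of_memA h

theorem half_mul_iff (ha : a ∈ pA Γ u) :
    Half Γ u (g * a) ↔ Half Γ u g := (am Γ u).starts_mul_right_iff ha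

theorem half_mul_iff' (hb : b ∈ pS Γ u) (hg : g ∉ pL Γ u)
    (hgb : g * b ∉ pL Γ u) : Half Γ u (g * b) ↔ Half Γ u g := by
  rw [mem_pL_iff] at hg hgb
  refine ⟨starts_mul_right_iff' hb hg, fun h => ?_⟩
  refine starts_mul_right_iff' (inv_mem hb) hgb ?_
  rwa [mul_inv_cancel_right]

theorem half_disjoint (hne : x ≠ y) (hxy : ¬ Γ.graph.Adj x y) (g : ArtinGroup Γ) :
    ¬ (Half Γ x g ∧ Half Γ y g) := by
  have hyx : ¬ Γ.graph.Adj y x := fun h => hxy h.symm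
  have hSx : pS Γ x ≤ pA Γ y := parabolic_mono (by
    rintro v (rfl | hv)
    · exact hne
    · rintro rfl; exact hxy hv)
  have hSy : pS Γ y ≤ pA Γ x := parabolic_mono (by
    rintro v (rfl | hv)
    · exact hne.symm
    · rintro rfl; exact hyx hv)
  have step : ∀ (h b : ArtinGroup Γ) v, (b = gen Γ v ∨ b = (gen Γ v)⁻¹) →
      ¬ (Half Γ x h ∧ Half Γ y h) → ¬ (Half Γ x (h * b) ∧ Half Γ y (h * b)) := by
    rintro h b v hb ih ⟨h1, h2⟩
    have hbm : ∀ S : Set V, v ∈ S → b ∈ parabolic Γ S := by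
      intro S hS
      rcases hb with rfl | rfl
      · exact gen_mem hS
      · exact inv_mem (gen_mem hS)
    have hx : Half Γ x h := by
      by_cases hv : v = x
      · subst hv
        have hbS := hbm (st Γ v) (mem_st_self v)
        by_cases hL : h ∈ pL Γ v
        · exact (not_half_of_mem (hSx (mul_mem (parabolic_mono (lk_sub_st _) hL) hbS)) h2).elim
        by_cases hL' : h * b ∈ pL Γ v
        · exact (not_half_of_mem (parabolic_mono (lk_sub_compl _) hL') h1).elim
        exact (half_mul_iff' hbS hL hL').1 h1
      · exact (half_mul_iff (hbm _ hv)).1 h1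
    have hy : Half Γ y h := by
      by_cases hv : v = y
      · subst hv
        have hbS := hbm (st Γ v) (mem_st_self v)
        by_cases hL : h ∈ pL Γ v
        · exact (not_half_of_mem (hSy (mul_mem (parabolic_mono (lk_sub_st _) hL) hbS)) h1).elim
        by_cases hL' : h * b ∈ pL Γ v
        · exact (not_half_of_mem (parabolic_mono (lk_sub_compl _) hL') h2).elim
        exact (half_mul_iff' hbS hL hL').1 h2
      · exact (half_mul_iff (hbm _ hv)).1 h2
    exact ih ⟨hx, hy⟩
  refine gen_induction (fun h => half_one x h.1) (fun h v => step h _ v (Or.inl rfl))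
    (fun h v => step h _ v (Or.inr rfl)) g

theorem half_zpow_mul (hi : i ≠ 0) (hg : ¬ Half Γ u g) : Half Γ u (gen Γ u ^ i * g) :=
  Starts.cons_iff (am Γ u) (gen_zpow_mem (mem_st_self u) i) (zpow_not_mem (fun h : u ∈ ({u}ᶜ : Set V) => h (Set.mem_singleton u)) hi) hg

/-- A reduced word in independent generators lies in the half-space of its first letter. -/
theorem indep_reduced_half (hL : Indep Γ L) (p : V × ℤ) (l : List (V × ℤ))
    (hl : ∀ q ∈ p :: l, q.1 ∈ L ∧ q.2 ≠ 0) (hc : (p :: l).IsChain (fun p q => p.1 ≠ q.1)) :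
    Half Γ p.1 (((p :: l).map fun p => gen Γ p.1 ^ p.2).prod) := by
  induction l generalizing p with
  | nil =>
    have := half_zpow_mul (Γ := Γ) (hl p (by simp)).2 (half_one p.1)
    simpa using this
  | cons q l ih =>
    have h := ih q (fun r hr => hl r (List.mem_cons_of_mem _ hr)) hc.tail
    rw [List.map_cons, List.prod_cons]
    refine half_zpow_mul (hl p (by simp)).2 fun hp => ?_
    have hne : p.1 ≠ q.1 := by
      have := List.isChain_cons_cons.1 hc
      exact this.1
    exact half_disjoint hne (hL _ (hl p (by simp)).1 _ (hl q (by simp)).1) _ ⟨hp, h⟩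

end Half

section Induced

variable {V : Type u} {W : Type u} {Γ : DefiningGraph V} {Δ : DefiningGraph W}

/-- The homomorphism of Artin groups induced by a label-preserving map of graphs. -/
def mapHom (φ : V → W) (h : ∀ a b, Γ.graph.Adj a b →
    Δ.graph.Adj (φ a) (φ b) ∧ Δ.label (φ a) (φ b) = Γ.label a b) :
    ArtinGroup Γ →* ArtinGroup Δ :=
  liftHom (fun v => gen Δ (φ v)) (fun a b hab => by
    rw [← (h a b hab).2]; exact gen_rel (h a b hab).1)

@[simp] theorem mapHom_gen (φ : V → W) (h) (v : V) :
    mapHom (Γ := Γ) (Δ := Δ) φ h (gen Γ v) = gen Δ (φ v) := liftHom_gen _ _ v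

theorem mapHom_injective_of_indep (φ : V → W) (h) (hφ : Function.Injective φ)
    (hL : Indep Δ (Set.range φ)) : Function.Injective (mapHom (Γ := Γ) (Δ := Δ) φ h) := by
  rw [injective_iff_map_eq_one]
  intro g hg
  obtain ⟨l, hl, hc, rfl⟩ := exists_reduced (Γ := Γ) (L := Set.univ) (g := g)
    (by rw [parabolic_univ]; exact Subgroup.mem_top g)
  rcases l with _ | ⟨p, l⟩
  · rfl
  exfalso
  have key := indep_reduced_half hL (φ p.1, p.2) (l.map fun q => (φ q.1, q.2)) (by
      grind) (by
      have := List.isChain_map_of_isChain (S := fun p q : W × ℤ => p.1 ≠ q.1)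
        (fun q : V × ℤ => (φ q.1, q.2)) (fun a b hab => hφ.ne hab) hc
      simpa using this)
  have e : ((((φ p.1, p.2) :: l.map fun q => (φ q.1, q.2)) : List (W × ℤ)).map
      fun p => gen Δ p.1 ^ p.2).prod = 1 := by
    rw [← hg, map_list_prod]
    simp only [List.map_cons, List.map_map, Function.comp_def, map_zpow, mapHom_gen]
  rw [e] at key
  exact half_one (Γ := Δ) (φ p.1) key

/-- The homomorphism between induced subgraphs. -/
def incl (Γ : DefiningGraph V) {P Q : Set V} (h : P ⊆ Q) :
    ArtinGroup (Γ.induce P) →* ArtinGroup (Γ.induce Q) :=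
  mapHom (fun v => ⟨v.1, h v.2⟩) (fun _ _ hab => ⟨hab, rfl⟩)

/-- The homomorphism from an induced subgraph. -/
def emb (Γ : DefiningGraph V) (P : Set V) : ArtinGroup (Γ.induce P) →* ArtinGroup Γ :=
  mapHom (fun v => v.1) (fun _ _ hab => ⟨hab, rfl⟩)

@[simp] theorem emb_gen (P : Set V) (v : P) : emb Γ P (gen (Γ.induce P) v) = gen Γ v.1 :=
  mapHom_gen _ _ v

@[simp] theorem incl_gen {P Q : Set V} (h : P ⊆ Q) (v : P) :
    incl Γ h (gen (Γ.induce P) v) = gen (Γ.induce Q) ⟨v.1, h v.2⟩ :=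
  mapHom_gen _ _ v

theorem range_emb (P : Set V) : (emb Γ P).range = parabolic Γ P := by
  rw [MonoidHom.range_eq_map, ← parabolic_univ, parabolic, MonoidHom.map_closure, parabolic]
  congr 1
  ext g
  constructor
  · rintro ⟨_, ⟨v, -, rfl⟩, rfl⟩
    exact ⟨v.1, v.2, (emb_gen P v).symm⟩
  · rintro ⟨v, hv, rfl⟩
    exact ⟨_, ⟨⟨v, hv⟩, trivial, rfl⟩, emb_gen P ⟨v, hv⟩⟩

open Monoid in
open Classical in
theorem emb_compl_injective [Finite V] [TF Γ] (u : V) : Function.Injective (emb Γ {u}ᶜ) := by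
  let S : Bool → Set V := fun i => bif i then st Γ u else {u}ᶜ
  have hS : ∀ i, lk Γ u ⊆ S i := by
    rintro (_ | _)
    · exact lk_sub_compl u
    · exact lk_sub_st u
  let φ : ∀ i, ArtinGroup (Γ.induce (lk Γ u)) →* ArtinGroup (Γ.induce (S i)) :=
    fun i => incl Γ (hS i)
  have hφ : ∀ i, Function.Injective (φ i) := by
    intro i
    refine mapHom_injective_of_indep _ _ (fun a b hab => Subtype.ext (Subtype.mk.inj hab)) ?_
    rintro _ ⟨a, rfl⟩ _ ⟨b, rfl⟩ hab
    exact TF.indep_lk u a.1 a.2 b.1 b.2 hab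
  have hst : ∀ v, v ∉ S false → v ∈ S true := by
    intro v hv
    have : v = u := by_contra fun h => hv h
    rw [this]; exact mem_st_self u
  let f : V → PushoutI φ := fun v =>
    if h : v ∈ S false then PushoutI.of (φ := φ) false (gen (Γ.induce (S false)) ⟨v, h⟩) else
      PushoutI.of (φ := φ) true (gen (Γ.induce (S true)) ⟨v, hst v h⟩)
  have f0 : ∀ v (h : v ∈ S false),
      f v = PushoutI.of (φ := φ) false (gen (Γ.induce (S false)) ⟨v, h⟩) :=
    fun v h => by simp only [f, dif_pos h]
  have f1 : ∀ v (h : v ∈ S true),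
      f v = PushoutI.of (φ := φ) true (gen (Γ.induce (S true)) ⟨v, h⟩) := by
    intro v h
    by_cases h' : v ∈ S false
    · have hv : v ∈ lk Γ u := by
        rcases h with h | h
        · exact (h' h).elim
        · exact h
      rw [f0 v h']
      have e1 := PushoutI.of_apply_eq_base φ false (gen (Γ.induce (lk Γ u)) ⟨v, hv⟩)
      have e2 := PushoutI.of_apply_eq_base φ true (gen (Γ.induce (lk Γ u)) ⟨v, hv⟩)
      simp only [φ, incl_gen] at e1 e2
      exact e1.trans e2.symm
    · simp only [f, dif_neg h']
  have key : ∀ i a b, ∀ (ha : a ∈ S i) (hb : b ∈ S i), (∀ v (h : v ∈ S i),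
      f v = PushoutI.of (φ := φ) i (gen (Γ.induce (S i)) ⟨v, h⟩)) → Γ.graph.Adj a b →
      altProd (f a) (f b) (Γ.label a b) = altProd (f b) (f a) (Γ.label a b) := by
    intro i a b ha hb hf hab
    rw [hf a ha, hf b hb, ← map_altProd, ← map_altProd]
    congr 1
    exact gen_rel (Γ := Γ.induce (S i)) (a := ⟨a, ha⟩) (b := ⟨b, hb⟩) hab
  let F : ArtinGroup Γ →* PushoutI φ := liftHom f (by
    intro a b hab
    by_cases ha : a = u
    · subst ha
      exact key true a b (mem_st_self a) (Or.inr hab) f1 hab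
    by_cases hb : b = u
    · subst hb
      exact key true a b (Or.inr hab.symm) (mem_st_self b) f1 hab
    exact key false a b ha hb f0 hab)
  have hF : F.comp (emb Γ (S false)) = PushoutI.of (φ := φ) false := by
    refine hom_ext fun v => ?_
    rw [MonoidHom.comp_apply, emb_gen]
    exact (liftHom_gen _ _ v.1).trans (f0 v.1 v.2)
  have hinj : Function.Injective (F.comp (emb Γ (S false))) := by
    rw [hF]; exact PushoutI.of_injective hφ false
  exact Function.Injective.of_comp (f := F) (by rw [MonoidHom.coe_comp] at hinj; exact hinj)

instance TF.induce [TF Γ] (P : Set V) : TF (Γ.induce P) :=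
  ⟨fun a b c h1 h2 h3 => TF.out a.1 b.1 c.1 h1 h2 h3⟩

instance [Large Γ] (P : Set V) : Large (Γ.induce P) := ⟨fun a b h => Large.out a.1 b.1 h⟩

theorem emb_injective_aux (n : ℕ) : ∀ (V : Type u) [Finite V] (Γ : DefiningGraph V) [TF Γ]
    (P : Set V), Nat.card V = n → Function.Injective (emb Γ P) := by
  induction n with
  | zero =>
    intro V _ Γ _ P hn x y hxy
    have hV : IsEmpty V := by
      rcases Nat.card_eq_zero.1 hn with h | h
      · exact h
      · exact (h.not_finite ‹_›).elim
    have : ∀ z : ArtinGroup (Γ.induce P), z = 1 := fun z =>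
      gen_induction (P := fun z => z = 1) rfl (fun _ v => (hV.false v.1).elim)
        (fun _ v => (hV.false v.1).elim) z
    rw [this x, this y]
  | succ n ih =>
    intro V _ Γ _ P hn
    by_cases hP : ∀ u, u ∈ P
    · let r : ArtinGroup Γ →* ArtinGroup (Γ.induce P) :=
        mapHom (fun v => ⟨v, hP v⟩) (fun _ _ h => ⟨h, rfl⟩)
      have : r.comp (emb Γ P) = MonoidHom.id _ := hom_ext fun v => by
        rw [MonoidHom.comp_apply, emb_gen]; exact mapHom_gen _ _ _
      refine Function.LeftInverse.injective (g := r) fun x => ?_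
      rw [← MonoidHom.comp_apply, this]; rfl
    · push Not at hP
      obtain ⟨u, hu⟩ := hP
      let Γ' := Γ.induce {u}ᶜ
      let P' : Set ({u}ᶜ : Set V) := {v | v.1 ∈ P}
      have hne : ∀ v : P, v.1 ∈ ({u}ᶜ : Set V) := fun v h => hu (by rw [← h]; exact v.2)
      let j : ArtinGroup (Γ.induce P) →* ArtinGroup (Γ'.induce P') :=
        mapHom (fun v => ⟨⟨v.1, hne v⟩, v.2⟩) (fun _ _ h => ⟨h, rfl⟩)
      let j' : ArtinGroup (Γ'.induce P') →* ArtinGroup (Γ.induce P) :=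
        mapHom (fun v => ⟨v.1.1, v.2⟩) (fun _ _ h => ⟨h, rfl⟩)
      have hj : j'.comp j = MonoidHom.id _ := hom_ext fun v => by
        rw [MonoidHom.comp_apply]
        change j' (mapHom _ _ (gen _ v)) = _
        rw [mapHom_gen]; exact mapHom_gen _ _ _
      have hjinj : Function.Injective j := Function.LeftInverse.injective (g := j') fun x => by
        rw [← MonoidHom.comp_apply, hj]; rfl
      have hcard : Nat.card ({u}ᶜ : Set V) = n := by
        have h1 := Set.ncard_add_ncard_compl ({u} : Set V)
        rw [Set.ncard_singleton, hn] at h1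
        have : Nat.card ({u}ᶜ : Set V) = ({u}ᶜ : Set V).ncard := rfl
        omega
      have h1 := ih _ Γ' P' hcard
      have h2 := emb_compl_injective (Γ := Γ) u
      have he : emb Γ P = ((emb Γ {u}ᶜ).comp (emb Γ' P')).comp j := hom_ext fun v => by
        rw [emb_gen, MonoidHom.comp_apply, MonoidHom.comp_apply]
        change _ = emb Γ {u}ᶜ (emb Γ' P' (mapHom _ _ (gen _ v)))
        rw [mapHom_gen, emb_gen, emb_gen]
      simp_all

/-- Standard parabolic subgroups of triangle-free Artin groups are Artin groups. -/
theorem emb_injective [Finite V] [TF Γ] (P : Set V) : Function.Injective (emb Γ P) :=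
  emb_injective_aux _ V Γ P rfl

/-- The Artin group of an induced subgraph, as a parabolic subgroup. -/
noncomputable def embEquiv [Finite V] [TF Γ] (P : Set V) :
    ArtinGroup (Γ.induce P) ≃* parabolic Γ P :=
  (MonoidHom.ofInjective (emb_injective P)).trans (MulEquiv.subgroupCongr (range_emb P))

end Induced

theorem pow_mul_swap {M : Type*} [Monoid M] (x y : M) (k : ℕ) :
    (y * x) ^ k * y = y * (x * y) ^ k := by
  have h : SemiconjBy y (x * y) (y * x) := by
    change y * (x * y) = y * x * y
    rw [mul_assoc]
  exact (h.pow_right k).eq.symm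

/-- A group with two generators satisfying exactly one braid relation of length `m`. -/
structure Dih {D : Type u} [Group D] (a b : D) (m : ℕ) (ℓ : D →* Multiplicative ℤ) : Prop where
  three_le : 3 ≤ m
  rel : altProd a b m = altProd b a m
  closure_eq : Subgroup.closure {a, b} = ⊤
  len_a : ℓ a = Multiplicative.ofAdd 1
  len_b : ℓ b = Multiplicative.ofAdd 1
  lift : ∀ (H : Type u) [Group H] (x y : H), altProd x y m = altProd y x m →
    ∃ f : D →* H, f a = x ∧ f b = y
  sep_a : ∀ i : ℤ, Commute (a ^ i) b → i = 0

section

variable {D : Type u} [Group D] (a b : D) (m : ℕ)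

/-- The exponent of `ab` that is central. -/
def dN (m : ℕ) : ℕ := if Even m then m / 2 else m

/-- The central element. -/
def dz : D := (a * b) ^ dN m

/-- The noncentral generator of the second factor. -/
def dc : D := if Even m then a else altProd a b m

/-- The first factor of the splitting of a dihedral Artin group. -/
abbrev dT : Subgroup D := Subgroup.zpowers (a * b)

/-- The second factor of the splitting of a dihedral Artin group. -/
abbrev dV : Subgroup D := Subgroup.closure {dc a b m, dz a b m}

end

section Abstract

variable {D : Type u} [Group D] {a b : D} {m : ℕ} {ℓ : D →* Multiplicative ℤ}
variable {g x y : D} {k : ℕ}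

theorem dN_even : dN (2 * k) = k := by simp [dN]

theorem dN_odd : dN (2 * k + 1) = 2 * k + 1 := by simp [dN]

theorem dc_even : dc a b (2 * k) = a := by simp [dc]

theorem dc_odd : dc a b (2 * k + 1) = (a * b) ^ k * a := by simp [dc, altProd_odd]

variable (h : Dih a b m ℓ)
include h

theorem Dih.dN_pos : 2 ≤ dN m := by
  have := h.three_le
  unfold dN
  grind

theorem Dih.induct {H : Subgroup D} (ha : a ∈ H) (hb : b ∈ H) (g : D) : g ∈ H := by
  have : Subgroup.closure {a, b} ≤ H := by
    rw [Subgroup.closure_le]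
    rintro x (rfl | rfl)
    · exact ha
    · exact hb
  exact this (by rw [h.closure_eq]; exact Subgroup.mem_top g)

theorem Dih.rel_even (hm : m = 2 * k) : (a * b) ^ k = (b * a) ^ k := by
  have := h.rel
  rwa [hm, altProd_even, altProd_even] at this

theorem Dih.rel_odd (hm : m = 2 * k + 1) : (a * b) ^ k * a = (b * a) ^ k * b := by
  have := h.rel
  rwa [hm, altProd_odd, altProd_odd] at this

theorem Dih.dc_sq (hm : m = 2 * k + 1) : dc a b m ^ 2 = dz a b m := by
  have h1 := h.rel_odd hm
  subst hm
  rw [dz, dc_odd, dN_odd, sq]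
  nth_rewrite 2 [h1]
  rw [mul_assoc, ← mul_assoc a, ← pow_mul_swap, ← mul_assoc, ← mul_assoc, mul_assoc ((a*b)^k * (a*b)^k)]
  rw [← pow_add, ← pow_succ]
  congr 1
  ring

theorem Dih.central (g : D) : Commute (dz a b m) g := by
  have key : Commute (dz a b m) a ∧ Commute (dz a b m) b := by
    rcases Nat.even_or_odd' m with ⟨k, hm | hm⟩
    · have h1 := h.rel_even hm
      subst hm
      rw [dz, dN_even]
      constructor
      · change _ * _ = _ * _
        rw [pow_mul_swap b a, h1]
      · change _ * _ = _ * _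
        rw [← pow_mul_swap, h1]
    · have h1 := h.rel_odd hm
      have h2 := h.dc_sq hm
      rw [← h2]
      subst hm
      rw [dc_odd]
      have e1 : a * ((a * b) ^ k * a) = (a * b) ^ k * a * b := by
        rw [h1, ← mul_assoc, ← pow_mul_swap, h1]
      have e2 : b * ((a * b) ^ k * a) = (a * b) ^ k * a * a := by
        rw [← mul_assoc, ← pow_mul_swap, ← h1]
      generalize (a * b) ^ k * a = Δ at e1 e2 ⊢
      constructor
      · change _ * _ = _ * _
        rw [sq, ← mul_assoc a, e1, mul_assoc Δ b, e2, mul_assoc]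
      · change _ * _ = _ * _
        rw [sq, ← mul_assoc b, e2, mul_assoc Δ a, e1, mul_assoc]
  have := h.induct (H := Subgroup.centralizer {dz a b m})
    (Subgroup.mem_centralizer_singleton_iff.2 key.1.symm.eq)
    (Subgroup.mem_centralizer_singleton_iff.2 key.2.symm.eq) g
  exact (Subgroup.mem_centralizer_singleton_iff.1 this).symm

theorem Dih.dz_swap : dz b a m = dz a b m := by
  have h1 := h.central a
  have h2 : a * dz b a m = dz a b m * a := (pow_mul_swap b a _).symm
  rw [h1.eq] at h2
  exact mul_left_cancel h2

theorem Dih.mem_dV : g ∈ dV a b m ↔ ∃ q r : ℤ, g = dc a b m ^ q * dz a b m ^ r := by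
  constructor
  · intro hg
    have hc : ∀ (q r : ℤ), Commute (dc a b m ^ q) (dz a b m ^ r) := fun q r =>
      ((h.central (dc a b m)).symm.zpow_zpow q r)
    induction hg using Subgroup.closure_induction with
    | mem x hx =>
      rcases hx with rfl | rfl
      · exact ⟨1, 0, by simp⟩
      · exact ⟨0, 1, by simp⟩
    | one => exact ⟨0, 0, by simp⟩
    | mul x y _ _ h1 h2 =>
      obtain ⟨q, r, rfl⟩ := h1
      obtain ⟨q', r', rfl⟩ := h2
      refine ⟨q + q', r + r', ?_⟩
      rw [zpow_add, zpow_add, mul_assoc, ← mul_assoc (dz a b m ^ r), (hc q' r).symm.eq]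
      simp only [mul_assoc]
    | inv x _ h1 =>
      obtain ⟨q, r, rfl⟩ := h1
      refine ⟨-q, -r, ?_⟩
      rw [mul_inv_rev, zpow_neg, zpow_neg, ← zpow_neg, ← zpow_neg, (hc (-q) (-r)).eq]
  · rintro ⟨q, r, rfl⟩
    exact mul_mem (zpow_mem (Subgroup.subset_closure (by simp)) _)
      (zpow_mem (Subgroup.subset_closure (by simp)) _)

theorem Dih.dT_comm (hx : x ∈ dT a b) (hy : y ∈ dT a b) : Commute x y := by
  obtain ⟨i, rfl⟩ := hx
  obtain ⟨j, rfl⟩ := hy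
  exact (Commute.refl _).zpow_zpow i j

theorem Dih.dV_comm (hx : x ∈ dV a b m) (hy : y ∈ dV a b m) : Commute x y := by
  obtain ⟨q, r, rfl⟩ := h.mem_dV.1 hx
  obtain ⟨q', r', rfl⟩ := h.mem_dV.1 hy
  have h1 := fun g => (h.central g).zpow_left r
  have h2 := fun g => (h.central g).zpow_left r'
  exact (Commute.mul_right ((Commute.refl _).zpow_zpow q q') (h2 _).symm).mul_left (h1 _)

theorem Dih.exists_hom {H : Type u} [Group H] {τ δ ζ : H} (hτζ : τ ^ dN m = ζ) (hδζ : Commute ζ δ)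
    (hodd : Odd m → δ ^ 2 = ζ) : ∃ F : D →* H, F (a * b) = τ ∧ F (dc a b m) = δ := by
  rcases Nat.even_or_odd' m with ⟨k, hm | hm⟩
  · have hk : τ ^ k = ζ := by rw [← hτζ, hm, dN_even]
    obtain ⟨F, h1, h2⟩ := h.lift _ δ (δ⁻¹ * τ) (by
      rw [hm, altProd_even, altProd_even, mul_inv_cancel_left, hk]
      have := pow_mul_swap δ (δ⁻¹ * τ) k
      rw [mul_inv_cancel_left, hk] at this
      rw [← mul_left_inj (δ⁻¹ * τ), this]
      refine (Commute.mul_right hδζ.inv_right ?_).eq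
      rw [← hk]; exact (Commute.refl τ).pow_left k)
    refine ⟨F, ?_, ?_⟩
    · rw [map_mul, h1, h2, mul_inv_cancel_left]
    · rw [hm, dc_even, h1]
  · have hk : τ ^ (2 * k + 1) = δ ^ 2 := by
      have : τ ^ (2 * k + 1) = ζ := by rw [← hτζ, hm, dN_odd]
      rw [this, hodd ⟨k, hm⟩]
    have hXY : (τ ^ k)⁻¹ * δ * (δ⁻¹ * τ ^ (k + 1)) = τ := by
      rw [mul_assoc, mul_inv_cancel_left, pow_succ, inv_mul_cancel_left]
    have hΔ : ((τ ^ k)⁻¹ * δ * (δ⁻¹ * τ ^ (k + 1))) ^ k * ((τ ^ k)⁻¹ * δ) = δ := by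
      rw [hXY, mul_inv_cancel_left]
    obtain ⟨F, h1, h2⟩ := h.lift _ ((τ ^ k)⁻¹ * δ) (δ⁻¹ * τ ^ (k + 1)) (by
      rw [hm, altProd_odd, altProd_odd, hΔ, pow_mul_swap, hXY, mul_assoc, ← pow_add,
        show k + 1 + k = 2 * k + 1 by ring, hk, sq, inv_mul_cancel_left])
    refine ⟨F, ?_, ?_⟩
    · rw [map_mul, h1, h2, hXY]
    · rw [hm, dc_odd, map_mul, map_pow, map_mul, h1, h2, hΔ]

open Monoid in
theorem Dih.amalg : Amalg (dT a b) (dV a b m) ∧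
    dT a b ⊓ dV a b m = Subgroup.zpowers (dz a b m) := by
  have hA : Subgroup.zpowers (dz a b m) ≤ dT a b := by
    rw [Subgroup.zpowers_le]
    exact pow_mem (Subgroup.mem_zpowers _) _
  have hB : Subgroup.zpowers (dz a b m) ≤ dV a b m := by
    rw [Subgroup.zpowers_le]
    exact Subgroup.subset_closure (by simp)
  let ofA : dT a b →* PushoutI (inclusions hA hB) := PushoutI.of (φ := inclusions hA hB) false
  let ofB : dV a b m →* PushoutI (inclusions hA hB) := PushoutI.of (φ := inclusions hA hB) true
  obtain ⟨τ, hτ⟩ : ∃ τ, τ = ofA ⟨a * b, Subgroup.mem_zpowers _⟩ := ⟨_, rfl⟩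
  have hdcV : dc a b m ∈ dV a b m := Subgroup.subset_closure (by simp)
  have hdzV : dz a b m ∈ dV a b m := Subgroup.subset_closure (by simp)
  obtain ⟨δ, hδ⟩ : ∃ δ, δ = ofB ⟨dc a b m, hdcV⟩ := ⟨_, rfl⟩
  obtain ⟨ζ, hζ⟩ : ∃ ζ, ζ = ofB ⟨dz a b m, hdzV⟩ := ⟨_, rfl⟩
  have hτζ : τ ^ dN m = ζ := by
    have e1 := PushoutI.of_apply_eq_base (inclusions hA hB) false ⟨dz a b m, Subgroup.mem_zpowers _⟩
    have e2 := PushoutI.of_apply_eq_base (inclusions hA hB) true ⟨dz a b m, Subgroup.mem_zpowers _⟩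
    rw [hτ, hζ, ← map_pow]
    exact e1.trans e2.symm
  have hδζ : Commute ζ δ := by
    change _ * _ = _ * _
    rw [hδ, hζ, ← map_mul, ← map_mul]
    congr 1
    exact Subtype.ext (h.central _).eq
  have hF := h.exists_hom hτζ hδζ (fun ho => by
    obtain ⟨k, hm⟩ := ho
    rw [hζ, hδ, ← map_pow]
    congr 1
    exact Subtype.ext (h.dc_sq hm))
  obtain ⟨F, h1, h2⟩ := hF
  refine amalg_of_hom hA hB ?_ F ?_ ?_
  · rw [eq_top_iff]
    intro g _
    have ht : a * b ∈ dT a b ⊔ dV a b m := Subgroup.mem_sup_left (Subgroup.mem_zpowers _)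
    have hd : dc a b m ∈ dT a b ⊔ dV a b m := Subgroup.mem_sup_right hdcV
    have ha : a ∈ dT a b ⊔ dV a b m := by
      rcases Nat.even_or_odd' m with ⟨k, hm | hm⟩
      · rwa [hm, dc_even, ← hm] at hd
      · have := mul_mem (inv_mem (pow_mem ht k)) hd
        rwa [hm, dc_odd, inv_mul_cancel_left, ← hm] at this
    refine h.induct ha ?_ g
    have := mul_mem (inv_mem ha) ht
    rwa [inv_mul_cancel_left] at this
  · rintro _ ⟨i, rfl⟩
    change F ((a * b) ^ i) = ofA ⟨(a * b) ^ i, _⟩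
    rw [map_zpow, h1, hτ, ← map_zpow]
    rfl
  · intro g hg
    change F g = ofB ⟨g, hg⟩
    induction hg using Subgroup.closure_induction with
    | mem x hx =>
      rcases hx with rfl | rfl
      · rw [h2, hδ]
      · change F ((a * b) ^ dN m) = _
        rw [map_pow, h1, hτζ, hζ]
    | one => rw [map_one]; exact (map_one ofB).symm
    | mul x y hx hy h1 h2 => rw [map_mul, h1, h2, ← map_mul]; rfl
    | inv x hx h1 => rw [map_inv, h1, ← map_inv]; rfl

end Abstract

section Trees

variable {G : Type*} [Group G] {A B : Subgroup G} {k u : G}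

theorem bs_fix_adj {v w : BSVert A B} (h : (bsTree A B).Adj v w) (hv : k • v = v)
    (hw : k • w = w) : ∃ x, x⁻¹ * k * x ∈ A ∧ x⁻¹ * k * x ∈ B := by
  obtain ⟨g, ⟨rfl, rfl⟩ | ⟨rfl, rfl⟩⟩ := h
  · exact ⟨g, smul_vA_eq_iff.1 hv, smul_vB_eq_iff.1 hw⟩
  · exact ⟨g, smul_vA_eq_iff.1 hw, smul_vB_eq_iff.1 hv⟩

theorem push_away {T : Type*} [MulAction G T] {X : SimpleGraph T} {τ : T → Bool} {p p' x : T}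
    (h : TreeAction G X τ) (hp : u • p = p) (ha : X.Adj p p')
    (hne : u • p' ≠ p') (hx : X.dist p' x < X.dist p x) : X.dist p (u • x) < X.dist p' (u • x) := by
  by_contra hc
  have h1 := dist_step h.tree ha (u • x)
  have h2 : X.dist p' (u • x) < X.dist p (u • x) := by omega
  have h3 : X.dist (u • p') (u • x) < X.dist p (u • x) := by
    rw [h.dist_smul]
    calc X.dist p' x < X.dist p x := hx
      _ = X.dist (u • p) (u • x) := (h.dist_smul _ _ _).symm
      _ = _ := by rw [hp]
  have h4 : X.Adj p (u • p') := by
    have := h.smul_adj u _ _ ha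
    rwa [hp] at this
  exact hne (eq_of_adj_of_dist_lt h.tree h4 ha h3 h2)

end Trees

section Abstract

variable {D : Type u} [Group D] {a b : D} {m : ℕ} {ℓ : D →* Multiplicative ℤ}
variable {x y z : D} {i n r : ℤ} {k : ℕ}

/-- The integer length. -/
def dlen (ℓ : D →* Multiplicative ℤ) (g : D) : ℤ := (ℓ g).toAdd

@[simp] theorem dlen_mul (x y : D) : dlen ℓ (x * y) = dlen ℓ x + dlen ℓ y := by simp [dlen]
@[simp] theorem dlen_inv (x : D) : dlen ℓ x⁻¹ = - dlen ℓ x := by simp [dlen]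
@[simp] theorem dlen_one : dlen ℓ (1 : D) = 0 := by simp [dlen]
@[simp] theorem dlen_pow (x : D) (n : ℕ) : dlen ℓ (x ^ n) = n * dlen ℓ x := by simp [dlen]
@[simp] theorem dlen_zpow (x : D) (n : ℤ) : dlen ℓ (x ^ n) = n * dlen ℓ x := by simp [dlen]

theorem dlen_conj (x g : D) : dlen ℓ (g⁻¹ * x * g) = dlen ℓ x := by simp

variable (h : Dih a b m ℓ)
include h

theorem Dih.dlen_a : dlen ℓ a = 1 := by simp [dlen, h.len_a]

theorem Dih.dlen_b : dlen ℓ b = 1 := by simp [dlen, h.len_b]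

theorem Dih.dlen_dz : dlen ℓ (dz a b m) = 2 * dN m := by
  rw [dz, dlen_pow, dlen_mul, h.dlen_a, h.dlen_b]; ring

theorem Dih.dlen_dc_odd (hm : m = 2 * k + 1) : dlen ℓ (dc a b m) = m := by
  subst hm
  rw [dc_odd, dlen_mul, dlen_pow, dlen_mul, h.dlen_a, h.dlen_b]; push_cast; ring

theorem Dih.dz_zpow_eq_one (hr : dlen ℓ (dz a b m ^ r) = 0) : r = 0 := by
  rw [dlen_zpow, h.dlen_dz] at hr
  have := h.dN_pos
  rcases mul_eq_zero.1 hr with h1 | h1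
  · exact h1
  · omega

theorem Dih.not_commute : a * b ≠ b * a := fun hc => by
  have := h.sep_a 1 (by rw [zpow_one]; exact hc)
  omega

theorem Dih.fix_two {k : D} {v w : BSVert (dT a b) (dV a b m)} (hne : v ≠ w)
    (hv : k • v = v) (hw : k • w = w) : ∃ r : ℤ, k = dz a b m ^ r := by
  have ta := h.amalg.1.treeAction
  have hn : k • nxt (bsTree _ _) v w = nxt (bsTree _ _) v w := by
    rw [ta.smul_nxt k hne, hv, hw]
  obtain ⟨x, h1, h2⟩ := bs_fix_adj (nxt_adj ta.tree hne) hv hn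
  have h3 : x⁻¹ * k * x ∈ Subgroup.zpowers (dz a b m) := by
    rw [← h.amalg.2]; exact ⟨h1, h2⟩
  obtain ⟨r, hr⟩ := h3
  refine ⟨r, ?_⟩
  have : k = x * dz a b m ^ r * x⁻¹ := by
    change dz a b m ^ r = _ at hr
    rw [hr]; group
  rw [this, ((h.central x).zpow_left r).symm.eq, mul_inv_cancel_right]

theorem Dih.stab_comm {v : BSVert (dT a b) (dV a b m)}
    (hx : x • v = v) (hy : y • v = v) : x * y = y * x := by
  have key : ∀ g : D, Commute (g⁻¹ * x * g) (g⁻¹ * y * g) → x * y = y * x := by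
    intro g hc
    have h1 := hc.eq
    have h2 : g⁻¹ * (x * y) * g = g⁻¹ * (y * x) * g := by
      calc _ = g⁻¹ * x * g * (g⁻¹ * y * g) := by group
        _ = _ := h1
        _ = _ := by group
    exact mul_left_cancel (mul_right_cancel h2)
  rcases bs_cases v with ⟨g, rfl⟩ | ⟨g, rfl⟩
  · exact key g (h.dT_comm (smul_vA_eq_iff.1 hx) (smul_vA_eq_iff.1 hy))
  · exact key g (h.dV_comm (smul_vB_eq_iff.1 hx) (smul_vB_eq_iff.1 hy))

/-- An element commuting with two noncommuting elements is central. -/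
theorem Dih.mem_center (hx : Commute x z) (hy : Commute y z)
    (hxy : x * y ≠ y * x) : ∃ r : ℤ, z = dz a b m ^ r := by
  have ta := h.amalg.1.treeAction
  by_cases hz : Hyp (BSVert (dT a b) (dV a b m)) z
  · obtain ⟨p, hp⟩ := ta.comm_elliptic hz hx hy
    have hk : Commute (x * y * x⁻¹ * y⁻¹) z :=
      ((hx.mul_left hy).mul_left hx.inv_left).mul_left hy.inv_left
    obtain ⟨i, hi⟩ := ta.elliptic_fix_flow hz hk hp p
    have h1 := hi i le_rfl
    have h2 := hi (i + 1) (by omega)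
    rw [Function.iterate_succ_apply'] at h2
    obtain ⟨r, hr⟩ := h.fix_two (ta.flow_adj hz _).ne h1 h2
    have h0 : r = 0 := h.dz_zpow_eq_one (by rw [← hr]; simp)
    rw [h0, zpow_zero, mul_inv_eq_one, mul_inv_eq_iff_eq_mul] at hr
    exact (hxy hr).elim
  · obtain ⟨v, hv⟩ := not_hyp_iff.1 hz
    by_contra hn
    have key : ∀ x : D, Commute x z → x • v = v := by
      intro x hx
      by_contra hne
      refine hn (h.fix_two hne ?_ hv)
      rw [← mul_smul, ← hx.eq, mul_smul, hv]
    exact hxy (h.stab_comm (key x hx) (key y hy))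

theorem Dih.hyp_odd (hm : m = 2 * k + 1) : Hyp (BSVert (dT a b) (dV a b m)) a := by
  intro v hv
  rcases bs_cases v with ⟨g, rfl⟩ | ⟨g, rfl⟩
  · obtain ⟨i, hi⟩ := smul_vA_eq_iff.1 hv
    have := congrArg (dlen ℓ) hi
    rw [dlen_conj, dlen_zpow, dlen_mul, h.dlen_a, h.dlen_b] at this
    omega
  · obtain ⟨q, r, hi⟩ := h.mem_dV.1 (smul_vB_eq_iff.1 hv)
    have := congrArg (dlen ℓ) hi
    rw [dlen_conj, dlen_mul, dlen_zpow, h.dlen_dc_odd hm, ← h.dc_sq hm, dlen_zpow, dlen_pow,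
      h.dlen_dc_odd hm, h.dlen_a] at this
    have h3 := h.three_le
    have h4 : (m : ℤ) ∣ 1 := ⟨q + r * 2, by rw [this]; push_cast; ring⟩
    have := Int.eq_one_of_dvd_one (by omega) h4
    omega

/-- The centralizer of a generator. -/
theorem Dih.centralizer_a (hy : Commute y a) : ∃ q r : ℤ, y = a ^ q * dz a b m ^ r := by
  have ta := h.amalg.1.treeAction
  have hN := h.dN_pos
  rcases Nat.even_or_odd' m with ⟨k, hm | hm⟩
  · have hdc : dc a b m = a := by rw [hm, dc_even]
    have ha : a • vB (dT a b) (dV a b m) 1 = vB _ _ 1 := by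
      rw [smul_vB_eq_iff, inv_one, one_mul, mul_one]
      have : dc a b m ∈ dV a b m := Subgroup.subset_closure (by simp)
      rwa [hdc] at this
    have hya : y • vB (dT a b) (dV a b m) 1 = vB _ _ 1 := by
      by_contra hne
      obtain ⟨r, hr⟩ := h.fix_two hne (by rw [← mul_smul, ← hy.eq, mul_smul, ha]) ha
      have := congrArg (dlen ℓ) hr
      rw [dlen_zpow, h.dlen_dz, h.dlen_a] at this
      have h4 : (2 : ℤ) ∣ 1 := ⟨r * dN m, by rw [this]; ring⟩
      omega
    rw [smul_vB_eq_iff, inv_one, one_mul, mul_one, h.mem_dV, hdc] at hya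
    exact hya
  · have hz := h.hyp_odd hm
    have hA1 : (a * b) ^ k ∈ dT a b := pow_mem (Subgroup.mem_zpowers _) _
    have hadj : (bsTree (dT a b) (dV a b m)).Adj (vA _ _ 1) (vB _ _ a) := by
      rw [bs_adj_iff]
      refine ⟨((a * b) ^ k)⁻¹, by simpa using inv_mem hA1, ?_⟩
      have : a⁻¹ * ((a * b) ^ k)⁻¹ = (dc a b m)⁻¹ := by
        rw [hm, dc_odd, mul_inv_rev]
      rw [this]
      exact inv_mem (Subgroup.subset_closure (by simp))
    have hf0 : flow (bsTree (dT a b) (dV a b m)) a (vB _ _ 1) = vA _ _ 1 := by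
      unfold flow
      rw [smul_vB, mul_one]
      symm
      refine eq_nxt ta.tree (bs_adj 1).symm ?_
      have h1 := dist_step ta.tree (bs_adj (A := dT a b) (B := dV a b m) 1).symm (vB _ _ a)
      have h2 := hadj.reachable
      have h3 : (bsTree (dT a b) (dV a b m)).dist (vA _ _ 1) (vB _ _ a) = 1 :=
        SimpleGraph.dist_eq_one_iff_adj.2 hadj
      rcases h1 with h1 | h1
      · omega
      · have h4 : (bsTree (dT a b) (dV a b m)).dist (vB _ _ 1) (vB _ _ a) = 0 := by omega
        rw [dist_eq_zero' ta.tree] at h4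
        have := hz (vB _ _ 1)
        rw [smul_vB, mul_one] at this
        exact (this h4.symm).elim
    have hf1 : flow (bsTree (dT a b) (dV a b m)) a (vA _ _ 1) = vB _ _ a := by
      rcases ta.flow_or hz hadj with h1 | h1
      · exact h1
      · have h2 := ta.flow_smul hz (Commute.refl a) (vB _ _ 1)
        rw [hf0, smul_vB, smul_vA, mul_one, h1] at h2
        have := hz (vA _ _ 1)
        simp_all
    have hev : ∀ n : ℕ, (flow (bsTree (dT a b) (dV a b m)) a)^[2 * n] (vB _ _ 1) =
        vB _ _ (a ^ n) := by
      intro n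
      induction n with
      | zero => simp
      | succ n ih =>
        rw [show 2 * (n + 1) = 2 * n + 2 by ring, Function.iterate_add_apply]
        have : (flow (bsTree (dT a b) (dV a b m)) a)^[2] (vB _ _ 1) = a • vB _ _ 1 := by
          rw [Function.iterate_succ_apply, Function.iterate_one, hf0, hf1, smul_vB, mul_one]
        rw [this, ← ta.flow_iterate_smul hz (Commute.refl a), ih, smul_vB, pow_succ']
    have hod : ∀ n : ℕ, (flow (bsTree (dT a b) (dV a b m)) a)^[2 * n + 1] (vB _ _ 1) =
        vA _ _ (a ^ n) := by
      intro n
      have h1 : Commute (a ^ n) a := (Commute.refl a).pow_left n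
      rw [Function.iterate_succ_apply', hev]
      have := ta.flow_smul hz h1 (vB _ _ 1)
      rw [smul_vB, mul_one, hf0, smul_vA, mul_one] at this
      exact this.symm
    have fin : ∀ (p q : ℕ) (v : BSVert (dT a b) (dV a b m)),
        ((a ^ p)⁻¹ * y * a ^ q) • v = v → ∃ q r : ℤ, y = a ^ q * dz a b m ^ r := by
      intro p q v hv
      have hc : Commute ((a ^ p)⁻¹ * y * a ^ q) a :=
        ((((Commute.refl a).pow_left p).inv_left).mul_left hy).mul_left
          ((Commute.refl a).pow_left q)
      obtain ⟨r, hr⟩ := h.fix_two (ta.flow_adj hz v).ne hv (by rw [ta.flow_smul hz hc, hv])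
      refine ⟨p - q, r, ?_⟩
      have h1 : y = a ^ p * dz a b m ^ r * (a ^ q)⁻¹ := by rw [← hr]; group
      rw [h1, mul_assoc, ((h.central _).zpow_left r).eq, ← mul_assoc, zpow_sub]
      norm_cast
    obtain ⟨i, j, hij⟩ := ta.flow_merge hz (vB _ _ 1) (y • vB _ _ 1)
    rw [← ta.flow_iterate_smul hz hy] at hij
    rcases Nat.even_or_odd' i with ⟨p, rfl | rfl⟩ <;> rcases Nat.even_or_odd' j with ⟨q, rfl | rfl⟩
    · rw [hev, hev, smul_vB, vB_eq, ← mul_assoc] at hij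
      exact fin p q (vB _ _ 1) (by
        rw [smul_vB_eq_iff, inv_one, one_mul, mul_one]; exact hij)
    · simp_all
    · simp_all
    · rw [hod, hod, smul_vA, vA_eq, ← mul_assoc] at hij
      exact fin p q (vA _ _ 1) (by
        rw [smul_vA_eq_iff, inv_one, one_mul, mul_one]; exact hij)

theorem Dih.zpow_a_eq (hi : a ^ i = dz a b m ^ r) : i = 0 ∧ r = 0 := by
  have h0 : i = 0 := h.sep_a i (by rw [hi]; exact (h.central b).zpow_left r)
  refine ⟨h0, h.dz_zpow_eq_one ?_⟩
  rw [← hi, h0]; simp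

/-- Roots of nontrivial powers of a generator are powers of this generator. -/
theorem Dih.root_a (hi : i ≠ 0) (hx : x ^ n = a ^ i) : x ∈ Subgroup.zpowers a := by
  have hn : n ≠ 0 := by
    rintro rfl
    have := congrArg (dlen ℓ) hx
    simp [h.dlen_a] at this
    exact hi this.symm
  have h1 : Commute x (a ^ i) := by rw [← hx]; exact (Commute.refl x).zpow_right n
  have hxa : Commute x a := by
    by_contra hc
    obtain ⟨r, hr⟩ := h.mem_center h1 ((Commute.refl a).zpow_right i) hc
    exact hi (h.zpow_a_eq hr).1
  obtain ⟨q, r, rfl⟩ := h.centralizer_a hxa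
  have hc : Commute (a ^ q) (dz a b m ^ r) := ((h.central _).zpow_left r).symm
  rw [hc.mul_zpow, ← zpow_mul, ← zpow_mul] at hx
  have h2 : a ^ (i - q * n) = dz a b m ^ (r * n) := by
    rw [sub_eq_neg_add, zpow_add, ← hx, ← mul_assoc, ← zpow_add]; simp
  have h3 := (h.zpow_a_eq h2).2
  simp_all

theorem Dih.torsion_free (hn : n ≠ 0) (hx : x ^ n = 1) : x = 1 := by
  have ta := h.amalg.1.treeAction
  have hp : x ^ n • vA (dT a b) (dV a b m) 1 = vA _ _ 1 := by rw [hx, one_smul]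
  have hlen : dlen ℓ x = 0 := by
    have := congrArg (dlen ℓ) hx
    rw [dlen_zpow, dlen_one] at this
    rcases mul_eq_zero.1 this with h1 | h1
    · exact (hn h1).elim
    · exact h1
  obtain ⟨v, hv⟩ := ta.elliptic_of_zpow hn hp
  have hconj : ∀ g : D, g⁻¹ * x * g = 1 → x = 1 := by
    intro g hg
    have : x = g * (g⁻¹ * x * g) * g⁻¹ := by group
    rw [this, hg]; group
  rcases bs_cases v with ⟨g, rfl⟩ | ⟨g, rfl⟩
  · obtain ⟨i, hi⟩ := smul_vA_eq_iff.1 hv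
    have h1 := congrArg (dlen ℓ) hi
    rw [dlen_conj, hlen, dlen_zpow, dlen_mul, h.dlen_a, h.dlen_b] at h1
    have : i = 0 := by omega
    subst this
    exact hconj g (hi.symm.trans (zpow_zero _))
  · obtain ⟨q, r, hi⟩ := h.mem_dV.1 (smul_vB_eq_iff.1 hv)
    have h1 := congrArg (dlen ℓ) hi
    rw [dlen_conj, hlen, dlen_mul, dlen_zpow, dlen_zpow, h.dlen_dz] at h1
    have hgn : (g⁻¹ * x * g) ^ n = 1 := by
      have := conj_zpow (i := n) (a := g⁻¹) (b := x)
      rw [inv_inv] at this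
      rw [this, hx]; group
    have hN := h.dN_pos
    rcases Nat.even_or_odd' m with ⟨k, hm | hm⟩
    · have hdc : dc a b m = a := by rw [hm, dc_even]
      rw [hdc] at hi h1
      have hc : Commute (a ^ q) (dz a b m ^ r) := ((h.central _).zpow_left r).symm
      rw [hi, hc.mul_zpow, ← zpow_mul, ← zpow_mul, mul_eq_one_iff_eq_inv, ← zpow_neg] at hgn
      have h2 := (h.zpow_a_eq hgn)
      have hq : q = 0 := by
        rcases mul_eq_zero.1 h2.1 with h4 | h4
        · exact h4
        · exact (hn h4).elim
      have hr : r = 0 := by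
        rcases mul_eq_zero.1 (neg_eq_zero.1 h2.2) with h4 | h4
        · exact h4
        · exact (hn h4).elim
      exact hconj g (by rw [hi, hq, hr]; simp)
    · rw [← h.dc_sq hm, ← zpow_natCast, ← zpow_mul, ← zpow_add] at hi
      have h2 := congrArg (dlen ℓ) hi
      rw [dlen_conj, hlen, dlen_zpow, h.dlen_dc_odd hm] at h2
      have h3 := h.three_le
      rcases mul_eq_zero.1 h2.symm with h4 | h4
      · exact hconj g (by rw [hi, h4, zpow_zero])
      · omega

end Abstract

section Abstract

variable {D : Type u} [Group D] {a b : D} {m : ℕ} {ℓ : D →* Multiplicative ℤ}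
variable {g : D}

variable (h : Dih a b m ℓ)
include h

theorem Dih.gen_td {H : Subgroup D} (ht : a * b ∈ H) (hd : dc a b m ∈ H) (g : D) : g ∈ H := by
  have : dT a b ⊔ dV a b m ≤ H := by
    rw [sup_le_iff, Subgroup.zpowers_le, Subgroup.closure_le]
    refine ⟨ht, ?_⟩
    rintro x (rfl | rfl)
    · exact hd
    · exact pow_mem ht _
  exact this (by rw [h.amalg.1.sup]; trivial)

theorem Dih.eq_of_td {H : Type*} [Group H] {f f' : D →* H}
    (ht : f (a * b) = f' (a * b)) (hd : f (dc a b m) = f' (dc a b m)) (x : D) : f x = f' x :=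
  h.gen_td (H := f.eqLocus f') ht hd x

theorem Dih.dc_not_mem (r : ℤ) : dc a b m ≠ dz a b m ^ r := by
  intro hr
  have h1 := congrArg (dlen ℓ) hr
  have hN := h.dN_pos
  rcases Nat.even_or_odd' m with ⟨k, hm | hm⟩
  · rw [hm, dc_even, h.dlen_a, ← hm, dlen_zpow, h.dlen_dz] at h1
    grind
  · rw [h.dlen_dc_odd hm, dlen_zpow, ← h.dc_sq hm, dlen_pow, h.dlen_dc_odd hm] at h1
    grind

/-- If `dT` and a conjugate of `dV` generate, then this conjugate is a `dT`-conjugate. -/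
theorem Dih.adj_of_sup (hsup : dT a b ⊔ (dV a b m).map (MulAut.conj g).toMonoidHom = ⊤) :
    (bsTree (dT a b) (dV a b m)).Adj (vA _ _ 1) (vB _ _ g) := by
  by_contra hna
  have ta := h.amalg.1.treeAction
  set X := bsTree (dT a b) (dV a b m) with hX
  set p0 : BSVert (dT a b) (dV a b m) := vA _ _ 1 with hp0
  set q : BSVert (dT a b) (dV a b m) := vB _ _ g with hq
  have h0q : p0 ≠ q := vA_ne_vB _ _
  set p1 := nxt X p0 q with hp1
  set r := nxt X q p0 with hr
  have a01 : X.Adj p0 p1 := nxt_adj ta.tree h0q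
  have aqr : X.Adj q r := nxt_adj ta.tree h0q.symm
  have d0q : X.dist p1 q + 1 = X.dist p0 q := dist_nxt ta.tree h0q
  have hTfix : ∀ x ∈ dT a b, x • p0 = p0 := by
    intro x hx
    rw [hp0, smul_vA_eq_iff]; simpa using hx
  have hVfix : ∀ x, x ∈ (dV a b m).map (MulAut.conj g).toMonoidHom → x • q = q := by
    rintro _ ⟨x, hx, rfl⟩
    rw [hq, smul_vB_eq_iff]
    simpa [mul_assoc] using hx
  have hZ : ∀ r : ℤ, dz a b m ^ r ∈ dT a b ∧
      dz a b m ^ r ∈ (dV a b m).map (MulAut.conj g).toMonoidHom := by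
    intro r
    refine ⟨zpow_mem (pow_mem (Subgroup.mem_zpowers _) _) r, dz a b m ^ r,
      zpow_mem (Subgroup.subset_closure (by simp)) r, ?_⟩
    change g * _ * g⁻¹ = _
    rw [← ((h.central g).zpow_left r).eq, mul_inv_cancel_right]
  -- the far side of the last edge lies on the far side of the first edge
  have key : ∀ x, X.dist q x < X.dist r x → X.dist p0 x = X.dist p0 q + X.dist q x := by
    intro x hx
    by_cases hxq : x = q
    · rw [hxq, SimpleGraph.dist_self]; rfl
    refine dist_turn ta.tree (Or.inr (Or.inr ?_))
    intro he
    have := dist_nxt ta.tree (v := q) (w := x) (fun h => hxq h.symm)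
    rw [← he, ← hr] at this
    omega
  have conn := ta.tree.1
  have far : ∀ x, X.dist q x < X.dist r x → X.dist p1 x < X.dist p0 x := by
    intro x hx
    have h1 := key x hx
    have h2 := conn.dist_triangle (u := p1) (v := q) (w := x)
    omega
  have hp1q : p1 ≠ q := fun he => hna (he ▸ a01)
  have hp1r : ¬ X.dist q p1 < X.dist r p1 := by
    intro hlt
    have h1 := key p1 hlt
    have h2 : X.dist p0 p1 = 1 := SimpleGraph.dist_eq_one_iff_adj.2 a01
    have h3 : X.dist q p1 = 0 := by omega
    rw [dist_eq_zero' ta.tree] at h3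
    exact hp1q h3.symm
  have hmain : ∀ (x : D) (l : List D), Alt (dT a b) ((dV a b m).map (MulAut.conj g).toMonoidHom)
      (x :: l) → (x ∈ dT a b → X.dist p0 ((x :: l).prod • p1) < X.dist p1 ((x :: l).prod • p1)) ∧
        (x ∉ dT a b → X.dist q ((x :: l).prod • p1) < X.dist r ((x :: l).prod • p1)) := by
    intro x l
    induction l generalizing x with
    | nil =>
      intro hl
      rw [alt_singleton] at hl
      rw [List.prod_singleton]
      refine ⟨fun hx => ?_, fun hx => ?_⟩
      · refine push_away ta (hTfix x hx) a01 (fun hc => ?_) ?_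
        · obtain ⟨i, rfl⟩ := h.fix_two a01.ne (hTfix _ hx) hc
          grind
        · rw [SimpleGraph.dist_self]
          exact conn.pos_dist_of_ne a01.ne
      · have hx' : x ∈ (dV a b m).map (MulAut.conj g).toMonoidHom := by tauto
        refine push_away ta (hVfix x hx') aqr (fun hc => ?_) ?_
        · obtain ⟨i, rfl⟩ := h.fix_two aqr.ne (hVfix _ hx') hc
          exact hx (hZ i).1
        · have := dist_step ta.tree aqr p1
          omega
    | cons y l ih =>
      intro hl
      rw [alt_cons_cons] at hl
      obtain ⟨hl1, hl2, hl3⟩ := hl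
      have ih' := ih y hl3
      have hy : ¬ (y ∈ dT a b ↔ y ∈ (dV a b m).map (MulAut.conj g).toMonoidHom) := hl3.1 y (by simp)
      rw [List.prod_cons, mul_smul]
      generalize (y :: l).prod • p1 = v at ih' ⊢
      refine ⟨fun hx => ?_, fun hx => ?_⟩
      · refine push_away ta (hTfix x hx) a01 (fun hc => ?_) (far v (ih'.2 (by tauto)))
        obtain ⟨i, rfl⟩ := h.fix_two a01.ne (hTfix _ hx) hc
        grind
      · have hx' : x ∈ (dV a b m).map (MulAut.conj g).toMonoidHom := by tauto
        refine push_away ta (hVfix x hx') aqr (fun hc => ?_) ?_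
        · obtain ⟨i, rfl⟩ := h.fix_two aqr.ne (hVfix _ hx') hc
          exact hx (hZ i).1
        · have h1 := ih'.1 (by tauto)
          have h2 := far v
          have h3 := dist_step ta.tree aqr v
          omega
  have hstab : ∀ x : D, x • p1 = p1 → ∃ i : ℤ, x = dz a b m ^ i := by
    intro x hx
    have hword : ∀ (y : D) (l : List D), Alt (dT a b)
        ((dV a b m).map (MulAut.conj g).toMonoidHom) (y :: l) → (y :: l).prod ≠ x := by
      rintro y l hl rfl
      have := hmain y l hl
      rw [hx, SimpleGraph.dist_self] at this
      by_cases hy : y ∈ dT a b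
      · have := this.1 hy
        omega
      · exact hp1r (this.2 hy)
    rcases starts_trichotomy hsup x with h1 | ⟨y, l, hl, _, he⟩ | ⟨y, l, hl, _, he⟩
    · exact h.fix_two h0q (hTfix _ h1.1) (hVfix _ h1.2)
    · exact (hword y l hl he).elim
    · exact (hword y l hl.symm he).elim
  rcases bs_cases p1 with ⟨k, hk⟩ | ⟨k, hk⟩
  · rw [hk] at a01
    exact (ta.type_ne _ _ a01 rfl)
  · obtain ⟨i, hi⟩ := hstab (k * dc a b m * k⁻¹) (by
      rw [hk, smul_vB_eq_iff]
      have : k⁻¹ * (k * dc a b m * k⁻¹) * k = dc a b m := by group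
      rw [this]
      exact Subgroup.subset_closure (by simp))
    rw [mul_inv_eq_iff_eq_mul, ((h.central k).zpow_left i).eq] at hi
    exact h.dc_not_mem i (mul_left_cancel hi)

/-- Length preserving automorphisms (also preserving the class of `a` if `m` is even) are
inner. -/
theorem Dih.inner (φ : D ≃* D) (hℓ : ∀ x, dlen ℓ (φ x) = dlen ℓ x)
    (hev : Even m → ∃ g, φ a = g * a * g⁻¹) : ∃ g, ∀ x, φ x = g * x * g⁻¹ := by
  have ta := h.amalg.1.treeAction
  have hN := h.dN_pos
  have hz : φ (dz a b m) = dz a b m := by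
    have hc : ∀ x, Commute x (φ (dz a b m)) := by
      intro x
      have := (h.central (φ.symm x)).map φ
      rw [MulEquiv.apply_symm_apply] at this
      exact this.symm
    obtain ⟨r, hr⟩ := h.mem_center (hc a) (hc b) h.not_commute
    have h1 := congrArg (dlen ℓ) hr
    rw [hℓ, dlen_zpow, h.dlen_dz] at h1
    have : r = 1 := by
      have h2 : (2 * dN m : ℤ) * (r - 1) = 0 := by linarith
      rcases mul_eq_zero.1 h2 with h3 | h3 <;> omega
    rw [hr, this, zpow_one]
  have ht : ∃ g, φ (a * b) = g * (a * b) * g⁻¹ := by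
    have hp : φ (a * b) ^ dN m • vA (dT a b) (dV a b m) 1 = vA _ _ 1 := by
      rw [← map_pow]
      change φ (dz a b m) • _ = _
      rw [hz, smul_vA_eq_iff, inv_one, one_mul, mul_one]
      exact pow_mem (Subgroup.mem_zpowers _) _
    have hlt : dlen ℓ (φ (a * b)) = 2 := by
      rw [hℓ, dlen_mul, h.dlen_a, h.dlen_b]; rfl
    obtain ⟨v, hv⟩ := ta.elliptic_of_pow (by omega) hp
    rcases bs_cases v with ⟨g, rfl⟩ | ⟨g, rfl⟩
    · obtain ⟨i, hi⟩ := smul_vA_eq_iff.1 hv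
      have h1 := congrArg (dlen ℓ) hi
      rw [dlen_conj, hlt, dlen_zpow, dlen_mul, h.dlen_a, h.dlen_b] at h1
      have : i = 1 := by omega
      subst this
      refine ⟨g, ?_⟩
      have e : a * b = g⁻¹ * φ (a * b) * g := (zpow_one _).symm.trans hi
      calc φ (a * b) = g * (g⁻¹ * φ (a * b) * g) * g⁻¹ := by group
        _ = _ := by rw [← e]
    · obtain ⟨q, r, hi⟩ := h.mem_dV.1 (smul_vB_eq_iff.1 hv)
      exfalso
      rcases Nat.even_or_odd' m with ⟨k, hm | hm⟩
      · have hdc : dc a b m = a := by rw [hm, dc_even]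
        rw [hdc] at hi
        have hc : Commute (a ^ q) (dz a b m ^ r) := ((h.central _).zpow_left r).symm
        have h1 : (g⁻¹ * φ (a * b) * g) ^ dN m = dz a b m := by
          have := conj_pow (i := dN m) (a := g⁻¹) (b := φ (a * b))
          rw [inv_inv] at this
          rw [this, ← map_pow]
          change g⁻¹ * φ (dz a b m) * g = _
          rw [hz, mul_assoc, (h.central g).eq, inv_mul_cancel_left]
        rw [hi, ← zpow_natCast, hc.mul_zpow, ← zpow_mul, ← zpow_mul] at h1
        have h2 : a ^ (q * (dN m : ℤ)) = dz a b m ^ (1 - r * (dN m : ℤ)) := by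
          rw [sub_eq_add_neg, zpow_add, zpow_one, zpow_neg]; exact eq_mul_inv_of_mul_eq h1
        have hq : q = 0 := by
          rcases mul_eq_zero.1 (h.zpow_a_eq h2).1 with h4 | h4
          · exact h4
          · omega
        have h3 := congrArg (dlen ℓ) hi
        rw [hq, zpow_zero, one_mul, dlen_conj, hlt, dlen_zpow, h.dlen_dz] at h3
        have h4 : (dN m : ℤ) ∣ 1 := ⟨r, by linarith⟩
        have := Int.eq_one_of_dvd_one (by omega) h4
        omega
      · rw [← h.dc_sq hm, ← zpow_natCast, ← zpow_mul, ← zpow_add] at hi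
        have h2 := congrArg (dlen ℓ) hi
        rw [dlen_conj, hlt, dlen_zpow, h.dlen_dc_odd hm] at h2
        have h3 := h.three_le
        have h4 : (m : ℤ) ∣ 2 := ⟨q + (2 : ℕ) * r, by rw [h2]; ring⟩
        have := Int.le_of_dvd (by omega) h4
        omega
  have hd : ∃ g, φ (dc a b m) = g * dc a b m * g⁻¹ := by
    rcases Nat.even_or_odd' m with ⟨k, hm | hm⟩
    · have hdc : dc a b m = a := by rw [hm, dc_even]
      rw [hdc]
      exact hev ⟨k, by omega⟩
    · have hp : φ (dc a b m) ^ 2 • vA (dT a b) (dV a b m) 1 = vA _ _ 1 := by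
        rw [← map_pow, h.dc_sq hm, hz, smul_vA_eq_iff, inv_one, one_mul, mul_one]
        exact pow_mem (Subgroup.mem_zpowers _) _
      obtain ⟨v, hv⟩ := ta.elliptic_of_pow (by omega) hp
      rcases bs_cases v with ⟨g, rfl⟩ | ⟨g, rfl⟩
      · obtain ⟨i, hi⟩ := smul_vA_eq_iff.1 hv
        have h1 := congrArg (dlen ℓ) hi
        rw [dlen_conj, hℓ, h.dlen_dc_odd hm, dlen_zpow, dlen_mul, h.dlen_a, h.dlen_b] at h1
        omega
      · obtain ⟨q, r, hi⟩ := h.mem_dV.1 (smul_vB_eq_iff.1 hv)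
        rw [← h.dc_sq hm, ← zpow_natCast, ← zpow_mul, ← zpow_add] at hi
        have h2 := congrArg (dlen ℓ) hi
        rw [dlen_conj, hℓ, dlen_zpow, h.dlen_dc_odd hm] at h2
        have h3 := h.three_le
        have h5 : q + (2 : ℕ) * r = 1 := by
          have h6 : (m : ℤ) * (q + (2 : ℕ) * r - 1) = 0 := by linarith
          rcases mul_eq_zero.1 h6 with h7 | h7 <;> omega
        rw [h5, zpow_one] at hi
        refine ⟨g, ?_⟩
        calc φ (dc a b m) = g * (g⁻¹ * φ (dc a b m) * g) * g⁻¹ := by group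
          _ = _ := by rw [hi]
  obtain ⟨g, hg⟩ := ht
  obtain ⟨k, hk⟩ := hd
  have hsup : dT a b ⊔ (dV a b m).map (MulAut.conj (g⁻¹ * k)).toMonoidHom = ⊤ := by
    rw [eq_top_iff]
    intro x _
    have hx := h.gen_td (H := (dT a b ⊔ (dV a b m).map (MulAut.conj (g⁻¹ * k)).toMonoidHom).comap
        ((MulAut.conj g⁻¹).toMonoidHom.comp φ.toMonoidHom)) ?_ ?_
      (φ.symm (g * x * g⁻¹))
    · have : g⁻¹ * φ (φ.symm (g * x * g⁻¹)) * g⁻¹⁻¹ ∈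
        dT a b ⊔ (dV a b m).map (MulAut.conj (g⁻¹ * k)).toMonoidHom := hx
      rw [MulEquiv.apply_symm_apply] at this
      have e : g⁻¹ * (g * x * g⁻¹) * g⁻¹⁻¹ = x := by group
      rwa [e] at this
    · rw [Subgroup.mem_comap]
      change g⁻¹ * φ (a * b) * g⁻¹⁻¹ ∈ dT a b ⊔ (dV a b m).map (MulAut.conj (g⁻¹ * k)).toMonoidHom
      rw [hg]
      have e : g⁻¹ * (g * (a * b) * g⁻¹) * g⁻¹⁻¹ = a * b := by group
      rw [e]
      exact Subgroup.mem_sup_left (Subgroup.mem_zpowers _)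
    · rw [Subgroup.mem_comap]
      change g⁻¹ * φ (dc a b m) * g⁻¹⁻¹ ∈
        dT a b ⊔ (dV a b m).map (MulAut.conj (g⁻¹ * k)).toMonoidHom
      rw [hk]
      refine Subgroup.mem_sup_right ⟨dc a b m, Subgroup.subset_closure (by simp), ?_⟩
      simp_all
  obtain ⟨x, hx1, hx2⟩ := bs_adj_iff.1 (h.adj_of_sup hsup)
  rw [inv_one, one_mul] at hx1
  have c1 := h.dT_comm hx1 (Subgroup.mem_zpowers (a * b))
  have c2 := h.dV_comm hx2 (Subgroup.subset_closure (by simp) : dc a b m ∈ dV a b m)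
  refine ⟨g * x, fun y => ?_⟩
  refine h.eq_of_td (f := φ.toMonoidHom) (f' := (MulAut.conj (g * x)).toMonoidHom) ?_ ?_ y
  · change φ (a * b) = g * x * (a * b) * (g * x)⁻¹
    rw [hg, mul_assoc g x, c1.eq]
    group
  · change φ (dc a b m) = g * x * dc a b m * (g * x)⁻¹
    rw [hk]
    have e : g * x = k * ((g⁻¹ * k)⁻¹ * x) := by group
    rw [e, mul_assoc k ((g⁻¹ * k)⁻¹ * x), c2.eq]
    group

/-- The outer automorphism group of an odd dihedral Artin group is finite. -/
theorem Dih.finite_out (hodd : Odd m) : Finite (Out D) := by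
  obtain ⟨k, hm⟩ := hodd
  have key : ∀ φ : MulAut D, ∀ x, dlen ℓ (φ x) = dlen ℓ (φ a) * dlen ℓ x := by
    intro φ
    have hab : dlen ℓ (φ b) = dlen ℓ (φ a) := by
      have h1 := congrArg (fun x => dlen ℓ (φ x)) (h.rel_odd hm)
      simp only [map_mul, map_pow, dlen_mul, dlen_pow] at h1
      rw [add_comm (dlen ℓ (φ b)) (dlen ℓ (φ a))] at h1
      omega
    have hH : ∀ x, x ∈ (ℓ.comp φ.toMonoidHom).eqLocus ((zpowGroupHom (dlen ℓ (φ a))).comp ℓ) := by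
      refine h.induct ?_ ?_
      · change ℓ (φ a) = ℓ a ^ (dlen ℓ (φ a))
        rw [h.len_a, ← ofAdd_zsmul]; simp [dlen]
      · change ℓ (φ b) = ℓ b ^ (dlen ℓ (φ a))
        rw [h.len_b, ← ofAdd_zsmul, ← hab]; simp [dlen]
    intro x
    have h1 : ℓ (φ x) = ℓ x ^ (dlen ℓ (φ a)) := hH x
    have h2 := congrArg Multiplicative.toAdd h1
    rw [toAdd_zpow] at h2
    exact h2
  have key2 : ∀ φ : MulAut D, dlen ℓ (φ a) = 1 ∨ dlen ℓ (φ a) = -1 := by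
    intro φ
    have h1 := key φ (φ⁻¹ a)
    rw [MulAut.apply_inv_self, h.dlen_a] at h1
    exact Int.eq_one_or_neg_one_of_mul_eq_one h1.symm
  let f : Out D → Set Bool := fun q => {t | ∃ φ : MulAut D, (φ : Out D) = q ∧
    (t = true ↔ dlen ℓ (φ a) = 1)}
  refine Finite.of_injective f ?_
  intro q q' hqq
  induction q using QuotientGroup.induction_on with | H φ => ?_
  have hφ : decide (dlen ℓ (φ a) = 1) ∈ f (φ : Out D) := ⟨φ, rfl, by simp⟩
  rw [hqq] at hφ
  obtain ⟨φ', rfl, hφ'⟩ := hφ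
  have he : dlen ℓ (φ a) = dlen ℓ (φ' a) := by
    rw [decide_eq_true_iff] at hφ'
    grind
  rw [QuotientGroup.eq]
  have hin : ∀ x, dlen ℓ ((φ⁻¹ * φ') x) = dlen ℓ x := by
    intro x
    have e1 := key φ ((φ⁻¹ * φ') x)
    rw [MulAut.mul_apply, MulAut.apply_inv_self, key φ', he] at e1
    rcases key2 φ' with h2 | h2 <;> rw [h2] at e1 <;> rw [MulAut.mul_apply] <;> omega
  obtain ⟨g, hg⟩ := h.inner (φ⁻¹ * φ') hin (fun hev => by
    obtain ⟨j, hj⟩ := hev; omega)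
  exact ⟨g, MulEquiv.ext fun x => (hg x).symm⟩

end Abstract

section

variable {V : Type u} {Γ : DefiningGraph V}
variable {g x y z : ArtinGroup Γ} {i n r : ℤ}

/-- The central element of the dihedral parabolic subgroup of an edge. -/
def zc (Γ : DefiningGraph V) (a b : V) : ArtinGroup Γ := (gen Γ a * gen Γ b) ^ dN (Γ.label a b)

theorem gen_mem_pair_left (a b : V) : gen Γ a ∈ parabolic Γ {a, b} := gen_mem (by simp)

theorem gen_mem_pair_right (a b : V) : gen Γ b ∈ parabolic Γ {a, b} := gen_mem (by simp)

/-- The first generator in the parabolic subgroup of a pair. -/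
def pg (Γ : DefiningGraph V) (a b : V) : parabolic Γ {a, b} := ⟨gen Γ a, gen_mem_pair_left a b⟩

/-- The second generator in the parabolic subgroup of a pair. -/
def qg (Γ : DefiningGraph V) (a b : V) : parabolic Γ {a, b} := ⟨gen Γ b, gen_mem_pair_right a b⟩

variable [Finite V]

theorem dih_pair [TF Γ] [Large Γ] {a b : V} (hab : Γ.graph.Adj a b) :
    Dih (pg Γ a b) (qg Γ a b) (Γ.label a b) ((lam Γ).comp (parabolic Γ {a, b}).subtype) where
  three_le := Large.out a b hab
  rel := by
    apply Subtype.val_injective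
    have := gen_rel hab
    change (parabolic Γ {a, b}).subtype _ = (parabolic Γ {a, b}).subtype _
    rw [map_altProd, map_altProd]
    exact this
  closure_eq := by
    rw [eq_top_iff]
    rintro ⟨x, hx⟩ -
    have h1 : (Subgroup.closure {pg Γ a b, qg Γ a b}).map (parabolic Γ {a, b}).subtype
        = parabolic Γ {a, b} := by
      rw [MonoidHom.map_closure, Set.image_pair]
      exact (parabolic_pair a b).symm
    have h2 := hx
    rw [← h1] at h2
    obtain ⟨y, hy, hyx⟩ := h2
    have : y = ⟨x, hx⟩ := Subtype.ext hyx
    exact this ▸ hy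
  len_a := by
    change lam Γ (gen Γ a) = _
    simp [lam]
  len_b := by
    change lam Γ (gen Γ b) = _
    simp [lam]
  lift := by
    intro H _ x y hxy
    classical
    have hne : a ≠ b := hab.ne
    let f : ArtinGroup (Γ.induce {a, b}) →* H := liftHom (fun v => if v.1 = a then x else y) (by
        rintro ⟨v, hv⟩ ⟨w, hw⟩ (hvw : Γ.graph.Adj v w)
        change altProd _ _ (Γ.label v w) = altProd _ _ (Γ.label v w)
        rcases hv with rfl | rfl <;> rcases hw with rfl | rfl
        · exact (hvw.ne rfl).elim
        · simpa [hne.symm] using hxy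
        · rw [Γ.label_symm]; simpa [hne.symm] using hxy.symm
        · exact (hvw.ne rfl).elim)
    have e1 : (embEquiv {a, b}).symm (pg Γ a b) = gen (Γ.induce {a, b}) ⟨a, by simp⟩ := by
      rw [MulEquiv.symm_apply_eq]
      apply Subtype.val_injective
      exact (emb_gen (Γ := Γ) {a, b} ⟨a, by simp⟩).symm
    have e2 : (embEquiv {a, b}).symm (qg Γ a b) = gen (Γ.induce {a, b}) ⟨b, by simp⟩ := by
      rw [MulEquiv.symm_apply_eq]
      apply Subtype.val_injective
      exact (emb_gen (Γ := Γ) {a, b} ⟨b, by simp⟩).symm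
    refine ⟨f.comp (embEquiv {a, b}).symm.toMonoidHom, ?_, ?_⟩
    · change f ((embEquiv {a, b}).symm (pg Γ a b)) = x
      rw [e1, liftHom_gen]; simp
    · change f ((embEquiv {a, b}).symm (qg Γ a b)) = y
      rw [e2, liftHom_gen]; simp [hne.symm]
  sep_a := by
    intro i hi
    by_contra h
    have h1 : Commute (gen Γ b) (gen Γ a ^ i) := (hi.map (parabolic Γ {a, b}).subtype).symm
    have h2 := lk_inter_centralizer h (gen_mem (S := lk Γ a) hab) h1
    have := gen_zpow_eq_one (i := 1) (by simpa using h2)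
    omega

variable {a b : V}

theorem coe_dz (a b : V) : ((dz (pg Γ a b) (qg Γ a b) (Γ.label a b) : parabolic Γ {a, b}) :
    ArtinGroup Γ) = zc Γ a b := rfl

theorem zc_mem (a b : V) : zc Γ a b ∈ parabolic Γ {a, b} :=
  (dz (pg Γ a b) (qg Γ a b) (Γ.label a b)).2

theorem commute_coe {a b : V} (hx : x ∈ parabolic Γ {a, b})
    (hy : y ∈ parabolic Γ {a, b}) (h : Commute x y) :
    Commute (⟨x, hx⟩ : parabolic Γ {a, b}) ⟨y, hy⟩ := Subtype.ext h.eq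

theorem zc_comm [TF Γ] [Large Γ] (hab : Γ.graph.Adj a b) : zc Γ b a = zc Γ a b := by
  have := congrArg (Subtype.val) (dih_pair hab).dz_swap
  rw [coe_dz] at this
  rw [← this]
  unfold zc dz
  rw [Γ.label_symm]
  rfl

theorem zc_central [TF Γ] [Large Γ] (hab : Γ.graph.Adj a b)
    (hg : g ∈ parabolic Γ {a, b}) : Commute (zc Γ a b) g :=
  ((dih_pair hab).central ⟨g, hg⟩).map (parabolic Γ {a, b}).subtype

theorem len_zc (a b : V) : len (zc Γ a b) = 2 * dN (Γ.label a b) := by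
  unfold zc
  have : len (gen Γ a * gen Γ b) = 2 := by simp
  unfold len at this ⊢
  rw [map_pow, toAdd_pow, this]
  simp [mul_comm]

theorem len_zpow' (g : ArtinGroup Γ) (i : ℤ) : len (g ^ i) = i * len g := by
  simp_all

theorem two_le_dN [Large Γ] (hab : Γ.graph.Adj a b) : 2 ≤ dN (Γ.label a b) := by
  have := Large.out a b hab
  unfold dN
  grind

variable [TF Γ] [Large Γ]

variable (hab : Γ.graph.Adj a b)
include hab

theorem pair_center
    (hx : x ∈ parabolic Γ {a, b}) (hy : y ∈ parabolic Γ {a, b}) (hz : z ∈ parabolic Γ {a, b})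
    (hxz : Commute x z) (hyz : Commute y z) (hxy : x * y ≠ y * x) : ∃ r : ℤ, z = zc Γ a b ^ r := by
  obtain ⟨r, hr⟩ := (dih_pair hab).mem_center (commute_coe hx hz hxz)
    (commute_coe hy hz hyz) (fun h => hxy (congrArg Subtype.val h))
  exact ⟨r, congrArg Subtype.val hr⟩

theorem pair_centralizer (hy : y ∈ parabolic Γ {a, b}) (hc : Commute y (gen Γ a))
    : ∃ q r : ℤ, y = gen Γ a ^ q * zc Γ a b ^ r := by
  obtain ⟨q, r, h⟩ := (dih_pair hab).centralizer_a (commute_coe hy (gen_mem_pair_left a b) hc)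
  exact ⟨q, r, congrArg Subtype.val h⟩

theorem pair_zpow_eq (h : gen Γ a ^ i = zc Γ a b ^ r) : i = 0 ∧ r = 0 :=
  (dih_pair hab).zpow_a_eq (Subtype.ext h)

theorem pair_root (hx : x ∈ parabolic Γ {a, b}) (hi : i ≠ 0)
    (h : x ^ n = gen Γ a ^ i) : ∃ j : ℤ, x = gen Γ a ^ j := by
  obtain ⟨j, hj⟩ := (dih_pair hab).root_a hi (x := ⟨x, hx⟩) (Subtype.ext h)
  exact ⟨j, (congrArg Subtype.val hj).symm⟩

theorem pair_torsion_free (hx : x ∈ parabolic Γ {a, b}) (hn : n ≠ 0) (h : x ^ n = 1) : x = 1 :=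
  congrArg Subtype.val ((dih_pair hab).torsion_free hn (x := ⟨x, hx⟩) (Subtype.ext h))

theorem pair_not_commute : gen Γ a * gen Γ b ≠ gen Γ b * gen Γ a :=
  fun h => (dih_pair hab).not_commute (Subtype.ext h)

end

section

variable {V : Type u} {Γ : DefiningGraph V}
variable {g h x y z : ArtinGroup Γ} {K : Set V} {a b s : V} {i n : ℤ} {N m : ℕ}

theorem bs_adj_vB_one {G : Type*} [Group G] {A B : Subgroup G} {w : BSVert A B}
    (h : (bsTree A B).Adj (vB A B 1) w) : ∃ β ∈ B, w = vA A B β := by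
  rcases bs_cases w with ⟨g, rfl⟩ | ⟨g, rfl⟩
  · obtain ⟨x, h1, h2⟩ := bs_adj_iff.1 h.symm
    refine ⟨x, by simpa using h2, vA_eq.2 h1⟩
  · obtain ⟨x, ⟨h1, -⟩ | ⟨-, h2⟩⟩ := h
    · exact (vB_ne_vA _ _ h1).elim
    · exact (vB_ne_vA _ _ h2).elim

theorem conj_zpow' {G : Type*} [Group G] (g x : G) (n : ℤ) :
    (g⁻¹ * x * g) ^ n = g⁻¹ * x ^ n * g := by
  have := conj_zpow (i := n) (a := g⁻¹) (b := x)
  simpa using this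

theorem len_conj' (g h : ArtinGroup Γ) : len (g⁻¹ * h * g) = len h := by
  simpa using len_conj g⁻¹ h

/-- Conjugates of standard generators. -/
def GC (x : ArtinGroup Γ) : Prop := ∃ (g : ArtinGroup Γ) (s : V), x = g * gen Γ s * g⁻¹

theorem GC.len (h : GC x) : len x = 1 := by
  obtain ⟨g, s, rfl⟩ := h
  rw [len_conj]; simp

theorem GC.conj (h : GC x) (k : ArtinGroup Γ) : GC (k * x * k⁻¹) := by
  obtain ⟨g, s, rfl⟩ := h
  exact ⟨k * g, s, by group⟩

theorem GC.conj' (h : GC x) (k : ArtinGroup Γ) : GC (k⁻¹ * x * k) := by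
  simpa using h.conj k⁻¹

theorem GC.vertexType (h : GC x) : VertexType x := by
  obtain ⟨g, s, rfl⟩ := h
  exact ⟨g, s, 1, by simp⟩

theorem VertexType.elliptic (h : VertexType x) (u : V) : ∃ v : TV Γ u, x • v = v := by
  obtain ⟨g, s, i, rfl⟩ := h
  by_cases hs : s = u
  · subst hs
    refine ⟨vB _ _ g, smul_vB_eq_iff.2 ?_⟩
    have : g⁻¹ * (g * gen Γ s ^ i * g⁻¹) * g = gen Γ s ^ i := by group
    rw [this]
    exact gen_zpow_mem (Set.mem_insert _ _) i
  · refine ⟨vA _ _ g, smul_vA_eq_iff.2 ?_⟩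
    have : g⁻¹ * (g * gen Γ s ^ i * g⁻¹) * g = gen Γ s ^ i := by group
    rw [this]
    exact gen_zpow_mem (by simpa using hs) i

theorem clique_cases [TF Γ] (hK : IsCl Γ K) :
    K = ∅ ∨ (∃ a, K = {a}) ∨ ∃ a b, Γ.graph.Adj a b ∧ K = {a, b} := by
  rcases K.eq_empty_or_nonempty with h | ⟨a, ha⟩
  · exact Or.inl h
  right
  by_cases h : ∃ b ∈ K, b ≠ a
  · obtain ⟨b, hb, hba⟩ := h
    right
    have hab := hK a ha b hb hba.symm
    refine ⟨a, b, hab, Set.Subset.antisymm ?_ (by rintro x (rfl | rfl) <;> assumption)⟩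
    intro c hc
    by_contra hne
    simp only [Set.mem_insert_iff, Set.mem_singleton_iff, not_or] at hne
    exact TF.out a b c hab (hK b hb c hc (Ne.symm hne.2)) (hK a ha c hc (Ne.symm hne.1))
  · push Not at h
    exact Or.inl ⟨a, Set.Subset.antisymm (fun x hx => h x hx) (by rintro x rfl; exact ha)⟩

variable [Finite V]

theorem vertexType_pair_aux [TF Γ] (hab : Γ.graph.Adj a b)
    (hy : y ∈ parabolic Γ {a, b}) (hs : s ≠ a) (hyh : y = h * gen Γ s ^ i * h⁻¹) : ∃
    g ∈ parabolic Γ {a, b}, ∃ i : ℤ, g⁻¹ * y * g = gen Γ a ^ i ∨ g⁻¹ * y * g = gen Γ b ^ i := by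
  have hyS : y ∈ pS Γ a := parabolic_mono (by
    rintro x (rfl | rfl)
    · exact Set.mem_insert _ _
    · exact Set.mem_insert_of_mem _ hab) hy
  have hyS' : y ∈ pS Γ b := parabolic_mono (by
    rintro x (rfl | rfl)
    · exact Set.mem_insert_of_mem _ hab.symm
    · exact Set.mem_insert _ _) hy
  have f1 : y • vB (pA Γ a) (pS Γ a) 1 = vB _ _ 1 := smul_vB_eq_iff.2 (by simpa using hyS)
  have f2 : y • vA (pA Γ a) (pS Γ a) h = vA _ _ h := smul_vA_eq_iff.2 (by
    have : h⁻¹ * y * h = gen Γ s ^ i := by rw [hyh]; group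
    rw [this]
    exact gen_zpow_mem (by simpa using hs) i)
  have f3 := (ta Γ a).cvx_fixS y _ f1 _ f2 (vB_ne_vA _ _)
  obtain ⟨β, hβ, hβ'⟩ := bs_adj_vB_one
    (nxt_adj (ta Γ a).tree (v := vB (pA Γ a) (pS Γ a) 1) (w := vA _ _ h) (vB_ne_vA _ _))
  rw [hβ', mem_fixS, smul_vA_eq_iff] at f3
  have hF : β⁻¹ * y * β ∈ pL Γ a := mem_pL_iff.2 ⟨f3, mul_mem (mul_mem (inv_mem hβ) hyS) hβ⟩
  have hLS : pL Γ a ≤ pS Γ a := parabolic_mono (Set.subset_insert _ _)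
  have hX := (ta Γ b).tree
  have hcv := (ta Γ b).cvx_smul (cvx_YP (Γ := Γ) b (lk Γ a)) β
  obtain ⟨q, hq, hgate⟩ := gate_exists hX hcv ⟨vB _ _ β, by
    change β⁻¹ • vB (pA Γ b) (pS Γ b) β ∈ YP Γ b (lk Γ a)
    rw [smul_vB, inv_mul_cancel]
    exact ⟨1, one_mem _, Or.inr rfl⟩⟩ (vB (pA Γ b) (pS Γ b) 1)
  have g1 : y • vB (pA Γ b) (pS Γ b) 1 = vB _ _ 1 := smul_vB_eq_iff.2 (by simpa using hyS')
  have g2 : y • q = q := (ta Γ b).gate_fixed (Y := {v | β⁻¹ • v ∈ YP Γ b (lk Γ a)}) (by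
    intro v hv
    change β⁻¹ • y • v ∈ YP Γ b (lk Γ a)
    have : β⁻¹ • y • v = (β⁻¹ * y * β) • β⁻¹ • v := by simp [smul_smul, mul_assoc]
    rw [this]
    exact smul_orbY hF hv) g1 hq hgate
  have hst : ∀ x ∈ pS Γ a, x ∈ pS Γ b → x ∈ parabolic Γ {a, b} := fun x h1 h2 =>
    parabolic_mono (TF.st_inter hab) (TF.inter h1 h2)
  obtain ⟨f, hf, hqf⟩ := hq
  by_cases hq1 : vB (pA Γ b) (pS Γ b) 1 = q
  · have hfB : β * f ∈ pS Γ b := by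
      rcases hqf with e | e
      · rw [← hq1, smul_vB] at e
        exact (vB_ne_vA _ _ e).elim
      · rw [← hq1, smul_vB, vB_eq] at e
        have := e
        simpa using this
    have hfS : β * f ∈ pS Γ a := mul_mem hβ (hLS hf)
    have hm := hst _ hfS hfB
    refine ⟨β * f, hm, ?_⟩
    have h1 : (β * f)⁻¹ * y * (β * f) ∈ pL Γ a := by
      have : (β * f)⁻¹ * y * (β * f) = f⁻¹ * (β⁻¹ * y * β) * f := by group
      rw [this]
      exact mul_mem (mul_mem (inv_mem hf) hF) hf
    have h2 := TF.inter h1 (mul_mem (mul_mem (inv_mem hm) hy) hm)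
    have h3 : (β * f)⁻¹ * y * (β * f) ∈ parabolic Γ {b} := parabolic_mono (by
      rintro x ⟨hx, rfl | rfl⟩
      · exact (Γ.graph.loopless.irrefl _ hx).elim
      · rfl) h2
    obtain ⟨j, hj⟩ := mem_zpow h3
    exact ⟨j, Or.inr hj⟩
  · have k1 := (ta Γ b).cvx_fixS y _ g1 _ g2 hq1
    have hYst := cvx_YP (Γ := Γ) b (st Γ a)
    have hqY : q ∈ YP Γ b (st Γ a) := by
      refine ⟨β * f, mul_mem hβ (hLS hf), ?_⟩
      rcases hqf with e | e
      · left; rw [← smul_vA, ← e, smul_inv_smul]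
      · right; rw [← smul_vB, ← e, smul_inv_smul]
    have h1Y : vB (pA Γ b) (pS Γ b) 1 ∈ YP Γ b (st Γ a) := ⟨1, one_mem _, Or.inr rfl⟩
    have k2 := hYst _ h1Y _ hqY hq1
    have k3 := nxt_adj hX hq1
    obtain ⟨f', hf', e | e⟩ := k2
    · rw [e] at k1 k3
      obtain ⟨γ, hγ, e1, e2⟩ := YP_edge hf' (one_mem _) k3.symm
      have hγb : γ ∈ pS Γ b := by simpa using vB_eq.1 e2
      have hm := hst _ hγ hγb
      rw [mem_fixS, e1, smul_vA_eq_iff] at k1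
      obtain ⟨j, hj⟩ := mem_zpow (TF.mem_compl_pair hab.ne
        (mul_mem (mul_mem (inv_mem hm) hy) hm) k1)
      exact ⟨γ, hm, j, Or.inl hj⟩
    · rw [e] at k3
      exact ((ta Γ b).type_ne _ _ k3 rfl).elim

/-- A vertex type element of an edge parabolic is conjugate there to a power of a generator. -/
theorem vertexType_pair [TF Γ] (hab : Γ.graph.Adj a b)
    (hy : y ∈ parabolic Γ {a, b}) (hv : VertexType y) :
    ∃ g ∈ parabolic Γ {a, b}, ∃ i : ℤ, g⁻¹ * y * g = gen Γ a ^ i ∨ g⁻¹ * y * g = gen Γ b ^ i := by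
  obtain ⟨h, s, i, e⟩ := hv
  by_cases hs : s = a
  · have hsb : s ≠ b := by rw [hs]; exact hab.ne
    rw [Set.pair_comm] at hy
    obtain ⟨g, hg, j, hj⟩ := vertexType_pair_aux hab.symm hy hsb e
    rw [Set.pair_comm] at hg
    exact ⟨g, hg, j, hj.symm⟩
  · exact vertexType_pair_aux hab hy hs e

/-- Symmetric form: up to exchanging the two generators, the conjugate is a power of the first. -/
theorem vertexType_pair' [TF Γ] (hab : Γ.graph.Adj a b) (hy : y ∈ parabolic Γ {a, b})
    (hv : VertexType y) : ∃ a' b', Γ.graph.Adj a' b' ∧ ({a, b} : Set V) = {a', b'} ∧ ∃ g ∈ parabolic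
    Γ {a', b'}, ∃ i : ℤ, g⁻¹ * y * g = gen Γ a' ^ i := by
  obtain ⟨g, hg, i, h | h⟩ := vertexType_pair hab hy hv
  · exact ⟨a, b, hab, rfl, g, hg, i, h⟩
  · exact ⟨b, a, hab.symm, Set.pair_comm _ _, g, Set.pair_comm a b ▸ hg, i, h⟩

variable [TF Γ] [Large Γ]

theorem GC.root_aux (hn : n ≠ 0) (N : ℕ) : ∀ (P : Set V), P.ncard ≤ N → ∀ x ∈ parabolic Γ P,
    ∀ y ∈ parabolic Γ P, GC x → GC y → x ^ n = y ^ n → x = y := by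
  induction N with
  | zero =>
    intro P hP x hx y hy hgx _ _
    have : P = ∅ := by
      rw [← Set.ncard_eq_zero (Set.toFinite P)]; omega
    subst this
    rw [parabolic_empty, Subgroup.mem_bot] at hx
    have := hgx.len
    simp [hx] at this
  | succ N ih =>
    intro P hP x hx y hy hgx hgy hxy
    by_cases hj : ∀ u ∈ P, ∃ v : TV Γ u, x • v = v ∧ y • v = v
    · obtain ⟨g, hg, K, hKP, hK, hH⟩ := TF.desc (H := {x, y}) (P := P)
        (by rintro z (rfl | rfl) <;> assumption)
        (fun u hu => by
          simp_all)
      have h1 := hH x (by simp)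
      have h2 := hH y (by simp)
      have l1 := (hgx.conj' g).len
      have l2 := (hgy.conj' g).len
      suffices g⁻¹ * x * g = g⁻¹ * y * g by simpa using this
      rcases clique_cases hK with rfl | ⟨a, rfl⟩ | ⟨a, b, hab, rfl⟩
      · rw [parabolic_empty, Subgroup.mem_bot] at h1 h2
        rw [h1, h2]
      · obtain ⟨i, hi⟩ := mem_zpow h1
        obtain ⟨j, hj⟩ := mem_zpow h2
        rw [hi, len_zpow', len_gen] at l1
        rw [hj, len_zpow', len_gen] at l2
        rw [hi, hj]
        congr 1; omega
      · obtain ⟨a', b', hab', hpair, k, hk, i, hi⟩ :=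
          vertexType_pair' hab h1 (hgx.conj' g).vertexType
        rw [hpair] at h2
        have l3 := ((hgx.conj' g).conj' k).len
        rw [hi, len_zpow', len_gen] at l3
        have i1 : i = 1 := by omega
        subst i1
        have e : (k⁻¹ * (g⁻¹ * y * g) * k) ^ n = gen Γ a' ^ n := by
          rw [conj_zpow', conj_zpow', ← hxy, ← conj_zpow' g, ← conj_zpow' k, hi]; simp
        obtain ⟨j, hj⟩ := pair_root hab' (mul_mem (mul_mem (inv_mem hk) h2) hk) hn e
        have l4 := ((hgy.conj' g).conj' k).len
        rw [hj, len_zpow', len_gen] at l4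
        have j1 : j = 1 := by omega
        subst j1
        rw [← hi] at hj
        simpa using hj.symm
    · exfalso
      push Not at hj
      obtain ⟨u, hu, hno⟩ := hj
      obtain ⟨p, hp, hpx⟩ := exists_fixed_YP (Γ := Γ) (u := u) (P := P) (H := {x})
        (by rintro z rfl; exact hx)
        (by obtain ⟨v, hv⟩ := hgx.vertexType.elliptic u; exact ⟨v, by rintro z rfl; exact hv⟩)
      obtain ⟨q, hq, hqy⟩ := exists_fixed_YP (Γ := Γ) (u := u) (P := P) (H := {y})
        (by rintro z rfl; exact hy)
        (by obtain ⟨v, hv⟩ := hgy.vertexType.elliptic u; exact ⟨v, by rintro z rfl; exact hv⟩)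
      replace hpx := hpx x rfl
      replace hqy := hqy y rfl
      have hX := (ta Γ u).tree
      have hcv := ((ta Γ u).cvx_fixS x).inter (cvx_YP (Γ := Γ) u P)
      obtain ⟨r, ⟨hr1, hr2⟩, hgate⟩ := gate_exists hX hcv ⟨p, hpx, hp⟩ q
      have hrq : r ≠ q := by
        rintro rfl
        exact hno r hr1 hqy
      have hadj := nxt_adj hX hrq
      have hnY := cvx_YP (Γ := Γ) u P _ hr2 _ hq hrq
      have zfix : ∀ (w : ArtinGroup Γ) (v : TV Γ u), w • v = v → w ^ n • v = v := fun w v h =>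
        (MulAction.stabilizer (ArtinGroup Γ) v).zpow_mem h n
      have hnn := (ta Γ u).cvx_fixS (x ^ n) _ (zfix x r hr1) _
        (by rw [mem_fixS, hxy]; exact zfix y q hqy) hrq
      have hnx : x • nxt (TX Γ u) r q ≠ nxt (TX Γ u) r q := by
        intro h
        have h1 := hgate _ ⟨h, hnY⟩
        have h2 := dist_nxt hX hrq
        rw [SimpleGraph.dist_comm (u := q), SimpleGraph.dist_comm (u := q) (v := r)] at h1
        omega
      -- the edge is a translate of the base edge
      obtain ⟨e, he, hedge⟩ : ∃ e ∈ parabolic Γ P, (r = vA _ _ e ∧ nxt (TX Γ u) r q = vB _ _ e) ∨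
            (r = vB _ _ e ∧ nxt (TX Γ u) r q = vA _ _ e) := by
        generalize nxt (TX Γ u) r q = r' at *
        obtain ⟨f, hf, rfl | rfl⟩ := hr2 <;> obtain ⟨f', hf', rfl | rfl⟩ := hnY
        · exact ((ta Γ u).type_ne _ _ hadj rfl).elim
        · obtain ⟨w, hw, e1, e2⟩ := YP_edge hf hf' hadj
          exact ⟨w, hw, Or.inl ⟨e1, e2⟩⟩
        · obtain ⟨w, hw, e1, e2⟩ := YP_edge hf' hf hadj.symm
          exact ⟨w, hw, Or.inr ⟨e2, e1⟩⟩
        · exact ((ta Γ u).type_ne _ _ hadj rfl).elim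
      have hxnr := zfix x r hr1
      rw [mem_fixS] at hnn hr1
      have hAB : x ^ n • vA (pA Γ u) (pS Γ u) e = vA _ _ e ∧
          x ^ n • vB (pA Γ u) (pS Γ u) e = vB _ _ e := by
        rcases hedge with ⟨e1, e2⟩ | ⟨e1, e2⟩
        · grind
        · grind
      have hL : e⁻¹ * x ^ n * e ∈ pL Γ u :=
        mem_pL_iff.2 ⟨smul_vA_eq_iff.1 hAB.1, smul_vB_eq_iff.1 hAB.2⟩
      have hLP : e⁻¹ * x ^ n * e ∈ parabolic Γ (lk Γ u ∩ P) :=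
        TF.inter hL (mul_mem (mul_mem (inv_mem he) (zpow_mem hx n)) he)
      have hind : Indep Γ (lk Γ u ∩ P) := (TF.indep_lk u).mono Set.inter_subset_left
      obtain ⟨f, hf, K, hKL, hK, hH⟩ := TF.desc (H := {e⁻¹ * x ^ n * e}) (P := lk Γ u ∩ P)
        (by rintro z rfl; exact hLP)
        (fun w _ => by
          have : VertexType (e⁻¹ * x ^ n * e) := by
            rw [← conj_zpow']; exact (hgx.conj' e).vertexType.zpow n
          obtain ⟨v, hv⟩ := this.elliptic w
          exact ⟨v, by rintro z rfl; exact hv⟩)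
      replace hH := hH _ rfl
      have hlen : ArtinRigid.len (f⁻¹ * (e⁻¹ * x ^ n * e) * f) = n := by
        rw [len_conj', len_conj', len_zpow', hgx.len, mul_one]
      obtain ⟨d, hd, hdn⟩ : ∃ d ∈ lk Γ u ∩ P, f⁻¹ * (e⁻¹ * x ^ n * e) * f = gen Γ d ^ n := by
        rcases clique_cases hK with rfl | ⟨a, rfl⟩ | ⟨a, b, hab, rfl⟩
        · rw [parabolic_empty, Subgroup.mem_bot] at hH
          rw [hH] at hlen
          simp only [len_one] at hlen
          exact (hn hlen.symm).elim
        · obtain ⟨i, hi⟩ := mem_zpow hH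
          rw [hi, len_zpow', len_gen, mul_one] at hlen
          exact ⟨a, hKL rfl, hlen ▸ hi⟩
        · exact (hind a (hKL (by simp)) b (hKL (by simp)) hab).elim
      have hpow : (e⁻¹ * x * e) ^ n = (f * gen Γ d * f⁻¹) ^ n := by
        rw [conj_zpow', conj_zpow, ← hdn]; group
      have hdL : f * gen Γ d * f⁻¹ ∈ parabolic Γ (lk Γ u ∩ P) :=
        mul_mem (mul_mem hf (gen_mem hd)) (inv_mem hf)
      have hfin : e⁻¹ * x * e = f * gen Γ d * f⁻¹ := by
        have hxe : e⁻¹ * x * e ∈ parabolic Γ P := mul_mem (mul_mem (inv_mem he) hx) he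
        rcases hedge with ⟨e1, e2⟩ | ⟨e1, e2⟩
        · rw [e1, smul_vA_eq_iff] at hr1
          refine ih (P \ {u}) ?_ _ (TF.inter_compl hxe hr1) _ ?_ (hgx.conj' e) ⟨f, d, rfl⟩ hpow
          · rw [Set.ncard_sdiff_singleton_of_mem hu]; omega
          · exact parabolic_mono (by
              intro z hz
              exact ⟨hz.2, by rintro rfl; exact Γ.graph.loopless.irrefl _ hz.1⟩) hdL
        · have hPst : ¬ P ⊆ st Γ u := by
            intro hsub
            refine hno (vB _ _ 1) (smul_vB_eq_iff.2 ?_) (smul_vB_eq_iff.2 ?_)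
            · simpa using parabolic_mono hsub hx
            · simpa using parabolic_mono hsub hy
          rw [e1, smul_vB_eq_iff] at hr1
          refine ih (P ∩ st Γ u) ?_ _ (TF.inter hxe hr1) _ ?_ (hgx.conj' e) ⟨f, d, rfl⟩ hpow
          · have : (P ∩ st Γ u).ncard < P.ncard := Set.ncard_lt_ncard
              ⟨Set.inter_subset_left, fun h => hPst fun z hz => (h hz).2⟩ (Set.toFinite P)
            omega
          · exact parabolic_mono (by
              intro z hz
              exact ⟨hz.2, Set.mem_insert_of_mem _ hz.1⟩) hdL
      have hxL : e⁻¹ * x * e ∈ pL Γ u := by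
        rw [hfin]; exact parabolic_mono Set.inter_subset_left hdL
      rcases hedge with ⟨e1, e2⟩ | ⟨e1, e2⟩
      · rw [e2] at hnx
        exact hnx (smul_vB_eq_iff.2 (mem_pL_iff.1 hxL).2)
      · rw [e2] at hnx
        exact hnx (smul_vA_eq_iff.2 (mem_pL_iff.1 hxL).1)

/-- Uniqueness of roots among conjugates of generators. -/
theorem GC.root (hx : GC x) (hy : GC y) (hn : n ≠ 0) (h : x ^ n = y ^ n) : x = y :=
  GC.root_aux hn _ Set.univ le_rfl x (by simp [parabolic_univ]) y (by simp [parabolic_univ]) hx hy h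

theorem commute_of_commute_zpow
    (hn : n ≠ 0) (h : Commute g (gen Γ s ^ n)) : Commute g (gen Γ s) := by
  have : g * gen Γ s * g⁻¹ = gen Γ s := by
    refine GC.root ⟨g, s, rfl⟩ ⟨1, s, by simp⟩ hn ?_
    rw [conj_zpow, h.eq]; simp
  rw [mul_inv_eq_iff_eq_mul] at this
  exact this

/-- A nonvertex element commuting with two noncommuting elements is dihedral. -/
theorem dihedral_of_commute (hz : ¬ VertexType z) (hx : Commute x z)
    (hy : Commute y z) (hxy : x * y ≠ y * x) : ∃ (g : ArtinGroup Γ) (K : Set V), IsCl Γ K ∧ g⁻¹ * x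
    * g ∈ parabolic Γ K ∧ g⁻¹ * y * g ∈ parabolic Γ K ∧ g⁻¹ * z * g ∈ parabolic Γ K := by
  obtain ⟨g, -, K, -, hK, hH⟩ := TF.desc (Γ := Γ) (H := {x, y, z}) (P := Set.univ)
    (fun h _ => by simp [parabolic_univ]) (fun u _ => by
      have hzu : ∃ v : TV Γ u, z • v = v := by
        by_contra hno
        have hhyp : Hyp (TV Γ u) z := by
          by_contra h; exact hno (not_hyp_iff.1 h)
        obtain ⟨p, hp⟩ := (ta Γ u).comm_elliptic hhyp hx hy
        obtain ⟨v, hv⟩ := exists_fixed_by_centralizer (not_vertexType_comm hxy) ⟨p, hp⟩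
        refine hno ⟨v, hv z ?_⟩
        exact ((hx.symm.mul_right hy.symm).mul_right hx.symm.inv_right).mul_right hy.symm.inv_right
      obtain ⟨v, hv⟩ := exists_fixed_by_centralizer hz hzu
      refine ⟨v, ?_⟩
      simp_all)
  exact ⟨g, K, hK, hH x (by simp), hH y (by simp), hH z (by simp)⟩

/-- Noncommuting `x, y` with a power of `xy` central in `⟨x, y⟩` lie in a common conjugate of the
parabolic of a clique. -/
theorem dihedral_of_pow_commute (hN : N ≠ 0) (hx : Commute x ((x * y) ^ N))
    (hy : Commute y ((x * y) ^ N)) (hxy : x * y ≠ y * x) : ∃ (g : ArtinGroup Γ) (K : Set V), IsCl Γ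
    K ∧ g⁻¹ * x * g ∈ parabolic Γ K ∧ g⁻¹ * y * g ∈ parabolic Γ K := by
  by_cases hz : VertexType ((x * y) ^ N)
  · exfalso
    have hne : x * y ≠ 1 := by
      intro h
      rw [mul_eq_one_iff_eq_inv] at h
      subst h
      simp at hxy
    have key : ∀ (g : ArtinGroup Γ) (a : V) (j : ℤ), g⁻¹ * (x * y) * g ≠ gen Γ a ^ j := by
      intro g a j hj
      have hj0 : j ≠ 0 := by
        rintro rfl
        apply hne
        rw [zpow_zero] at hj
        calc x * y = g * (g⁻¹ * (x * y) * g) * g⁻¹ := by group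
          _ = 1 := by rw [hj]; group
      have hxN : Commute (g⁻¹ * x * g) (gen Γ a ^ (j * N)) := by
        rw [zpow_mul, ← hj, zpow_natCast, ← zpow_natCast, conj_zpow', zpow_natCast]
        have h1 := hx.map (MulAut.conj g⁻¹).toMonoidHom
        simpa using h1
      have h2 := (commute_of_commute_zpow (by positivity) hxN).zpow_right j
      rw [← hj] at h2
      have h3 := h2.map (MulAut.conj g).toMonoidHom
      have h4 : Commute x (x * y) := by
        have e1 : (MulAut.conj g).toMonoidHom (g⁻¹ * x * g) = x := by
          change g * (g⁻¹ * x * g) * g⁻¹ = x; group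
        have e2 : (MulAut.conj g).toMonoidHom (g⁻¹ * (x * y) * g) = x * y := by
          change g * (g⁻¹ * (x * y) * g) * g⁻¹ = x * y; group
        rwa [e1, e2] at h3
      apply hxy
      have h5 := h4.eq
      rw [mul_assoc] at h5
      exact mul_left_cancel h5
    obtain ⟨g, -, K, -, hK, hH⟩ := TF.desc (Γ := Γ) (H := {x * y}) (P := Set.univ)
      (fun h _ => by simp [parabolic_univ]) (fun u _ => by
        obtain ⟨v, hv⟩ := hz.elliptic u
        obtain ⟨w, hw⟩ := (ta Γ u).elliptic_of_pow hN hv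
        exact ⟨w, by rintro h rfl; exact hw⟩)
    replace hH := hH _ rfl
    rcases clique_cases hK with rfl | ⟨a, rfl⟩ | ⟨a, b, hab, rfl⟩
    · rw [parabolic_empty, Subgroup.mem_bot] at hH
      apply hne
      calc x * y = g * (g⁻¹ * (x * y) * g) * g⁻¹ := by group
        _ = 1 := by rw [hH]; group
    · obtain ⟨i, hi⟩ := mem_zpow hH
      exact key g a i hi
    · have hv : VertexType ((g⁻¹ * (x * y) * g) ^ N) := by
        rw [← zpow_natCast, conj_zpow', zpow_natCast]
        simpa using hz.conj g⁻¹
      obtain ⟨a', b', hab', hpair, k, hk, i, hi⟩ := vertexType_pair' hab (pow_mem hH N) hv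
      rw [hpair] at hH
      rw [← zpow_natCast, ← conj_zpow'] at hi
      have hmem := mul_mem (mul_mem (inv_mem hk) hH) hk
      by_cases hi0 : i = 0
      · subst hi0
        have := pair_torsion_free hab' hmem (n := (N : ℤ)) (by exact_mod_cast hN)
          (by simpa using hi)
        apply hne
        calc x * y = (g * k) * (k⁻¹ * (g⁻¹ * (x * y) * g) * k) * (g * k)⁻¹ := by group
          _ = 1 := by rw [this]; group
      · obtain ⟨j, hj⟩ := pair_root hab' hmem hi0 hi
        apply key (g * k) a' j
        rw [← hj]; group
  · obtain ⟨g, K, hK, h1, h2, -⟩ := dihedral_of_commute hz hx hy hxy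
    exact ⟨g, K, hK, h1, h2⟩

/-- The exponent making `(xy)^N` commute with `x` and `y` from a braid relation. -/
theorem braid_pow_commute {G : Type*} [Group G] {x y : G} (hm : 2 ≤ m)
    (h : altProd x y m = altProd y x m) :
    ∃ N : ℕ, N ≠ 0 ∧ (N = dN m) ∧ Commute x ((x * y) ^ N) ∧ Commute y ((x * y) ^ N) := by
  rcases Nat.even_or_odd' m with ⟨k, rfl | rfl⟩
  · rw [altProd_even, altProd_even] at h
    refine ⟨k, by omega, dN_even.symm, ?_, ?_⟩
    · change x * (x * y) ^ k = (x * y) ^ k * x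
      rw [pow_mul_swap, ← h]
    · change y * (x * y) ^ k = (x * y) ^ k * y
      rw [← pow_mul_swap, h]
  · rw [altProd_odd, altProd_odd] at h
    refine ⟨2 * k + 1, by omega, dN_odd.symm, ?_, ?_⟩
    all_goals
      have e1 : (x * y) ^ (2 * k + 1) = ((x * y) ^ k * x) * ((x * y) ^ k * x) := by
        calc (x * y) ^ (2 * k + 1) = (x * y) ^ k * ((x * y) * (x * y) ^ k) := by
              rw [← pow_succ', ← pow_add]; congr 1; omega
          _ = (x * y) ^ k * x * (y * (x * y) ^ k) := by simp only [mul_assoc]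
          _ = _ := by rw [← pow_mul_swap, ← h]
      have e2 : x * ((x * y) ^ k * x) = ((x * y) ^ k * x) * y := by
        calc x * ((x * y) ^ k * x) = x * (y * x) ^ k * y := by rw [h, mul_assoc]
          _ = _ := by rw [← pow_mul_swap]
      have e3 : y * ((x * y) ^ k * x) = ((x * y) ^ k * x) * x := by
        rw [← mul_assoc, ← pow_mul_swap, ← h]
      rw [e1]
      generalize (x * y) ^ k * x = δ at *
    · change _ * _ = _ * _
      grind
    · change _ * _ = _ * _
      grind

end

section

section General

variable {G : Type*} [Group G] {A B : Subgroup G}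
variable {x y z : G}

/-- Two elements commuting with `z` share a fixed vertex, unless `z` or their commutator is
conjugate into the edge group. -/
theorem Amalg.common_fixed (h : Amalg A B) (hx : Commute x z) (hy : Commute y z)
    (hk : ∀ g, ¬ (g⁻¹ * (x * y * x⁻¹ * y⁻¹) * g ∈ A ∧ g⁻¹ * (x * y * x⁻¹ * y⁻¹) * g ∈ B))
    (hz : ∀ g, ¬ (g⁻¹ * z * g ∈ A ∧ g⁻¹ * z * g ∈ B)) :
    ∃ v : BSVert A B, x • v = v ∧ y • v = v := by
  have ht := h.treeAction
  have hfix : ∀ (w : G) (v v' : BSVert A B), (bsTree A B).Adj v v' → w • v = v → w • v' = v' →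
      ∃ g, g⁻¹ * w * g ∈ A ∧ g⁻¹ * w * g ∈ B := fun w v v' ha h1 h2 => bs_fix_adj ha h1 h2
  by_cases hyp : Hyp (BSVert A B) z
  · exfalso
    obtain ⟨p, hp⟩ := ht.comm_elliptic hyp hx hy
    have hc : Commute (x * y * x⁻¹ * y⁻¹) z :=
      ((hx.mul_left hy).mul_left hx.inv_left).mul_left hy.inv_left
    obtain ⟨i, hi⟩ := ht.elliptic_fix_flow hyp hc hp p
    obtain ⟨g, hg⟩ := hfix _ _ _ (ht.flow_adj hyp ((flow (bsTree A B) z)^[i] p)) (hi i le_rfl) (by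
      have := hi (i + 1) (by omega)
      rwa [Function.iterate_succ_apply'] at this)
    exact hk g hg
  · obtain ⟨v, hv⟩ := not_hyp_iff.1 hyp
    have key : ∀ c, Commute c z → c • v = v := by
      intro c hc
      by_contra hne
      have h1 : z • c • v = c • v := by rw [smul_smul, ← hc.eq, mul_smul, hv]
      obtain ⟨g, hg⟩ := hfix z _ _ (nxt_adj ht.tree (Ne.symm hne)) hv
        (ht.cvx_fixS z _ hv _ h1 (Ne.symm hne))
      exact hz g hg
    exact ⟨v, key x hx, key y hy⟩

end General

section Graph

variable {W : Type v} {Λ : DefiningGraph W}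
variable {i j : ℤ}

theorem conn_induct {G : SimpleGraph W} (hc : G.Preconnected) {P : W → Prop} {a : W} (h0 : P a)
    (hs : ∀ x y, G.Adj x y → P x → P y) (b : W) : P b := by
  obtain ⟨p⟩ := hc a b
  induction p with
  | nil => exact h0
  | cons hadj _ ih => exact ih (hs _ _ hadj h0)

theorem exists_adj {G : SimpleGraph W} [Nontrivial W] (hc : G.Preconnected) (a : W) :
    ∃ b, G.Adj a b := by
  obtain ⟨b, hb⟩ := exists_ne a
  by_contra hno
  push Not at hno
  exact hb (conn_induct hc (P := fun x => x = a) rfl (fun x y hxy hx => (hno y (hx ▸ hxy)).elim) b)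

/-- The homomorphism counting a generator all of whose labels are even. -/
noncomputable def chi (Λ : DefiningGraph W) (w : W)
    (h : ∀ x, Λ.graph.Adj w x → Even (Λ.label w x)) : ArtinGroup Λ →* Multiplicative ℤ :=
  open Classical in
  liftHom (fun x => if x = w then Multiplicative.ofAdd 1 else 1) (by
    intro a b hab
    by_cases ha : a = w
    · obtain ⟨k, hk⟩ := h b (ha ▸ hab)
      rw [ha, hk, ← two_mul, altProd_even, altProd_even, mul_comm]
    · by_cases hb : b = w
      · obtain ⟨k, hk⟩ := h a (hb ▸ hab.symm)
        rw [hb, Λ.label_symm, hk, ← two_mul, altProd_even, altProd_even, mul_comm]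
      · simp [ha, hb])

@[simp] theorem chi_self (w : W) (h) : chi Λ w h (gen Λ w) = Multiplicative.ofAdd 1 := by
  simp [chi]

theorem chi_of_ne {w x : W} (h) (hx : x ≠ w) : chi Λ w h (gen Λ x) = 1 := by
  simp [chi, hx]

theorem chi_parabolic {w : W} (h) {g : ArtinGroup Λ} (hg : g ∈ parabolic Λ {w}ᶜ) :
    chi Λ w h g = 1 := by
  have : parabolic Λ {w}ᶜ ≤ (chi Λ w h).ker := parabolic_le fun x hx => chi_of_ne h hx
  exact this hg

theorem parabolic_comm {S : Set W} (h : ∀ a ∈ S, ∀ b ∈ S, Commute (gen Λ a) (gen Λ b))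
    {x y : ArtinGroup Λ} (hx : x ∈ parabolic Λ S) (hy : y ∈ parabolic Λ S) : Commute x y := by
  have h1 : ∀ a ∈ S, parabolic Λ S ≤ Subgroup.centralizer {gen Λ a} := fun a ha =>
    parabolic_le fun b hb => Subgroup.mem_centralizer_singleton_iff.2 (h b hb a ha).eq
  have h2 : parabolic Λ S ≤ Subgroup.centralizer {y} := parabolic_le fun a ha =>
    Subgroup.mem_centralizer_singleton_iff.2
      (Subgroup.mem_centralizer_singleton_iff.1 (h1 a ha hy)).symm
  exact Subgroup.mem_centralizer_singleton_iff.1 (h2 hx)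

theorem gen_zpow_ne {w w' : W} (h : w ≠ w') (he : gen Λ w ^ i = gen Λ w' ^ j) : i = 0 :=
  zpow_mem_compl (by rw [he]; exact gen_zpow_mem (by simpa using h.symm) j)

theorem len_zero_pow_of {w w' : W} (h : w ≠ w') (hij : i ≠ 0 ∨ j ≠ 0) :
    gen Λ w ^ i * gen Λ w' ^ j ≠ 1 := by
  intro he
  have h1 : gen Λ w ^ i = gen Λ w' ^ (-j) := by
    rw [zpow_neg]; exact mul_eq_one_iff_eq_inv.1 he
  have h2 := gen_zpow_ne h h1
  have h3 := gen_zpow_ne h.symm h1.symm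
  omega

end Graph

variable {V : Type u} {Γ : DefiningGraph V} [Finite V]
variable {x y z : ArtinGroup Γ} {a b u : V} {r : ℤ}

variable [TF Γ] [Large Γ]

theorem zc_not_vertexType (hab : Γ.graph.Adj a b) (h : VertexType (zc Γ a b ^ r)) : r = 0 := by
  obtain ⟨g, hg, i, h | h⟩ := vertexType_pair hab (zpow_mem (zc_mem a b) r) h
  all_goals
    have hc := ((zc_central hab hg).zpow_left r).eq
    rw [mul_assoc, hc, inv_mul_cancel_left] at h
  · exact (pair_zpow_eq hab h.symm).2
  · rw [← zc_comm hab] at h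
    exact (pair_zpow_eq hab.symm h.symm).2

/-- Centralizers of elements hyperbolic in some tree are abelian. -/
theorem hyp_centralizer
    (hz : Hyp (TV Γ u) z) (hx : Commute x z) (hy : Commute y z) : x * y = y * x := by
  by_contra hxy
  obtain ⟨p, hp⟩ := (ta Γ u).comm_elliptic hz hx hy
  obtain ⟨v, hv⟩ := exists_fixed_by_centralizer (not_vertexType_comm hxy) ⟨p, hp⟩
  refine hz v (hv z ?_)
  exact ((hx.symm.mul_right hy.symm).mul_right hx.symm.inv_right).mul_right hy.symm.inv_right

/-- An elliptic element commuting with a hyperbolic one is of vertex type. -/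
theorem vertexType_of_commute_hyp
    (hz : Hyp (TV Γ u) z) (hx : Commute x z) (he : ∃ v : TV Γ u, x • v = v) : VertexType x := by
  by_contra hn
  obtain ⟨v, hv⟩ := exists_fixed_by_centralizer hn he
  exact hz v (hv z hx.symm)

theorem VertexType.len_ne (h : VertexType x) (hx : x ≠ 1) : len x ≠ 0 := fun h0 => hx (h.eq_one h0)

section Iso

variable {W : Type v} [Finite W] {Λ : DefiningGraph W} (ψ : ArtinGroup Γ ≃* ArtinGroup Λ)
variable {x y : ArtinGroup Γ}

theorem map_comm_ne (h : x * y ≠ y * x) : ψ x * ψ y ≠ ψ y * ψ x := by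
  rw [← map_mul, ← map_mul]
  exact fun e => h (ψ.injective e)

include ψ in
theorem connected_of_iso (hc : Γ.graph.Preconnected) [Nontrivial V] : Λ.graph.Connected := by
  obtain ⟨a0⟩ := (inferInstance : Nonempty V)
  have gne : ∀ a, gen Γ a ≠ 1 := fun a h => by
    have := gen_zpow_eq_one (i := 1) (by simpa using h); omega
  have hW : Nonempty W := by
    by_contra hno
    rw [not_nonempty_iff] at hno
    have h1 : (⊤ : Subgroup (ArtinGroup Λ)) = ⊥ := by
      rw [← parabolic_univ, Set.eq_empty_of_isEmpty Set.univ, parabolic_empty]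
    have h2 : ψ (gen Γ a0) ∈ (⊤ : Subgroup (ArtinGroup Λ)) := Subgroup.mem_top _
    rw [h1, Subgroup.mem_bot] at h2
    exact gne a0 (by simpa using h2)
  by_contra hnc
  have hnp : ¬ Λ.graph.Preconnected := fun h => hnc ⟨h⟩
  unfold SimpleGraph.Preconnected at hnp
  push Not at hnp
  obtain ⟨w0, w1, h01⟩ := hnp
  obtain ⟨P, hP⟩ : ∃ P : Set W, P = {w | Λ.graph.Reachable w0 w} := ⟨_, rfl⟩
  have hw0 : w0 ∈ P := by rw [hP]; exact SimpleGraph.Reachable.refl _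
  have hw1 : w1 ∉ P := by rw [hP]; exact h01
  have hcl : ∀ a b, Λ.graph.Adj a b → a ∈ P → b ∈ P := by
    intro a b hab ha
    rw [hP] at ha ⊢
    exact SimpleGraph.Reachable.trans ha hab.reachable
  obtain ⟨ham, hint⟩ := visual_amalg (Γ := Λ) (P := P) (Q := Pᶜ) (fun v => em _) (by
    intro a b hab
    by_cases ha : a ∈ P
    · exact Or.inl ⟨ha, hcl a b hab ha⟩
    · exact Or.inr ⟨ha, fun hb => ha (hcl b a hab.symm hb)⟩)
  rw [Set.inter_compl_self, parabolic_empty] at hint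
  have htriv : ∀ x : ArtinGroup Λ, x ≠ 1 → ∀ g, ¬ (g⁻¹ * x * g ∈ parabolic Λ P ∧
      g⁻¹ * x * g ∈ parabolic Λ Pᶜ) := by
    intro x hx g hg
    have := Subgroup.mem_inf.2 hg
    rw [hint, Subgroup.mem_bot] at this
    apply hx
    calc x = g * (g⁻¹ * x * g) * g⁻¹ := by group
      _ = 1 := by rw [this]; group
  have huniq : ∀ (x : ArtinGroup Λ), x ≠ 1 → ∀ v w : BSVert (parabolic Λ P) (parabolic Λ Pᶜ),
      x • v = v → x • w = w → v = w := by
    intro x hx v w hv hw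
    by_contra hne
    obtain ⟨g, hg⟩ := bs_fix_adj (nxt_adj ham.treeAction.tree hne) hv
      (ham.treeAction.cvx_fixS x _ hv _ hw hne)
    exact htriv x hx g hg
  have hedge : ∀ a b, Γ.graph.Adj a b → ∃ v : BSVert (parabolic Λ P) (parabolic Λ Pᶜ),
      ψ (gen Γ a) • v = v ∧ ψ (gen Γ b) • v = v := by
    intro a b hab
    have hz1 : zc Γ a b ≠ 1 := by
      intro h
      have := len_zc (Γ := Γ) a b
      rw [h] at this
      have h2 := two_le_dN hab
      simp only [len_one] at this
      omega
    have hnc := pair_not_commute hab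
    refine ham.common_fixed (z := ψ (zc Γ a b))
      ((zc_central hab (gen_mem_pair_left a b)).symm.map ψ)
      ((zc_central hab (gen_mem_pair_right a b)).symm.map ψ) (htriv _ ?_) (htriv _ ?_)
    · intro h
      have h' := map_comm_ne ψ hnc
      apply h'
      rw [mul_inv_eq_one, mul_inv_eq_iff_eq_mul] at h
      exact h
    · simpa using hz1
  obtain ⟨b0, hb0⟩ := exists_adj hc a0
  obtain ⟨p, hp, -⟩ := hedge a0 b0 hb0
  have hall : ∀ a, ψ (gen Γ a) • p = p := conn_induct hc (P := fun a => ψ (gen Γ a) • p = p) hp (by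
    intro a b hab ha
    obtain ⟨v, h1, h2⟩ := hedge a b hab
    have : v = p := huniq _ (by simpa using gne a) v p h1 ha
    rw [← this]; exact h2)
  have hG : ∀ g : ArtinGroup Λ, g • p = p := by
    intro g
    have h1 : parabolic Γ Set.univ ≤ (MulAction.stabilizer (ArtinGroup Λ) p).comap ψ.toMonoidHom :=
      parabolic_le fun a _ => hall a
    rw [parabolic_univ] at h1
    have h2 := h1 (Subgroup.mem_top (ψ.symm g))
    change ψ (ψ.symm g) • p = p at h2
    simpa using h2
  rcases bs_cases p with ⟨g, rfl⟩ | ⟨g, rfl⟩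
  · have := smul_vA_eq_iff.1 (hG (g * gen Λ w1 * g⁻¹))
    have e : g⁻¹ * (g * gen Λ w1 * g⁻¹) * g = gen Λ w1 ^ (1 : ℤ) := by group
    rw [e] at this
    have := zpow_mem_compl (parabolic_mono (by rintro x hx rfl; exact hw1 hx) this)
    omega
  · have := smul_vB_eq_iff.1 (hG (g * gen Λ w0 * g⁻¹))
    have e : g⁻¹ * (g * gen Λ w0 * g⁻¹) * g = gen Λ w0 ^ (1 : ℤ) := by group
    rw [e] at this
    have := zpow_mem_compl (parabolic_mono (by rintro x hx rfl; exact hx hw0) this)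
    omega

/-- No commuting set of generators of the target hangs off a single vertex-type generator. -/
theorem no_commuting_branch (hc : Γ.graph.Preconnected) [Nontrivial V] {Q : Set W} {w w' : W}
    (hw : w ∈ Q) (hw' : w' ∉ Q) (hadj : ∀ x ∈ Q, ∀ y, Λ.graph.Adj x y → y ∈ Q ∨ y = w') (hcomm : ∀ x
    ∈ insert w' Q, ∀ y ∈ insert w' Q, Commute (gen Λ x) (gen Λ y))
    (hv : VertexType (ψ.symm (gen Λ w'))) : False := by
  obtain ⟨ham, hint⟩ := visual_amalg (Γ := Λ) (P := Qᶜ) (Q := insert w' Q)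
    (fun v => by by_cases h : v ∈ Q <;> simp [h]) (by
      intro a b hab
      by_cases ha : a ∈ Q
      · grind
      · by_cases hb : b ∈ Q
        · right
          exact ⟨(hadj b hb a hab.symm).symm, Set.mem_insert_of_mem _ hb⟩
        · exact Or.inl ⟨ha, hb⟩)
  have hQ : Qᶜ ∩ insert w' Q = {w'} := by
    ext x
    simp only [Set.mem_inter_iff, Set.mem_compl_iff, Set.mem_insert_iff, Set.mem_singleton_iff]
    constructor
    · simp_all
    · rintro rfl
      exact ⟨hw', Or.inl rfl⟩
  rw [hQ] at hint
  have hvt : ∀ x : ArtinGroup Λ, (∃ g, g⁻¹ * x * g ∈ parabolic Λ Qᶜ ∧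
      g⁻¹ * x * g ∈ parabolic Λ (insert w' Q)) → VertexType (ψ.symm x) := by
    rintro x ⟨g, hg⟩
    have := Subgroup.mem_inf.2 hg
    rw [hint] at this
    obtain ⟨i, hi⟩ := mem_zpow this
    have hx : x = g * gen Λ w' ^ i * g⁻¹ := by rw [← hi]; group
    rw [hx, map_mul, map_mul, map_inv, map_zpow]
    exact (hv.zpow i).conj _
  have hlab : ∀ x, Λ.graph.Adj w x → Even (Λ.label w x) := by
    intro x hx
    have h1 : x ∈ insert w' Q := (hadj w hw x hx).symm
    have := adj_of_commute hx.ne (hcomm w (Set.mem_insert_of_mem _ hw) x h1)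
    rw [this.2]; exact even_two
  have hfix : ∀ a b, Γ.graph.Adj a b →
      chi Λ w hlab (ψ (gen Γ a)) = 1 ∧ chi Λ w hlab (ψ (gen Γ b)) = 1 := by
    intro a b hab
    have hnc := pair_not_commute hab
    obtain ⟨v, h1, h2⟩ := ham.common_fixed (z := ψ (zc Γ a b))
      ((zc_central hab (gen_mem_pair_left a b)).symm.map ψ)
      ((zc_central hab (gen_mem_pair_right a b)).symm.map ψ)
      (fun g hg => by
        have := hvt _ ⟨g, hg⟩
        simp only [map_mul, map_inv, MulEquiv.symm_apply_apply] at this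
        exact not_vertexType_comm hnc this)
      (fun g hg => by
        have := hvt _ ⟨g, hg⟩
        rw [MulEquiv.symm_apply_apply] at this
        have := zc_not_vertexType hab (r := 1) (by simpa using this)
        omega)
    rcases bs_cases v with ⟨g, rfl⟩ | ⟨g, rfl⟩
    · have key : ∀ x : ArtinGroup Λ, g⁻¹ * x * g ∈ parabolic Λ Qᶜ → chi Λ w hlab x = 1 := by
        intro x hx
        have h3 := chi_parabolic hlab (parabolic_mono (by rintro y hy rfl; exact hy hw) hx)
        rw [map_mul, map_mul, map_inv] at h3
        rwa [mul_right_comm, inv_mul_cancel, one_mul] at h3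
      exact ⟨key _ (smul_vA_eq_iff.1 h1), key _ (smul_vA_eq_iff.1 h2)⟩
    · exfalso
      apply map_comm_ne ψ hnc
      have h3 := parabolic_comm hcomm (smul_vB_eq_iff.1 h1) (smul_vB_eq_iff.1 h2)
      have h4 := h3.map (MulAut.conj g).toMonoidHom
      have e : ∀ x : ArtinGroup Λ, (MulAut.conj g).toMonoidHom (g⁻¹ * x * g) = x := fun x => by
        change g * (g⁻¹ * x * g) * g⁻¹ = x
        group
      rw [e, e] at h4
      exact h4.eq
  have hker : parabolic Γ Set.univ ≤ ((chi Λ w hlab).comp ψ.toMonoidHom).ker := by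
    refine parabolic_le fun a _ => ?_
    obtain ⟨b, hb⟩ := exists_adj hc a
    exact (hfix a b hb).1
  rw [parabolic_univ] at hker
  have h1 := hker (Subgroup.mem_top (ψ.symm (gen Λ w)))
  change chi Λ w hlab (ψ (ψ.symm (gen Λ w))) = 1 at h1
  simp_all

end Iso

end

section

section Dihedral

variable {D : Type u} [Group D] {a b : D} {m : ℕ} {ℓ : D →* Multiplicative ℤ}
variable {T : Type*} [MulAction D T] {p : T} {x y y' z : D} {X : SimpleGraph T} {d d' : ℤ}

/-- `y` translates the ray `flow^n p` by `d` far out. -/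
def Shift (X : SimpleGraph T) (z : D) (p : T) (y : D) (d : ℤ) : Prop :=
  ∃ n₀ : ℕ, ∀ n n' : ℕ, n₀ ≤ n → n₀ ≤ n' → (n' : ℤ) = n + d →
    y • (flow X z)^[n] p = (flow X z)^[n'] p

theorem Shift.mul (h : Shift X z p y d) (h' : Shift X z p y' d') : Shift X z p (y * y') (d + d') := by
  obtain ⟨n₀, h⟩ := h
  obtain ⟨n₁, h'⟩ := h'
  refine ⟨n₀ + n₁ + d.natAbs + d'.natAbs, fun n n' hn hn' he => ?_⟩
  obtain ⟨k, hk⟩ : ∃ k : ℕ, (k : ℤ) = n + d' := ⟨(n + d').toNat, by omega⟩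
  rw [mul_smul, h' n k (by omega) (by omega) hk, h k n' (by omega) (by omega) (by omega)]

theorem Shift.inv (h : Shift X z p y d) : Shift X z p y⁻¹ (-d) := by
  obtain ⟨n₀, h⟩ := h
  refine ⟨n₀, fun n n' hn hn' he => ?_⟩
  rw [inv_smul_eq_iff, h n' n hn' hn (by omega)]

theorem Shift.one : Shift X z p (1 : D) 0 :=
  ⟨0, fun n n' _ _ he => by rw [one_smul, show n' = n by omega]⟩

theorem Shift.zpow (h : Shift X z p y d) (i : ℤ) : Shift X z p (y ^ i) (i * d) := by
  induction i using Int.induction_on with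
  | zero => simpa using Shift.one
  | succ i ih => rw [zpow_add_one, add_mul, one_mul]; exact ih.mul h
  | pred i ih => rw [zpow_sub_one, sub_mul, one_mul, sub_eq_add_neg]; exact ih.mul h.inv

theorem TreeAction.exists_shift {τ : T → Bool} (h : TreeAction D X τ)
    (hz : Hyp T z) (hy : Commute y z) (p : T) : ∃ d, Shift X z p y d := by
  obtain ⟨i, j, hij⟩ := h.flow_merge hz (y • p) p
  refine ⟨j - i, i + j, fun n n' hn hn' he => ?_⟩
  rw [h.flow_iterate_smul hz hy]
  obtain ⟨k, rfl⟩ : ∃ k, n = k + i := ⟨n - i, by omega⟩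
  obtain rfl : n' = k + j := by omega
  rw [Function.iterate_add_apply, hij, ← Function.iterate_add_apply]

/-- The centralizer of a noncentral element of a dihedral Artin group has rank one modulo the
centre. -/
theorem Dih.centralizer_rank (h : Dih a b m ℓ) (hx : ∀ r : ℤ, x ≠ dz a b m ^ r) : ∃ d : D →
    ℤ, d x ≠ 0 ∧ ∀ y, Commute y x → ∃ r : ℤ, x ^ d y * y ^ (-d x) = dz a b m ^ r := by
  classical
  have ta := h.amalg.1.treeAction
  by_cases hh : Hyp (BSVert (dT a b) (dV a b m)) x
  · let p : BSVert (dT a b) (dV a b m) := vA _ _ 1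
    have key : ∀ y, ∃ d, Commute y x → Shift (bsTree (dT a b) (dV a b m)) x p y d := by
      intro y
      by_cases hy : Commute y x
      · obtain ⟨d, hd⟩ := ta.exists_shift hh hy p
        exact ⟨d, fun _ => hd⟩
      · exact ⟨0, fun h => absurd h hy⟩
    choose d hd using key
    have two : ∀ k, Shift (bsTree (dT a b) (dV a b m)) x p k 0 → ∃ r : ℤ, k = dz a b m ^ r := by
      rintro k ⟨n₀, hk⟩
      refine h.fix_two (v := (flow (bsTree (dT a b) (dV a b m)) x)^[n₀] p)
        (w := (flow (bsTree (dT a b) (dV a b m)) x)^[n₀ + 1] p) ?_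
        (hk _ _ le_rfl le_rfl (by omega)) (hk _ _ (by omega) (by omega) (by omega))
      rw [Function.iterate_succ_apply']
      exact (ta.flow_adj hh _).ne
    refine ⟨d, fun h0 => ?_, fun y hy => two _ ?_⟩
    · have := hd x (Commute.refl x)
      grind
    · have := ((hd x (Commute.refl x)).zpow (d y)).mul ((hd y hy).zpow (-d x))
      grind
  · obtain ⟨p, hp⟩ := not_hyp_iff.1 hh
    have fixp : ∀ y, Commute y x → y • p = p := by
      intro y hy
      by_contra hne
      obtain ⟨r, hr⟩ := h.fix_two hne (by rw [← mul_smul, ← hy.eq, mul_smul, hp]) hp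
      exact hx r hr
    rcases bs_cases p with ⟨g, rfl⟩ | ⟨g, rfl⟩
    · have key : ∀ y, ∃ j : ℤ, Commute y x → y = g * (a * b) ^ j * g⁻¹ := by
        intro y
        by_cases hy : Commute y x
        · obtain ⟨j, hj⟩ := smul_vA_eq_iff.1 (fixp y hy)
          refine ⟨j, fun _ => ?_⟩
          have hj : (a * b) ^ j = g⁻¹ * y * g := hj
          rw [hj]; group
        · exact ⟨0, fun h => absurd h hy⟩
      choose d hd using key
      refine ⟨d, fun h0 => hx 0 ?_, fun y hy => ⟨0, ?_⟩⟩
      · rw [hd x (Commute.refl x), h0]; simp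
      · have e1 : x ^ d y = g * (a * b) ^ (d x * d y) * g⁻¹ := by
          conv_lhs => rw [hd x (Commute.refl x)]
          rw [conj_zpow, zpow_mul]
        have e2 : y ^ (-d x) = g * (a * b) ^ (-(d x * d y)) * g⁻¹ := by
          conv_lhs => rw [hd y hy]
          rw [conj_zpow, ← zpow_mul, mul_neg, mul_comm]
        rw [e1, e2, zpow_neg]; simp
    · have key : ∀ y, ∃ j : ℤ, Commute y x → ∃ r : ℤ,
          y = g * dc a b m ^ j * g⁻¹ * dz a b m ^ r := by
        intro y
        by_cases hy : Commute y x
        · obtain ⟨j, r, hj⟩ := h.mem_dV.1 (smul_vB_eq_iff.1 (fixp y hy))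
          refine ⟨j, fun _ => ⟨r, ?_⟩⟩
          rw [mul_assoc, ((h.central g⁻¹).zpow_left r).symm.eq, ← mul_assoc, mul_assoc g, ← hj]
          group
        · exact ⟨0, fun h => absurd h hy⟩
      choose d hd using key
      have pw : ∀ y, Commute y x → ∀ i : ℤ, ∃ r : ℤ,
          y ^ i = g * dc a b m ^ (d y * i) * g⁻¹ * dz a b m ^ r := by
        intro y hy i
        obtain ⟨r, hr⟩ := hd y hy
        refine ⟨r * i, ?_⟩
        conv_lhs => rw [hr]
        rw [((h.central _).zpow_left r).symm.mul_zpow, conj_zpow, ← zpow_mul, ← zpow_mul]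
      refine ⟨d, fun h0 => ?_, fun y hy => ?_⟩
      · obtain ⟨r, hr⟩ := hd x (Commute.refl x)
        exact hx r (by rw [hr, h0]; simp)
      · obtain ⟨r, hr⟩ := pw x (Commute.refl x) (d y)
        obtain ⟨s, hs⟩ := pw y hy (-d x)
        refine ⟨r + s, ?_⟩
        rw [hr, hs, mul_assoc _ (dz a b m ^ r), ((h.central _).zpow_left r).eq, mul_assoc _ _ (dz a b m ^ r),
          ← zpow_add, ← mul_assoc, add_comm s r]
        have : d y * -d x = -(d x * d y) := by ring
        simp_all

end Dihedral

variable {V : Type u} {Γ : DefiningGraph V} [Finite V]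
variable {x y : ArtinGroup Γ} {a b : V}

theorem pair_centralizer_rank [TF Γ] [Large Γ] (hab : Γ.graph.Adj a b)
    (hx : x ∈ parabolic Γ {a, b}) (hn : ∀ r : ℤ, x ≠ zc Γ a b ^ r) : ∃ d : ArtinGroup Γ → ℤ, d x ≠ 0
    ∧ ∀ y ∈ parabolic Γ {a, b}, Commute y x → ∃ r : ℤ, x ^ d y * y ^ (-d x) = zc Γ a b ^ r := by
  classical
  obtain ⟨d, hd, h⟩ := (dih_pair hab).centralizer_rank (x := ⟨x, hx⟩) (fun r hr => hn r (by
      have := congrArg Subtype.val hr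
      rwa [Subgroup.coe_zpow, coe_dz] at this))
  refine ⟨fun y => if hy : y ∈ parabolic Γ {a, b} then d ⟨y, hy⟩ else 0, by simpa [hx] using hd,
    fun y hy hc => ?_⟩
  obtain ⟨r, hr⟩ := h ⟨y, hy⟩ (commute_coe hy hx hc)
  refine ⟨r, ?_⟩
  have := congrArg Subtype.val hr
  rw [Subgroup.coe_zpow, coe_dz] at this
  simpa [hx, hy] using this

/-- Commuting conjugates of standard generators are equal. -/
theorem GC.eq_of_commute [TF Γ] [Large Γ] (hx : GC x) (hy : GC y) (h : Commute x y) : x = y := by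
  by_contra hne
  have hk : ¬ VertexType (x * y⁻¹) := fun hv => hne (mul_inv_eq_one.1 (hv.eq_one (by
    simp [hx.len, hy.len])))
  have hfix : ∀ u : V, ∃ v : TV Γ u, ∀ h ∈ ({x, y} : Set (ArtinGroup Γ)), h • v = v := by
    intro u
    obtain ⟨p, hp⟩ := hx.vertexType.elliptic u
    obtain ⟨q, hq⟩ := hy.vertexType.elliptic u
    obtain ⟨v, h1, h2⟩ := (ta Γ u).commuting_fix h hp hq
    obtain ⟨v, hv⟩ := exists_fixed_by_centralizer hk
      ⟨v, by rw [mul_smul, inv_smul_eq_iff.2 h2.symm, h1]⟩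
    refine ⟨v, ?_⟩
    rintro z (rfl | rfl)
    · simp_all
    · exact hv _ (h.symm.mul_right (Commute.refl _).inv_right)
  obtain ⟨g, -, K, -, hK, hg⟩ := TF.desc (P := Set.univ) (H := {x, y})
    (by intro z _; rw [parabolic_univ]; trivial) (fun u _ => hfix u)
  have hgx := hg x (by simp)
  have hgy := hg y (by simp)
  have hcan : g⁻¹ * x * g = g⁻¹ * y * g → False := fun e => hne (by simpa using e)
  have hx' := hx.conj' g
  have hy' := hy.conj' g
  have hc' : Commute (g⁻¹ * x * g) (g⁻¹ * y * g) := by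
    have := h.map (MulAut.conj g⁻¹).toMonoidHom
    simpa using this
  generalize g⁻¹ * x * g = x' at *
  generalize g⁻¹ * y * g = y' at *
  rcases clique_cases hK with rfl | ⟨a, rfl⟩ | ⟨a, b, hab, rfl⟩
  · rw [parabolic_empty, Subgroup.mem_bot] at hgx hgy
    exact hcan (hgx.trans hgy.symm)
  · obtain ⟨i, rfl⟩ := mem_zpow hgx
    obtain ⟨j, rfl⟩ := mem_zpow hgy
    have h1 := hx'.len
    have h2 := hy'.len
    simp_all
  · obtain ⟨a, b, hab, hs, k, hk, i, hi⟩ := vertexType_pair' hab hgx hx'.vertexType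
    rw [hs] at hgx hgy
    have hi1 : i = 1 := by
      have := congrArg ArtinRigid.len hi
      rwa [len_conj', hx'.len, len_zpow', len_gen, mul_one, eq_comm] at this
    subst hi1
    rw [zpow_one] at hi
    have hy2 : k⁻¹ * y' * k ∈ parabolic Γ {a, b} := mul_mem (mul_mem (inv_mem hk) hgy) hk
    have hc2 : Commute (k⁻¹ * y' * k) (gen Γ a) := by
      have := hc'.symm.map (MulAut.conj k⁻¹).toMonoidHom
      rw [← hi]
      simpa using this
    have hcan2 : k⁻¹ * y' * k = gen Γ a → False := fun e => hcan (by simpa using hi.trans e.symm)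
    have hy3 := hy'.conj' k
    generalize k⁻¹ * y' * k = y at *
    obtain ⟨q, r, hqr⟩ := pair_centralizer hab hy2 hc2
    have hlen : q + r * (2 * dN (Γ.label a b)) = 1 := by
      have := congrArg ArtinRigid.len hqr
      rw [hy3.len, len_mul, len_zpow', len_zpow', len_gen, len_zc] at this
      omega
    have hN := two_le_dN hab
    have key : ∃ q' : ℤ, q * q' = 1 := by
      have fin : ∀ s t, Γ.graph.Adj s t → ({a, b} : Set V) = {s, t} → zc Γ s t = zc Γ a b →
          ∀ h ∈ parabolic Γ {a, b}, ∀ j : ℤ, h⁻¹ * y * h = gen Γ s ^ j → ∃ q' : ℤ, q * q' = 1 := by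
        intro s t hst hset hz h hh j hj
        have hj1 : j = 1 := by
          have := congrArg ArtinRigid.len hj
          rwa [len_conj', hy3.len, len_zpow', len_gen, mul_one, eq_comm] at this
        subst hj1
        rw [zpow_one] at hj
        have hc3 : Commute (h⁻¹ * gen Γ a * h) (gen Γ s) := by
          have := hc2.symm.map (MulAut.conj h⁻¹).toMonoidHom
          rw [← hj]
          simpa using this
        obtain ⟨q', r', he⟩ := pair_centralizer hst (y := h⁻¹ * gen Γ a * h) (hset ▸
          mul_mem (mul_mem (inv_mem hh) (gen_mem_pair_left a b)) hh) hc3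
        refine ⟨q', ?_⟩
        have hcz : Commute (zc Γ a b) h := zc_central hab hh
        have e1 : gen Γ a = y ^ q' * zc Γ a b ^ r' := by
          calc gen Γ a = h * (h⁻¹ * gen Γ a * h) * h⁻¹ := by group
            _ = h * ((h⁻¹ * y * h) ^ q' * zc Γ a b ^ r') * h⁻¹ := by rw [he, hj, hz]
            _ = y ^ q' * (h * zc Γ a b ^ r' * h⁻¹) := by rw [conj_zpow']; group
            _ = _ := by rw [(hcz.zpow_left r').symm.eq, mul_inv_cancel_right]
        have hca : Commute (zc Γ a b) (gen Γ a) := zc_central hab (gen_mem_pair_left a b)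
        rw [hqr, ((hca.zpow_left r).zpow_right q).symm.mul_zpow, ← zpow_mul, ← zpow_mul, mul_assoc,
          ← zpow_add] at e1
        have := (pair_zpow_eq hab (i := 1 - q * q') (r := r * q' + r') (by
          rw [sub_eq_neg_add, zpow_add, zpow_one, zpow_neg, inv_mul_eq_iff_eq_mul]
          exact e1)).1
        omega
      obtain ⟨h, hh, j, hj | hj⟩ := vertexType_pair hab hy2 hy3.vertexType
      · exact fin a b hab rfl rfl h hh j hj
      · exact fin b a hab.symm (Set.pair_comm a b) (zc_comm hab) h hh j hj
    obtain ⟨q', hq'⟩ := key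
    rcases Int.isUnit_iff.1 (IsUnit.of_mul_eq_one _ hq') with rfl | rfl
    · have : r = 0 := by
        rcases mul_eq_zero.1 (show r * (2 * (dN (Γ.label a b) : ℤ)) = 0 by omega) with h | h
        · exact h
        · omega
      exact hcan2 (by rw [hqr, this]; simp)
    · have h1 : r * (dN (Γ.label a b) : ℤ) = 1 := by linarith
      rcases Int.isUnit_iff.1 (IsUnit.of_mul_eq_one _ ((mul_comm _ _).trans h1)) with h | h <;> omega

end

section

variable {V : Type u} {Γ : DefiningGraph V} [Finite V] {W : Type v} [Finite W]
variable {t : ArtinGroup Γ} {a b : V} {Λ : DefiningGraph W} (ψ : ArtinGroup Γ ≃* ArtinGroup Λ)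

theorem commute_symm_iff {x y : ArtinGroup Λ} : Commute (ψ.symm x) (ψ.symm y) ↔ Commute x y :=
  ⟨fun h => by simpa using h.map ψ, fun h => h.map ψ.symm⟩

theorem symm_gen_ne_one (w : W) : ψ.symm (gen Λ w) ≠ 1 := fun h => by
  have : gen Λ w ^ (1 : ℤ) = 1 := by simpa using congrArg ψ h
  exact one_ne_zero (gen_zpow_eq_one this)

variable [TF Γ] [Large Γ]

theorem braid_clique {w v : W} (hwv : Λ.graph.Adj w v) (hnc : ¬ Commute (gen Λ w) (gen Λ v)) : ∃
    (g : ArtinGroup Γ) (K : Set V), IsCl Γ K ∧ g⁻¹ * ψ.symm (gen Λ w) * g ∈ parabolic Γ K ∧ g⁻¹ *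
    ψ.symm (gen Λ v) * g ∈ parabolic Γ K := by
  obtain ⟨N, hN, -, h1, h2⟩ := braid_pow_commute (Λ.two_le_label _ _ hwv) (gen_rel hwv)
  have e : ψ.symm ((gen Λ w * gen Λ v) ^ N) = (ψ.symm (gen Λ w) * ψ.symm (gen Λ v)) ^ N := by simp
  exact dihedral_of_pow_commute hN (e ▸ h1.map ψ.symm) (e ▸ h2.map ψ.symm)
    (fun h => hnc ((commute_symm_iff ψ).1 h))

theorem braid_fixed {w v : W} (hwv : Λ.graph.Adj w v) (hnc : ¬ Commute (gen Λ w) (gen Λ v)) (u : V)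
    : ∃ p : TV Γ u, ψ.symm (gen Λ w) • p = p ∧ ψ.symm (gen Λ v) • p = p := by
  obtain ⟨g, K, hK, h1, h2⟩ := braid_clique ψ hwv hnc
  obtain ⟨p, hp⟩ := clique_elliptic hK u
  have := fun x hx => smul_conj_iff (g := g) (k := x) (v := g • p) |>.1
    (by rw [inv_smul_smul]; exact hp _ hx)
  exact ⟨g • p, this _ h1, this _ h2⟩

include ψ in
theorem not_all_commute (hc : Γ.graph.Preconnected) [Nontrivial V]
    (h : ∀ a b, Commute (gen Λ a) (gen Λ b)) : False := by
  obtain ⟨a, -⟩ := exists_pair_ne V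
  obtain ⟨b, hab⟩ := exists_adj hc a
  refine pair_not_commute hab ?_
  have := parabolic_comm (S := Set.univ) (fun a _ b _ => h a b)
    (x := ψ (gen Γ a)) (y := ψ (gen Γ b)) (by rw [parabolic_univ]; trivial)
    (by rw [parabolic_univ]; trivial)
  exact ψ.injective (by simpa using this.eq)

theorem symm_gen_elliptic (hc : Γ.graph.Preconnected) [Nontrivial V]
    (w₀ : W) (u : V) : ∃ p : TV Γ u, ψ.symm (gen Λ w₀) • p = p := by
  by_contra hu
  rw [← not_hyp_iff, not_not] at hu
  let Gn : W → Prop := fun w => ∃ u, Hyp (TV Γ u) (ψ.symm (gen Λ w))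
  have h0 : Gn w₀ := ⟨u, hu⟩
  have hα : ∀ {w v}, Gn w → Λ.graph.Adj w v → Commute (gen Λ w) (gen Λ v) := by
    rintro w v ⟨u, hu⟩ hwv
    by_contra hnc
    obtain ⟨p, hp, -⟩ := braid_fixed ψ hwv hnc u
    exact hu p hp
  have hβ : ∀ {w x y}, Gn w → Commute (gen Λ x) (gen Λ w) → Commute (gen Λ y) (gen Λ w) →
      Commute (gen Λ x) (gen Λ y) := by
    rintro w x y ⟨u, hu⟩ hx hy
    exact (commute_symm_iff ψ).1 (hyp_centralizer hu (hx.map ψ.symm) (hy.map ψ.symm))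
  let Q : Set W := {w | Gn w ∧ (w = w₀ ∨ Λ.graph.Adj w₀ w)}
  have hQc : ∀ {x y}, (x = w₀ ∨ Λ.graph.Adj w₀ x) → (y = w₀ ∨ Λ.graph.Adj w₀ y) →
      Commute (gen Λ x) (gen Λ y) := by
    have : ∀ x, (x = w₀ ∨ Λ.graph.Adj w₀ x) → Commute (gen Λ x) (gen Λ w₀) := by
      rintro x (rfl | hx)
      · exact Commute.refl _
      · exact (hα h0 hx).symm
    intro x y hx hy
    exact hβ h0 (this _ hx) (this _ hy)
  have hnbr : ∀ x ∈ Q, ∀ y, Λ.graph.Adj x y → y = w₀ ∨ Λ.graph.Adj w₀ y := by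
    rintro x ⟨hx, hx'⟩ y hxy
    by_cases hy : y = w₀
    · exact Or.inl hy
    · refine Or.inr (adj_of_commute (Ne.symm hy) (hβ hx ?_ (hα hx hxy).symm)).1
      exact hQc (Or.inl rfl) hx'
  by_cases hN : ∃ w', ¬ Gn w' ∧ Λ.graph.Adj w₀ w'
  · obtain ⟨w', hw', hadj⟩ := hN
    have hell : ∀ {w}, ¬ Gn w → Λ.graph.Adj w₀ w →
        (∃ p : TV Γ u, ψ.symm (gen Λ w) • p = p) ∧ VertexType (ψ.symm (gen Λ w)) := by
      intro w hw hadj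
      have he : ∃ p : TV Γ u, ψ.symm (gen Λ w) • p = p := not_hyp_iff.1 fun h => hw ⟨u, h⟩
      exact ⟨he, vertexType_of_commute_hyp hu ((hα h0 hadj).symm.map ψ.symm) he⟩
    have huniq : ∀ w, ¬ Gn w → Λ.graph.Adj w₀ w → w = w' := by
      intro w hw hwadj
      by_contra hne
      obtain ⟨⟨p, hp⟩, hv⟩ := hell hw hwadj
      obtain ⟨⟨q, hq⟩, hv'⟩ := hell hw' hadj
      have h1 : ∀ w, ψ.symm (gen Λ w) ≠ 1 := fun w h => by
        have : gen Λ w ^ (1 : ℤ) = 1 := by simpa using congrArg ψ h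
        exact one_ne_zero (gen_zpow_eq_one this)
      have hcm := hQc (Or.inr hwadj) (Or.inr hadj)
      obtain ⟨o, ho, ho'⟩ := (ta Γ u).commuting_fix (hcm.map ψ.symm) hp hq
      set i := len (ψ.symm (gen Λ w')) with hi
      set j := len (ψ.symm (gen Λ w)) with hj
      have hk : VertexType (ψ.symm (gen Λ w) ^ i * ψ.symm (gen Λ w') ^ (-j)) := by
        refine vertexType_of_commute_hyp hu ?_ ⟨o, ?_⟩
        · exact (((hα h0 hwadj).symm.map ψ.symm).zpow_left i).mul_left
            (((hα h0 hadj).symm.map ψ.symm).zpow_left (-j))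
        · exact (MulAction.stabilizer (ArtinGroup Γ) o).mul_mem
            (zpow_mem (MulAction.mem_stabilizer_iff.2 ho) _)
            (zpow_mem (MulAction.mem_stabilizer_iff.2 ho') _)
      have := hk.eq_one (by rw [len_mul, len_zpow', len_zpow', ← hi, ← hj]; ring)
      refine len_zero_pow_of (Λ := Λ) hne (i := i) (j := -j) (Or.inl (hv'.len_ne (h1 _))) ?_
      simpa using congrArg ψ this
    refine no_commuting_branch ψ hc (Q := Q) (w := w₀) (w' := w') ⟨h0, Or.inl rfl⟩
      (fun h => hw' h.1) ?_ ?_ (hell hw' hadj).2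
    · grind
    grind
  · push Not at hN
    have hall : ∀ x, x ∈ Q := conn_induct (connected_of_iso ψ hc).preconnected
      (a := w₀) ⟨h0, Or.inl rfl⟩ (fun x y hxy hx => by
        grind)
    exact not_all_commute ψ hc fun a b => hQc (hall a).2 (hall b).2

/-- In the dihedral subgroup on `{a, b}`. -/
theorem nonvertex_nbr_mem {w v : W}
    (hw : ψ.symm (gen Λ w) ∈ parabolic Γ {a, b}) (hn : ¬ VertexType (ψ.symm (gen Λ w)))
    (hwv : Λ.graph.Adj w v) : ψ.symm (gen Λ v) ∈ parabolic Γ {a, b} := by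
  by_cases hc : Commute (gen Λ w) (gen Λ v)
  · refine mem_of_conj_mem hn hw ?_
    have := (commute_symm_iff ψ).2 hc
    rwa [mul_assoc, this.eq, inv_mul_cancel_left]
  · obtain ⟨g, K, hK, h1, h2⟩ := braid_clique ψ hwv hc
    obtain ⟨hKs, hg⟩ := clique_conj_sub hK hn hw h1
    have := mul_mem (mul_mem hg (parabolic_mono hKs h2)) (inv_mem hg)
    convert this using 1
    group

theorem nonvertex_not_central (hab : Γ.graph.Adj a b) {w : W}
    (hw : ψ.symm (gen Λ w) ∈ parabolic Γ {a, b}) (hn : ¬ VertexType (ψ.symm (gen Λ w))) (r : ℤ) :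
    ψ.symm (gen Λ w) ≠ zc Γ a b ^ r := by
  intro he
  have hev : ∀ v, Λ.graph.Adj w v → Even (Λ.label w v) := by
    intro v hwv
    have : Commute (ψ.symm (gen Λ w)) (ψ.symm (gen Λ v)) := by
      rw [he]
      exact (zc_central hab (nonvertex_nbr_mem ψ hw hn hwv)).zpow_left r
    rw [(adj_of_commute hwv.ne ((commute_symm_iff ψ).1 this)).2]
    exact even_two
  have h1 : ((chi Λ w hev).comp ψ.toMonoidHom (zc Γ a b ^ r)).toAdd = 1 := by
    rw [← he]
    simp
  rw [zc, map_zpow, map_pow, toAdd_zpow, toAdd_pow, smul_eq_mul, nsmul_eq_mul] at h1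
  have hN := two_le_dN hab
  have : (dN (Γ.label a b) : ℤ) ∣ 1 := h1 ▸ (dvd_mul_right _ _).mul_left r
  have := Int.le_of_dvd one_pos this
  omega

theorem nonvertex_nbr_aux (hab : Γ.graph.Adj a b) {w v₁ v₂ : W}
    (hw : ψ.symm (gen Λ w) ∈ parabolic Γ {a, b}) (hn : ¬ VertexType (ψ.symm (gen Λ w)))
    (h1 : Λ.graph.Adj w v₁) (h2 : Λ.graph.Adj w v₂) (hne : v₁ ≠ v₂) : Commute (gen Λ w) (gen Λ v₁)
    := by
  by_contra hnc
  have m1 := nonvertex_nbr_mem ψ hw hn h1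
  have m2 := nonvertex_nbr_mem ψ hw hn h2
  obtain ⟨N, hN, -, c1, c2⟩ := braid_pow_commute (Λ.two_le_label _ _ h1) (gen_rel h1)
  have e : ψ.symm ((gen Λ w * gen Λ v₁) ^ N) = (ψ.symm (gen Λ w) * ψ.symm (gen Λ v₁)) ^ N := by simp
  have hnc' : ψ.symm (gen Λ w) * ψ.symm (gen Λ v₁) ≠ ψ.symm (gen Λ v₁) * ψ.symm (gen Λ w) :=
    fun h => hnc ((commute_symm_iff ψ).1 h)
  obtain ⟨r, hr⟩ := pair_center hab hw m1 (z := ψ.symm ((gen Λ w * gen Λ v₁) ^ N))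
    (by rw [e]; exact pow_mem (mul_mem hw m1) _) (c1.map ψ.symm) (c2.map ψ.symm) hnc'
  have c3 : Commute ((gen Λ w * gen Λ v₁) ^ N) (gen Λ v₂) := by
    rw [← commute_symm_iff ψ, hr]
    exact (zc_central hab m2).zpow_left r
  obtain ⟨z1, z2⟩ := coef_eq_zero_of_commute h1.ne h2.ne hne hN c1.symm c2.symm c3
  have cm : ∀ {x}, coef Λ x v₂ = 0 → Commute (gen Λ x) (gen Λ v₂) := by
    intro x hx
    obtain ⟨hadj, hlab⟩ := coef_eq_zero Λ hx
    have := gen_rel hadj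
    rw [hlab] at this
    simpa [altProd, commute_iff_eq] using this
  obtain ⟨s, hs⟩ := pair_center hab hw m1 m2 ((cm z1).map ψ.symm) ((cm z2).map ψ.symm) hnc'
  refine nonvertex_not_central ψ hab m2 (fun hv => ?_) s hs
  rw [hs] at hv
  rw [zc_not_vertexType hab hv, zpow_zero] at hs
  exact symm_gen_ne_one ψ _ hs

theorem nonvertex_nbr_unique_aux (hab : Γ.graph.Adj a b) {w v₁ v₂ : W}
    (hw : ψ.symm (gen Λ w) ∈ parabolic Γ {a, b}) (hn : ¬ VertexType (ψ.symm (gen Λ w)))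
    (h1 : Λ.graph.Adj w v₁) (h2 : Λ.graph.Adj w v₂) : v₁ = v₂ := by
  by_contra hne
  have c1 := nonvertex_nbr_aux ψ hab hw hn h1 h2 hne
  have c2 := nonvertex_nbr_aux ψ hab hw hn h2 h1 (Ne.symm hne)
  obtain ⟨d, hd, hd'⟩ := pair_centralizer_rank hab hw (nonvertex_not_central ψ hab hw hn)
  obtain ⟨r₁, e1⟩ := hd' _ (nonvertex_nbr_mem ψ hw hn h1) (c1.symm.map ψ.symm)
  obtain ⟨r₂, e2⟩ := hd' _ (nonvertex_nbr_mem ψ hw hn h2) (c2.symm.map ψ.symm)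
  generalize d (ψ.symm (gen Λ w)) = n at *
  generalize d (ψ.symm (gen Λ v₁)) = d₁ at *
  generalize d (ψ.symm (gen Λ v₂)) = d₂ at *
  replace e1 := congrArg ψ e1
  replace e2 := congrArg ψ e2
  simp only [map_mul, map_zpow, MulEquiv.apply_symm_apply] at e1 e2
  by_cases hr : r₁ = 0
  · rw [hr, zpow_zero, zpow_neg, mul_inv_eq_one] at e1
    exact hd (gen_zpow_ne h1.ne.symm e1.symm)
  · have e3 := (congrArg (· ^ r₂) e1).trans (((zpow_mul _ _ _).symm.trans
      ((congrArg _ (mul_comm _ _)).trans (zpow_mul _ _ _))).trans (congrArg (· ^ r₁) e2.symm))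
    simp only [((c2.zpow_zpow d₂ (-n))).mul_zpow, ← zpow_mul] at e3
    have : gen Λ v₂ ^ (-n * r₁) ∈ parabolic Λ {v₂}ᶜ := by
      rw [← inv_mul_eq_iff_eq_mul] at e3
      rw [← e3]
      exact mul_mem (inv_mem (gen_zpow_mem (by simpa using h2.ne) _)) (zpow_mem (mul_mem
        (gen_zpow_mem (by simpa using h2.ne) _) (gen_zpow_mem (by simpa using hne) _)) _)
    have := zpow_mem_compl this
    simp_all

theorem nonvertex_elliptic_edge [Finite V] [Nontrivial V]
    (hn : ¬ VertexType t) (he : ∀ u, ∃ p : TV Γ u, t • p = p) :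
    ∃ g a b, Γ.graph.Adj a b ∧ g⁻¹ * t * g ∈ parabolic Γ {a, b} := by
  obtain ⟨g, -, K, -, hK, hg⟩ := TF.desc (P := Set.univ) (H := {t})
    (by intro z _; rw [parabolic_univ]; trivial)
    (fun u _ => by simp_all)
  have hgt := hg t rfl
  rcases clique_cases hK with rfl | ⟨a, rfl⟩ | ⟨a, b, hab, rfl⟩
  · rw [parabolic_empty, Subgroup.mem_bot] at hgt
    have : t = 1 := by rw [mul_assoc, inv_mul_eq_one] at hgt; exact mul_right_cancel (b := g) (by rw [← hgt, one_mul])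
    exact absurd (this ▸ vertexType_one) hn
  · obtain ⟨i, hi⟩ := mem_zpow hgt
    exact absurd ⟨g, a, i, by rw [← hi]; group⟩ hn
  · exact ⟨g, a, b, hab, hgt⟩

theorem nonvertex_nbr_unique (hc : Γ.graph.Preconnected) [Nontrivial V]
    {w v₁ v₂ : W} (hn : ¬ VertexType (ψ.symm (gen Λ w)))
    (h1 : Λ.graph.Adj w v₁) (h2 : Λ.graph.Adj w v₂) : v₁ = v₂ := by
  obtain ⟨g, a, b, hab, hg⟩ := nonvertex_elliptic_edge hn (symm_gen_elliptic ψ hc w)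
  have e : ((MulAut.conj g).trans ψ).symm (gen Λ w) = g⁻¹ * ψ.symm (gen Λ w) * g := rfl
  refine nonvertex_nbr_unique_aux ((MulAut.conj g).trans ψ) hab (w := w) ?_ ?_ h1 h2
  · rwa [e]
  · have := vertexType_conj_iff (k := ψ.symm (gen Λ w)) g⁻¹
    rw [inv_inv] at this
    rwa [e, this]

include ψ in
theorem label_ne_two (hc : Γ.graph.Preconnected) [Nontrivial V]
    {w₁ w₂ : W} (hadj : Λ.graph.Adj w₁ w₂) : ¬ Commute (gen Λ w₁) (gen Λ w₂) := by
  intro hcm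
  have half : ∀ {w₁ w₂}, Λ.graph.Adj w₁ w₂ → Commute (gen Λ w₁) (gen Λ w₂) →
      ¬ VertexType (ψ.symm (gen Λ w₁)) → VertexType (ψ.symm (gen Λ w₂)) → False := by
    intro w₁ w₂ hadj hcm hn hv
    refine no_commuting_branch ψ hc (Q := {w₁}) rfl (w' := w₂) hadj.ne.symm ?_ ?_ hv
    · rintro x rfl y hxy
      exact Or.inr (nonvertex_nbr_unique ψ hc hn hxy hadj)
    · rintro x (rfl | rfl) y (rfl | rfl)
      exacts [Commute.refl _, hcm.symm, hcm, Commute.refl _]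
  by_cases v1 : VertexType (ψ.symm (gen Λ w₁)) <;> by_cases v2 : VertexType (ψ.symm (gen Λ w₂))
  · have c := hcm.map ψ.symm
    have n1 := symm_gen_ne_one ψ w₁
    have n2 := symm_gen_ne_one ψ w₂
    obtain ⟨g, s, i, hi⟩ := v1
    obtain ⟨h, t, j, hj⟩ := v2
    have hi0 : i ≠ 0 := by rintro rfl; exact n1 (by simpa using hi)
    have hj0 : j ≠ 0 := by rintro rfl; exact n2 (by simpa using hj)
    have step : ∀ {y g : ArtinGroup Γ} {s : V} {i : ℤ}, i ≠ 0 → Commute y (g * gen Γ s ^ i * g⁻¹) →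
        Commute y (g * gen Γ s * g⁻¹) := by
      intro y g s i hi h
      have h' : Commute (g⁻¹ * y * g) (gen Γ s ^ i) := by
        have := h.map (MulAut.conj g⁻¹).toMonoidHom
        simp only [MulEquiv.toMonoidHom_eq_coe, MonoidHom.coe_coe, MulAut.conj_apply, inv_inv] at this
        convert this using 1
        group
      have := (commute_of_commute_zpow hi h').map (MulAut.conj g).toMonoidHom
      simp only [MulEquiv.toMonoidHom_eq_coe, MonoidHom.coe_coe, MulAut.conj_apply] at this
      convert this using 1
      group
    have e := GC.eq_of_commute ⟨g, s, rfl⟩ ⟨h, t, rfl⟩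
      (step hj0 (step hi0 (by rw [← hi, ← hj]; exact c.symm)).symm)
    have e2 : ψ.symm (gen Λ w₁) ^ j = ψ.symm (gen Λ w₂) ^ i := by
      rw [hi, hj, ← conj_zpow, ← conj_zpow, e, ← zpow_mul, ← zpow_mul, mul_comm]
    exact hj0 (gen_zpow_ne hadj.ne (i := j) (j := i) (by simpa using congrArg ψ e2))
  · exact half hadj.symm hcm.symm v2 v1
  · exact half hadj hcm v1 v2
  · have hall : ∀ x, x = w₁ ∨ x = w₂ := conn_induct (connected_of_iso ψ hc).preconnected
      (a := w₁) (Or.inl rfl) (by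
        rintro x y hxy (rfl | rfl)
        · exact Or.inr (nonvertex_nbr_unique ψ hc v1 hxy hadj)
        · exact Or.inl (nonvertex_nbr_unique ψ hc v2 hxy hadj.symm))
    refine not_all_commute ψ hc fun a b => ?_
    rcases hall a with rfl | rfl <;> rcases hall b with rfl | rfl
    exacts [Commute.refl _, hcm, hcm.symm, Commute.refl _]

include ψ in
theorem large_of_iso (hc : Γ.graph.Preconnected) [Nontrivial V] : Large Λ := by
  refine ⟨fun a b hab => ?_⟩
  by_contra hlt
  have h2 : Λ.label a b = 2 := by have := Λ.two_le_label _ _ hab; omega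
  refine label_ne_two ψ hc hab ?_
  have := gen_rel hab
  rw [h2] at this
  simpa [altProd, commute_iff_eq] using this

include ψ in
theorem triangleFree_of_iso (hc : Γ.graph.Preconnected) [Nontrivial V] : TF Λ := by
  refine ⟨fun w₁ w₂ w₃ h12 h23 h13 => ?_⟩
  have nc := fun {x y} => label_ne_two ψ hc (w₁ := x) (w₂ := y)
  have hfix : ∀ u, ∃ p : TV Γ u, ∀ t ∈ ({ψ.symm (gen Λ w₁), ψ.symm (gen Λ w₂),
      ψ.symm (gen Λ w₃)} : Set (ArtinGroup Γ)), t • p = p := by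
    intro u
    obtain ⟨p, h1, h2, h3⟩ := helly_three (am Γ u).isTree ((ta Γ u).cvx_fixS (ψ.symm (gen Λ w₁)))
      ((ta Γ u).cvx_fixS (ψ.symm (gen Λ w₂))) ((ta Γ u).cvx_fixS (ψ.symm (gen Λ w₃)))
      (braid_fixed ψ h12 (nc h12) u) (braid_fixed ψ h13 (nc h13) u)
      (braid_fixed ψ h23 (nc h23) u)
    refine ⟨p, ?_⟩
    rintro t (rfl | rfl | rfl)
    exacts [h1, h2, h3]
  obtain ⟨g, -, K, -, hK, hg⟩ := TF.desc (P := Set.univ)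
    (by intro z _; rw [parabolic_univ]; trivial) (fun u _ => hfix u)
  have m1 := hg _ (Or.inl rfl)
  have m2 := hg _ (Or.inr (Or.inl rfl))
  have m3 := hg _ (Or.inr (Or.inr rfl))
  let ψ' := (MulAut.conj g).trans ψ
  have e : ∀ x, ψ'.symm x = g⁻¹ * ψ.symm x * g := fun x => rfl
  rw [← e] at m1 m2 m3
  rcases clique_cases hK with rfl | ⟨a, rfl⟩ | ⟨a, b, hab, rfl⟩
  · rw [parabolic_empty, Subgroup.mem_bot] at m1
    exact symm_gen_ne_one ψ' _ m1
  · obtain ⟨i, hi⟩ := mem_zpow m1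
    obtain ⟨j, hj⟩ := mem_zpow m2
    exact nc h12 ((commute_symm_iff ψ').1 (by
      simp_all))
  · obtain ⟨N, hN, -, c1, c2⟩ := braid_pow_commute (Λ.two_le_label _ _ h12) (gen_rel h12)
    obtain ⟨r, hr⟩ := pair_center hab m1 m2 (z := ψ'.symm ((gen Λ w₁ * gen Λ w₂) ^ N))
      (by rw [map_pow, map_mul]; exact pow_mem (mul_mem m1 m2) _) (c1.map ψ'.symm) (c2.map ψ'.symm)
      (fun h => nc h12 ((commute_symm_iff ψ').1 h))
    have c3 : Commute ((gen Λ w₁ * gen Λ w₂) ^ N) (gen Λ w₃) := by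
      rw [← commute_symm_iff ψ', hr]
      exact (zc_central hab m3).zpow_left r
    have z := (coef_eq_zero_of_commute h12.ne h13.ne h23.ne hN c1.symm c2.symm c3).1
    have := (large_of_iso ψ hc).out _ _ h13
    have := (coef_eq_zero Λ z).2
    omega

end

section

section Tree
variable {T : Type*} {X : SimpleGraph T}
variable {c x y y' : T} {Z : Set T}

/-- A convex set meeting both sides of an edge contains the edge. -/
theorem Cvx.edge_mem (hX : X.IsTree) (hZ : Cvx X Z) (hy : X.Adj y y') (hc : c ∈ Z) (hx : x ∈ Z)
    (h1 : X.dist y c < X.dist y' c) (h2 : X.dist y' x < X.dist y x) : y ∈ Z ∧ y' ∈ Z := by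
  have n1 : nxt X y x = y' := (eq_nxt hX hy h2).symm
  have n2 : nxt X y' c = y := (eq_nxt hX hy.symm h1).symm
  constructor
  · refine hZ.between hX hx hc (dist_turn hX (Or.inr (Or.inr ?_)))
    rw [n1]
    rintro h
    by_cases hyc : y = c
    · subst hyc
      have : nxt X y y = y := by
        unfold nxt; rw [dif_neg]; rintro ⟨z, -, hz⟩; simp at hz
      rw [this] at h; exact hy.ne h.symm
    · have := dist_nxt hX hyc; rw [← h] at this; omega
  · refine hZ.between hX hc hx (dist_turn hX (Or.inr (Or.inr ?_)))
    rw [n2]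
    rintro h
    by_cases hyc : y' = x
    · subst hyc
      have : nxt X y' y' = y' := by
        unfold nxt; rw [dif_neg]; rintro ⟨z, -, hz⟩; simp at hz
      rw [this] at h; exact hy.ne h
    · have := dist_nxt hX hyc; rw [← h] at this; omega

/-- If convex sets indexed by a graph meet along edges, and the index set stays connected after
deleting the indices of the sets containing any given edge, then the sets pairwise meet. -/
theorem Cvx.meet_of_connected (hX : X.IsTree) {ι : Type*} {L : SimpleGraph ι} {F : ι → Set T}
    (hF : ∀ i, Cvx X (F i)) (hne : ∀ i, (F i).Nonempty)
    (hadj : ∀ i j, L.Adj i j → (F i ∩ F j).Nonempty) (hsep : ∀ y y', X.Adj y y' → (L.induce {i | ¬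
    (y ∈ F i ∧ y' ∈ F i)}).Preconnected) (i j : ι) : (F i ∩ F j).Nonempty := by
  by_contra hno
  rw [Set.not_nonempty_iff_eq_empty] at hno
  have hdis : ∀ z, z ∈ F i → z ∈ F j → False := fun z h1 h2 =>
    (Set.ext_iff.1 hno z).1 ⟨h1, h2⟩
  obtain ⟨x, hx⟩ := hne j
  obtain ⟨y, hy, hg⟩ := gate_exists hX (hF i) (hne i) x
  have hyx : y ≠ x := by rintro rfl; exact hdis _ hy hx
  have hadj' := nxt_adj hX hyx
  set y' := nxt X y x with hy'
  have hd : X.dist y' x < X.dist y x := by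
    have := dist_nxt hX hyx; rw [← hy'] at this; omega
  have hny' : y' ∉ F i := fun h => by
    have h1 := hg y' h
    rw [SimpleGraph.dist_comm (u := x) (v := y'), SimpleGraph.dist_comm (u := x) (v := y)] at h1
    omega
  have key : ∀ k l : {i | ¬ (y ∈ F i ∧ y' ∈ F i)}, (L.induce _).Adj k l →
      (∀ c ∈ F k, X.dist y c < X.dist y' c) → ∀ c ∈ F l, X.dist y c < X.dist y' c := by
    rintro ⟨k, hk⟩ ⟨l, hl⟩ hkl h c hc
    obtain ⟨e, he1, he2⟩ := hadj k l hkl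
    by_contra hcc
    have := dist_step hX hadj' c
    exact hl ((hF l).edge_mem hX hadj' he2 hc (h e he1) (by omega))
  have := conn_induct (hsep y y' hadj')
    (P := fun k => ∀ c ∈ F k, X.dist y c < X.dist y' c) (a := ⟨i, fun h => hny' h.2⟩)
    (fun c hc => by
      by_contra hcc
      have hs := dist_step hX hadj' c
      have hyy : X.dist y y < X.dist y' y := by
        rw [SimpleGraph.dist_self, SimpleGraph.dist_eq_one_iff_adj.2 hadj'.symm]; omega
      exact hny' ((hF i).edge_mem hX hadj' hy hc hyy (by omega)).2)
    key ⟨j, fun h => hdis _ hy h.1⟩ x hx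
  omega

end Tree

section Good
variable {V : Type u} {Γ : DefiningGraph V}
variable {K Q Q₁ Q₂ R₁ R₂ S : Set V} {s : V}

/-- `Q = Q₁ ∪ Q₂` with no edges across and the intersection a clique. -/
def Split (Γ : DefiningGraph V) (Q Q₁ Q₂ : Set V) : Prop := Q₁ ∪ Q₂ = Q ∧ IsCl Γ (Q₁ ∩ Q₂) ∧
    ∀ a ∈ Q, ∀ b ∈ Q, Γ.graph.Adj a b → (a ∈ Q₁ ∧ b ∈ Q₁) ∨ (a ∈ Q₂ ∧ b ∈ Q₂)

theorem Split.symm (h : Split Γ Q Q₁ Q₂) : Split Γ Q Q₂ Q₁ :=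
  ⟨Set.union_comm Q₁ Q₂ ▸ h.1, Set.inter_comm Q₁ Q₂ ▸ h.2.1, fun a ha b hb hab =>
    (h.2.2 a ha b hb hab).symm⟩

/-- Every splitting of `Q` extends to a splitting of the whole graph. -/
def Good (Γ : DefiningGraph V) (Q : Set V) : Prop :=
  ∀ Q₁ Q₂, Split Γ Q Q₁ Q₂ → ∃ P₁ P₂, Split Γ Set.univ P₁ P₂ ∧ P₁ ∩ P₂ = Q₁ ∩ Q₂ ∧
    P₁ ∩ Q = Q₁ ∧ P₂ ∩ Q = Q₂

theorem good_univ : Good Γ Set.univ := fun Q₁ Q₂ h => ⟨Q₁, Q₂, h, rfl, by simp, by simp⟩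

theorem Good.piece_aux (hQ : Good Γ Q) (h : Split Γ Q Q₁ Q₂)
    (hR : Split Γ Q₁ R₁ R₂) (hs : Q₁ ∩ Q₂ ⊆ R₂) :
    ∃ P₁ P₂, Split Γ Set.univ P₁ P₂ ∧ P₁ ∩ P₂ = R₁ ∩ R₂ ∧ P₁ ∩ Q₁ = R₁ ∧ P₂ ∩ Q₁ = R₂ := by
  obtain ⟨h1, h2, h3⟩ := h
  obtain ⟨r1, r2, r3⟩ := hR
  have e1 : ∀ x, x ∈ Q ↔ x ∈ Q₁ ∨ x ∈ Q₂ := fun x => by rw [← h1]; rfl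
  have e2 : ∀ x, x ∈ Q₁ ↔ x ∈ R₁ ∨ x ∈ R₂ := fun x => by rw [← r1]; rfl
  have e3 : R₁ ∩ (R₂ ∪ Q₂) = R₁ ∩ R₂ := by
    ext x
    have := e2 x
    have := @hs x
    simp only [Set.mem_inter_iff, Set.mem_union] at *
    tauto
  obtain ⟨P₁, P₂, p, q, s, t⟩ := hQ R₁ (R₂ ∪ Q₂) ⟨by rw [← Set.union_assoc, r1, h1], by rwa [e3],
    fun a ha b hb hab => by
      grind⟩
  refine ⟨P₁, P₂, p, q.trans e3, ?_, ?_⟩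
  · grind
  · ext x
    have := e1 x; have := e2 x; have s' := Set.ext_iff.1 t x; grind

theorem Good.piece (hQ : Good Γ Q) (h : Split Γ Q Q₁ Q₂) : Good Γ Q₁ := by
  intro R₁ R₂ hR
  have e2 : ∀ x, x ∈ Q₁ ↔ x ∈ R₁ ∨ x ∈ R₂ := fun x => by rw [← hR.1]; rfl
  by_cases hs : Q₁ ∩ Q₂ ⊆ R₂
  · exact hQ.piece_aux h hR hs
  · obtain ⟨P₁, P₂, p, q, s, t⟩ := hQ.piece_aux h hR.symm (fun b hb => by
      by_contra hb1
      obtain ⟨a, ha, ha2⟩ := Set.not_subset.1 hs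
      have := e2 a; have := e2 b
      have hab := h.2.1 a ha b hb (by
        rintro rfl; have := ha.1; tauto)
      have := ha.1; have := hb.1
      have := hR.2.2 a ha.1 b hb.1 hab
      tauto)
    exact ⟨P₂, P₁, p.symm, by rw [Set.inter_comm, q, Set.inter_comm], t, s⟩

theorem exists_split (hKQ : K ⊆ Q) (hK : IsCl Γ K)
    (h : ¬ (Γ.graph.induce (Q \ K)).Preconnected) : ∃ Q₁ Q₂, Split Γ Q Q₁ Q₂ ∧ Q₁ ≠ Q ∧ Q₂ ≠ Q := by
  simp only [SimpleGraph.Preconnected, not_forall] at h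
  obtain ⟨a, b, hab⟩ := h
  let R : Set V := {x | ∃ h : x ∈ Q \ K, (Γ.graph.induce (Q \ K)).Reachable a ⟨x, h⟩}
  have hRQ : R ⊆ Q \ K := fun x ⟨h, _⟩ => h
  refine ⟨R ∪ K, Q \ R, ⟨?_, ?_, ?_⟩, ?_, ?_⟩
  · grind
  · exact fun x hx y hy => hK x (hx.1.resolve_left hx.2.2) y (hy.1.resolve_left hy.2.2)
  · have key : ∀ x ∈ Q, ∀ y ∈ Q, Γ.graph.Adj x y → x ∈ R → y ∈ R ∪ K := by
      rintro x - y hy hxy ⟨hx, hr⟩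
      by_cases hyK : y ∈ K
      · exact Or.inr hyK
      · exact Or.inl ⟨⟨hy, hyK⟩, hr.trans (SimpleGraph.Adj.reachable (by exact hxy))⟩
    intro x hx y hy hxy
    have := key x hx y hy hxy; have := key y hy x hx hxy.symm
    grind
  · grind
  · intro he
    have ha : a.1 ∈ Q \ R := by rw [he]; exact a.2.1
    exact ha.2 ⟨a.2, SimpleGraph.Reachable.refl _⟩

theorem exists_chunk [Finite V] (hQ : (Γ.graph.induce Q).Connected ∧ NoSeparating
    Γ.graph Q) : ∃ S, Q ⊆ S ∧ IsChunk Γ.graph S := by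
  obtain ⟨S, hS, hm⟩ := Set.Finite.exists_le_maximal
    (Set.toFinite {T : Set V | (Γ.graph.induce T).Connected ∧ NoSeparating Γ.graph T}) hQ
  exact ⟨S, hS, hm.1, fun T hT h => (hm.2 h hT).antisymm hT⟩

/-- A chunk of a connected graph with at least two vertices has no isolated vertices. -/
theorem chunk_nbr [Nontrivial V] (hc : Γ.graph.Preconnected)
    (hS : IsChunk Γ.graph S) (hs : s ∈ S) : ∃ t ∈ S, Γ.graph.Adj s t := by
  by_cases hn : ∃ t ∈ S, t ≠ s
  · obtain ⟨t, ht, hts⟩ := hn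
    have : Nontrivial S := ⟨⟨s, hs⟩, ⟨t, ht⟩, fun h => hts (congrArg Subtype.val h).symm⟩
    obtain ⟨b, hb⟩ := exists_adj hS.1.1.preconnected ⟨s, hs⟩
    exact ⟨b.1, b.2, hb⟩
  · push Not at hn
    obtain ⟨t, hst⟩ := exists_adj hc s
    have hsub : ∀ Q : Set V, Q ⊆ {s, t} → (Γ.graph.induce Q).Preconnected := by
      rintro Q hQ ⟨x, hx⟩ ⟨y, hy⟩
      by_cases hxy : x = y
      · simp_all
      · refine SimpleGraph.Adj.reachable (show Γ.graph.Adj x y from ?_)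
        rcases hQ hx with rfl | rfl <;> rcases hQ hy with rfl | rfl <;>
          first | exact hst | exact hst.symm | exact (hxy rfl).elim
    have := hS.2 {s, t} (fun x hx => Or.inl (hn x hx))
      ⟨(SimpleGraph.connected_iff _).2 ⟨hsub _ le_rfl, ⟨⟨s, Or.inl rfl⟩⟩⟩,
        fun v _ => hsub _ Set.sdiff_subset, fun a _ b _ _ => hsub _ Set.sdiff_subset⟩
    exact ⟨t, this ▸ Or.inr rfl, hst⟩

end Good

variable {V : Type u} {Γ : DefiningGraph V} [Finite V] {W : Type v} [Finite W]
variable {g : ArtinGroup Γ} {K S : Set V} {w w' : V}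
  {Λ : DefiningGraph W} (ψ : ArtinGroup Γ ≃* ArtinGroup Λ)

theorem conj_map_mem {H : Type*} [Group H] (f : ArtinGroup Γ →* H) {g : H} {P : Subgroup H}
    (h : ∀ v ∈ S, g⁻¹ * f (gen Γ v) * g ∈ P) : ∀ x ∈ parabolic Γ S, g⁻¹ * f x * g ∈ P := by
  intro x hx
  have : parabolic Γ S ≤ P.comap ((MulAut.conj g⁻¹).toMonoidHom.comp f) :=
    parabolic_le fun v hv => by
      simp_all
  have h2 : g⁻¹ * f x * g⁻¹⁻¹ ∈ P := this hx
  rwa [inv_inv] at h2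

/-- Nonadjacent generators have disjoint fixed point sets. -/
theorem adj_of_mem_clique [TF Γ] [Large Γ] (hne : w ≠ w')
    (hK : IsCl Γ K) (h1 : g⁻¹ * gen Γ w * g ∈ parabolic Γ K)
    (h2 : g⁻¹ * gen Γ w' * g ∈ parabolic Γ K) : Γ.graph.Adj w w' := by
  by_contra hna
  have am := (visual_amalg (Γ := Γ) (P := {w}ᶜ) (Q := {w'}ᶜ) (fun v => by
    grind) (fun a b hab => by
      by_contra hcon
      simp only [Set.mem_compl_iff, Set.mem_singleton_iff] at hcon
      have hn := hab.ne
      by_cases ha : a = w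
      · simp_all
      · by_cases hb : b = w
        · by_cases ha' : a = w'
          · exact hna (ha' ▸ hb ▸ hab).symm
          simp_all
        · exact hcon (Or.inl ⟨ha, hb⟩))).1
  have ht := am.treeAction
  have nm : ∀ x : V, gen Γ x ∉ parabolic Γ {x}ᶜ := fun x h =>
    zpow_not_mem (a := x) (S := {x}ᶜ) (by simp) one_ne_zero (by simpa using h)
  have gm : ∀ {x y : V}, x ≠ y → gen Γ x ∈ parabolic Γ {y}ᶜ := fun h => gen_mem (by simpa using h)
  obtain ⟨p, p1, p2⟩ : ∃ p : BSVert (parabolic Γ {w}ᶜ) (parabolic Γ {w'}ᶜ),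
      gen Γ w • p = p ∧ gen Γ w' • p = p := by
    by_cases hw : w ∈ K
    · have hw' : w' ∉ K := fun h => hna (hK _ hw _ h hne)
      exact ⟨vB _ _ g, smul_vB_eq_iff.2 (parabolic_mono (by rintro x hx rfl; exact hw' hx) h1),
        smul_vB_eq_iff.2 (parabolic_mono (by rintro x hx rfl; exact hw' hx) h2)⟩
    · exact ⟨vA _ _ g, smul_vA_eq_iff.2 (parabolic_mono (by rintro x hx rfl; exact hw hx) h1),
        smul_vA_eq_iff.2 (parabolic_mono (by rintro x hx rfl; exact hw hx) h2)⟩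
  have fB := fun k => smul_vB_eq_iff (k := k) (A := parabolic Γ {w}ᶜ) (B := parabolic Γ {w'}ᶜ) (g := 1)
  have fA := fun k => smul_vA_eq_iff (k := k) (A := parabolic Γ {w}ᶜ) (B := parabolic Γ {w'}ᶜ) (g := 1)
  simp only [inv_one, one_mul, mul_one] at fA fB
  have a1 := mt (fA _).1 (nm w)
  have a2 := (fA _).2 (gm hne.symm)
  have b1 := (fB _).2 (gm hne)
  have b2 := mt (fB _).1 (nm w')
  have hadj := bs_adj (A := parabolic Γ {w}ᶜ) (B := parabolic Γ {w'}ᶜ) 1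
  have hpA : vA _ _ 1 ≠ p := by rintro rfl; exact a1 p1
  have hpB : vB _ _ 1 ≠ p := by rintro rfl; exact b2 p2
  rcases dist_step am.isTree hadj p with h | h
  · have e := eq_nxt am.isTree hadj (w := p) (by omega)
    have := ht.cvx_fixS (gen Γ w') _ a2 _ p2 hpA
    rw [← e] at this
    exact b2 this
  · have e := eq_nxt am.isTree hadj.symm (w := p) (by omega)
    have := ht.cvx_fixS (gen Γ w) _ b1 _ p1 hpB
    rw [← e] at this
    exact a1 this

/-- Preimages of generators in a common clique parabolic come from adjacent generators. -/
theorem adj_of_symm_mem_clique [TF Γ] [Large Γ] [TF Λ] [Large Λ] {w w' : W} (hne : w ≠ w')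
    (hK : IsCl Γ K) (h1 : g⁻¹ * ψ.symm (gen Λ w) * g ∈ parabolic Γ K)
    (h2 : g⁻¹ * ψ.symm (gen Λ w') * g ∈ parabolic Γ K) : Λ.graph.Adj w w' := by
  let ψ' := (MulAut.conj g).trans ψ
  have e : ∀ x, ψ'.symm x = g⁻¹ * ψ.symm x * g := fun x => rfl
  rw [← e] at h1 h2
  rcases clique_cases hK with rfl | ⟨a, rfl⟩ | ⟨a, b, hab, rfl⟩
  · rw [parabolic_empty, Subgroup.mem_bot] at h1
    exact (symm_gen_ne_one ψ' _ h1).elim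
  · obtain ⟨i, hi⟩ := mem_zpow h1
    obtain ⟨j, hj⟩ := mem_zpow h2
    exact (adj_of_commute hne ((commute_symm_iff ψ').1 (by
      simp_all))).1
  · obtain ⟨k, K', hK', m1, m2⟩ := braid_clique ψ'.symm hab (pair_not_commute hab)
    have key := conj_map_mem ψ'.toMonoidHom (g := k) (S := {a, b}) (P := parabolic Λ K')
      (by rintro x (rfl | rfl); exacts [m1, m2])
    have k1 := key _ h1
    have k2 := key _ h2
    change k⁻¹ * ψ' (ψ'.symm _) * k ∈ _ at k1 k2
    rw [MulEquiv.apply_symm_apply] at k1 k2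
    exact adj_of_mem_clique hne hK' k1 k2

end

section

section
variable {V : Type u} {Γ : DefiningGraph V}
variable {K P₁ P₂ : Set V}

theorem Split.clique (h : Split Γ Set.univ P₁ P₂) (hK : IsCl Γ K) : K ⊆ P₁ ∨ K ⊆ P₂ := by
  by_contra hno
  push Not at hno
  obtain ⟨h1, h2⟩ := hno
  obtain ⟨a, ha, ha1⟩ := Set.not_subset.1 h1
  obtain ⟨b, hb, hb2⟩ := Set.not_subset.1 h2
  have e : ∀ x, x ∈ P₁ ∨ x ∈ P₂ := fun x => by
    have : x ∈ P₁ ∪ P₂ := by rw [h.1]; trivial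
    exact this
  have := h.2.2 a trivial b trivial (hK a ha b hb (by rintro rfl; exact (e a).elim ha1 hb2))
  tauto

end

variable {V : Type u} {Γ : DefiningGraph V} [Finite V] {W : Type v} [Finite W]
variable {P₁ P₂ Q Q₁ Q₂ S : Set V} {a b : V}
  {Λ : DefiningGraph W} (ψ : ArtinGroup Γ ≃* ArtinGroup Λ)

/-- A parabolic on a connected vertex set without separating vertices or edges lands on one side
of a splitting. -/
theorem chunk_step [TF Γ] [Large Γ] [TF Λ] [Large Λ] (hc' : Λ.graph.Preconnected) [Nontrivial W]
    {S : Set W} (hS : (Λ.graph.induce S).Connected ∧ NoSeparating Λ.graph S)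
    (hP : Split Γ Set.univ P₁ P₂) (hQ : Q₁ ∪ Q₂ = Q) (h1 : P₁ ∩ Q = Q₁) (h2 : P₂ ∩ Q = Q₂)
    (hm : ∀ s ∈ S, ψ.symm (gen Λ s) ∈ parabolic Γ Q) : ∃ g, (∀ s ∈ S, g⁻¹ * ψ.symm (gen Λ s) * g ∈
    parabolic Γ Q₁) ∨ ∀ s ∈ S, g⁻¹ * ψ.symm (gen Λ s) * g ∈ parabolic Γ Q₂ := by
  have e : ∀ x, x ∈ P₁ ∨ x ∈ P₂ := fun x => by
    have : x ∈ P₁ ∪ P₂ := by rw [hP.1]; trivial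
    exact this
  obtain ⟨am, hin⟩ := visual_amalg (Γ := Γ) e (fun a b => hP.2.2 a trivial b trivial)
  have ht := am.treeAction
  have hnc : ∀ {a b : W}, Λ.graph.Adj a b → ¬ Commute (gen Λ a) (gen Λ b) :=
    fun h => pair_not_commute h
  have hpair : ∀ {a b : W}, Λ.graph.Adj a b → ∃ p : BSVert (parabolic Γ P₁) (parabolic Γ P₂),
      ψ.symm (gen Λ a) • p = p ∧ ψ.symm (gen Λ b) • p = p := by
    intro a b hab
    obtain ⟨g, K, hK, m1, m2⟩ := braid_clique ψ hab (hnc hab)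
    rcases hP.clique hK with h | h
    · exact ⟨vA _ _ g, smul_vA_eq_iff.2 (parabolic_mono h m1),
        smul_vA_eq_iff.2 (parabolic_mono h m2)⟩
    · exact ⟨vB _ _ g, smul_vB_eq_iff.2 (parabolic_mono h m1),
        smul_vB_eq_iff.2 (parabolic_mono h m2)⟩
  let F : S → Set (BSVert (parabolic Γ P₁) (parabolic Γ P₂)) := fun s => fixS _ (ψ.symm (gen Λ s.1))
  have meet := Cvx.meet_of_connected am.isTree (L := Λ.graph.induce S) (F := F)
    (fun s => ht.cvx_fixS _)
    (fun s => by
      obtain ⟨v, hv⟩ := exists_adj hc' s.1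
      obtain ⟨p, hp, -⟩ := hpair hv
      exact ⟨p, hp⟩)
    (fun i j hij => by
      obtain ⟨p, hp, hp'⟩ := hpair (show Λ.graph.Adj i.1 j.1 from hij)
      exact ⟨p, hp, hp'⟩)
    (fun y y' hy => by
      let K : Set W := {w | ∃ h : w ∈ S, y ∈ F ⟨w, h⟩ ∧ y' ∈ F ⟨w, h⟩}
      have hK : IsCl Λ K := by
        rintro w ⟨hw, w1, w2⟩ w' ⟨hw', w1', w2'⟩ hne
        have key : ∀ g : ArtinGroup Γ, vA _ _ g ∈ F ⟨w, hw⟩ → vB _ _ g ∈ F ⟨w, hw⟩ →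
            vA _ _ g ∈ F ⟨w', hw'⟩ → vB _ _ g ∈ F ⟨w', hw'⟩ → Λ.graph.Adj w w' := by
          intro g a1 a2 b1 b2
          refine adj_of_symm_mem_clique ψ hne (g := g) hP.2.1 ?_ ?_
          · rw [← hin]
            exact ⟨smul_vA_eq_iff.1 a1, smul_vB_eq_iff.1 a2⟩
          · rw [← hin]
            exact ⟨smul_vA_eq_iff.1 b1, smul_vB_eq_iff.1 b2⟩
        obtain ⟨g, ⟨rfl, rfl⟩ | ⟨rfl, rfl⟩⟩ := hy
        · exact key g w1 w2 w1' w2'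
        · exact key g w2 w1 w2' w1'
      have hKS : ∀ w ∈ K, w ∈ S := fun w ⟨h, _⟩ => h
      have hpre : (Λ.graph.induce (S \ K)).Preconnected := by
        rcases clique_cases hK with h | ⟨a, h⟩ | ⟨a, b, hab, h⟩
        · rw [h, Set.sdiff_empty]; exact hS.1.preconnected
        · have ha := hKS a (by rw [h]; rfl)
          rw [h]; exact hS.2.1 a ha
        · have ha := hKS a (by rw [h]; exact Or.inl rfl)
          have hb := hKS b (by rw [h]; exact Or.inr rfl)
          rw [h]; exact hS.2.2 a ha b hb hab
      intro i j
      let f : Λ.graph.induce (S \ K) →g (Λ.graph.induce S).induce {i | ¬ (y ∈ F i ∧ y' ∈ F i)} :=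
        ⟨fun x => ⟨⟨x.1, x.2.1⟩, fun h => x.2.2 ⟨x.2.1, h⟩⟩, fun h => h⟩
      exact (hpre ⟨i.1.1, i.1.2, fun ⟨_, h⟩ => i.2 h⟩ ⟨j.1.1, j.1.2, fun ⟨_, h⟩ => j.2 h⟩).map f)
  have : Fintype S := Fintype.ofFinite S
  have : Nonempty S := hS.1.nonempty
  obtain ⟨p, hp⟩ := helly am.isTree (Finset.univ : Finset S) Finset.univ_nonempty F
    (fun i _ => ht.cvx_fixS _) (fun i _ j _ => meet i j)
  have sub1 : parabolic Γ Q₁ ≤ parabolic Γ P₁ := parabolic_mono (by rw [← h1]; exact Set.inter_subset_left)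
  have sub2 : parabolic Γ Q₂ ≤ parabolic Γ P₂ := parabolic_mono (by rw [← h2]; exact Set.inter_subset_left)
  have hsup : parabolic Γ Q₁ ⊔ parabolic Γ Q₂ = parabolic Γ Q := by rw [← parabolic_union, hQ]
  have hcv := am.cvx_orbY sub1 sub2
  rw [hsup] at hcv
  obtain ⟨y, hy, hg⟩ := gate_exists am.isTree hcv ⟨_, vA_mem_orbY (one_mem _)⟩ p
  have hfix : ∀ s ∈ S, ψ.symm (gen Λ s) • y = y := fun s hs =>
    ht.gate_fixed (fun w hw => smul_orbY (hm s hs) hw) (hp ⟨s, hs⟩ (Finset.mem_univ _)) hy hg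
  obtain ⟨a, ha, rfl | rfl⟩ := hy
  · refine ⟨a, Or.inl fun s hs => ?_⟩
    rw [← h1]
    exact TF.inter (smul_vA_eq_iff.1 (hfix s hs)) (mul_mem (mul_mem (inv_mem ha) (hm s hs)) ha)
  · refine ⟨a, Or.inr fun s hs => ?_⟩
    rw [← h2]
    exact TF.inter (smul_vB_eq_iff.1 (hfix s hs)) (mul_mem (mul_mem (inv_mem ha) (hm s hs)) ha)

theorem isCl_singleton (a : V) : IsCl Γ {a} := by
  rintro x rfl y rfl h; exact (h rfl).elim

theorem isCl_pair (h : Γ.graph.Adj a b) : IsCl Γ {a, b} := by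
  rintro x (rfl | rfl) y (rfl | rfl) hn
  exacts [(hn rfl).elim, h, h.symm, (hn rfl).elim]

include ψ in
/-- The case of a single vertex. -/
theorem chunk_image_subsingleton [Subsingleton V] [Nonempty V] : Subsingleton W ∧ Nonempty W := by
  obtain ⟨v⟩ := ‹Nonempty V›
  have huniv : (Set.univ : Set V) = {v} := by ext x; simp [Subsingleton.elim x v]
  have hz : ∀ x : ArtinGroup Γ, ∃ i : ℤ, x = gen Γ v ^ i := fun x => mem_zpow (by
    rw [← huniv, parabolic_univ]; trivial)
  constructor
  · by_contra hno
    rw [not_subsingleton_iff_nontrivial] at hno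
    obtain ⟨a, b, hab⟩ := hno.exists_pair_ne
    obtain ⟨i, hi⟩ := hz (ψ.symm (gen Λ a))
    obtain ⟨j, hj⟩ := hz (ψ.symm (gen Λ b))
    have h0 : gen Λ a ^ j = gen Λ b ^ i := ψ.symm.injective (by
      rw [map_zpow, map_zpow, hi, hj, ← zpow_mul, ← zpow_mul, mul_comm])
    have := gen_zpow_ne hab h0
    rw [this, zpow_zero] at hj
    exact symm_gen_ne_one ψ b hj
  · by_contra hno
    have hu : (Set.univ : Set W) = ∅ := by
      ext x; exact (hno ⟨x⟩).elim
    have h1 : ψ (gen Γ v) ∈ parabolic Λ Set.univ := by rw [parabolic_univ]; trivial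
    rw [hu, parabolic_empty, Subgroup.mem_bot] at h1
    exact symm_gen_ne_one ψ.symm v h1

theorem isChunk_univ [Subsingleton V] [Nonempty V] : IsChunk Γ.graph Set.univ := by
  have hp : ∀ S : Set V, (Γ.graph.induce S).Preconnected := fun S a b => by
    rw [Subsingleton.elim a b]
  exact ⟨⟨(SimpleGraph.connected_iff _).2 ⟨hp _, ⟨⟨Classical.arbitrary V, trivial⟩⟩⟩,
    fun _ _ => hp _, fun _ _ _ _ _ => hp _⟩, fun T hT _ => Set.univ_subset_iff.1 hT⟩

variable [TF Γ] [Large Γ]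

theorem exists_chunk_of_connected [TF Λ] [Large Λ] (hc' : Λ.graph.Preconnected) [Nontrivial W]
    {S : Set W} (hS : (Λ.graph.induce S).Connected ∧ NoSeparating Λ.graph S) : ∃ g S', IsChunk
    Γ.graph S' ∧ ∀ x ∈ parabolic Λ S, g⁻¹ * ψ.symm x * g ∈ parabolic Γ S' := by
  classical
  have hex : ∃ n, ∃ Q : Set V, Q.ncard = n ∧ Good Γ Q ∧
      ∃ g, ∀ s ∈ S, g⁻¹ * ψ.symm (gen Λ s) * g ∈ parabolic Γ Q :=
    ⟨_, Set.univ, rfl, good_univ, 1, fun s _ => by rw [parabolic_univ]; trivial⟩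
  obtain ⟨Q, hQn, hQ, g, hg⟩ := Nat.find_spec hex
  have hmin : ∀ Q' : Set V, Q' ⊆ Q → Q' ≠ Q → Good Γ Q' →
      ∀ g, ¬ ∀ s ∈ S, g⁻¹ * ψ.symm (gen Λ s) * g ∈ parabolic Γ Q' := by
    intro Q' hs hne hgood g' h
    refine Nat.find_min hex (m := Q'.ncard) ?_ ⟨Q', rfl, hgood, g', h⟩
    rw [← hQn]
    exact Set.ncard_lt_ncard (hs.ssubset_of_ne hne) (Set.toFinite _)
  have hpre : ∀ K ⊆ Q, IsCl Γ K → (Γ.graph.induce (Q \ K)).Preconnected := by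
    intro K hKQ hK
    by_contra hno
    obtain ⟨Q₁, Q₂, hs, n1, n2⟩ := exists_split hKQ hK hno
    obtain ⟨P₁, P₂, hP, -, e1, e2⟩ := hQ Q₁ Q₂ hs
    obtain ⟨g', h⟩ := chunk_step ((MulAut.conj g).trans ψ) hc' hS hP hs.1 e1 e2 hg
    have key : ∀ s, (g * g')⁻¹ * ψ.symm (gen Λ s) * (g * g') =
        g'⁻¹ * ((MulAut.conj g).trans ψ).symm (gen Λ s) * g' := fun s => by
      change _ = g'⁻¹ * (g⁻¹ * ψ.symm (gen Λ s) * g) * g'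
      group
    rcases h with h | h
    · exact hmin Q₁ (hs.1 ▸ Set.subset_union_left) n1 (hQ.piece hs) (g * g')
        fun s hs => by rw [key]; exact h s hs
    · exact hmin Q₂ (hs.1 ▸ Set.subset_union_right) n2 (hQ.piece hs.symm) (g * g')
        fun s hs => by rw [key]; exact h s hs
  have hne : Nonempty Q := by
    by_contra hno
    rw [Set.nonempty_coe_sort, Set.not_nonempty_iff_eq_empty] at hno
    obtain ⟨s, hs⟩ := hS.1.nonempty
    have := hg s hs
    rw [hno, parabolic_empty, Subgroup.mem_bot] at this
    exact symm_gen_ne_one ((MulAut.conj g).trans ψ) s this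
  obtain ⟨S', hS', hch⟩ := exists_chunk (Γ := Γ) (Q := Q) ⟨(SimpleGraph.connected_iff _).2 ⟨by
        have := hpre ∅ (Set.empty_subset _) (fun a ha => ha.elim)
        rwa [Set.sdiff_empty] at this, hne⟩,
      fun v hv => hpre _ (Set.singleton_subset_iff.2 hv) (isCl_singleton v),
      fun a ha b hb hab => hpre _ (by rintro x (rfl | rfl) <;> assumption) (isCl_pair hab)⟩
  exact ⟨g, S', hch, conj_map_mem ψ.symm.toMonoidHom fun s hs => parabolic_mono hS' (hg s hs)⟩

theorem chunk_image (hc : Γ.graph.Preconnected) [Nontrivial V] (hS : IsChunk Γ.graph S)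
    : ∃ h S', IsChunk Λ.graph S' ∧ ∀ x, x ∈ parabolic Γ S ↔ h⁻¹ * ψ x * h ∈ parabolic Λ S' := by
  have := large_of_iso ψ hc
  have := triangleFree_of_iso ψ hc
  have hc' : Λ.graph.Preconnected := (connected_of_iso ψ hc).preconnected
  have : Nontrivial W := by
    by_contra hno
    rw [not_nontrivial_iff_subsingleton] at hno
    exact not_all_commute ψ hc fun a b => by rw [Subsingleton.elim a b]
  obtain ⟨h, S', hS', hh⟩ := exists_chunk_of_connected ψ.symm hc hS.1
  obtain ⟨k, S'', hS'', hk⟩ := exists_chunk_of_connected ψ hc' hS'.1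
  refine ⟨h, S', hS', fun x => ⟨hh x, fun hx => ?_⟩⟩
  change ∀ x ∈ parabolic Γ S, h⁻¹ * ψ x * h ∈ parabolic Λ S' at hh
  have e : ∀ x, h⁻¹ * ψ x * h ∈ parabolic Λ S' →
      (ψ.symm h * k)⁻¹ * x * (ψ.symm h * k) ∈ parabolic Γ S'' := fun x hx => by
    have := hk _ hx
    rw [map_mul, map_mul, map_inv, MulEquiv.symm_apply_apply] at this
    convert this using 1
    group
  have key : ∀ s ∈ S, s ∈ S'' ∧ (ψ.symm h * k)⁻¹ ∈ parabolic Γ S'' := by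
    intro s hs
    obtain ⟨t, ht, hst⟩ := chunk_nbr hc hS hs
    have hz : zc Γ s t ∈ parabolic Γ S := parabolic_mono
      (by rintro x (rfl | rfl) <;> assumption) (zc_mem s t)
    obtain ⟨h1, h2⟩ := clique_conj_sub (S := S'') (g := (ψ.symm h * k)⁻¹)
      (isCl_pair hst) (t := (ψ.symm h * k)⁻¹ * zc Γ s t * (ψ.symm h * k))
      (fun hv => by
        rw [show (ψ.symm h * k)⁻¹ * zc Γ s t * (ψ.symm h * k) =
          (ψ.symm h * k)⁻¹ * zc Γ s t * (ψ.symm h * k)⁻¹⁻¹ by group, vertexType_conj_iff] at hv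
        have := zc_not_vertexType hst (r := 1) (by simpa using hv)
        omega)
      (e _ (hh _ hz)) (by convert zc_mem (Γ := Γ) s t using 1; group)
    exact ⟨h1 (Or.inl rfl), h2⟩
  have hSS := hS.2 S'' (fun s hs => (key s hs).1) hS''.1
  subst hSS
  obtain ⟨s, hs⟩ := hS.1.1.nonempty
  have hm := (key s hs).2
  have := e x hx
  have := mul_mem (mul_mem (inv_mem hm) this) hm
  convert this using 1
  group

/-- Isomorphisms preserve chunk parabolic subgroups. -/
theorem chunk_parabolic_image (hc : Γ.graph.Connected) (g : ArtinGroup Γ)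
    (hS : IsChunk Γ.graph S) : ∃ (h : ArtinGroup Λ) (S' : Set W), IsChunk Λ.graph S' ∧ Subgroup.map
    ψ.toMonoidHom (Subgroup.map (MulAut.conj g).toMonoidHom (parabolic Γ S)) = Subgroup.map
    (MulAut.conj h).toMonoidHom (parabolic Λ S') := by
  have : Nonempty V := hc.nonempty
  have main : ∃ h S', IsChunk Λ.graph S' ∧
      ∀ x, x ∈ parabolic Γ S ↔ h⁻¹ * ψ x * h ∈ parabolic Λ S' := by
    rcases subsingleton_or_nontrivial V with hV | hV
    · obtain ⟨h1, h2⟩ := chunk_image_subsingleton ψ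
      obtain ⟨s, hs⟩ := hS.1.1.nonempty
      have hSu : S = Set.univ := by ext x; simp [Subsingleton.elim x s, hs]
      exact ⟨1, Set.univ, isChunk_univ, fun x => by simp [hSu, parabolic_univ]⟩
    · exact chunk_image ψ hc.preconnected hS
  obtain ⟨h, S', hS', hh⟩ := main
  refine ⟨ψ g * h, S', hS', ?_⟩
  ext y
  simp only [Subgroup.mem_map, MulEquiv.coe_toMonoidHom, MulAut.conj_apply]
  constructor
  · rintro ⟨_, ⟨x, hx, rfl⟩, rfl⟩
    refine ⟨_, (hh x).1 hx, ?_⟩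
    rw [map_mul, map_mul, map_inv]
    group
  · rintro ⟨z, hz, rfl⟩
    refine ⟨_, ⟨ψ.symm (h * z * h⁻¹), (hh _).2 ?_, rfl⟩, ?_⟩
    · rw [MulEquiv.apply_symm_apply]
      convert hz using 1
      group
    · rw [map_mul, map_mul, map_inv, MulEquiv.apply_symm_apply]
      group

end

section Walls

variable {V : Type u} {Γ : DefiningGraph V}
variable {F F' F₀ F₁ F₂ F₃ f h h' t : ArtinGroup Γ} {J K K' : Set V} {a s x y z : V}

theorem side_cross {v w : TV Γ y} (h : (TX Γ y).Adj v w) (hv : side _ _ v)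
    (hw : ¬ side _ _ w) : v = vB (pA Γ y) (pS Γ y) 1 ∧ w = vA (pA Γ y) (pS Γ y) 1 := by
  obtain ⟨g, ⟨rfl, rfl⟩ | ⟨rfl, rfl⟩⟩ := h
  · have : g ∈ pA Γ y ∧ g ∈ pS Γ y := by
      by_contra hg; exact hw (((am Γ y).side_iff_of_edge hg).1 hv)
    exact (not_half_of_mem this.1 (((am Γ y).side_vA g).1 hv)).elim
  · have : g ∈ pA Γ y ∧ g ∈ pS Γ y := by
      by_contra hg; exact hw (((am Γ y).side_iff_of_edge hg).2 hv)
    exact ⟨vB_eq.2 (by simpa using this.2), vA_eq.2 (by simpa using this.1)⟩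

theorem mem_pL_of_fix_sides {w : TV Γ y} (hw : ¬ side _ _ w) (hFw : F • w = w) (n : ℕ) : ∀ v : TV Γ
    y, (TX Γ y).dist v w = n → side _ _ v → F • v = v → F ∈ pL Γ y := by
  induction n with
  | zero =>
    intro v hd hv _
    rw [dist_eq_zero' (ta Γ y).tree] at hd
    exact (hw (hd ▸ hv)).elim
  | succ n ih =>
    intro v hd hv hF
    have hne : v ≠ w := by rintro rfl; exact hw hv
    have hadj := nxt_adj (ta Γ y).tree hne
    have hfix : F • nxt (TX Γ y) v w = nxt (TX Γ y) v w := by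
      rw [(ta Γ y).smul_nxt F hne, hF, hFw]
    by_cases hs : side _ _ (nxt (TX Γ y) v w)
    · have := dist_nxt (ta Γ y).tree hne
      exact ih _ (by omega) hs hfix
    · obtain ⟨h1, h2⟩ := side_cross hadj hv hs
      rw [h2, smul_vA_eq_iff] at hfix
      rw [h1, smul_vB_eq_iff] at hF
      exact mem_pL_iff.2 ⟨by simpa using hfix, by simpa using hF⟩

theorem dist_side {w : TV Γ y} (hw : side _ _ w) (n : ℕ) : ∀ v : TV Γ y, (TX Γ y).dist v w =
    n → ¬ side _ _ v → (TX Γ y).dist v (vA _ _ 1) < (TX Γ y).dist v w := by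
  induction n with
  | zero =>
    intro v hd hv
    rw [dist_eq_zero' (ta Γ y).tree] at hd
    exact (hv (hd ▸ hw)).elim
  | succ n ih =>
    intro v hd hv
    have hne : v ≠ w := by rintro rfl; exact hv hw
    have hadj := nxt_adj (ta Γ y).tree hne
    have h1 := dist_nxt (ta Γ y).tree hne
    by_cases hs : side _ _ (nxt (TX Γ y) v w)
    · obtain ⟨-, h2⟩ := side_cross hadj.symm hs hv
      simp_all
    · have := ih _ (by omega) hs
      rcases dist_step (ta Γ y).tree hadj (vA (pA Γ y) (pS Γ y) 1) with h | h <;> omega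

/-- The coset `h A_K` meets the half-space at `y`. -/
def Sig (Γ : DefiningGraph V) (y : V) (h : ArtinGroup Γ) (K : Set V) : Prop :=
  ∃ k ∈ parabolic Γ K, Half Γ y (h * k)

theorem exists_node_vertex (hK : IsCl Γ K) (y : V) (h : ArtinGroup Γ) :
    ∃ v : TV Γ y, (∀ F, h⁻¹ * F * h ∈ parabolic Γ K → F • v = v) ∧ (Sig Γ y h K ↔ side _ _ v) := by
  by_cases hy : y ∈ K
  · have hKS : parabolic Γ K ≤ pS Γ y := parabolic_mono (by
      intro z hz
      by_cases hzy : z = y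
      · exact Or.inl hzy
      · exact Or.inr (hK y hy z hz (Ne.symm hzy)))
    refine ⟨vB _ _ h, fun F hF => smul_vB_eq_iff.2 (hKS hF), ?_, fun hs => ?_⟩
    · rintro ⟨k, hk, hh⟩
      have e : vB (pA Γ y) (pS Γ y) h = vB _ _ (h * k) := vB_eq.2 (by simpa using hKS hk)
      rw [e, ← (am Γ y).side_iff_of_edge (fun hc => not_half_of_mem hc.1 hh)]
      exact ((am Γ y).side_vA _).2 hh
    · by_cases hc : h ∈ pA Γ y ∧ h ∈ pS Γ y
      · refine ⟨gen Γ y, gen_mem hy, ((am Γ y).side_vA _).1 ?_⟩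
        have hn : ¬ (h * gen Γ y ∈ pA Γ y ∧ h * gen Γ y ∈ pS Γ y) := by
          rintro ⟨h1, -⟩
          have := (Subgroup.mul_mem_cancel_left _ hc.1).1 h1
          exact zpow_not_mem (Γ := Γ) (a := y) (S := {y}ᶜ) (by simp) one_ne_zero (by simpa using this)
        have e : vB (pA Γ y) (pS Γ y) h = vB _ _ (h * gen Γ y) :=
          vB_eq.2 (by simpa using hKS (gen_mem hy))
        rw [(am Γ y).side_iff_of_edge hn, ← e]; exact hs
      · refine ⟨1, one_mem _, ?_⟩
        rw [mul_one]
        exact ((am Γ y).side_vA _).1 (((am Γ y).side_iff_of_edge hc).2 hs)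
  · have hKA : parabolic Γ K ≤ pA Γ y := parabolic_mono (by
      rintro z hz rfl; exact hy hz)
    refine ⟨vA _ _ h, fun F hF => smul_vA_eq_iff.2 (hKA hF), ?_⟩
    rw [(am Γ y).side_vA]
    exact ⟨fun ⟨k, hk, hh⟩ => (half_mul_iff (hKA hk)).1 hh,
      fun hh => ⟨1, one_mem _, by rw [mul_one]; exact hh⟩⟩

/-- An element fixing nodes on both sides of a wall fixes the wall. -/
theorem mem_pL_of_sig (hK : IsCl Γ K)
    (hK' : IsCl Γ K') (hF : h⁻¹ * F * h ∈ parabolic Γ K) (hF' : h'⁻¹ * F * h' ∈ parabolic Γ K')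
    (hs : Sig Γ y h K) (hs' : ¬ Sig Γ y h' K') : F ∈ pL Γ y := by
  obtain ⟨v, hv, hv'⟩ := exists_node_vertex hK y h
  obtain ⟨w, hw, hw'⟩ := exists_node_vertex hK' y h'
  exact mem_pL_of_fix_sides (fun h => hs' (hw'.2 h)) (hw F hF') _ v rfl (hv'.1 hs) (hv F hF)

theorem sig_of_half (hK : IsCl Γ K)
    (hF : h⁻¹ * F * h ∈ parabolic Γ K) (hh : Half Γ y F) : Sig Γ y h K := by
  obtain ⟨v, hv, hv'⟩ := exists_node_vertex hK y h
  rw [hv']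
  by_contra hs
  have h1 := dist_side (((am Γ y).side_vA F).2 hh) _ v rfl hs
  have h2 := (ta Γ y).dist_smul F v (vA (pA Γ y) (pS Γ y) 1)
  rw [hv F hF, smul_vA, mul_one] at h2
  omega

theorem sig_adj (hK : IsCl Γ K) (hy : Sig Γ y h K)
    (hz : Sig Γ z h K) (hne : y ≠ z) : Γ.graph.Adj y z := by
  by_contra hn
  have key : ∀ y z : V, y ≠ z → ¬ Γ.graph.Adj y z → Sig Γ y h K → Sig Γ z h K → z ∉ K → False := by
    rintro y z hne hn ⟨k, hk, hh⟩ ⟨k', hk', hh'⟩ hzK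
    have hA : parabolic Γ K ≤ pA Γ z := parabolic_mono (by rintro x hx rfl; exact hzK hx)
    refine half_disjoint hne hn (h * k) ⟨hh, ?_⟩
    rw [half_mul_iff (hA hk)]
    exact (half_mul_iff (hA hk')).1 hh'
  by_cases hzK : z ∈ K
  · by_cases hyK : y ∈ K
    · exact hn (hK y hyK z hzK hne)
    · exact key z y hne.symm (fun h => hn h.symm) hz hy hyK
  · exact key y z hne hn hy hz hzK

variable [Finite V]

theorem exists_half [TF Γ] (hh : h ≠ 1) : ∃ s, Half Γ s h := by
  suffices H : ∀ g : ArtinGroup Γ, g = 1 ∨ ∃ s, Half Γ s g from (H h).resolve_left hh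
  have step : ∀ (h : ArtinGroup Γ) v b, (b = gen Γ v ∨ b = (gen Γ v)⁻¹) →
      (h = 1 ∨ ∃ s, Half Γ s h) → h * b = 1 ∨ ∃ s, Half Γ s (h * b) := by
    intro h v b hb ih
    have hbm : ∀ S : Set V, v ∈ S → b ∈ parabolic Γ S := by
      intro S hS
      rcases hb with rfl | rfl
      exacts [gen_mem hS, inv_mem (gen_mem hS)]
    have hb' : ∃ i : ℤ, i ≠ 0 ∧ b = gen Γ v ^ i := by
      rcases hb with rfl | rfl
      exacts [⟨1, one_ne_zero, by simp⟩, ⟨-1, by norm_num, by simp⟩]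
    rcases ih with rfl | ⟨s, hs⟩
    · obtain ⟨i, hi, rfl⟩ := hb'
      exact Or.inr ⟨v, by simpa using half_zpow_mul hi (half_one v)⟩
    · by_cases hsv : v = s
      · subst hsv
        have hL : h ∉ pL Γ v := fun hL => not_half_of_mem (mem_pL_iff.1 hL).1 hs
        by_cases hL' : h * b ∈ pL Γ v
        · by_cases h1 : h * b = 1
          · exact Or.inl h1
          · obtain ⟨l, hl, hc, hp⟩ := exists_reduced hL'
            cases l with
            | nil => exact (h1 (by simpa using hp.symm)).elim
            | cons p l =>
              exact Or.inr ⟨p.1, hp ▸ indep_reduced_half (TF.indep_lk v) p l hl hc⟩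
        · exact Or.inr ⟨v, (half_mul_iff' (hbm _ (mem_st_self v)) hL hL').2 hs⟩
      · exact Or.inr ⟨s, (half_mul_iff (hbm _ hsv)).2 hs⟩
  exact gen_induction (Or.inl rfl) (fun h v => step h v _ (Or.inl rfl))
    (fun h v => step h v _ (Or.inr rfl))

/-- A vertex whose base wall separates `1` from `F`. -/
noncomputable def xw [Nonempty V] (F : ArtinGroup Γ) : V := Classical.epsilon fun y => Half Γ y F

/-- `F` and `F'` lie in a common conjugate of a clique parabolic subgroup. -/
def Near (F F' : ArtinGroup Γ) : Prop :=
  ∃ (h : ArtinGroup Γ) (K : Set V), IsCl Γ K ∧ h⁻¹ * F * h ∈ parabolic Γ K ∧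
    h⁻¹ * F' * h ∈ parabolic Γ K

theorem GC.ne_one (h : GC F) : F ≠ 1 := by
  rintro rfl
  have := h.len
  simp [ArtinRigid.len] at this

variable [Nonempty V]

variable [TF Γ]

theorem half_xw (hF : F ≠ 1) : Half Γ (xw F) F := Classical.epsilon_spec (exists_half hF)

theorem eq_of_half_gen (h : Half Γ x (gen Γ s)) : x = s := by
  by_contra hne
  exact not_half_of_mem (gen_mem (S := {x}ᶜ) (fun h => hne h.symm)) h

theorem xw_gen (s : V) : xw (gen Γ s) = s := eq_of_half_gen (half_xw (GC.ne_one ⟨1, s, by simp⟩))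

theorem xw_near (hF : GC F) (hF' : GC F') (h : Near F F') :
    xw F = xw F' ∨ Γ.graph.Adj (xw F) (xw F') := by
  obtain ⟨h, K, hK, h1, h2⟩ := h
  exact or_iff_not_imp_left.2 fun hne => sig_adj hK (sig_of_half hK h1 (half_xw hF.ne_one))
    (sig_of_half hK h2 (half_xw hF'.ne_one)) hne

theorem xw_cone (hh : h ≠ 1) :
    ∃ s, ∀ t, xw (h * gen Γ t * h⁻¹) = s ∨ Γ.graph.Adj (xw (h * gen Γ t * h⁻¹)) s := by
  obtain ⟨s, hs⟩ := exists_half hh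
  refine ⟨s, fun t => or_iff_not_imp_left.2 fun hne => sig_adj (isCl_singleton t) (h := h)
    (sig_of_half (isCl_singleton t) ?_ (half_xw (GC.ne_one ⟨h, t, rfl⟩)))
    ⟨1, one_mem _, by rwa [mul_one]⟩ hne⟩
  convert gen_mem (Γ := Γ) (Set.mem_singleton t) using 1; group

/-- An elliptic element of an independent parabolic, if a generator conjugate, is conjugate to a
generator inside it. -/
theorem GC.conj_in_indep (hJ : Indep Γ J) (ht : GC t)
    (h : t ∈ parabolic Γ J) : ∃ f ∈ parabolic Γ J, ∃ a ∈ J, t = f * gen Γ a * f⁻¹ := by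
  obtain ⟨f, hf, K, hK, hKc, hk⟩ := TF.desc (P := J) (H := {t}) (by rintro _ rfl; exact h) (by
    intro u _; obtain ⟨v, hv⟩ := ht.vertexType.elliptic u
    exact ⟨v, by rintro _ rfl; exact hv⟩)
  have hk := hk t rfl
  rcases clique_cases hKc with rfl | ⟨a, rfl⟩ | ⟨a, b, hab, rfl⟩
  · rw [parabolic_empty, Subgroup.mem_bot] at hk
    have := ht.conj' f
    rw [hk] at this
    exact (this.ne_one rfl).elim
  · obtain ⟨i, hi⟩ := mem_zpow hk
    have h1 : ArtinRigid.len (f⁻¹ * t * f) = 1 := by rw [len_conj', ht.len]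
    rw [hi, len_zpow, len_gen, mul_one] at h1
    subst h1
    refine ⟨f, hf, a, hK rfl, ?_⟩
    rw [zpow_one] at hi
    rw [← hi]; group
  · exact (hJ a (hK (by simp)) b (hK (by simp)) hab).elim

/-- A conjugate of a generator in an independent parabolic, other than the generator `x` itself, is
separated from the base by a translate under `⟨x⟩` of a wall other than that of `x`. -/
theorem indep_strip (hJ : Indep Γ J)
    (hf : f ∈ parabolic Γ J) (ha : a ∈ J) (hne : f * gen Γ a * f⁻¹ ≠ gen Γ x) : ∃ (j : ℤ) (y : V)
    (f' : ArtinGroup Γ), y ∈ J ∧ y ≠ x ∧ f = gen Γ x ^ j * f' ∧ (Half Γ y f' ∨ f' = 1 ∧ a = y) := by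
  obtain ⟨l, hl, hc, rfl⟩ := exists_reduced hf
  have one : ∀ j : ℤ, gen Γ x ^ j * gen Γ a * (gen Γ x ^ j)⁻¹ ≠ gen Γ x → a ≠ x := by
    rintro j h rfl
    exact h (by group)
  cases l with
  | nil =>
    refine ⟨0, a, 1, ha, one 0 ?_, by simp, Or.inr ⟨rfl, rfl⟩⟩
    simpa using hne
  | cons p l =>
    by_cases hp : p.1 = x
    · cases l with
      | nil =>
        refine ⟨p.2, a, 1, ha, one p.2 ?_, by simp [hp], Or.inr ⟨rfl, rfl⟩⟩
        simpa [hp] using hne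
      | cons q l =>
        rw [List.isChain_cons_cons] at hc
        refine ⟨p.2, q.1, _, (hl q (by simp)).1, fun h => hc.1 (hp.trans h.symm), ?_, Or.inl
          (indep_reduced_half hJ q l (fun r hr => hl r (List.mem_cons_of_mem _ hr)) hc.2)⟩
        rw [List.map_cons, List.prod_cons, hp]
    · exact ⟨0, p.1, _, (hl p (by simp)).1, hp, by simp, Or.inl (indep_reduced_half hJ p l hl hc)⟩

/-- Four consecutive generator conjugates whose walls are pairwise distinct in the way forced by a
cycle of length at least four: the second one is a generator. -/
theorem eq_gen_xw [Large Γ] (h0 : GC F₀) (h1 : GC F₁) (h2 : GC F₂) (h3 : GC F₃) (n01 : Near F₀ F₁)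
    (n12 : Near F₁ F₂) (n23 : Near F₂ F₃) (x01 : xw F₀ ≠ xw F₁) (x12 : xw F₁ ≠ xw F₂)
    (x23 : xw F₂ ≠ xw F₃) (x02 : xw F₀ ≠ xw F₂) (x13 : xw F₁ ≠ xw F₃) : F₁ = gen Γ (xw F₁) := by
  have hx12 := (xw_near h1 h2 n12).resolve_left x12
  obtain ⟨h, K, hK, e0, e1⟩ := n01
  obtain ⟨h', K', hK', e1', e2⟩ := n12
  obtain ⟨h'', K'', hK'', e2', e3⟩ := n23
  have H : ∀ {F}, GC F → Half Γ (xw F) F := fun hF => half_xw hF.ne_one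
  have tri : ∀ {a b c : V} {h : ArtinGroup Γ} {K : Set V}, IsCl Γ K → Sig Γ a h K → Sig Γ b h K →
      a ≠ b → a ≠ c → b ≠ c → ¬ Sig Γ c h K := fun hK ha hb hab hac hbc hc =>
    TF.out _ _ _ (sig_adj hK ha hb hab) (sig_adj hK hb hc hbc) (sig_adj hK ha hc hac)
  set x := xw F₁ with hx
  set b := xw F₂
  have t1 : F₁ ∈ pL Γ b := mem_pL_of_sig hK' hK e1' e1 (sig_of_half hK' e2 (H h2))
    (tri hK (sig_of_half hK e0 (H h0)) (sig_of_half hK e1 (H h1)) x01 x02 x12)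
  have t2 : F₂ ∈ pL Γ x := mem_pL_of_sig hK' hK'' e2 e2' (sig_of_half hK' e1' (H h1))
    (tri hK'' (sig_of_half hK'' e2' (H h2)) (sig_of_half hK'' e3 (H h3)) x23 x12.symm x13.symm)
  by_contra hne
  have hJ := TF.indep_lk (Γ := Γ) b
  obtain ⟨f, hf, a, ha, hfa⟩ := h1.conj_in_indep hJ t1
  obtain ⟨j, y, f₁, hyJ, hyx, hff, hy⟩ := indep_strip hJ hf ha (hfa ▸ hne)
  have hyx' : ¬ Γ.graph.Adj y x := hJ y hyJ x hx12.symm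
  set t := f₁ * gen Γ a * f₁⁻¹ with ht
  have hF1 : F₁ = gen Γ x ^ j * t * (gen Γ x ^ j)⁻¹ := by rw [hfa, hff, ht]; group
  have htL : t ∉ pL Γ y := by
    intro hL
    have hJt : t ∈ pL Γ b := by
      have : t = (gen Γ x ^ j)⁻¹ * F₁ * gen Γ x ^ j := by rw [hF1]; group
      rw [this]
      have hg : gen Γ x ^ j ∈ pL Γ b := gen_zpow_mem hx12.symm j
      exact mul_mem (mul_mem (inv_mem hg) t1) hg
    have := TF.inter hL hJt
    rw [show lk Γ y ∩ lk Γ b = ∅ by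
      ext z; simp only [Set.mem_inter_iff, mem_lk, Set.mem_empty_iff_false, iff_false, not_and]
      exact fun hz hz' => hJ y hyJ z hz' hz, parabolic_empty, Subgroup.mem_bot] at this
    exact GC.ne_one ⟨f₁, a, rfl⟩ this
  have hsig : ∀ {k : ArtinGroup Γ} {L : Set V}, IsCl Γ L → k⁻¹ * t * k ∈ parabolic Γ L →
      Sig Γ y k L := by
    intro k L hL hk
    by_contra hn
    refine htL (mem_pL_of_sig (h := f₁) (isCl_singleton a) hL ?_ hk ?_ hn)
    · convert gen_mem (Γ := Γ) (Set.mem_singleton a) using 1; rw [ht]; group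
    · rcases hy with hy | ⟨rfl, rfl⟩
      · exact ⟨1, one_mem _, by rwa [mul_one]⟩
      · exact ⟨gen Γ a, gen_mem rfl, by simpa using half_zpow_mul one_ne_zero (half_one (Γ := Γ) a)⟩
  have hk' : ∀ F, ((gen Γ x ^ j)⁻¹ * h')⁻¹ * ((gen Γ x ^ j)⁻¹ * F * gen Γ x ^ j) *
      ((gen Γ x ^ j)⁻¹ * h') = h'⁻¹ * F * h' := by intro F; group
  have htF : t = (gen Γ x ^ j)⁻¹ * F₁ * gen Γ x ^ j := by rw [hF1]; group
  have hj : j ≠ 0 := by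
    rintro rfl
    have : Sig Γ y h' K' := hsig hK' (by rw [htF]; simpa using e1')
    exact hyx' (sig_adj hK' this (sig_of_half hK' e1' (H h1)) hyx)
  have hs1 : Sig Γ y ((gen Γ x ^ j)⁻¹ * h') K' := hsig hK' (by rw [htF, hk']; exact e1')
  obtain ⟨f', hf', a', ha', hfa'⟩ := h2.conj_in_indep (TF.indep_lk x) t2
  have hyL : (gen Γ x ^ j)⁻¹ * F₂ * gen Γ x ^ j ∈ pL Γ y := by
    refine mem_pL_of_sig (h' := (gen Γ x ^ j)⁻¹ * f') hK' (isCl_singleton a') ?_ ?_ hs1 ?_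
    · rw [hk']; exact e2
    · convert gen_mem (Γ := Γ) (Set.mem_singleton a') using 1; rw [hfa']; group
    · rintro ⟨k, hk, hh⟩
      have hmem : ∀ {S : Set V}, S ⊆ {y}ᶜ → parabolic Γ S ≤ pA Γ y := parabolic_mono
      have hlk : lk Γ x ⊆ {y}ᶜ := by rintro z hz rfl; exact hyx' hz.symm
      refine not_half_of_mem (mul_mem (mul_mem (inv_mem (gen_zpow_mem ?_ j)) (hmem hlk hf'))
        (hmem ?_ hk)) hh
      · exact fun h => hyx h.symm
      · rintro _ rfl; exact hlk ha'
  have hxL : (gen Γ x ^ j)⁻¹ * F₂ * gen Γ x ^ j ∈ pL Γ x := by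
    have hg : gen Γ x ^ j ∈ pS Γ x := gen_zpow_mem (mem_st_self x) j
    refine parabolic_mono ?_ (TF.inter hyL
      (mul_mem (mul_mem (inv_mem hg) (parabolic_mono (lk_sub_st x) t2)) hg))
    rintro z ⟨hz, rfl | hz'⟩
    · exact (hyx' hz).elim
    · exact hz'
  exact h2.ne_one (star_zpow hj t2 hxL)

end Walls

section Ribbon

variable {V : Type u} {Γ : DefiningGraph V} [Finite V] [Nonempty V] [TF Γ]
variable {h t : ArtinGroup Γ} {K : Set V} {a b : V}

theorem GC.conj_in_clique (hK : IsCl Γ K) (ht : GC t)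
    (h : t ∈ parabolic Γ K) : ∃ f ∈ parabolic Γ K, ∃ a ∈ K, t = f * gen Γ a * f⁻¹ := by
  rcases clique_cases hK with rfl | ⟨a, rfl⟩ | ⟨a, b, hab, rfl⟩
  · exact ht.conj_in_indep (by simp [Indep]) h
  · exact ht.conj_in_indep (by rintro x rfl y rfl hx; exact Γ.graph.loopless.irrefl _ hx) h
  · obtain ⟨g, hg, i, hi⟩ := vertexType_pair hab h ht.vertexType
    have h1 : ArtinRigid.len (g⁻¹ * t * g) = 1 := by rw [len_conj', ht.len]
    rcases hi with hi | hi <;>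
    · rw [hi, len_zpow, len_gen, mul_one] at h1
      subst h1
      rw [zpow_one] at hi
      refine ⟨g, hg, _, ?_, by rw [← hi]; group⟩
      simp

variable {R : V → V → ArtinGroup Γ → Prop}
  (trans : ∀ {a b c x y}, R a b x → R b c y → R a c (x * y))
  (base : ∀ {a b r} {K : Set V}, IsCl Γ K → r ∈ parabolic Γ K → a ∈ K → b ∈ K →
    r⁻¹ * gen Γ a * r = gen Γ b → R a b r)

include trans base

/-- Conjugators between generators are products of conjugators inside clique parabolics. -/
theorem ribbon_aux (N : ℕ) : ∀ P : Set V, P.ncard ≤ N → ∀ a ∈ P, ∀ b ∈ P, ∀ h ∈ parabolic Γ P, h⁻¹ *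
    gen Γ a * h = gen Γ b → R a b h := by
  induction N with
  | zero =>
    intro P hP a ha
    rw [Nat.le_zero, Set.ncard_eq_zero P.toFinite] at hP
    subst hP; exact ha.elim
  | succ N ih =>
    intro P hP
    by_cases hcl : IsCl Γ P
    · exact fun a ha b hb h hh e => base hcl hh ha hb e
    obtain ⟨u, hu, z, hz, huz, hnadj⟩ : ∃ u ∈ P, ∃ z ∈ P, u ≠ z ∧ ¬ Γ.graph.Adj u z := by
      unfold IsCl at hcl; push Not at hcl; exact hcl
    have ih1 := ih (P \ {u}) (by
      simp_all)
    have ih2 := ih (P ∩ st Γ u) (by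
      have : (P ∩ st Γ u).ncard < P.ncard := Set.ncard_lt_ncard ⟨Set.inter_subset_left, fun h => by
        rcases (h hz).2 with h | h
        exacts [huz h.symm, hnadj h]⟩ P.toFinite
      omega)
    have gA : ∀ {a : V}, gen Γ a ∈ pA Γ u → a ≠ u := by
      rintro a h rfl
      exact zpow_not_mem (Γ := Γ) (a := a) (S := {a}ᶜ) (by simp) one_ne_zero (by simpa using h)
    have gS : ∀ {a : V}, gen Γ a ∈ pS Γ u → a ∈ st Γ u := by
      intro a h; by_contra hn
      exact zpow_not_mem (Γ := Γ) hn one_ne_zero (by simpa using h)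
    have inA : ∀ {a b h}, a ∈ P → b ∈ P → h ∈ parabolic Γ P → gen Γ a ∈ pA Γ u → gen Γ b ∈ pA Γ u →
        h ∈ pA Γ u → h⁻¹ * gen Γ a * h = gen Γ b → R a b h := fun {a b h} ha hb hh h1 h2 h3 e =>
      ih1 a ⟨ha, gA h1⟩ b ⟨hb, gA h2⟩ h (TF.inter_compl hh h3) e
    have inS : ∀ {a b h}, a ∈ P → b ∈ P → h ∈ parabolic Γ P → gen Γ a ∈ pS Γ u → gen Γ b ∈ pS Γ u →
        h ∈ pS Γ u → h⁻¹ * gen Γ a * h = gen Γ b → R a b h := fun {a b h} ha hb hh h1 h2 h3 e =>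
      ih2 a ⟨ha, gS h1⟩ b ⟨hb, gS h2⟩ h (TF.inter hh h3) e
    have fA : ∀ {k : ArtinGroup Γ}, k • vA (pA Γ u) (pS Γ u) 1 = vA _ _ 1 → k ∈ pA Γ u := fun h => by
      simpa using smul_vA_eq_iff.1 h
    have fS : ∀ {k : ArtinGroup Γ}, k • vB (pA Γ u) (pS Γ u) 1 = vB _ _ 1 → k ∈ pS Γ u := fun h => by
      simpa using smul_vB_eq_iff.1 h
    have Bs : ∀ w : TV Γ u, (w = vA _ _ 1 ∨ w = vB _ _ 1) → w ∈ YP Γ u P := by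
      rintro w (rfl | rfl)
      exacts [⟨1, one_mem _, Or.inl rfl⟩, ⟨1, one_mem _, Or.inr rfl⟩]
    have key : ∀ n, ∀ a ∈ P, ∀ b ∈ P, ∀ h ∈ parabolic Γ P, h⁻¹ * gen Γ a * h = gen Γ b →
        ∀ w w' : TV Γ u, (w = vA _ _ 1 ∨ w = vB _ _ 1) → (w' = vA _ _ 1 ∨ w' = vB _ _ 1) →
        gen Γ a • w = w → gen Γ b • w' = w' → (TX Γ u).dist w (h • w') = n → R a b h := by
      intro n
      induction n with
      | zero =>
        rintro a ha b hb h hh e w w' (rfl | rfl) (rfl | rfl) hw hw' hd <;>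
          rw [dist_eq_zero' (ta Γ u).tree] at hd
        · exact inA ha hb hh (fA hw) (fA hw') (fA hd.symm) e
        · rw [smul_vB] at hd; exact (vA_ne_vB _ _ hd).elim
        · rw [smul_vA] at hd; exact (vB_ne_vA _ _ hd).elim
        · exact inS ha hb hh (fS hw) (fS hw') (fS hd.symm) e
      | succ n ihn =>
        intro a ha b hb h hh e w w' hwb hwb' hw hw' hd
        have hahb : gen Γ a * h = h * gen Γ b := by rw [← e]; group
        have hfix : gen Γ a • h • w' = h • w' := by rw [smul_smul, hahb, ← smul_smul, hw']
        have hne : w ≠ h • w' := by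
          intro h0; rw [(dist_eq_zero' (ta Γ u).tree).2 h0] at hd; omega
        have hadj := nxt_adj (ta Γ u).tree hne
        have hd' := dist_nxt (ta Γ u).tree hne
        have hvY := cvx_YP u P w (Bs w hwb) _ (smul_orbY hh (Bs w' hwb')) hne
        have hva : gen Γ a • nxt (TX Γ u) w (h • w') = nxt (TX Γ u) w (h • w') := by
          rw [(ta Γ u).smul_nxt _ hne, hw, hfix]
        set v := nxt (TX Γ u) w (h • w')
        have edge : ∃ x ∈ parabolic Γ P, (w = vA _ _ x ∧ v = vB _ _ x) ∨
            (w = vB _ _ x ∧ v = vA _ _ x) := by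
          obtain ⟨f, hf, rfl | rfl⟩ := Bs w hwb <;> obtain ⟨f', hf', hv | hv⟩ := hvY <;>
            rw [hv] at hadj ⊢
          · exact ((ta Γ u).type_ne _ _ hadj rfl).elim
          · obtain ⟨x, hx, h1, h2⟩ := YP_edge hf hf' hadj
            exact ⟨x, hx, Or.inl ⟨h1, h2⟩⟩
          · obtain ⟨x, hx, h1, h2⟩ := YP_edge hf' hf hadj.symm
            exact ⟨x, hx, Or.inr ⟨h2, h1⟩⟩
          · exact ((ta Γ u).type_ne _ _ hadj rfl).elim
        obtain ⟨x, hx, hwx⟩ := edge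
        have hxL : x⁻¹ * gen Γ a * x ∈ pL Γ u := by
          rw [mem_pL_iff]
          rcases hwx with ⟨h1, h2⟩ | ⟨h1, h2⟩ <;> rw [h1] at hw <;> rw [h2] at hva
          · exact ⟨smul_vA_eq_iff.1 hw, smul_vB_eq_iff.1 hva⟩
          · exact ⟨smul_vA_eq_iff.1 hva, smul_vB_eq_iff.1 hw⟩
        have hxP := TF.inter (mul_mem (mul_mem (inv_mem hx) (gen_mem ha)) hx) hxL
        obtain ⟨f, hf, c, hc, hfc⟩ := GC.conj_in_indep
          ((TF.indep_lk u).mono Set.inter_subset_right) (GC.conj' ⟨1, a, by simp⟩ x) hxP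
        have hfL : f ∈ pL Γ u := parabolic_mono Set.inter_subset_right hf
        have hfP : f ∈ parabolic Γ P := parabolic_mono Set.inter_subset_left hf
        have hcA : gen Γ c ∈ pA Γ u := parabolic_mono (lk_sub_compl u) (gen_mem hc.2)
        have hcS : gen Γ c ∈ pS Γ u := parabolic_mono (lk_sub_st u) (gen_mem hc.2)
        have hxc : (x * f)⁻¹ * gen Γ a * (x * f) = gen Γ c := by
          have : (x * f)⁻¹ * gen Γ a * (x * f) = f⁻¹ * (x⁻¹ * gen Γ a * x) * f := by group
          rw [this, hfc]; group
        have hA : vA (pA Γ u) (pS Γ u) x = vA _ _ (x * f) := vA_eq.2 (by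
          simpa using (mem_pL_iff.1 hfL).1)
        have hB : vB (pA Γ u) (pS Γ u) x = vB _ _ (x * f) := vB_eq.2 (by
          simpa using (mem_pL_iff.1 hfL).2)
        rw [hA, hB] at hwx
        have hxfP := mul_mem hx hfP
        set y := x * f
        have rest : ∀ w₀ : TV Γ u, (w₀ = vA _ _ 1 ∨ w₀ = vB _ _ 1) → gen Γ c • w₀ = w₀ → v = y • w₀ →
            R c b (y⁻¹ * h) := by
          intro w₀ hw₀ hcw hv
          refine ihn c hc.1 b hb _ (mul_mem (inv_mem hxfP) hh) ?_ w₀ w' hw₀ hwb' hcw hw' ?_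
          · rw [← hxc, ← e]; group
          · rw [← (ta Γ u).dist_smul y, ← hv, smul_smul, mul_inv_cancel_left]; omega
        have h2 : h = y * (y⁻¹ * h) := by group
        rw [h2]
        rcases hwx with ⟨h1, hv⟩ | ⟨h1, hv⟩
        · have hwA : w = vA _ _ 1 := by
            rcases hwb with h | h
            · exact h
            · rw [h1] at h; exact (vA_ne_vB _ _ h).elim
          refine trans (inA ha hc.1 hxfP (fA (hwA ▸ hw)) hcA ?_ hxc)
            (rest (vB _ _ 1) (Or.inr rfl) (smul_vB_eq_iff.2 (by simpa using hcS)) (by simpa using hv))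
          rw [hwA] at h1
          simpa using vA_eq.1 h1
        · have hwB : w = vB _ _ 1 := by
            rcases hwb with h | h
            · rw [h1] at h; exact (vB_ne_vA _ _ h).elim
            · exact h
          refine trans (inS ha hc.1 hxfP (fS (hwB ▸ hw)) hcS ?_ hxc)
            (rest (vA _ _ 1) (Or.inl rfl) (smul_vA_eq_iff.2 (by simpa using hcA)) (by simpa using hv))
          rw [hwB] at h1
          simpa using vB_eq.1 h1
    intro a ha b hb h hh e
    have bw : ∀ a : V, ∃ w : TV Γ u, (w = vA _ _ 1 ∨ w = vB _ _ 1) ∧ gen Γ a • w = w := by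
      intro a
      by_cases hau : a = u
      · exact ⟨_, Or.inr rfl, smul_vB_eq_iff.2 (by
          simpa using gen_mem (Γ := Γ) (show a ∈ st Γ u from Or.inl hau))⟩
      · exact ⟨_, Or.inl rfl, smul_vA_eq_iff.2 (by simpa using gen_mem (S := {u}ᶜ) hau)⟩
    obtain ⟨w, hw, hw'⟩ := bw a
    obtain ⟨w₂, hw₂, hw₂'⟩ := bw b
    exact key _ a ha b hb h hh e w w₂ hw hw₂ hw' hw₂' rfl

theorem ribbon (e : h⁻¹ * gen Γ a * h = gen Γ b) : R a b h :=
  ribbon_aux trans base _ Set.univ le_rfl a trivial b trivial h (by rw [parabolic_univ]; trivial) e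

end Ribbon

section Potential

variable {V : Type u} {Γ : DefiningGraph V} {M : Type v} [AddCommGroup M]
variable {F g h k k' : ArtinGroup Γ} {K : Set V} {s t : V}

/-- A function on pairs of generator conjugates that is additive on every conjugate of a clique
parabolic. -/
def LocallyAdditive (W : ArtinGroup Γ → ArtinGroup Γ → M) : Prop :=
  ∀ (h : ArtinGroup Γ) (K : Set V), IsCl Γ K → ∀ F₁ F₂ F₃, GC F₁ → GC F₂ → GC F₃ →
    h⁻¹ * F₁ * h ∈ parabolic Γ K → h⁻¹ * F₂ * h ∈ parabolic Γ K →
    h⁻¹ * F₃ * h ∈ parabolic Γ K → W F₁ F₃ = W F₁ F₂ + W F₂ F₃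

variable (h2 : ∀ m : M, m + m = 0) {W : ArtinGroup Γ → ArtinGroup Γ → M} (hW : LocallyAdditive W)
  {f : ArtinGroup Γ → V → M}
  (hf : ∀ g s t, Γ.graph.Adj s t → W (g * gen Γ s * g⁻¹) (g * gen Γ t * g⁻¹) = f g s + f g t)

/-- The difference between the potentials on two standard copies of `Γ`. -/
def jump (W : ArtinGroup Γ → ArtinGroup Γ → M) (f : ArtinGroup Γ → V → M) (s : V)
    (g g' : ArtinGroup Γ) : M := f g s + f g' s + W (g * gen Γ s * g⁻¹) (g' * gen Γ s * g'⁻¹)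

theorem gc_mk (g : ArtinGroup Γ) (s : V) : GC (g * gen Γ s * g⁻¹) := ⟨g, s, rfl⟩

theorem conj_gen_mem (hk : k ∈ parabolic Γ K) (hs : s ∈ K) :
    g⁻¹ * (g * k * gen Γ s * (g * k)⁻¹) * g ∈ parabolic Γ K := by
  have : g⁻¹ * (g * k * gen Γ s * (g * k)⁻¹) * g = k * gen Γ s * k⁻¹ := by group
  rw [this]
  exact mul_mem (mul_mem hk (gen_mem hs)) (inv_mem hk)

theorem conj_gen_mem' (hs : s ∈ K) : g⁻¹ * (g * gen Γ s * g⁻¹) * g ∈ parabolic Γ K := by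
  simpa using conj_gen_mem (g := g) (one_mem (parabolic Γ K)) hs

include h2

omit h2 in
include hW in
theorem LocallyAdditive.self (hF : GC F)
    (hK : IsCl Γ K) (h1 : h⁻¹ * F * h ∈ parabolic Γ K) : W F F = 0 := by
  have := hW h K hK F F F hF hF hF h1 h1 h1
  simpa using this

include hW hf

theorem potential_pair (hK : IsCl Γ K) (hs : s ∈ K) (ht : t ∈ K)
    (g : ArtinGroup Γ) : W (g * gen Γ s * g⁻¹) (g * gen Γ t * g⁻¹) = f g s + f g t := by
  by_cases hst : s = t
  · subst hst
    rw [h2, hW.self (gc_mk g s) hK (conj_gen_mem' hs)]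
  · exact hf g s t (hK s hs t ht hst)

theorem jump_indep (hK : IsCl Γ K) (hs : s ∈ K) (ht : t ∈ K)
    (hk : k ∈ parabolic Γ K) : jump W f s g (g * k) = jump W f t g (g * k) := by
  have e1 := potential_pair h2 hW hf hK hs ht g
  have e2 := potential_pair h2 hW hf hK hs ht (g * k)
  have a1 := hW g K hK _ _ _ (gc_mk g s) (gc_mk g t) (gc_mk (g * k) t) (conj_gen_mem' hs)
    (conj_gen_mem' ht) (conj_gen_mem hk ht)
  have b1 := h2 (f g s)
  have b2 := h2 (f (g * k) t)
  have a2 := hW g K hK _ _ _ (gc_mk g s) (gc_mk (g * k) s) (gc_mk (g * k) t) (conj_gen_mem' hs)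
    (conj_gen_mem hk hs) (conj_gen_mem hk ht)
  unfold jump
  grind

theorem jump_add (hK : IsCl Γ K) (hs : s ∈ K) (hk : k ∈ parabolic Γ K) (hk' : k' ∈ parabolic Γ K) :
    jump W f s g (g * (k * k')) = jump W f s g (g * k) + jump W f s (g * k) (g * k * k') := by
  have a1 := hW g K hK _ _ _ (gc_mk g s) (gc_mk (g * k) s) (gc_mk (g * (k * k')) s)
    (conj_gen_mem' hs) (conj_gen_mem hk hs) (conj_gen_mem (mul_mem hk hk') hs)
  unfold jump
  rw [a1, mul_assoc g k k']
  have := h2 (f (g * k) s)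
  grind

theorem jump_self (hK : IsCl Γ K) (hs : s ∈ K) (g : ArtinGroup Γ) : jump W f s g g = 0 := by
  unfold jump
  rw [hW.self (gc_mk g s) hK (conj_gen_mem' hs), h2, add_zero]

omit h2 hW hf in
/-- The permutation of `A_Γ × M` by which a generator acts. -/
def jumpPerm (W : ArtinGroup Γ → ArtinGroup Γ → M) (f : ArtinGroup Γ → V → M) (s : V) :
    Equiv.Perm (ArtinGroup Γ × M) where
  toFun p := (p.1 * (gen Γ s)⁻¹, p.2 + jump W f s p.1 (p.1 * (gen Γ s)⁻¹))
  invFun p := (p.1 * gen Γ s, p.2 - jump W f s (p.1 * gen Γ s) p.1)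
  left_inv p := by ext <;> simp
  right_inv p := by ext <;> simp

theorem altProd_jumpPerm (hK : IsCl Γ K) (hs : s ∈ K) (n : ℕ) :
    ∀ a ∈ K, ∀ b ∈ K, altProd (gen Γ a) (gen Γ b) n ∈ parabolic Γ K ∧ ∀ p : ArtinGroup Γ × M,
      altProd (jumpPerm W f a) (jumpPerm W f b) n p = (p.1 * (altProd (gen Γ a) (gen Γ b) n)⁻¹,
        p.2 + jump W f s p.1 (p.1 * (altProd (gen Γ a) (gen Γ b) n)⁻¹)) := by
  induction n with
  | zero =>
    refine fun a _ b _ => ⟨one_mem _, fun p => ?_⟩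
    simp [altProd, jump_self h2 hW hf hK hs]
  | succ n ih =>
    intro a ha b hb
    obtain ⟨h1, h3⟩ := ih b hb a ha
    refine ⟨mul_mem (gen_mem ha) h1, fun p => ?_⟩
    rw [altProd, Equiv.Perm.mul_apply, h3, altProd, mul_inv_rev,
      jump_add h2 hW hf hK hs (inv_mem h1) (inv_mem (gen_mem ha))]
    ext
    · simp [jumpPerm, mul_assoc]
    · simp only [jumpPerm, Equiv.coe_fn_mk, add_assoc]
      rw [jump_indep h2 hW hf hK ha hs (inv_mem (gen_mem ha))]

theorem exists_jump_potential (hV : ∀ a b, Γ.graph.Adj a b → IsCl Γ {a, b}) :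
    ∃ F : ArtinGroup Γ → M, ∀ (K : Set V), IsCl Γ K → ∀ s ∈ K, ∀ g, ∀ k ∈ parabolic Γ K,
      F (g * k) = F g + jump W f s g (g * k) := by
  let ρ : ArtinGroup Γ →* Equiv.Perm (ArtinGroup Γ × M) := liftHom (jumpPerm W f) (by
    intro a b hab
    ext1 p
    rw [(altProd_jumpPerm h2 hW hf (hV a b hab) (Or.inl rfl) _ a (by simp) b (by simp)).2,
      (altProd_jumpPerm h2 hW hf (hV a b hab) (Or.inl rfl) _ b (by simp) a (by simp)).2,
      gen_rel hab])
  have hρ : ∀ v p, ρ (gen Γ v) p = jumpPerm W f v p := fun v p => by rw [liftHom_gen]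
  have fst : ∀ g p, (ρ g p).1 = p.1 * g⁻¹ := by
    intro g
    induction g using gen_induction with
    | one => simp
    | mul h v ih => intro p; rw [map_mul, Equiv.Perm.mul_apply, ih, hρ]; simp [jumpPerm, mul_assoc]
    | mul_inv h v ih =>
      intro p
      obtain ⟨q, rfl⟩ := (jumpPerm W f v).surjective p
      rw [map_mul, Equiv.Perm.mul_apply, map_inv, ← hρ, Equiv.Perm.inv_def, Equiv.symm_apply_apply, ih, hρ]
      simp [jumpPerm]
  have snd : ∀ (K : Set V), IsCl Γ K → ∀ s ∈ K, ∀ k ∈ parabolic Γ K, ∀ p,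
      (ρ k p).2 = p.2 + jump W f s p.1 (p.1 * k⁻¹) := by
    intro K hK s hs k hk
    induction hk using Subgroup.closure_induction with
    | mem x hx =>
      obtain ⟨v, hv, rfl⟩ := hx
      intro p
      refine Eq.trans ?_ (congrArg (p.2 + ·) (jump_indep h2 hW hf hK hv hs (inv_mem (gen_mem hv))))
      exact congrArg Prod.snd (hρ v p)
    | one => intro p; simp [jump_self h2 hW hf hK hs]
    | mul x y hx hy ihx ihy =>
      intro p
      rw [map_mul, Equiv.Perm.mul_apply, ihx, ihy, fst, mul_inv_rev,
        jump_add h2 hW hf hK hs (inv_mem hy) (inv_mem hx), add_assoc]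
    | inv x hx ihx =>
      intro p
      obtain ⟨q, rfl⟩ := (ρ x).surjective p
      rw [map_inv, Equiv.Perm.inv_def, Equiv.symm_apply_apply, ihx, fst, inv_inv, inv_mul_cancel_right]
      have h3 := jump_add h2 hW hf hK hs (g := q.1) (inv_mem hx) hx
      rw [inv_mul_cancel, mul_one, jump_self h2 hW hf hK hs, inv_mul_cancel_right] at h3
      rw [add_assoc, ← h3, add_zero]
  refine ⟨fun g => (ρ g⁻¹ (1, 0)).2, fun K hK s hs g k hk => ?_⟩
  have := snd K hK s hs _ (inv_mem hk) (ρ g⁻¹ (1, 0))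
  rw [← Equiv.Perm.mul_apply, ← map_mul, ← mul_inv_rev, fst, inv_inv, inv_inv, one_mul] at this
  exact this

variable [Finite V] [Nonempty V]

/-- A locally additive function that is a coboundary on every standard copy of `Γ` is one. -/
theorem exists_potential [TF Γ] :
    ∃ Φ : ArtinGroup Γ → M, ∀ F F', GC F → GC F' → Near F F' → W F F' = Φ F + Φ F' := by
  obtain ⟨E, hE⟩ := exists_jump_potential h2 hW hf fun _ _ => isCl_pair
  have wd : ∀ {a b : V} {h : ArtinGroup Γ}, h⁻¹ * gen Γ a * h = gen Γ b →
      ∀ g, f (g * h) b + E (g * h) = f g a + E g := by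
    intro a b h
    refine ribbon (R := fun a b h => ∀ g, f (g * h) b + E (g * h) = f g a + E g) ?_ ?_
    · grind
    · intro a b r K hK hr ha hb e g
      have e1 := potential_pair h2 hW hf hK hb ha (g * r)
      have e2 : g * r * gen Γ b * (g * r)⁻¹ = g * gen Γ a * g⁻¹ := by rw [← e]; group
      rw [e2] at e1
      have := h2 (f (g * r) b)
      have h3 := h2 (f (g * r) a)
      rw [hE K hK a ha g r hr, jump, e1]
      grind
  let Φ : ArtinGroup Γ → M := fun F => open Classical in
    if h : GC F then f h.choose h.choose_spec.choose + E h.choose else 0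
  have hΦ : ∀ g s, Φ (g * gen Γ s * g⁻¹) = f g s + E g := by
    intro g s
    have hc := gc_mk (Γ := Γ) g s
    simp only [Φ, dif_pos hc]
    have e := hc.choose_spec.choose_spec
    set g' := hc.choose
    set s' := hc.choose_spec.choose
    have := wd (a := s') (b := s) (h := g'⁻¹ * g) (by
      have : (g'⁻¹ * g)⁻¹ * gen Γ s' * (g'⁻¹ * g) = g⁻¹ * (g' * gen Γ s' * g'⁻¹) * g := by group
      rw [this, ← e]; group) g'
    rw [mul_inv_cancel_left] at this
    exact this.symm
  refine ⟨Φ, fun F F' hF hF' ⟨h, K, hK, h1, h1'⟩ => ?_⟩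
  have nf : ∀ {F}, GC F → h⁻¹ * F * h ∈ parabolic Γ K → ∃ k ∈ parabolic Γ K, ∃ s ∈ K,
      F = h * k * gen Γ s * (h * k)⁻¹ := by
    intro F hF h1
    obtain ⟨k, hk, s, hs, e⟩ := (hF.conj' h).conj_in_clique hK h1
    refine ⟨k, hk, s, hs, ?_⟩
    have : F = h * (h⁻¹ * F * h) * h⁻¹ := by group
    rw [this, e]; group
  obtain ⟨k, hk, s, hs, rfl⟩ := nf hF h1
  obtain ⟨k', hk', s', hs', rfl⟩ := nf hF' h1'
  rw [hΦ, hΦ, hE K hK s hs h k hk, hE K hK s' hs' h k' hk', jump, jump]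
  have a0 := potential_pair h2 hW hf hK hs hs' h
  have a1 := hW h K hK _ _ _ (gc_mk h s) hF hF' (conj_gen_mem' hs) h1 h1'
  have a2 := hW h K hK _ _ _ (gc_mk h s) (gc_mk h s') hF' (conj_gen_mem' hs) (conj_gen_mem' hs') h1'
  have b1 := h2 (E h)
  have b2 := h2 (f (h * k) s)
  have b3 := h2 (f (h * k') s')
  have b4 := h2 (W (h * gen Γ s * h⁻¹) (h * k * gen Γ s * (h * k)⁻¹))
  grind

end Potential

section Cochains

variable {V : Type u} {Γ : DefiningGraph V}
variable {v : ℕ → V}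
variable {a b c : V} {i j n : ℕ}

/-- A lazy closed walk of length `n`. -/
def LazyClosed (Γ : DefiningGraph V) (n : ℕ) (v : ℕ → V) : Prop :=
  v n = v 0 ∧ ∀ i < n, v i = v (i + 1) ∨ Γ.graph.Adj (v i) (v (i + 1))

/-- The evaluation of a cochain on the first `n` steps of a walk. -/
def wsum (η : V → V → ZMod 2) (v : ℕ → V) (n : ℕ) : ZMod 2 :=
  ∑ i ∈ Finset.range n, η (v i) (v (i + 1))

theorem wsum_eq_add (η : V → V → ZMod 2) (v : ℕ → V) (hij : i ≤ j) (hjn : j ≤ n)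
    (h : v i = v j) : wsum η v n = wsum η (fun k => v (i + k)) (j - i) +
      wsum η (fun k => if k ≤ i then v k else v (k + (j - i))) (n - (j - i)) := by
  obtain ⟨d, rfl⟩ := Nat.exists_eq_add_of_le hij
  obtain ⟨e, rfl⟩ := Nat.exists_eq_add_of_le hjn
  have e1 : i + d - i = d := by omega
  have e2 : i + d + e - d = i + e := by omega
  unfold wsum
  rw [e1, e2, Finset.sum_range_add, Finset.sum_range_add, Finset.sum_range_add _ i e]
  have h1 : ∀ k ∈ Finset.range i, η (v k) (v (k + 1)) = η (if k ≤ i then v k else v (k + d))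
      (if k + 1 ≤ i then v (k + 1) else v (k + 1 + d)) := by
    intro k hk
    rw [Finset.mem_range] at hk
    rw [if_pos (by omega), if_pos (by omega)]
  have h3 : ∀ k ∈ Finset.range e, η (v (i + d + k)) (v (i + d + k + 1)) =
      η (if i + k ≤ i then v (i + k) else v (i + k + d))
        (if i + k + 1 ≤ i then v (i + k + 1) else v (i + k + 1 + d)) := by
    intro k hk
    rw [if_neg (show ¬ i + k + 1 ≤ i by omega)]
    rcases Nat.eq_zero_or_pos k with rfl | hk
    · grind
    · rw [if_neg (by omega)]; congr 2 <;> omega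
  rw [Finset.sum_congr rfl h1, Finset.sum_congr rfl h3]
  simp only [add_assoc]
  abel

variable {η : V → V → ZMod 2} (hs : ∀ a b, η a b = η b a) (h0 : ∀ a, η a a = 0)
include hs h0

theorem cochain_triangle [TF Γ] (h1 : a = b ∨ Γ.graph.Adj a b)
    (h2 : b = c ∨ Γ.graph.Adj b c) (h3 : a = c ∨ Γ.graph.Adj a c) : η a c = η a b + η b c := by
  rcases h1 with rfl | h1
  · rw [h0, zero_add]
  rcases h2 with rfl | h2
  · rw [h0, add_zero]
  rcases h3 with rfl | h3
  · rw [h0, hs b a, CharTwo.add_self_eq_zero]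
  · exact (TF.out a b c h1 h2 h3).elim

/-- A shortest lazy closed walk on which a cochain does not vanish is a cycle. -/
theorem minimal_injective [TF Γ]
    (hmin : ∀ m < n, ∀ v, LazyClosed Γ m v → wsum η v m = 0) (hv : LazyClosed Γ n v)
    (hne : wsum η v n ≠ 0) : 4 ≤ n ∧ ∀ i j, i < n → j < n → v i = v j → i = j := by
  have inj : ∀ i j, i < j → j < n → v i ≠ v j := by
    intro i j hij hj h
    apply hne
    rw [wsum_eq_add η v hij.le hj.le h, hmin _ (by omega), hmin _ (by omega), add_zero]
    · refine ⟨?_, fun k hk => ?_⟩ <;> dsimp only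
      · rw [if_neg (by omega), if_pos (Nat.zero_le _), ← hv.1]; congr 1; omega
      · by_cases hki : k + 1 ≤ i
        · rw [if_pos (by omega), if_pos hki]; exact hv.2 k (by omega)
        · rw [if_neg hki]
          have := hv.2 (k + (j - i)) (by omega)
          grind
    · refine ⟨?_, fun k hk => hv.2 (i + k) (by omega)⟩
      grind
  refine ⟨?_, fun i j hi hj h => ?_⟩
  · by_contra hn
    have hcases : n = 0 ∨ n = 1 ∨ n = 2 ∨ n = 3 := by omega
    rcases hcases with rfl | rfl | rfl | rfl
    · exact hne rfl
    · exact hne (by simp [wsum, hv.1, h0])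
    · apply hne
      rw [wsum, Finset.sum_range_succ, Finset.sum_range_one, zero_add, hv.1, hs (v 1),
        CharTwo.add_self_eq_zero]
    · have a1 := (hv.2 0 (by omega)).resolve_left (inj 0 1 (by omega) (by omega))
      have a2 := (hv.2 1 (by omega)).resolve_left (inj 1 2 (by omega) (by omega))
      have a3 := (hv.2 2 (by omega)).resolve_left (by
        rw [hv.1]; exact (inj 0 2 (by omega) (by omega)).symm)
      rw [hv.1] at a3
      exact TF.out _ _ _ a1 a2 a3.symm
  grind

omit hs h0

/-- The periodic extension of a closed walk. -/
theorem LazyClosed.periodic (hv : LazyClosed Γ n v) (hn : 0 < n) (i : ℕ) :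
    v ((i + 1) % n) = v (i % n + 1) := by
  have h := Nat.mod_lt i hn
  rw [Nat.add_mod]
  by_cases h1 : n = 1
  · subst h1; simpa [Nat.mod_one] using hv.1.symm
  rw [Nat.mod_eq_of_lt (show 1 < n by omega)]
  by_cases h2 : i % n + 1 = n
  · rw [h2, Nat.mod_self, hv.1]
  · rw [Nat.mod_eq_of_lt (by omega)]

end Cochains

section Star

variable {V : Type u} {Γ : DefiningGraph V} [Finite V]
variable {v : ℕ → V}
variable {F F' : ArtinGroup Γ} {K : Set V} {a b : V} {n : ℕ}

/-- `θ` agrees with an inner automorphism on every standard parabolic subgroup of a clique. -/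
def LocInner (θ : ArtinGroup Γ ≃* ArtinGroup Γ) : Prop :=
  ∀ K, IsCl Γ K → ∃ g, ∀ x ∈ parabolic Γ K, θ x = g * x * g⁻¹

theorem LocInner.symm {θ : ArtinGroup Γ ≃* ArtinGroup Γ} (h : LocInner θ) : LocInner θ.symm := by
  intro K hK
  obtain ⟨g, hg⟩ := h K hK
  refine ⟨(θ.symm g)⁻¹, fun x hx => ?_⟩
  rw [inv_inv, MulEquiv.symm_apply_eq, map_mul, map_mul, map_inv, hg x hx]
  simp [mul_assoc]

theorem LocInner.mem {θ : ArtinGroup Γ ≃* ArtinGroup Γ} (h : LocInner θ) (hK : IsCl Γ K)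
    (x : ArtinGroup Γ) : ∃ y, ∀ F, x⁻¹ * F * x ∈ parabolic Γ K → y⁻¹ * θ F * y ∈ parabolic Γ K := by
  obtain ⟨g, hg⟩ := h K hK
  refine ⟨θ x * g, fun F hF => ?_⟩
  have := hg _ hF
  rw [map_mul, map_mul, map_inv] at this
  rw [show (θ x * g)⁻¹ * θ F * (θ x * g) = g⁻¹ * ((θ x)⁻¹ * θ F * θ x) * g by group, this]
  simpa [mul_assoc] using hF

theorem LocInner.gc {θ : ArtinGroup Γ ≃* ArtinGroup Γ} (h : LocInner θ) (hF : GC F) : GC (θ F) := by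
  obtain ⟨x, s, rfl⟩ := hF
  obtain ⟨g, hg⟩ := h _ (isCl_singleton s)
  exact ⟨θ x * g, s, by rw [map_mul, map_mul, map_inv, hg _ (gen_mem rfl)]; group⟩

theorem LocInner.near {θ : ArtinGroup Γ ≃* ArtinGroup Γ} (h : LocInner θ)
    (hF : Near F F') : Near (θ F) (θ F') := by
  obtain ⟨x, K, hK, h1, h2⟩ := hF
  obtain ⟨y, hy⟩ := h.mem hK x
  exact ⟨y, K, hK, hy F h1, hy F' h2⟩

theorem Near.conj (h : Near F F') (g : ArtinGroup Γ) : Near (g⁻¹ * F * g) (g⁻¹ * F' * g) := by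
  obtain ⟨x, K, hK, h1, h2⟩ := h
  refine ⟨g⁻¹ * x, K, hK, ?_, ?_⟩
  · simpa [mul_assoc] using h1
  · simpa [mul_assoc] using h2

theorem near_gen (h : a = b ∨ Γ.graph.Adj a b) (g : ArtinGroup Γ) :
    Near (g * gen Γ a * g⁻¹) (g * gen Γ b * g⁻¹) := by
  rcases h with rfl | h
  · exact ⟨g, _, isCl_singleton a, conj_gen_mem' rfl, conj_gen_mem' rfl⟩
  · exact ⟨g, _, isCl_pair h, conj_gen_mem' (Or.inl rfl), conj_gen_mem' (Or.inr rfl)⟩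

theorem exists_residue (G : Type u) : ∃ (M : Type u) (_ : AddCommGroup M)
    (q : ((G → ZMod 2) × ZMod 2) →+ M), (∀ m : M, m + m = 0) ∧ (∀ h c, q (fun g => open Classical in
    if g = h then c else 0, c) = 0) ∧ ∀ p, q p = 0 → p.1 = 0 → p.2 = 0 := by
  classical
  let N : AddSubgroup ((G → ZMod 2) × ZMod 2) := ((Finsupp.coeFnAddHom).prod
    (Finsupp.liftAddHom fun _ : G => AddMonoidHom.id (ZMod 2))).range
  refine ⟨_ ⧸ N, inferInstance, QuotientAddGroup.mk' N, fun m => ?_, fun h c => ?_, fun p hp h1 => ?_⟩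
  · obtain ⟨p, rfl⟩ := QuotientAddGroup.mk'_surjective N m
    rw [← map_add]
    convert map_zero (QuotientAddGroup.mk' N)
    ext
    · exact CharTwo.add_self_eq_zero _
    · exact CharTwo.add_self_eq_zero _
  · rw [QuotientAddGroup.mk'_apply, QuotientAddGroup.eq_zero_iff]
    refine ⟨Finsupp.single h c, Prod.ext (funext fun g => ?_) ?_⟩
    · simp [Finsupp.single_apply, eq_comm]
    · simp
  · rw [QuotientAddGroup.mk'_apply, QuotientAddGroup.eq_zero_iff] at hp
    obtain ⟨f, rfl⟩ := hp
    obtain rfl : f = 0 := DFunLike.coe_injective h1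
    simp

variable [Nonempty V] [TF Γ] {θ : ArtinGroup Γ ≃* ArtinGroup Γ}
  (hθ : LocInner θ) {η : V → V → ZMod 2} (hs : ∀ a b, η a b = η b a) (h0 : ∀ a, η a a = 0)
include hθ

/-- The map induced on walks by a conjugate of the inverse of `θ` preserves adjacency. -/
theorem xw_symm_lazy (g : ArtinGroup Γ) (h : a = b ∨ Γ.graph.Adj a b) :
    xw (θ.symm (g * gen Γ a * g⁻¹)) = xw (θ.symm (g * gen Γ b * g⁻¹)) ∨
      Γ.graph.Adj (xw (θ.symm (g * gen Γ a * g⁻¹))) (xw (θ.symm (g * gen Γ b * g⁻¹))) :=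
  xw_near (hθ.symm.gc ⟨g, a, rfl⟩) (hθ.symm.gc ⟨g, b, rfl⟩) (hθ.symm.near (near_gen h g))

include hs h0

/-- A cochain with nonzero sum on a closed walk has nonzero sum on some transported walk. -/
theorem exists_transport (hv : LazyClosed Γ n v) (hne : wsum η v n ≠ 0) :
    ∃ g, wsum η (fun i => xw (θ.symm (g * gen Γ (xw (g⁻¹ * θ (gen Γ (v i)) * g)) * g⁻¹))) n ≠ 0 := by
  classical
  obtain ⟨M, _, q, hM, hq, hq'⟩ := exists_residue (ArtinGroup Γ)
  obtain ⟨z, hz⟩ : ∃ z : ArtinGroup Γ → V → V,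
    z = fun g a => xw (θ.symm (g * gen Γ a * g⁻¹)) := ⟨_, rfl⟩
  obtain ⟨om, hom⟩ : ∃ om : ArtinGroup Γ → V → V → ZMod 2, om = fun g a b => η (z g a) (z g b) :=
    ⟨_, rfl⟩
  have tri : ∀ g {a b c}, (a = b ∨ Γ.graph.Adj a b) → (b = c ∨ Γ.graph.Adj b c) →
      (a = c ∨ Γ.graph.Adj a c) → om g a c = om g a b + om g b c := by
    intro g a b c h1 h2 h3
    subst hom hz
    exact cochain_triangle hs h0 (xw_symm_lazy hθ g h1) (xw_symm_lazy hθ g h2)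
      (xw_symm_lazy hθ g h3)
  have oms : ∀ g a b, om g a b = om g b a := fun g a b => by subst hom; exact hs _ _
  obtain ⟨W, hW⟩ : ∃ W : ArtinGroup Γ → ArtinGroup Γ → M, W = fun F F' =>
    q (fun g => om g (xw (g⁻¹ * F * g)) (xw (g⁻¹ * F' * g)), η (xw (θ.symm F)) (xw (θ.symm F'))) :=
    ⟨_, rfl⟩
  have hcone : ∀ h : ArtinGroup Γ, ∃ s, h ≠ 1 → ∀ t, xw (h * gen Γ t * h⁻¹) = s ∨
      Γ.graph.Adj (xw (h * gen Γ t * h⁻¹)) s := by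
    intro h
    by_cases hh : h = 1
    · exact ⟨Classical.arbitrary V, fun h => (h hh).elim⟩
    · exact (xw_cone hh).imp fun s hs _ => hs
  choose κ hκ using hcone
  have nr : ∀ {F F' : ArtinGroup Γ} {h : ArtinGroup Γ} {K : Set V}, IsCl Γ K →
      h⁻¹ * F * h ∈ parabolic Γ K → h⁻¹ * F' * h ∈ parabolic Γ K → Near F F' :=
    fun hK h1 h2 => ⟨_, _, hK, h1, h2⟩
  have hla : LocallyAdditive W := by
    intro h K hK F₁ F₂ F₃ g1 g2 g3 m1 m2 m3
    subst hW
    dsimp only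
    rw [← map_add]
    congr 1
    have n12 := nr hK m1 m2
    have n23 := nr hK m2 m3
    have n13 := nr hK m1 m3
    refine Prod.ext (funext fun g => ?_) ?_
    · exact tri g (xw_near (g1.conj' g) (g2.conj' g) (n12.conj g))
        (xw_near (g2.conj' g) (g3.conj' g) (n23.conj g))
        (xw_near (g1.conj' g) (g3.conj' g) (n13.conj g))
    · exact cochain_triangle hs h0 (xw_near (hθ.symm.gc g1) (hθ.symm.gc g2) (hθ.symm.near n12))
        (xw_near (hθ.symm.gc g2) (hθ.symm.gc g3) (hθ.symm.near n23))
        (xw_near (hθ.symm.gc g1) (hθ.symm.gc g3) (hθ.symm.near n13))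
  obtain ⟨Φ, hΦ⟩ := exists_potential (f := fun h s => q (fun g => if g = h then 0 else
      om g (xw (g⁻¹ * (h * gen Γ s * h⁻¹) * g)) (κ (g⁻¹ * h)), 0)) hM hla (by
    intro h s t hst
    rw [hW]
    have key := hq h (om h s t)
    dsimp only
    rw [← add_zero (q _ + q _), ← key, ← map_add, ← map_add]
    congr 1
    refine Prod.ext (funext fun g => ?_) ?_
    · simp only [Prod.fst_add, Pi.add_apply]
      by_cases hg : g = h
      · subst hg
        have e : ∀ a, g⁻¹ * (g * gen Γ a * g⁻¹) * g = gen Γ a := fun a => by group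
        simp [e, xw_gen]
      · rw [if_neg hg, if_neg hg, if_neg hg, add_zero]
        have hg' : g⁻¹ * h ≠ 1 := fun e => hg (inv_mul_eq_one.1 e)
        have e : ∀ a, g⁻¹ * h * gen Γ a * (g⁻¹ * h)⁻¹ = g⁻¹ * (h * gen Γ a * h⁻¹) * g :=
          fun a => by group
        have k1 := hκ _ hg' s
        have k2 := hκ _ hg' t
        rw [e] at k1 k2
        rw [oms g (xw (g⁻¹ * (h * gen Γ t * h⁻¹) * g)) (κ _)]
        exact tri g k1 (k2.imp Eq.symm SimpleGraph.Adj.symm)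
          (xw_near ((gc_mk h s).conj' g) ((gc_mk h t).conj' g) ((near_gen (Or.inr hst) h).conj g))
    · subst hom hz
      simp)
  obtain ⟨F, hF⟩ : ∃ F : ℕ → ArtinGroup Γ, F = fun i => θ (gen Γ (v i)) := ⟨_, rfl⟩
  have hgc : ∀ i, GC (F i) := fun i => by
    subst hF; exact hθ.gc ⟨1, v i, by simp⟩
  have hnr : ∀ i < n, Near (F i) (F (i + 1)) := fun i hi => by
    have := near_gen (hv.2 i hi) 1
    subst hF
    exact hθ.near (by simpa using this)
  have tel : ∀ m ≤ n, ∑ i ∈ Finset.range m, W (F i) (F (i + 1)) = Φ (F 0) + Φ (F m) := by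
    intro m
    induction m with
    | zero => intro _; simp [hM]
    | succ m ih =>
      intro hm
      rw [Finset.sum_range_succ, ih (by omega), hΦ _ _ (hgc _) (hgc _) (hnr m hm)]
      have := hM (Φ (F m))
      grind
  have hsum := tel n le_rfl
  have hFn : F n = F 0 := by subst hF; exact congrArg (fun a => θ (gen Γ a)) hv.1
  rw [hFn, hM, hW, ← map_sum] at hsum
  by_contra! hall
  refine hne ?_
  have := hq' _ hsum (funext fun g => ?_)
  · rw [← this, Prod.snd_sum]
    subst hF
    simp [wsum, xw_gen]
  · have := hall g
    rw [Prod.fst_sum, Finset.sum_apply]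
    subst hom hz hF
    exact this

end Star

section StarTheorem

variable {V : Type u} {Γ : DefiningGraph V} [Finite V] [Nonempty V] [TF Γ] [Large Γ]
variable {η : V → V → ZMod 2} {v : ℕ → V}
variable {g : ArtinGroup Γ} {θ : ArtinGroup Γ ≃* ArtinGroup Γ} {d n : ℕ}

theorem add_mod_ne (h0 : 0 < d) (hd : d < n) (i : ℕ) : (i + d) % n ≠ i % n := by
  intro h
  have := Nat.sub_mod_eq_zero_of_mod_eq h
  rw [Nat.add_sub_cancel_left, Nat.mod_eq_of_lt hd] at this
  omega

/-- A closed walk transported to an injective one is rigid. -/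
theorem rigid_of_injective (hθ : LocInner θ) (hn : 4 ≤ n)
    (hv : LazyClosed Γ n v) (hi : ∀ i j, i < n → j < n → v i = v j → i = j)
    (hy : ∀ i j, i < n → j < n → xw (g⁻¹ * θ (gen Γ (v i)) * g) = xw (g⁻¹ * θ
    (gen Γ (v j)) * g) → i = j) : ∀ i ≤ n, θ (gen Γ (v i)) = g * gen Γ (v i) * g⁻¹ := by
  obtain ⟨p, hp⟩ : ∃ p : ℕ → V, p = fun i => v (i % n) := ⟨_, rfl⟩
  obtain ⟨F, hF⟩ : ∃ F : ℕ → ArtinGroup Γ, F = fun i => g⁻¹ * θ (gen Γ (p i)) * g := ⟨_, rfl⟩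
  have hlt : ∀ i, i % n < n := fun i => Nat.mod_lt i (by omega)
  have per : ∀ i, p (i + n) = p i := fun i => by subst hp; exact congrArg v (Nat.add_mod_right i n)
  have hadj : ∀ i, Γ.graph.Adj (p i) (p (i + 1)) := by
    intro i
    subst hp
    have h := hv.2 (i % n) (hlt i)
    rw [← hv.periodic (by omega)] at h
    exact h.resolve_left fun h => add_mod_ne one_pos (by omega) i (hi _ _ (hlt _) (hlt _) h).symm
  have hgc : ∀ i, GC (F i) := fun i => by
    subst hF; exact (hθ.gc ⟨1, p i, by simp⟩).conj' g
  have hnr : ∀ i, Near (F i) (F (i + 1)) := fun i => by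
    have := near_gen (Or.inr (hadj i)) 1
    subst hF
    exact (hθ.near (by simpa using this)).conj g
  have hne : ∀ {d} i, 0 < d → d < n → xw (F i) ≠ xw (F (i + d)) := by
    intro d i h0 hd h
    subst hF hp
    exact add_mod_ne h0 hd i (hy _ _ (hlt _) (hlt _) h).symm
  have hgen' : ∀ i, F (i + 1) = gen Γ (xw (F (i + 1))) := fun i =>
    eq_gen_xw (hgc i) (hgc (i + 1)) (hgc (i + 2)) (hgc (i + 3)) (hnr i) (hnr (i + 1))
      (hnr (i + 2)) (hne i (by omega) (by omega)) (hne (d := 1) (i + 1) (by omega) (by omega))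
      (hne (d := 1) (i + 2) (by omega) (by omega)) (hne i (by omega) (by omega))
      (hne (d := 2) (i + 1) (by omega) (by omega))
  have perF : ∀ i, F (i + n) = F i := fun i => by subst hF; simp only [per]
  have hgen : ∀ i, F i = gen Γ (xw (F i)) := fun i => by
    have := hgen' (i + n - 1)
    rwa [show i + n - 1 + 1 = i + n by omega, perF] at this
  have hsub : ∀ i, ({p i, p (i + 1)} : Set V) ⊆ {xw (F i), xw (F (i + 1))} := by
    intro i
    obtain ⟨k, hk⟩ := hθ _ (isCl_pair (hadj i))
    have hm := zc_mem (Γ := Γ) (p i) (p (i + 1))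
    refine (clique_conj_sub (isCl_pair (hadj i))
      (t := g⁻¹ * θ (zc Γ (p i) (p (i + 1))) * g) (g := g⁻¹ * k) ?_ ?_ ?_).1
    · rw [hk _ hm]
      intro h
      have h := h.conj (k⁻¹ * g)
      have := zc_not_vertexType (hadj i) (r := 1) (by convert h using 1; group)
      omega
    · refine conj_map_mem θ.toMonoidHom (fun a ha => ?_) _ hm
      have key : ∀ j, g⁻¹ * θ (gen Γ (p j)) * g = gen Γ (xw (F j)) := fun j => by
        rw [← hgen j, hF]
      rcases ha with rfl | rfl
      · exact (key i) ▸ gen_mem (Or.inl rfl)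
      · exact (key (i + 1)) ▸ gen_mem (Or.inr rfl)
    · rw [hk _ hm]
      convert hm using 1
      group
  have heq' : ∀ i, p (i + 1) = xw (F (i + 1)) := by
    intro i
    rcases hsub i (Or.inr rfl) with h | h
    · rcases hsub (i + 1) (Or.inl rfl) with h' | h'
      · exact h'
      · exact (hne (d := 2) i (by omega) (by omega) (h.symm.trans h')).elim
    · exact h
  intro i hin
  have hpi : p i = v i := by
    subst hp
    dsimp only
    rcases Nat.lt_or_eq_of_le hin with h | rfl
    · rw [Nat.mod_eq_of_lt h]
    · rw [Nat.mod_self, hv.1]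
  have h := heq' (i + n - 1)
  rw [show i + n - 1 + 1 = i + n by omega, per, perF, hpi] at h
  have h2 := hgen i
  rw [← h, hF] at h2
  dsimp only at h2
  rw [hpi] at h2
  conv_rhs => rw [← h2]
  group

/-- A cochain vanishing on the embedded cycles on which `θ` is a single conjugation vanishes on
all closed walks. -/
theorem wsum_eq_zero (hθ : LocInner θ)
    (hs : ∀ a b, η a b = η b a) (h0 : ∀ a, η a a = 0) (hr : ∀ n v, 4 ≤ n → LazyClosed Γ n v → (∀ i
    j, i < n → j < n → v i = v j → i = j) → (∃ g, ∀ i ≤ n, θ (gen Γ (v i)) = g * gen Γ (v i) * g⁻¹)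
    → wsum η v n = 0) (n : ℕ) : ∀ v, LazyClosed Γ n v → wsum η v n = 0 := by
  induction n using Nat.strong_induction_on with
  | _ n ih =>
    intro v hv
    by_contra hne
    obtain ⟨hn, hi⟩ := minimal_injective hs h0 ih hv hne
    obtain ⟨g, hg⟩ := exists_transport hθ hs h0 hv hne
    refine hne (hr n v hn hv hi ⟨g, rigid_of_injective hθ hn hv hi fun i j hin hjn h => ?_⟩)
    refine (minimal_injective hs h0 ih ?_ hg).2 i j hin hjn (by rw [h])
    refine ⟨by dsimp only; rw [hv.1], fun i hi => xw_symm_lazy hθ g ?_⟩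
    have := near_gen (hv.2 i hi) 1
    refine xw_near ((hθ.gc ⟨1, v i, by simp⟩).conj' g)
      ((hθ.gc ⟨1, v (i + 1), by simp⟩).conj' g) ((hθ.near (by simpa using this)).conj g)

/-- A cochain vanishing on closed walks is a coboundary. -/
theorem exists_coboundary (hs : ∀ a b, η a b = η b a)
    (hc : Γ.graph.Preconnected) (hz : ∀ n v, LazyClosed Γ n v → wsum η v n = 0) :
    ∃ c : V → ZMod 2, ∀ a b, Γ.graph.Adj a b → η a b = c a + c b := by
  let o := Classical.arbitrary V
  have hp : ∀ a, ∃ (m : ℕ) (v : ℕ → V), v 0 = o ∧ v m = a ∧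
      ∀ i < m, Γ.graph.Adj (v i) (v (i + 1)) := by
    intro a
    obtain ⟨w⟩ := hc o a
    exact ⟨w.length, w.getVert, w.getVert_zero, w.getVert_length, fun i hi => w.adj_getVert_succ hi⟩
  choose m p h1 h2 h3 using hp
  refine ⟨fun a => wsum η (p a) (m a), fun a b hab => ?_⟩
  -- the walk from `o` to `a`, across to `b` and back to `o`
  have key := hz (m a + 1 + m b) (fun i => if i ≤ m a then p a i else p b (m b - (i - m a - 1))) ?_
  · unfold wsum at key ⊢
    rw [Finset.sum_range_add, Finset.sum_range_succ] at key
    dsimp only at key ⊢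
    have e1 : ∀ i ∈ Finset.range (m a), η (if i ≤ m a then p a i else p b (m b - (i - m a - 1)))
        (if i + 1 ≤ m a then p a (i + 1) else p b (m b - (i + 1 - m a - 1))) =
        η (p a i) (p a (i + 1)) := by
      intro i hi
      rw [Finset.mem_range] at hi
      rw [if_pos (by omega), if_pos (by omega)]
    have e3 : ∀ i ∈ Finset.range (m b),
        η (if m a + 1 + i ≤ m a then p a (m a + 1 + i) else p b (m b - (m a + 1 + i - m a - 1)))
          (if m a + 1 + i + 1 ≤ m a then p a (m a + 1 + i + 1)
            else p b (m b - (m a + 1 + i + 1 - m a - 1))) =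
        η (p b (m b - 1 - i)) (p b (m b - 1 - i + 1)) := by
      intro i hi
      rw [Finset.mem_range] at hi
      rw [if_neg (by omega), if_neg (by omega), hs]
      congr 2 <;> omega
    rw [Finset.sum_congr rfl e1, Finset.sum_congr rfl e3, if_pos le_rfl, if_neg (by omega),
      Finset.sum_range_reflect (fun i => η (p b i) (p b (i + 1))), h2,
      show m b - (m a + 1 - m a - 1) = m b by omega, h2] at key
    have := CharTwo.add_self_eq_zero (η a b)
    grind
  · refine ⟨?_, fun i hi => Or.inr ?_⟩ <;> dsimp only
    · rw [if_neg (by omega), if_pos (by omega), h1,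
        show m b - (m a + 1 + m b - m a - 1) = 0 by omega, h1]
    · rcases lt_trichotomy i (m a) with h | h | h
      · rw [if_pos (by omega), if_pos (by omega)]; exact h3 a i h
      · rw [h, if_pos le_rfl, if_neg (by omega), h2,
          show m b - (m a + 1 - m a - 1) = m b by omega, h2]
        exact hab
      · rw [if_neg (by omega), if_neg (by omega)]
        have := (h3 b (m b - (i + 1 - m a - 1)) (by omega)).symm
        rwa [show m b - (i + 1 - m a - 1) + 1 = m b - (i - m a - 1) by omega] at this

end StarTheorem

section Gluing

variable {V : Type u} {Γ : DefiningGraph V}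
variable {η : V → V → ZMod 2}
variable {g g' : ArtinGroup Γ} {a b s w x y : V} {r : ℤ}

/-- The complement of `T` is connected. -/
def Joined (Γ : DefiningGraph V) (T : Set V) : Prop :=
  ∀ P : V → Prop, (∀ x ∉ T, ∀ y ∉ T, Γ.graph.Adj x y → P x → P y) → ∀ x ∉ T, ∀ y ∉ T, P x → P y

/-- `θ` conjugates the generator `a` by `g`. -/
def Fx (θ : ArtinGroup Γ ≃* ArtinGroup Γ) (g : ArtinGroup Γ) (a : V) : Prop :=
  θ (gen Γ a) = g * gen Γ a * g⁻¹

/-- The indicator of a proposition. -/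
noncomputable def ind (P : Prop) : ZMod 2 := open Classical in if P then 1 else 0

theorem ind_congr {P Q : Prop} : ind P = ind Q ↔ (P ↔ Q) := by
  unfold ind; by_cases P <;> by_cases Q <;> simp [*]

theorem ind_false {P : Prop} (h : ¬ P) : ind P = 0 := if_neg h

variable [Finite V] [Nonempty V] [TF Γ] [Large Γ] (hc : Γ.graph.Preconnected)
  {θ : ArtinGroup Γ ≃* ArtinGroup Γ} (hθ : LocInner θ)
include hc hθ

theorem exists_global (hs : ∀ a b, η a b = η b a) (h0 : ∀ a, η a a = 0) (h : ∀
    g, ∃ c : V → ZMod 2, ∀ a b, Γ.graph.Adj a b → Fx θ g a → Fx θ g b → η a b = c a + c b) : ∃ c : V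
    → ZMod 2, ∀ a b, Γ.graph.Adj a b → η a b = c a + c b := by
  refine exists_coboundary hs hc (wsum_eq_zero hθ hs h0 fun n v _ hv _ hg => ?_)
  obtain ⟨g, hg⟩ := hg
  obtain ⟨c, hc⟩ := h g
  have tel : ∀ m ≤ n, wsum η v m = c (v 0) + c (v m) := by
    intro m
    induction m with
    | zero => intro _; simp [wsum, CharTwo.add_self_eq_zero]
    | succ m ih =>
      intro hm
      have e : η (v m) (v (m + 1)) = c (v m) + c (v (m + 1)) := by
        rcases hv.2 m hm with h | h
        · rw [← h, h0, CharTwo.add_self_eq_zero]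
        · exact hc _ _ h (hg m (by omega)) (hg (m + 1) hm)
      have := CharTwo.add_self_eq_zero (c (v m))
      rw [wsum, Finset.sum_range_succ, ← wsum, ih (by omega), e]
      grind
  rw [tel n le_rfl, hv.1, CharTwo.add_self_eq_zero]

/-- A property of the edges at `s` and at `w` which is constant along each conjugating element is
constant if the edge `s, w` does not separate. -/
theorem edge_const (hsw : Γ.graph.Adj s w) (hj : Joined Γ {s, w}) {P Q : V → Prop} (h : ∀ g, ∃ p q :
    Prop, (Fx θ g s → ∀ x, Γ.graph.Adj s x → x ≠ w → Fx θ g x → (P x ↔ p)) ∧ (Fx θ g w → ∀ x,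
    Γ.graph.Adj w x → x ≠ s → Fx θ g x → (Q x ↔ q)) ∧ (Fx θ g s → Fx θ g w → (p ↔ q)))
    (hx : Γ.graph.Adj s x) (hxw : x ≠ w) (hy : Γ.graph.Adj w y) (hys : y ≠ s) : P x ↔ Q y := by
  have hne := hsw.ne
  obtain ⟨η, hη⟩ : ∃ η : V → V → ZMod 2, η = fun a b =>
      (ind (a = s ∧ b ≠ w ∧ P b) + ind (b = s ∧ a ≠ w ∧ P a)) +
      (ind (a = w ∧ b ≠ s ∧ Q b) + ind (b = w ∧ a ≠ s ∧ Q a)) := ⟨_, rfl⟩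
  have η1 : ∀ x, Γ.graph.Adj s x → x ≠ w → η s x = ind (P x) := fun x hx hxw => by
    simp [hη, hxw, hx.ne', hne, ind_false, hsw.ne]
  have η2 : ∀ x, Γ.graph.Adj w x → x ≠ s → η w x = ind (Q x) := fun x hx hxs => by
    simp [hη, hxs, hx.ne', hne.symm, ind_false]
  have η3 : η s w = 0 := by simp [hη, hne, hne.symm, ind_false]
  have η4 : ∀ a b, a ∉ ({s, w} : Set V) → b ∉ ({s, w} : Set V) → η a b = 0 := by
    intro a b ha hb
    simp only [Set.mem_insert_iff, Set.mem_singleton_iff, not_or] at ha hb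
    simp [hη, ha, hb, ind_false]
  have hs : ∀ a b, η a b = η b a := fun a b => by rw [hη]; dsimp only; ring
  obtain ⟨c, hcc⟩ := exists_global hc hθ hs
    (fun a => by rw [hη]; simp [CharTwo.add_self_eq_zero]) fun g => by
      obtain ⟨p, q, h1, h2, h3⟩ := h g
      refine ⟨fun a => ind (a = s ∧ p) + ind (a = w ∧ q), ?_⟩
      have key : ∀ a b, Γ.graph.Adj a b → Fx θ g a → Fx θ g b → a = s ∨ a = w → η a b =
          (ind (a = s ∧ p) + ind (a = w ∧ q)) + (ind (b = s ∧ p) + ind (b = w ∧ q)) := by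
        rintro a b hab ha hb (rfl | rfl)
        · by_cases hbw : b = w
          · subst hbw
            rw [η3]
            simp [hne, hne.symm, ind_false, ind_congr.2 (h3 ha hb), CharTwo.add_self_eq_zero]
          · rw [η1 b hab hbw]
            simp [hbw, hne, hab.ne', ind_false, ind_congr.2 (h1 ha b hab hbw hb)]
        · by_cases hbs : b = s
          · subst hbs
            rw [hs, η3]
            simp [hne, hne.symm, ind_false, ind_congr.2 (h3 hb ha), CharTwo.add_self_eq_zero]
          · rw [η2 b hab hbs]
            simp [hbs, hne.symm, hab.ne', ind_false, ind_congr.2 (h2 ha b hab hbs hb)]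
      intro a b hab ha hb
      by_cases h1 : a = s ∨ a = w
      · exact key a b hab ha hb h1
      · by_cases h2 : b = s ∨ b = w
        · rw [hs, key b a hab.symm hb ha h2]; ring
        · rw [η4 a b h1 h2]
          rw [not_or] at h1 h2
          simp [h1, h2, ind_false]
  have hxy : c x = c y := by
    refine (hj (fun z => c x = c z) (fun a ha b hb hab e => ?_) x ?_ y ?_ rfl)
    · have := hcc a b hab
      rw [η4 a b ha hb] at this
      exact e.trans (CharTwo.add_eq_zero.1 this.symm)
    · rintro (h | h)
      exacts [hx.ne' h, hxw h]
    · rintro (h | h)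
      exacts [hys h, hy.ne' h]
  have e1 := hcc s x hx
  have e2 := hcc w y hy
  have e3 := hcc s w hsw
  rw [η1 x hx hxw] at e1
  rw [η2 y hy hys] at e2
  rw [η3] at e3
  rw [← ind_congr, e1, e2, hxy, CharTwo.add_eq_zero.1 e3.symm]

/-- A property of the edges at `s` which is constant along each conjugating element is constant if
`s` does not separate. -/
theorem vertex_const (hj : Joined Γ {s}) {P : V → Prop}
    (h : ∀ g, ∃ p : Prop, Fx θ g s → ∀ x, Γ.graph.Adj s x → Fx θ g x → (P x ↔ p))
    (hx : Γ.graph.Adj s x) (hy : Γ.graph.Adj s y) : P x ↔ P y := by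
  obtain ⟨η, hη⟩ : ∃ η : V → V → ZMod 2, η = fun a b =>
      ind (a = s ∧ P b) + ind (b = s ∧ P a) := ⟨_, rfl⟩
  have η1 : ∀ x, Γ.graph.Adj s x → η s x = ind (P x) := fun x hx => by
    simp [hη, hx.ne', ind_false]
  have η4 : ∀ a b, a ≠ s → b ≠ s → η a b = 0 := fun a b ha hb => by simp [hη, ha, hb, ind_false]
  have hs : ∀ a b, η a b = η b a := fun a b => by rw [hη]; exact add_comm _ _
  obtain ⟨c, hcc⟩ := exists_global hc hθ hs
    (fun a => by rw [hη]; exact CharTwo.add_self_eq_zero _) fun g => by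
      obtain ⟨p, h1⟩ := h g
      refine ⟨fun a => ind (a = s ∧ p), ?_⟩
      have key : ∀ b, Γ.graph.Adj s b → Fx θ g s → Fx θ g b → η s b = ind (s = s ∧ p) +
          ind (b = s ∧ p) := fun b hab ha hb => by
        rw [η1 b hab]
        simp [hab.ne', ind_false, ind_congr.2 (h1 ha b hab hb)]
      intro a b hab ha hb
      by_cases h1 : a = s
      · subst h1; exact key b hab ha hb
      · by_cases h2 : b = s
        · subst h2; rw [hs, key a hab.symm hb ha]; ring
        · rw [η4 a b h1 h2]
          simp [h1, h2, ind_false]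
  have hxy : c x = c y := by
    refine (hj (fun z => c x = c z) (fun a ha b hb hab e => ?_) x hx.ne' y hy.ne' rfl)
    have := hcc a b hab
    rw [η4 a b ha hb] at this
    exact e.trans (CharTwo.add_eq_zero.1 this.symm)
  rw [← ind_congr, ← η1 x hx, ← η1 y hy, hcc s x hx, hcc s y hy, hxy]

omit [Nonempty V] hc hθ in
theorem Fx.zpow (hab : Γ.graph.Adj a b) (h1 : Fx θ g a)
    (h2 : Fx θ g b) (h1' : Fx θ g' a) (h2' : Fx θ g' b) : ∃ r : ℤ, g⁻¹ * g' = zc Γ a b ^ r := by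
  have cm : ∀ {c}, Fx θ g c → Fx θ g' c → Commute (gen Γ c) (g⁻¹ * g') := by
    intro c h h'
    have e : g * gen Γ c * g⁻¹ = g' * gen Γ c * g'⁻¹ := h.symm.trans h'
    change gen Γ c * (g⁻¹ * g') = g⁻¹ * g' * gen Γ c
    rw [show gen Γ c * (g⁻¹ * g') = g⁻¹ * (g * gen Γ c * g⁻¹) * g' by group, e]
    group
  have hm : g⁻¹ * g' ∈ parabolic Γ {a, b} := by
    have hz : ∀ x ∈ parabolic Γ {a, b}, x * (g⁻¹ * g') = (g⁻¹ * g') * x := by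
      intro x hx
      induction hx using Subgroup.closure_induction with
      | mem x hx =>
        obtain ⟨c, rfl | rfl, rfl⟩ := hx
        exacts [cm h1 h1', cm h2 h2']
      | one => simp
      | mul x y _ _ hx hy => exact (Commute.mul_left hx hy : Commute (x * y) _)
      | inv x _ hx => exact (Commute.inv_left hx : Commute x⁻¹ _)
    refine mem_of_conj_mem (t := zc Γ a b) (fun h => ?_) (zc_mem a b) ?_
    · have := zc_not_vertexType hab (r := 1) (by rwa [zpow_one])
      omega
    · rw [mul_assoc, hz _ (zc_mem a b), inv_mul_cancel_left]; exact zc_mem a b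
  exact pair_center hab (gen_mem (Or.inl rfl)) (gen_mem (Or.inr rfl)) hm (cm h1 h1')
    (cm h2 h2') (pair_not_commute hab)

omit [Nonempty V] hc hθ in
theorem zc_zpow_not_mem (hsw : Γ.graph.Adj s w) (h : zc Γ s w ^ r ∈ parabolic Γ {w}ᶜ) : r = 0 := by
  have h1 := TF.inter (zpow_mem (zc_mem s w) r) h
  have h2 : zc Γ s w ^ r ∈ parabolic Γ {s} := parabolic_mono (by
    rintro x ⟨rfl | rfl, hx⟩
    exacts [rfl, (hx rfl).elim]) h1
  obtain ⟨i, hi⟩ := mem_zpow h2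
  exact (pair_zpow_eq hsw hi.symm).2

variable (hd : ∀ s w, Γ.graph.Adj s w → ∃ x, Γ.graph.Adj s x ∧ x ≠ w)
  (h1 : ∀ s, Joined Γ {s}) (h2 : ∀ s w, Γ.graph.Adj s w → Joined Γ {s, w})

omit hd h1 h2 in
/-- Two conjugating elements along an edge, each also valid at a further neighbour of one endpoint,
agree. -/
theorem conj_unique (hsw : Γ.graph.Adj s w) (hj : Joined Γ {s, w}) (hs : Fx θ g s) (hw : Fx θ g w)
    (hs' : Fx θ g' s) (hw' : Fx θ g' w) (hx : Γ.graph.Adj s x) (hxw : x ≠ w) (hgx : Fx θ g x)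
    (hy : Γ.graph.Adj w y) (hys : y ≠ s) (hgy : Fx θ g' y) : g = g' := by
  have hk : ∀ a b, ∃ k, Γ.graph.Adj a b → Fx θ k a ∧ Fx θ k b := by
    intro a b
    by_cases hab : Γ.graph.Adj a b
    · obtain ⟨k, hk⟩ := hθ _ (isCl_pair hab)
      exact ⟨k, fun _ => ⟨hk _ (gen_mem (Or.inl rfl)), hk _ (gen_mem (Or.inr rfl))⟩⟩
    · exact ⟨1, fun h => (hab h).elim⟩
  choose k hk using hk
  have step : ∀ {a b g''}, a ≠ b → Fx θ g'' a → ∀ x, Γ.graph.Adj a x → x ≠ b → Fx θ g'' x →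
      (g⁻¹ * k a x ∈ parabolic Γ {b}ᶜ ↔ g⁻¹ * g'' ∈ parabolic Γ {b}ᶜ) := by
    intro a b g'' hab ha x hax hxb hx
    obtain ⟨r, hr⟩ := Fx.zpow hax (hk a x hax).1 (hk a x hax).2 ha hx
    rw [show g⁻¹ * g'' = g⁻¹ * k a x * ((k a x)⁻¹ * g'') by group, hr]
    refine (Subgroup.mul_mem_cancel_right _ (zpow_mem (parabolic_mono ?_ (zc_mem a x)) r)).symm
    rintro z (rfl | rfl)
    exacts [hab, hxb]
  have main := edge_const hc hθ hsw hj (P := fun x => g⁻¹ * k s x ∈ parabolic Γ {w}ᶜ)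
    (Q := fun x => g⁻¹ * k w x ∈ parabolic Γ {s}ᶜ) (fun g'' => ⟨g⁻¹ * g'' ∈ parabolic Γ {w}ᶜ,
      g⁻¹ * g'' ∈ parabolic Γ {s}ᶜ, step hsw.ne, step hsw.ne', fun e1 e2 => ?_⟩) hx hxw hy hys
  · have hm := main.1 ((step hsw.ne hs x hx hxw hgx).2 (by simp))
    rw [step hsw.ne' hw' y hy hys hgy] at hm
    obtain ⟨r, hr⟩ := Fx.zpow hsw hs hw hs' hw'
    rw [hr, ← zc_comm hsw] at hm
    obtain rfl := zc_zpow_not_mem hsw.symm hm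
    rw [zpow_zero, inv_mul_eq_one] at hr
    exact hr
  · obtain ⟨r, hr⟩ := Fx.zpow hsw hs hw e1 e2
    rw [hr]
    constructor
    · intro h
      rw [zc_zpow_not_mem hsw h]; simp
    · intro h
      rw [← zc_comm hsw] at h
      rw [zc_zpow_not_mem hsw.symm h]; simp

include hd h1 in
theorem exists_conj_path (hsw : Γ.graph.Adj s w) :
    ∃ g x, Γ.graph.Adj s x ∧ x ≠ w ∧ Fx θ g s ∧ Fx θ g w ∧ Fx θ g x := by
  by_contra! hno
  obtain ⟨x, hx, hxw⟩ := hd s w hsw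
  refine hxw ((vertex_const hc hθ (h1 s) (P := fun x => x = w)
    (fun g => ⟨Fx θ g w, fun hs x hx hgx => ⟨fun h => h ▸ hgx, fun hw => ?_⟩⟩) hx hsw).2 rfl)
  by_contra hxw
  exact hno g x hx hxw hs hw hgx

include hd h1 h2 in
/-- A locally inner automorphism is inner if there are no separating vertices or edges. -/
theorem LocInner.inner : ∃ g, ∀ x, θ x = g * x * g⁻¹ := by
  have ex := fun s w hsw => exists_conj_path hc hθ hd h1 (s := s) (w := w) hsw
  have uniq : ∀ {s w g g' x y}, Γ.graph.Adj s w → Fx θ g s → Fx θ g w → Fx θ g' s → Fx θ g' w →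
      Γ.graph.Adj s x → x ≠ w → Fx θ g x → Γ.graph.Adj s y → y ≠ w → Fx θ g' y → g = g' := by
    intro s w g g' x y hsw a1 a2 a3 a4 hx hxw hgx hy hyw hgy
    obtain ⟨g₀, z, hz, hzs, b1, b2, b3⟩ := ex w s hsw.symm
    rw [conj_unique hc hθ hsw (h2 s w hsw) a1 a2 b2 b1 hx hxw hgx hz hzs b3,
      conj_unique hc hθ hsw (h2 s w hsw) a3 a4 b2 b1 hy hyw hgy hz hzs b3]
  have hG : ∀ s w, ∃ g, Γ.graph.Adj s w →
      ∃ x, Γ.graph.Adj s x ∧ x ≠ w ∧ Fx θ g s ∧ Fx θ g w ∧ Fx θ g x := by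
    intro s w
    by_cases h : Γ.graph.Adj s w
    · exact (ex s w h).imp fun g hg _ => hg
    · exact ⟨1, fun h' => (h h').elim⟩
  choose G hG using hG
  have hsymm : ∀ s w, Γ.graph.Adj s w → G s w = G w s := by
    intro s w hsw
    obtain ⟨x, hx, hxw, a1, a2, a3⟩ := hG s w hsw
    obtain ⟨y, hy, hys, b1, b2, b3⟩ := hG w s hsw.symm
    exact conj_unique hc hθ hsw (h2 s w hsw) a1 a2 b2 b1 hx hxw a3 hy hys b3
  have heq : ∀ {s x y g}, Γ.graph.Adj s x → Γ.graph.Adj s y → x ≠ y → Fx θ g s → Fx θ g x →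
      Fx θ g y → G s x = g := by
    intro s x y g hx hy hxy a1 a2 a3
    obtain ⟨z, hz, hzx, b1, b2, b3⟩ := hG s x hx
    exact uniq hx b1 b2 a1 a2 hz hzx b3 hy hxy.symm a3
  have hstar : ∀ {s x y}, Γ.graph.Adj s x → Γ.graph.Adj s y → G s x = G s y := by
    intro s x y hx hy
    refine ((vertex_const hc hθ (h1 s) (P := fun z => G s z = G s y) (fun g =>
      ⟨∃ z, Γ.graph.Adj s z ∧ Fx θ g z ∧ G s z = G s y, fun hs z hz hgz =>
        ⟨fun h => ⟨z, hz, hgz, h⟩, ?_⟩⟩) hx hy).2 rfl)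
    rintro ⟨z', hz', hgz', h⟩
    by_cases hzz : z = z'
    · rw [hzz, h]
    · rw [heq hz hz' hzz hs hgz hgz', ← heq hz' hz (Ne.symm hzz) hs hgz' hgz, h]
  let o := Classical.arbitrary V
  by_cases hV : ∃ p, Γ.graph.Adj o p
  · obtain ⟨p, hp⟩ := hV
    refine ⟨G o p, ?_⟩
    have hall : ∀ a, (∃ b, Γ.graph.Adj a b) ∧ ∀ b, Γ.graph.Adj a b → G a b = G o p :=
      conn_induct hc ⟨⟨p, hp⟩, fun b hb => hstar hb hp⟩ fun x y hxy hx =>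
        ⟨⟨x, hxy.symm⟩, fun b hb => by rw [hstar hb hxy.symm, ← hsymm x y hxy, hx.2 y hxy]⟩
    have : θ.toMonoidHom = (MulAut.conj (G o p)).toMonoidHom := hom_ext fun a => by
      obtain ⟨⟨b, hb⟩, ha⟩ := hall a
      obtain ⟨x, _, _, a1, _⟩ := hG a b hb
      rw [ha b hb] at a1
      exact a1
    exact fun x => DFunLike.congr_fun this x
  · have hall : ∀ a, a = o := conn_induct hc rfl fun x y hxy hx => by
      subst hx; exact (hV ⟨y, hxy⟩).elim
    obtain ⟨g, hg⟩ := hθ _ (isCl_singleton o)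
    exact ⟨g, fun x => hg x (parabolic_mono (fun a _ => hall a)
      (by rw [parabolic_univ]; exact Subgroup.mem_top x))⟩

end Gluing

section FiniteOut

variable {V : Type u} {Γ : DefiningGraph V} [Finite V] [Nontrivial V]
variable {a b c d : V} {ψ ψ' : ArtinGroup Γ ≃* ArtinGroup Γ}
  [TF Γ] [Large Γ] (hc : Γ.graph.Preconnected)
  (hd : ∀ s w, Γ.graph.Adj s w → ∃ x, Γ.graph.Adj s x ∧ x ≠ w)
include hc

theorem exists_pair (ψ : ArtinGroup Γ ≃* ArtinGroup Γ) (hcd : Γ.graph.Adj c d) : ∃ h a b,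
    Γ.graph.Adj a b ∧ ∀ x ∈ parabolic Γ {c, d}, h⁻¹ * ψ.symm x * h ∈ parabolic Γ {a, b} := by
  obtain ⟨h, K, hK, h1, h2⟩ := braid_clique ψ hcd (fun h => pair_not_commute hcd h.eq)
  obtain ⟨a, b, hab, hsub⟩ : ∃ a b, Γ.graph.Adj a b ∧ K ⊆ {a, b} := by
    rcases clique_cases hK with rfl | ⟨a, rfl⟩ | ⟨a, b, hab, rfl⟩
    · exact ⟨c, d, hcd, by simp⟩
    · obtain ⟨b, hab⟩ := exists_adj hc a
      exact ⟨a, b, hab, by simp⟩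
    · exact ⟨a, b, hab, subset_rfl⟩
  refine ⟨h, a, b, hab, conj_map_mem ψ.symm.toMonoidHom ?_⟩
  rintro v (rfl | rfl)
  · exact parabolic_mono hsub h1
  · exact parabolic_mono hsub h2

include hd

theorem vertexType_symm_gen (ψ : ArtinGroup Γ ≃* ArtinGroup Γ) (w : V) :
    VertexType (ψ.symm (gen Γ w)) := by
  by_contra hn
  obtain ⟨b, hb⟩ := exists_adj hc w
  obtain ⟨x, hx, hxb⟩ := hd w b hb
  exact hxb (nonvertex_nbr_unique ψ hc hn hx hb)

omit hc hd [Nontrivial V] [Finite V] in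
/-- Combinatorial data recording how an automorphism permutes conjugates of edge subgroups. -/
def edgeData (ψ : ArtinGroup Γ ≃* ArtinGroup Γ) : Set (V × V × V × V × ℤˣ) :=
  {t | ∃ g, ψ (gen Γ t.1 ^ (t.2.2.2.2 : ℤ)) = g * gen Γ t.2.2.1 * g⁻¹ ∧
    ∀ x, x ∈ parabolic Γ {t.1, t.2.1} ↔ g⁻¹ * ψ x * g ∈ parabolic Γ {t.2.2.1, t.2.2.2.1}}

theorem exists_edgeData (ψ : ArtinGroup Γ ≃* ArtinGroup Γ) (hcd : Γ.graph.Adj c d) :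
    ∃ a b ε, (a, b, c, d, ε) ∈ edgeData ψ := by
  obtain ⟨h, a, b, hab, hh⟩ := exists_pair hc ψ hcd
  obtain ⟨k, a₁, b₁, -, hk⟩ := exists_pair hc ψ.symm hab
  rw [MulEquiv.symm_symm] at hk
  have h1 := hk _ (hh _ (zc_mem c d))
  have hp : (k⁻¹ * (ψ h)⁻¹) * zc Γ c d * (ψ h * k) ∈ parabolic Γ {a₁, b₁} := by
    simpa [mul_assoc] using h1
  obtain ⟨hsub, hg⟩ := clique_conj_sub (S := {a₁, b₁}) (K := {c, d})
    (g := k⁻¹ * (ψ h)⁻¹) (isCl_pair hcd)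
    (fun hv => by
      have := (vertexType_conj_iff (k := zc Γ c d) (k⁻¹ * (ψ h)⁻¹)).1 (by simpa [mul_assoc] using hv)
      exact one_ne_zero (zc_not_vertexType hcd (r := 1) (by rwa [zpow_one]))) hp
    (by simpa [mul_assoc] using zc_mem c d)
  have hne := hcd.ne
  have heq : ({a₁, b₁} : Set V) = {c, d} := by
    have h1 : c ∈ ({a₁, b₁} : Set V) := hsub (by simp)
    have h2 : d ∈ ({a₁, b₁} : Set V) := hsub (by simp)
    rcases h1 with rfl | rfl <;> rcases h2 with rfl | rfl
    · exact (hne rfl).elim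
    · rfl
    · exact Set.pair_comm _ _
    · exact (hne rfl).elim
  rw [heq] at hg hk
  have key : ∀ x, x ∈ parabolic Γ {a, b} ↔ ψ h * ψ x * (ψ h)⁻¹ ∈ parabolic Γ {c, d} := by
    intro x
    constructor
    · intro hx
      have := mul_mem (mul_mem (inv_mem hg) (hk x hx)) hg
      simpa [mul_assoc] using this
    · intro hx
      simpa [mul_assoc] using hh _ hx
  obtain ⟨a', b', -, hset, f, hf, i, hfi⟩ := vertexType_pair' hab
    (hh _ (gen_mem (by simp : c ∈ ({c, d} : Set V))))
    (by simpa using (vertexType_symm_gen hc hd ψ c).conj h⁻¹)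
  rw [hset] at key
  have hi : ψ (gen Γ a' ^ i) = (ψ (h * f))⁻¹ * gen Γ c * (ψ (h * f))⁻¹⁻¹ := by
    rw [← hfi]; simp [mul_assoc]
  have hu : i * len (ψ (gen Γ a')) = 1 := by
    have := congrArg len hi
    rwa [len_conj, len_gen, map_zpow, len_zpow] at this
  refine ⟨a', b', Units.mkOfMulEqOne i _ hu, (ψ (h * f))⁻¹, by simpa using hi, fun x => ?_⟩
  dsimp only
  have := key (f * x * f⁻¹)
  rw [Subgroup.mul_mem_cancel_right _ (inv_mem hf), Subgroup.mul_mem_cancel_left _ hf] at this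
  rw [this]
  simp [mul_assoc]

omit [Nontrivial V] hc hd in
theorem pair_conj_of_edgeData {ε : ℤˣ} (hcd : Γ.graph.Adj c d) (h : (a, b, c, d, ε) ∈ edgeData ψ)
    (h' : (a, b, c, d, ε) ∈ edgeData ψ') (hlen : ∀ x, len (ψ' (ψ.symm x)) = len x) : ∃ g, ∀ x ∈
    parabolic Γ {c, d}, ψ' (ψ.symm x) = g * x * g⁻¹ := by
  obtain ⟨g, hg, hgx⟩ := h
  obtain ⟨g', hg', hgx'⟩ := h'
  dsimp only at hg hgx hg' hgx'
  let Φ : ArtinGroup Γ ≃* ArtinGroup Γ :=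
    (MulAut.conj g).trans ((ψ.symm.trans ψ').trans (MulAut.conj g'⁻¹))
  have hΦ : ∀ y, Φ y = g'⁻¹ * ψ' (ψ.symm (g * y * g⁻¹)) * g' := fun y => by simp [Φ]
  have hmem : ∀ y, Φ y ∈ parabolic Γ {c, d} ↔ y ∈ parabolic Γ {c, d} := by
    intro y
    rw [hΦ, ← hgx', hgx]
    simp [mul_assoc]
  have hmap : (parabolic Γ {c, d}).map Φ.toMonoidHom = parabolic Γ {c, d} := by
    ext y
    constructor
    · rintro ⟨z, hz, rfl⟩
      exact (hmem z).2 hz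
    · intro hy
      exact ⟨Φ.symm y, (hmem _).1 (by simpa using hy), by simp⟩
  let φ := (Φ.subgroupMap (parabolic Γ {c, d})).trans (MulEquiv.subgroupCongr hmap)
  have hφ : ∀ y, ((φ y : parabolic Γ {c, d}) : ArtinGroup Γ) = Φ y := fun y => rfl
  obtain ⟨u, hu⟩ := (dih_pair hcd).inner φ (fun x => by
      change len ((φ x : parabolic Γ {c, d}) : ArtinGroup Γ) = len (x : ArtinGroup Γ)
      rw [hφ, hΦ, len_conj', hlen, len_conj])
    (fun _ => ⟨1, by
      apply Subtype.val_injective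
      rw [hφ, hΦ]
      simp only [pg]
      rw [← hg, MulEquiv.symm_apply_apply, hg']
      simp [mul_assoc]⟩)
  refine ⟨(ψ' (ψ.symm g))⁻¹ * g' * u, fun x hx => ?_⟩
  have := congrArg Subtype.val (hu ⟨x, hx⟩)
  rw [hφ, hΦ] at this
  simp only [map_mul, map_inv, Subgroup.coe_mul, Subgroup.coe_inv] at this
  have e : ψ' (ψ.symm x) = (ψ' (ψ.symm g))⁻¹ * g' *
      (g'⁻¹ * (ψ' (ψ.symm g) * ψ' (ψ.symm x) * (ψ' (ψ.symm g))⁻¹) * g') * g'⁻¹ *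
      ψ' (ψ.symm g) := by group
  rw [e, this]
  group

theorem locInner_of_edgeData_eq (h : edgeData ψ = edgeData ψ') : LocInner (ψ.symm.trans ψ') := by
  have hgen : ∀ c, len (ψ' (ψ.symm (gen Γ c))) = 1 := by
    intro c
    obtain ⟨d, hcd⟩ := exists_adj hc c
    obtain ⟨a, b, ε, ht⟩ := exists_edgeData hc hd ψ hcd
    obtain ⟨g', hg', -⟩ := h ▸ ht
    obtain ⟨g, hg, -⟩ := ht
    dsimp only at hg hg'
    have e : gen Γ c = g⁻¹ * ψ (gen Γ a ^ (ε : ℤ)) * g := by rw [hg]; group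
    rw [e, map_mul, map_mul, map_mul, map_mul, map_inv, map_inv, len_conj',
      MulEquiv.symm_apply_apply, hg', len_conj, len_gen]
  have hlen : ∀ x, len (ψ' (ψ.symm x)) = len x := by
    have e : (lam Γ).comp (ψ.symm.trans ψ').toMonoidHom = lam Γ := by
      apply hom_ext
      intro v
      have h1 := hgen v
      have h2 := len_gen (Γ := Γ) v
      rw [← h2] at h1
      exact Multiplicative.toAdd.injective h1
    intro x
    exact congrArg Multiplicative.toAdd (DFunLike.congr_fun e x)
  intro K hK
  obtain ⟨c, d, hcd, hsub⟩ : ∃ c d, Γ.graph.Adj c d ∧ K ⊆ {c, d} := by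
    rcases clique_cases hK with rfl | ⟨c, rfl⟩ | ⟨c, d, hcd, rfl⟩
    · obtain ⟨c⟩ := (inferInstance : Nonempty V)
      obtain ⟨d, hcd⟩ := exists_adj hc c
      exact ⟨c, d, hcd, by simp⟩
    · obtain ⟨d, hcd⟩ := exists_adj hc c
      exact ⟨c, d, hcd, by simp⟩
    · exact ⟨c, d, hcd, subset_rfl⟩
  obtain ⟨a, b, ε, ht⟩ := exists_edgeData hc hd ψ hcd
  obtain ⟨g, hg⟩ := pair_conj_of_edgeData hcd ht (h ▸ ht) hlen
  exact ⟨g, fun x hx => hg x (parabolic_mono hsub hx)⟩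

theorem finite_out_of_joined (h1 : ∀ s, Joined Γ {s})
    (h2 : ∀ s w, Γ.graph.Adj s w → Joined Γ {s, w}) : Finite (Out (ArtinGroup Γ)) := by
  refine Finite.of_injective (fun q : Out (ArtinGroup Γ) => edgeData (Quotient.out q)) ?_
  intro q q' h
  obtain ⟨g, hg⟩ := (locInner_of_edgeData_eq hc hd h).inner hc hd h1 h2
  rw [← Quotient.out_eq q, ← Quotient.out_eq q']
  refine QuotientGroup.eq.2 ⟨(Quotient.out q).symm g, ?_⟩
  ext x
  have := hg (Quotient.out q x)
  simp only [MulEquiv.trans_apply, MulEquiv.symm_apply_apply] at this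
  simp [MulAut.inv_def, this]

end FiniteOut

section Small

/-- Outer automorphism groups of isomorphic groups have the same finiteness. -/
theorem finite_out_congr {G : Type u} {H : Type v} [Group G] [Group H] (f : G ≃* H)
    [Finite (Out H)] : Finite (Out G) := by
  refine Finite.of_surjective (QuotientGroup.map (innerAutSubgroup H) (innerAutSubgroup G)
    (MulAut.congr f.symm).toMonoidHom ?_) ?_
  · rintro _ ⟨g, rfl⟩
    refine ⟨f.symm g, ?_⟩
    ext x
    simp [MulAut.congr]
  · intro q
    induction q using QuotientGroup.induction_on with
    | H φ => exact ⟨QuotientGroup.mk (MulAut.congr f φ), congrArg (QuotientGroup.mk (s := innerAutSubgroup G))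
      (show (MulAut.congr f.symm) (MulAut.congr f φ) = φ by ext x; simp [MulAut.congr])⟩

variable {V : Type u} {Γ : DefiningGraph V}
variable {S : Set V}

theorem finite_out_of_forall_eq (a : V) (ha : ∀ x, x = a) : Finite (Out (ArtinGroup Γ)) := by
  have hx : ∀ x : ArtinGroup Γ, ∃ i : ℤ, x = gen Γ a ^ i := by
    intro x
    have : (Set.univ : Set V) = {a} := Set.eq_singleton_iff_unique_mem.2 ⟨trivial, fun x _ => ha x⟩
    have hx : x ∈ parabolic Γ {a} := by rw [← this, parabolic_univ]; trivial
    rw [parabolic_singleton] at hx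
    obtain ⟨i, hi⟩ := Subgroup.mem_zpowers_iff.1 hx
    exact ⟨i, hi.symm⟩
  have hφ : ∀ (φ : MulAut (ArtinGroup Γ)) x, len (φ x) = len x * len (φ (gen Γ a)) := by
    intro φ x
    obtain ⟨i, rfl⟩ := hx x
    rw [map_zpow, len_zpow, len_zpow, len_gen, mul_one]
  let u : MulAut (ArtinGroup Γ) → ℤˣ := fun φ => Units.mkOfMulEqOne (len (φ (gen Γ a)))
    (len (φ.symm (gen Γ a))) (by rw [← hφ, MulEquiv.symm_apply_apply, len_gen])
  have : Finite (MulAut (ArtinGroup Γ)) := by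
    refine Finite.of_injective u fun φ φ' h => ?_
    have h : len (φ (gen Γ a)) = len (φ' (gen Γ a)) := congrArg Units.val h
    ext x
    obtain ⟨i, hi⟩ := hx (φ x)
    obtain ⟨j, hj⟩ := hx (φ' x)
    have := hφ φ x
    rw [h, ← hφ φ' x, hi, hj] at this
    simp only [len_zpow, len_gen, mul_one] at this
    rw [hi, hj, this]
  exact Quotient.finite _

theorem joined_induce {T : Set S}
    (h : (Γ.graph.induce (S \ Subtype.val '' T)).Preconnected) : Joined (Γ.induce S) T := by
  intro P hP x hx y hy hPx
  have hmem : ∀ z : S, z ∉ T → z.1 ∈ S \ Subtype.val '' T := fun z hz =>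
    ⟨z.2, by rintro ⟨z', hz', e⟩; exact hz (Subtype.ext e ▸ hz')⟩
  have hnot : ∀ z : ↥(S \ Subtype.val '' T), (⟨z.1, z.2.1⟩ : S) ∉ T :=
    fun z hz => z.2.2 ⟨_, hz, rfl⟩
  exact conn_induct h (P := fun z => P ⟨z.1, z.2.1⟩) (a := ⟨x, hmem x hx⟩) hPx
    (fun z z' hzz' => hP _ (hnot z) _ (hnot z') hzz') ⟨y, hmem y hy⟩

theorem chunk_finite_out [Finite V] [TF Γ] [Large Γ]
    (hS : IsChunk Γ.graph S) : Finite (Out (ArtinGroup (Γ.induce S))) ∨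
      ∃ a b : V, a ≠ b ∧ S = {a, b} ∧ Γ.graph.Adj a b ∧ Even (Γ.label a b) := by
  obtain ⟨⟨hconn, hv, he⟩, -⟩ := hS
  obtain ⟨a⟩ := hconn.nonempty
  by_cases h1 : ∀ x, x = a
  · exact Or.inl (finite_out_of_forall_eq a h1)
  push Not at h1
  obtain ⟨b₀, hb₀⟩ := h1
  have : Nontrivial S := ⟨b₀, a, hb₀⟩
  obtain ⟨b, hab⟩ := exists_adj hconn.preconnected a
  by_cases h2 : ∀ x, x = a ∨ x = b
  · have hSab : S = {a.1, b.1} := Set.Subset.antisymm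
      (fun x hx => (h2 ⟨x, hx⟩).imp (congrArg Subtype.val) (congrArg Subtype.val))
      (by rintro x (rfl | rfl); exacts [a.2, b.2])
    rcases Nat.even_or_odd (Γ.label a b) with h | h
    · exact Or.inr ⟨a, b, fun e => hab.ne (Subtype.ext e), hSab, hab, h⟩
    · left
      have := (dih_pair (show Γ.graph.Adj a b from hab)).finite_out h
      exact finite_out_congr ((embEquiv S).trans
        (MulEquiv.subgroupCongr (congrArg (parabolic Γ) hSab)))
  · left
    have hj1 : ∀ s : S, Joined (Γ.induce S) {s} := fun s =>
      joined_induce (by rw [Set.image_singleton]; exact hv s s.2)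
    refine finite_out_of_joined hconn.preconnected ?_ hj1
      (fun s w hsw => joined_induce (by rw [Set.image_pair]; exact he s s.2 w w.2 hsw))
    intro s w hsw
    by_contra hno
    push Not at hno
    obtain ⟨y, hys, hyw⟩ : ∃ y, y ≠ s ∧ y ≠ w := by
      by_contra hall
      push Not at h2 hall
      obtain ⟨z, hza, hzb⟩ := h2
      rcases eq_or_ne a s with rfl | has
      · exact hzb ((hall z hza).trans (hall b hab.ne.symm).symm)
      · obtain rfl := hall a has
        have hb : b = s := by_contra fun h => hab.ne (hall b h).symm
        exact hza (hall z (hb ▸ hzb))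
    exact hys (hj1 w (fun x => x = s) (fun x _ z hz hxz hx => (hz (hno z (hx ▸ hxz))).elim)
      s hsw.ne y hyw rfl)

end Small

end ArtinRigid

/-- **Connected large-type triangle-free Artin groups have rigid chunks.**
(1) Any isomorphism `ψ : A_Γ → A_Λ` sends each chunk parabolic subgroup `g A_{Γ'} g⁻¹` of
`A_Γ` to a chunk parabolic subgroup `h A_{Λ'} h⁻¹` of `A_Λ`; and (2) for every chunk `Γ'` of
`Γ`, either `Out(A_{Γ'})` is finite or `Γ'` is a single edge with even label. -/
theorem rigid_chunks_of_triangleFree {V : Type*} [Fintype V] (Γ : DefiningGraph V)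
    (hconn : Γ.graph.Connected)
    (hlarge : ∀ a b : V, Γ.graph.Adj a b → 3 ≤ Γ.label a b)
    (htrianglefree : ∀ a b c : V,
      Γ.graph.Adj a b → Γ.graph.Adj b c → Γ.graph.Adj a c → False) :
    (∀ (W : Type*) [Fintype W] (Λ : DefiningGraph W)
        (ψ : ArtinGroup Γ ≃* ArtinGroup Λ) (g : ArtinGroup Γ) (S : Set V),
        IsChunk Γ.graph S →
        ∃ (h : ArtinGroup Λ) (S' : Set W), IsChunk Λ.graph S' ∧
          Subgroup.map ψ.toMonoidHom
              (Subgroup.map (MulAut.conj g).toMonoidHom (parabolic Γ S)) =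
            Subgroup.map (MulAut.conj h).toMonoidHom (parabolic Λ S')) ∧
    (∀ S : Set V, IsChunk Γ.graph S →
        Finite (Out (ArtinGroup (Γ.induce S))) ∨
        ∃ a b : V, a ≠ b ∧ S = {a, b} ∧ Γ.graph.Adj a b ∧ Even (Γ.label a b)) := by
  have : ArtinRigid.TF Γ := ⟨htrianglefree⟩
  have : ArtinRigid.Large Γ := ⟨hlarge⟩
  exact ⟨fun W _ Λ ψ g S hS => ArtinRigid.chunk_parabolic_image ψ hconn g hS,
    fun S hS => ArtinRigid.chunk_finite_out hS⟩
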